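/- Let p ∈ (2,3]. Let (d_n)_{n∈ℤ} be an ℝ^d-valued stationary sequence of martingale differences with respect to (ℱ_n)_{n∈ℤ} with E|d_0|_d^p < ∞, satisfying conditions (C1) and (C2). Then, enlarging the probability space if necessary, there exists a sequence (N_i)_{i≥1} of i.i.d. ℝ^d-valued centered Gaussian random variables with covariance Var(N_1) = E(d_0 d_0^t) such that ‖ sup_{1≤k≤n} |M_k − Σ_{i=1}^k N_i|_d ‖_1 = O(n^{1/p} (log n)^{(p−1)/(2p)}) if p ∈ (2,3), and ‖ sup_{1≤k≤n} |M_k − Σ_{i=1}^k N_i|_d ‖_1 = O(n^{1/3} (log n)^{2/3}) if p = 3. -/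

import Mathlib

open MeasureTheory ProbabilityTheory Filter Asymptotics
open scoped ENNReal NNReal Topology

noncomputable section

/-- Standard normal cumulative distribution function Φ. -/
def stdNormalCDF (x : ℝ) : ℝ := ((gaussianReal 0 1) (Set.Iic x)).toReal

/-- Generalized inverse Φ⁻¹. -/
def stdNormalCDFInv (y : ℝ) : ℝ := sInf {x : ℝ | y ≤ stdNormalCDF x}

/-- Quantile function of `|X|`: the cadlag inverse of the tail function `x ↦ ℙ(|X| > x)`. -/
def absQuantile {Ω : Type*} [MeasurableSpace Ω] (P : Measure Ω) (X : Ω → ℝ) (u : ℝ) : ℝ :=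
  sInf {x : ℝ | (P {ω | x < |X ω|}).toReal ≤ u}

/-- The envelope norm `‖X‖_{1,Φ,p} = ∫₀¹ (1 ∨ Φ⁻¹(1-u/2))^{p-2} Q_X(u) du`. -/
def envNorm {Ω : Type*} [MeasurableSpace Ω] (P : Measure Ω) (p : ℝ) (X : Ω → ℝ) : ℝ≥0∞ :=
  ∫⁻ u in Set.Ioo (0:ℝ) 1,
    ENNReal.ofReal ((max 1 (stdNormalCDFInv (1 - u/2))) ^ (p - 2) * absQuantile P X u)

/-- `γ` is the centered Gaussian law on `ℝ^D` with covariance matrix `S`. -/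
def IsCenteredGaussianCov (D : ℕ) (S : Matrix (Fin D) (Fin D) ℝ)
    (γ : Measure (EuclideanSpace ℝ (Fin D))) : Prop :=
  IsProbabilityMeasure γ ∧
    ∀ t : Fin D → ℝ,
      Measure.map (fun x => ∑ i, t i * x i) γ =
        gaussianReal 0 (Real.toNNReal (∑ i, ∑ j, t i * S i j * t j))

/-- Partial sums `M_n = ∑_{k=1}^n d_k`. -/
def partialSum {Ω : Type*} {D : ℕ} (d : ℤ → Ω → EuclideanSpace ℝ (Fin D)) (n : ℕ) (ω : Ω) :
    EuclideanSpace ℝ (Fin D) :=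
  ∑ k ∈ Finset.Icc (1 : ℤ) (n : ℤ), d k ω

section helpers

open Finset (Icc Ico card_univ induction_on inf'_le measurable_sum mem_Icc mem_range mem_univ
  mul_sum range range_one range_zero single_le_sum stronglyMeasurable_fun_sum sum_add_distrib
  sum_comm sum_congr sum_const sum_div sum_empty sum_eq_zero sum_eq_zero_iff_of_nonneg sum_insert
  sum_le_sum sum_mul sum_mul_sum sum_nonneg sum_range_add sum_range_reflect sum_range_succ
  sum_sub_distrib univ univ_nonempty)
open ENNReal (mul_lt_top ofReal ofReal_add ofReal_le_ofReal ofReal_lt_top ofReal_mul ofReal_ne_top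
  ofReal_ofNat ofReal_one ofReal_sum_of_nonneg ofReal_toReal one_le_ofReal one_ne_top summable
  tendsto_toReal toReal_le_of_le_ofReal toReal_mono toReal_nonneg toReal_ofReal toReal_one
  toReal_pos tsum_le_tsum)
open Real (add_one_le_exp dist_eq div_rpow exp exp_add exp_le_exp exp_log exp_neg exp_pos log
  log_neg log_pos mul_rpow mul_self_sqrt norm_eq_abs norm_of_nonneg one_le_exp one_le_rpow
  one_le_sqrt rpow_add rpow_add_of_nonneg rpow_add_one rpow_le_rpow rpow_le_rpow_of_exponent_le
  rpow_le_rpow_of_nonpos rpow_mul rpow_natCast rpow_neg rpow_neg_one rpow_nonneg rpow_one rpow_sub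
  rpow_two sq_sqrt sqrt sqrt_eq_rpow sqrt_le_sqrt sqrt_nonneg sqrt_pos zero_rpow)
open EuclideanSpace (basisFun inner_eq_star_dotProduct proj real_norm_sq_eq single)
open Nat (cast_nonneg mod_lt pair two_pow_pos)
open Set (Iic Iio Ioc Ioi Ioo disjoint_left indicator indicator_of_mem inter_comm mem_union)
open NNReal (coe_one)
open Function (Injective comp_apply onFun uncurry)

local notation "𝔼" => EuclideanSpace ℝ
local notation "𝕌" => ℕ → unitInterval

variable {Ω κ : Type*} {mΩ : MeasurableSpace Ω} {μ P ν : Measure Ω} {ι : Type*} [Fintype ι]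
  {D N k n j : ℕ} {G : ℕ → MeasurableSpace Ω} {ℱ : ℤ → MeasurableSpace Ω} {d : ℤ → Ω → 𝔼 (Fin D)}
  {e : ℕ → Ω → 𝔼 ι} {x v L X : ℕ → Ω → ℝ} {a b : ℕ → ℝ} {p q r s t y K B C V ε : ℝ}
  {f g Y : Ω → ℝ} {ω : Ω} {A : 𝔼 (Fin D) →L[ℝ] 𝔼 ι}

/-! ### Elementary inequalities for powers -/

lemma one_add_rpow_le_of_le_three (hp : 2 ≤ p) (hp3 : p ≤ 3) (hy : |y| ≤ 1 / 2) :
    (1 + y) ^ p ≤ 1 + p * y + 4 * y ^ 2 := by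
  obtain ⟨h1, h2⟩ := abs_le.1 hy
  have h0 : 0 < 1 + y := by linarith
  have hb : (1 + y) ^ (p - 2) ≤ 1 + (p - 2) * y :=
    rpow_one_add_le_one_add_mul_self (by linarith) (by linarith) (by linarith)
  have he : (1 + y) ^ p = (1 + y) ^ 2 * (1 + y) ^ (p - 2) := by
    rw [← rpow_natCast, ← rpow_add h0]; norm_num
  rw [he]
  calc (1 + y) ^ 2 * (1 + y) ^ (p - 2) ≤ (1 + y) ^ 2 * (1 + (p - 2) * y) := by gcongr
    _ = 1 + p * y + (1 + 2 * (p - 2)) * y ^ 2 + (p - 2) * y * y ^ 2 := by ring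
    _ ≤ 1 + p * y + 4 * y ^ 2 := by
      have : 0 ≤ (4 - (1 + 2 * (p - 2)) - (p - 2) * y) * y ^ 2 :=
        mul_nonneg (by nlinarith) (sq_nonneg y)
      linarith

lemma one_add_rpow_le_of_le_two (hq : 1 ≤ q) (hq2 : q ≤ 2) (hy : |y| ≤ 1 / 2) :
    (1 + y) ^ q ≤ 1 + q * y + |y| ^ q := by
  obtain ⟨h1, h2⟩ := abs_le.1 hy
  have h0 : 0 < 1 + y := by linarith
  have hb : (1 + y) ^ (q - 1) ≤ 1 + (q - 1) * y :=
    rpow_one_add_le_one_add_mul_self (by linarith) (by linarith) (by linarith)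
  have he : (1 + y) ^ q = (1 + y) * (1 + y) ^ (q - 1) := by
    rw [mul_comm, ← rpow_add_one h0.ne']; norm_num
  have hy2 : y ^ 2 ≤ |y| ^ q := by
    rw [← sq_abs, ← rpow_natCast]
    rcases eq_or_lt_of_le (abs_nonneg y) with h | h
    · rw [← h, zero_rpow (by norm_num), zero_rpow (by linarith)]
    · exact Real.rpow_le_rpow_of_exponent_ge h (by linarith) (by exact_mod_cast hq2)
  rw [he]
  calc (1 + y) * (1 + y) ^ (q - 1) ≤ (1 + y) * (1 + (q - 1) * y) := by gcongr
    _ = 1 + q * y + (q - 1) * y ^ 2 := by ring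
    _ ≤ 1 + q * y + |y| ^ q := by nlinarith

lemma abs_add_rpow_le_of_large {a b : ℝ} (hr : 1 < r) (hr3 : r ≤ 3) (h : |a| ≤ 2 * |b|) :
    |a + b| ^ r ≤ |a| ^ r + r * |a| ^ (r - 2) * a * b + 39 * |b| ^ r := by
  have hb0 := abs_nonneg b
  have h1 : |a + b| ^ r ≤ 27 * |b| ^ r := by
    have : |a + b| ≤ 3 * |b| := (abs_add_le a b).trans (by linarith)
    calc |a + b| ^ r ≤ (3 * |b|) ^ r := rpow_le_rpow (abs_nonneg _) this (by linarith)
      _ = 3 ^ r * |b| ^ r := mul_rpow (by norm_num) hb0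
      _ ≤ 3 ^ (3 : ℝ) * |b| ^ r := by
        gcongr; norm_num
      _ = _ := by norm_num
  have h2 : -(r * |a| ^ (r - 2) * a * b) ≤ 12 * |b| ^ r := by
    rcases eq_or_ne a 0 with rfl | ha
    · simp; positivity
    have ha0 := abs_pos.2 ha
    calc -(r * |a| ^ (r - 2) * a * b) ≤ |r * |a| ^ (r - 2) * a * b| := neg_le_abs _
      _ = r * (|a| ^ (r - 2) * |a|) * |b| := by
        rw [abs_mul, abs_mul, abs_mul, abs_of_pos (by linarith : 0 < r),
          abs_of_nonneg (by positivity : 0 ≤ |a| ^ (r - 2))]; ring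
      _ = r * |a| ^ (r - 1) * |b| := by
        rw [← rpow_add_one ha0.ne']; congr 3; ring
      _ ≤ r * (2 * |b|) ^ (r - 1) * |b| := by
        gcongr
      _ = r * 2 ^ (r - 1) * (|b| ^ (r - 1) * |b|) := by
        rw [mul_rpow (by norm_num) hb0]; ring
      _ = r * 2 ^ (r - 1) * |b| ^ r := by
        have : 0 < |b| := by linarith
        rw [← rpow_add_one this.ne']; congr 2; ring
      _ ≤ 3 * 2 ^ (2 : ℝ) * |b| ^ r := by
        gcongr
        · norm_num
        · linarith
      _ = _ := by norm_num
  have h3 : 0 ≤ |a| ^ r := by positivity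
  linarith

lemma abs_add_eq_of_small {a b : ℝ} (h : 2 * |b| < |a|) :
    |b / a| ≤ 1 / 2 ∧ |a + b| ^ r = |a| ^ r * (1 + b / a) ^ r := by
  have ha0 : 0 < |a| := by linarith [abs_nonneg b]
  have ha := abs_pos.1 ha0
  have hy : |b / a| ≤ 1 / 2 := by
    rw [abs_div, div_le_iff₀ ha0]; linarith
  have h0 : 0 ≤ 1 + b / a := by linarith [(abs_le.1 hy).1]
  refine ⟨hy, ?_⟩
  rw [← mul_rpow ha0.le h0]
  congr 1
  rw [← abs_of_nonneg h0, ← abs_mul]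
  congr 1
  field_simp

lemma abs_add_rpow_le_three (hp : 2 < p) (hp3 : p ≤ 3) (a b : ℝ) :
    |a + b| ^ p ≤ |a| ^ p + p * |a| ^ (p - 2) * a * b
      + 39 * (|a| ^ (p - 2) * b ^ 2 + |b| ^ p) := by
  rcases le_or_gt (|a|) (2 * |b|) with h | h
  · have := abs_add_rpow_le_of_large (by linarith : 1 < p) hp3 h
    have : 0 ≤ |a| ^ (p - 2) * b ^ 2 := by positivity
    linarith
  · obtain ⟨hy, he⟩ := abs_add_eq_of_small h
    have ha0 : 0 < |a| := by linarith [abs_nonneg b]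
    have ha := abs_pos.1 ha0
    have := mul_le_mul_of_nonneg_left (one_add_rpow_le_of_le_three hp.le hp3 hy)
      (by positivity : 0 ≤ |a| ^ p)
    have e : |a| ^ p = |a| ^ (p - 2) * a ^ 2 := by
      rw [← sq_abs a, ← rpow_natCast, ← rpow_add ha0]; norm_num
    have e2 : |a| ^ p * (1 + p * (b / a) + 4 * (b / a) ^ 2)
        = |a| ^ p + p * |a| ^ (p - 2) * a * b + 4 * (|a| ^ (p - 2) * b ^ 2) := by
      rw [e]; field_simp
    rw [he]
    have h1 : 0 ≤ |a| ^ (p - 2) * b ^ 2 := by positivity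
    have h2 : 0 ≤ |b| ^ p := by positivity
    linarith

lemma abs_add_rpow_le_two (hq : 1 < q) (hq2 : q ≤ 2) (a b : ℝ) :
    |a + b| ^ q ≤ |a| ^ q + q * |a| ^ (q - 2) * a * b + 39 * |b| ^ q := by
  rcases le_or_gt (|a|) (2 * |b|) with h | h
  · exact abs_add_rpow_le_of_large hq (by linarith) h
  · obtain ⟨hy, he⟩ := abs_add_eq_of_small h
    have ha0 : 0 < |a| := by linarith [abs_nonneg b]
    have ha := abs_pos.1 ha0
    have := mul_le_mul_of_nonneg_left (one_add_rpow_le_of_le_two hq.le hq2 hy)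
      (by positivity : 0 ≤ |a| ^ q)
    have e : |a| ^ q = |a| ^ (q - 2) * a ^ 2 := by
      rw [← sq_abs a, ← rpow_natCast, ← rpow_add ha0]; norm_num
    have e3 : |a| ^ q * |b / a| ^ q = |b| ^ q := by
      rw [← mul_rpow ha0.le (abs_nonneg _), ← abs_mul, mul_div_cancel₀ _ ha]
    have e2 : |a| ^ q * (1 + q * (b / a) + |b / a| ^ q)
        = |a| ^ q + q * |a| ^ (q - 2) * a * b + |b| ^ q := by
      rw [mul_add, mul_add, e3, e]; field_simp
    rw [he]
    have h2 : 0 ≤ |b| ^ q := by positivity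
    linarith

/-- A weak form of Young's inequality with a free parameter. -/
lemma mul_rpow_le_young {S : ℝ} (hr : 0 < r) (hε : 0 < ε) (hs : 0 ≤ s) (hS : 0 ≤ S) (ht : 0 < t) :
    s ^ t * S ^ r ≤ ε * S ^ (r + t) + ε ^ (-(r / t)) * s ^ (r + t) := by
  have h0 : 0 ≤ ε * S ^ (r + t) := by positivity
  have h1 : 0 ≤ ε ^ (-(r / t)) * s ^ (r + t) := by positivity
  rcases le_total (s ^ t) (ε * S ^ t) with h | h
  · have : s ^ t * S ^ r ≤ ε * S ^ (r + t) := by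
      rw [rpow_add_of_nonneg hS hr.le ht.le]
      calc _ ≤ ε * S ^ t * S ^ r := by gcongr
        _ = _ := by ring
    linarith
  · have : S ^ r ≤ ε ^ (-(r / t)) * s ^ r := by
      have h2 : S ≤ ε ^ (-(1 / t)) * s := by
        have h3 : S ^ t ≤ (ε ^ (-(1 / t)) * s) ^ t := by
          rw [mul_rpow (by positivity) hs, ← rpow_mul hε.le]
          rw [show -(1 / t) * t = -1 by field_simp, rpow_neg_one]
          rw [inv_mul_eq_div, le_div_iff₀ hε]; linarith
        exact (Real.rpow_le_rpow_iff hS (by positivity) ht).1 h3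
      calc S ^ r ≤ (ε ^ (-(1 / t)) * s) ^ r := rpow_le_rpow hS h2 hr.le
        _ = _ := by
          rw [mul_rpow (by positivity) hs, ← rpow_mul hε.le]
          congr 2; ring
    have : s ^ t * S ^ r ≤ ε ^ (-(r / t)) * s ^ (r + t) := by
      rw [rpow_add_of_nonneg hs hr.le ht.le]
      calc _ ≤ s ^ t * (ε ^ (-(r / t)) * s ^ r) := by gcongr
        _ = _ := by ring
    linarith

lemma mul_rpow_le_add {a b : ℝ} (hr : 0 ≤ r) (ht : 0 ≤ t) (ha : 0 ≤ a) (hb : 0 ≤ b) :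
    a ^ r * b ^ t ≤ a ^ (r + t) + b ^ (r + t) := by
  have h0 : 0 ≤ a ^ (r + t) := by positivity
  have h1 : 0 ≤ b ^ (r + t) := by positivity
  rcases le_total a b with h | h
  · have : a ^ r * b ^ t ≤ b ^ (r + t) := by
      rw [rpow_add_of_nonneg hb hr ht]; gcongr
    linarith
  · have : a ^ r * b ^ t ≤ a ^ (r + t) := by
      rw [rpow_add_of_nonneg ha hr ht]; gcongr
    linarith

lemma add_rpow_le_two_rpow {a b : ℝ} (hr : 0 ≤ r) (ha : 0 ≤ a) (hb : 0 ≤ b) :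
    (a + b) ^ r ≤ 2 ^ r * (a ^ r + b ^ r) := by
  have key : ∀ {a b : ℝ}, 0 ≤ a → 0 ≤ b → a ≤ b → (a + b) ^ r ≤ 2 ^ r * (a ^ r + b ^ r) := by
    intro a b ha hb h
    calc (a + b) ^ r ≤ (2 * b) ^ r := rpow_le_rpow (by positivity) (by linarith) hr
      _ = 2 ^ r * b ^ r := mul_rpow (by norm_num) hb
      _ ≤ _ := by gcongr; linarith [rpow_nonneg ha r]
  rcases le_total a b with h | h
  · exact key ha hb h
  · rw [add_comm a, add_comm (a ^ r)]; exact key hb ha h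

/-! ### Integrability of powers -/

lemma integrable_abs_rpow_of_le (hr : 0 ≤ r) (hf : AEStronglyMeasurable f μ)
    (hg : Integrable (fun ω => |g ω| ^ r) μ) (h : ∀ ω, |f ω| ≤ C * |g ω|) :
    Integrable (fun ω => |f ω| ^ r) μ := by
  refine (hg.const_mul (|C| ^ r)).mono' (by fun_prop) (ae_of_all _ fun ω => ?_)
  rw [norm_of_nonneg (by positivity), ← mul_rpow (abs_nonneg _) (abs_nonneg _)]
  exact rpow_le_rpow (abs_nonneg _) ((h ω).trans (by gcongr; exact le_abs_self C)) hr

lemma integrable_abs_add_rpow (hr : 0 ≤ r) (hf : AEStronglyMeasurable f μ)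
    (hg : AEStronglyMeasurable g μ) (hfi : Integrable (fun ω => |f ω| ^ r) μ)
    (hgi : Integrable (fun ω => |g ω| ^ r) μ) :
    Integrable (fun ω => |f ω + g ω| ^ r) μ := by
  refine ((hfi.add hgi).const_mul (2 ^ r)).mono' (by fun_prop) (ae_of_all _ fun ω => ?_)
  rw [norm_of_nonneg (by positivity)]
  exact (rpow_le_rpow (abs_nonneg _) (abs_add_le _ _) hr).trans
    (add_rpow_le_two_rpow hr (abs_nonneg _) (abs_nonneg _))

lemma integrable_abs_sum_rpow {ι : Type*} {f : ι → Ω → ℝ} (hr : 0 < r) (s : Finset ι)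
    (hf : ∀ i ∈ s, AEStronglyMeasurable (f i) μ)
    (hfi : ∀ i ∈ s, Integrable (fun ω => |f i ω| ^ r) μ) :
    Integrable (fun ω => |∑ i ∈ s, f i ω| ^ r) μ := by
  classical
  induction s using induction_on with
  | empty => simp [zero_rpow hr.ne']
  | insert a s ha ih =>
    simp only [sum_insert ha]
    refine integrable_abs_add_rpow hr.le (hf a (by simp)) ?_ (hfi a (by simp))
      (ih (fun i hi => hf i (by simp [hi])) (fun i hi => hfi i (by simp [hi])))
    exact Finset.aestronglyMeasurable_fun_sum s fun i hi => hf i (by simp [hi])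

lemma integrable_of_abs_rpow [IsFiniteMeasure μ] (hr : 1 ≤ r) (hf : AEStronglyMeasurable f μ)
    (hfi : Integrable (fun ω => |f ω| ^ r) μ) :
    Integrable f μ := by
  refine ((integrable_const 1).add hfi).mono' hf (ae_of_all _ fun ω => ?_)
  simp
  have := mul_rpow_le_add (t := r - 1) zero_le_one (by linarith) (abs_nonneg (f ω))
    zero_le_one
  simpa [add_comm] using this

lemma integrable_abs_rpow_of_exponent_le [IsFiniteMeasure μ] (hr : 0 ≤ r) (hrs : r ≤ s)
    (hf : AEStronglyMeasurable f μ) (hfi : Integrable (fun ω => |f ω| ^ s) μ) :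
    Integrable (fun ω => |f ω| ^ r) μ := by
  refine ((integrable_const 1).add hfi).mono' (by fun_prop) (ae_of_all _ fun ω => ?_)
  simp only [Pi.add_apply]
  rw [norm_of_nonneg (by positivity)]
  have := mul_rpow_le_add (t := s - r) hr (by linarith) (abs_nonneg (f ω))
    zero_le_one
  simpa [add_comm] using this

lemma integrable_rpow_mul_rpow (hr : 0 ≤ r) (ht : 0 ≤ t) (hf : AEStronglyMeasurable f μ)
    (hg : AEStronglyMeasurable g μ) (hfi : Integrable (fun ω => |f ω| ^ (r + t)) μ)
    (hgi : Integrable (fun ω => |g ω| ^ (r + t)) μ) :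
    Integrable (fun ω => |f ω| ^ r * |g ω| ^ t) μ := by
  refine (hfi.add hgi).mono' (by fun_prop) (ae_of_all _ fun ω => ?_)
  rw [norm_of_nonneg (by positivity)]
  exact mul_rpow_le_add hr ht (abs_nonneg _) (abs_nonneg _)

lemma integrable_rpow_mul (hr : 1 ≤ r) (hf : AEStronglyMeasurable f μ)
    (hg : AEStronglyMeasurable g μ) (hfi : Integrable (fun ω => |f ω| ^ r) μ)
    (hgi : Integrable (fun ω => |g ω| ^ r) μ) :
    Integrable (fun ω => |f ω| ^ (r - 1) * g ω) μ := by
  have h := integrable_rpow_mul_rpow (r := r - 1) (by linarith) zero_le_one hf hg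
    (by simpa using hfi) (by simpa using hgi)
  have hr1 : 0 ≤ r - 1 := by linarith
  refine h.mono (by fun_prop) (ae_of_all _ fun ω => le_of_eq ?_)
  simp

lemma abs_rpow_sub_two_mul_self (hr : 1 < r) (a : ℝ) :
    |(|a| ^ (r - 2) * a)| = |a| ^ (r - 1) := by
  rcases eq_or_ne a 0 with rfl | ha
  · simp [zero_rpow (by linarith : r - 1 ≠ 0)]
  · rw [abs_mul, abs_of_nonneg (by positivity), ← rpow_add_one (abs_pos.2 ha).ne']
    congr 1; ring

lemma integral_mul_eq_zero_of_condExp_eq_zero {m : MeasurableSpace Ω} (hm : m ≤ mΩ)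
    [IsFiniteMeasure μ] {W x : Ω → ℝ}
    (hW : StronglyMeasurable[m] W) (hx : Integrable x μ) (hWx : Integrable (fun ω => W ω * x ω) μ)
    (h0 : μ[x | m] =ᵐ[μ] 0) : ∫ ω, W ω * x ω ∂μ = 0 := by
  have h := condExp_mul_of_stronglyMeasurable_left hW hWx hx
  have h2 : μ[W * x | m] =ᵐ[μ] 0 := by
    filter_upwards [h, h0] with ω h1 h2
    simp [h1, h2]
  calc ∫ ω, W ω * x ω ∂μ = ∫ ω, (μ[W * x | m]) ω ∂μ := (integral_condExp hm).symm
    _ = 0 := by rw [integral_congr_ae h2]; simp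

lemma integral_mul_condExp {m : MeasurableSpace Ω} (hm : m ≤ mΩ)
    [IsFiniteMeasure μ] {W x : Ω → ℝ}
    (hW : StronglyMeasurable[m] W) (hx : Integrable x μ)
    (hWx : Integrable (fun ω => W ω * x ω) μ) :
    ∫ ω, W ω * (μ[x | m]) ω ∂μ = ∫ ω, W ω * x ω ∂μ := by
  have h := condExp_mul_of_stronglyMeasurable_left hW hWx hx
  calc ∫ ω, W ω * (μ[x | m]) ω ∂μ = ∫ ω, (μ[W * x | m]) ω ∂μ := (integral_congr_ae h).symm
    _ = _ := integral_condExp hm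

/-! ### Running maxima -/

/-- The running maximum of a real sequence. -/
def runMax (a : ℕ → ℝ) : ℕ → ℝ
  | 0 => a 0
  | n + 1 => max (runMax a n) (a (n + 1))

lemma le_runMax (a : ℕ → ℝ) (h : k ≤ n) : a k ≤ runMax a n := by
  induction n with
  | zero => obtain rfl : k = 0 := by omega
            exact le_rfl
  | succ n ih =>
    rcases Nat.lt_or_ge n k with h' | h'
    · obtain rfl : k = n + 1 := by omega
      exact le_max_right _ _
    · exact (ih h').trans (le_max_left _ _)

lemma runMax_le (h : ∀ k ≤ n, a k ≤ B) : runMax a n ≤ B := by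
  induction n with
  | zero => exact h 0 le_rfl
  | succ n ih => exact max_le (ih fun k hk => h k (by omega)) (h _ le_rfl)

lemma runMax_nonneg (h : ∀ k, 0 ≤ a k) (n : ℕ) : 0 ≤ runMax a n :=
  (h 0).trans (le_runMax a (Nat.zero_le n))

lemma runMax_le_sum (h : ∀ k, 0 ≤ a k) (n : ℕ) :
    runMax a n ≤ ∑ k ∈ range (n + 1), a k :=
  runMax_le fun k hk => single_le_sum (fun i _ => h i) (by simp; omega)

lemma stronglyMeasurable_runMax {m : MeasurableSpace Ω} {f : ℕ → Ω → ℝ}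
    (hf : ∀ k ≤ n, StronglyMeasurable[m] (f k)) :
    StronglyMeasurable[m] (fun ω => runMax (fun k => f k ω) n) := by
  induction n with
  | zero => exact hf 0 le_rfl
  | succ n ih => exact (ih fun k hk => hf k (by omega)).sup (hf _ le_rfl)

/-! ### Martingale difference sequences -/

/-- `x` is a martingale difference sequence: `x n` is `G (n + 1)`-measurable and centered
given `G n`. -/
structure IsMDS (μ : Measure Ω) (G : ℕ → MeasurableSpace Ω) (x : ℕ → Ω → ℝ) : Prop where
  mono : Monotone G
  le : ∀ n, G n ≤ mΩ
  meas : ∀ n, StronglyMeasurable[G (n + 1)] (x n)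
  int : ∀ n, Integrable (x n) μ
  zero : ∀ n, μ[x n | G n] =ᵐ[μ] 0

/-- Partial sums `∑_{k<n} x_k`. -/
def psum (x : ℕ → Ω → ℝ) (n : ℕ) (ω : Ω) : ℝ := ∑ k ∈ range n, x k ω

@[simp] lemma psum_zero (ω : Ω) : psum x 0 ω = 0 := by simp [psum]

lemma psum_succ (n : ℕ) (ω : Ω) : psum x (n + 1) ω = psum x n ω + x n ω :=
  sum_range_succ _ _

lemma IsMDS.meas' (h : IsMDS μ G x) (n : ℕ) : StronglyMeasurable (x n) := (h.meas n).mono (h.le _)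

lemma IsMDS.psum_meas (h : IsMDS μ G x) (hk : k ≤ n) :
    StronglyMeasurable[G n] (psum x k) :=
  stronglyMeasurable_fun_sum _ fun i hi =>
    (h.meas i).mono (h.mono (by have := mem_range.1 hi; omega))

lemma IsMDS.psum_meas' (h : IsMDS μ G x) (n : ℕ) : StronglyMeasurable (psum x n) :=
  (h.psum_meas le_rfl).mono (h.le n)

lemma IsMDS.psum_int_rpow (h : IsMDS μ G x) (hr : 0 < r)
    (hx : ∀ k, Integrable (fun ω => |x k ω| ^ r) μ) (n : ℕ) :
    Integrable (fun ω => |psum x n ω| ^ r) μ :=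
  integrable_abs_sum_rpow hr _ (fun i _ => (h.meas' i).aestronglyMeasurable) fun i _ => hx i

lemma IsMDS.runMax_meas (h : IsMDS μ G x) (n : ℕ) :
    StronglyMeasurable[G n] (fun ω => runMax (fun k => |psum x k ω|) n) :=
  stronglyMeasurable_runMax
    fun _ hk => (h.psum_meas hk).norm

lemma IsMDS.runMax_int_rpow (h : IsMDS μ G x) (hr : 0 < r)
    (hx : ∀ k, Integrable (fun ω => |x k ω| ^ r) μ) (n : ℕ) :
    Integrable (fun ω => (runMax (fun k => |psum x k ω|) n) ^ r) μ := by
  have hm := ((h.runMax_meas n).mono (h.le n)).aestronglyMeasurable (μ := μ)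
  have h2 : Integrable (fun ω => |(∑ k ∈ range (n + 1), |psum x k ω|)| ^ r) μ :=
    integrable_abs_sum_rpow hr _
      (fun i _ => ((h.psum_meas' i).norm).aestronglyMeasurable)
      (fun i _ => by simpa using h.psum_int_rpow hr hx i)
  refine h2.mono' ((hm.aemeasurable.pow_const _).aestronglyMeasurable) (ae_of_all _ fun ω => ?_)
  have h0 := runMax_nonneg (a := fun k => |psum x k ω|) (fun k => abs_nonneg _) n
  rw [norm_of_nonneg (by positivity)]
  exact rpow_le_rpow h0 ((runMax_le_sum (fun k => abs_nonneg _) n).trans (le_abs_self _)) hr.le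

/-- Constant in Doob's inequality. -/
def doobC (r : ℝ) : ℝ := 2 * r / (r - 1) * ((r - 1) / (2 * r)) ^ (-(r - 1))

lemma doobC_nonneg (hr : 1 < r) : 0 ≤ doobC r := by
  have : 0 < r - 1 := by linarith
  unfold doobC; positivity

/-- Pathwise Azéma–Yor step behind Doob's inequality. -/
lemma azema_yor_step {S s' : ℝ} (hr : 1 < r) (hS : 0 ≤ S) :
    r * S ^ (r - 1) * (s' - s) ≤
      (r * s' * (max S s') ^ (r - 1) - (r - 1) * (max S s') ^ r)
        - (r * s * S ^ (r - 1) - (r - 1) * S ^ r) := by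
  rcases le_total s' S with h | h
  · rw [max_eq_left h]; linarith
  · rw [max_eq_right h]
    have hs' := hS.trans h
    have e : ∀ {a : ℝ}, 0 ≤ a → a * a ^ (r - 1) = a ^ r := by
      intro a ha
      conv_lhs => rw [← rpow_one a]
      rw [← rpow_mul ha, ← rpow_add_of_nonneg ha (by linarith) (by linarith)]
      congr 1; ring
    have key : S ^ r + r * S ^ (r - 1) * (s' - S) ≤ s' ^ r := by
      rcases eq_or_lt_of_le hS with h0 | h0
      · rw [← h0, zero_rpow (by linarith), zero_rpow (by linarith)]
        simp; positivity
      · have hb := one_add_mul_self_le_rpow_one_add (s := s' / S - 1)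
          (by have : 0 ≤ s' / S := by positivity
              linarith) hr.le
        have h1 := mul_le_mul_of_nonneg_left hb (by positivity : 0 ≤ S ^ r)
        rw [← mul_rpow hS (by linarith [show 0 ≤ s' / S by positivity])] at h1
        have e1 : S * (1 + (s' / S - 1)) = s' := by field_simp; ring
        rw [e1, ← e hS] at h1
        have e2 : S * S ^ (r - 1) * (1 + r * (s' / S - 1))
            = S * S ^ (r - 1) + r * S ^ (r - 1) * (s' - S) := by field_simp
        rw [e2, e hS] at h1
        exact h1
    have e3 : r * s' * s' ^ (r - 1) = r * s' ^ r := by rw [mul_assoc, e hs']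
    have e4 : r * s * S ^ (r - 1) - (r - 1) * S ^ r = r * S ^ (r - 1) * (s - S) + S ^ r := by
      rw [← e hS]; ring
    rw [e3, e4]
    have : r * S ^ (r - 1) * (s' - s) = r * S ^ (r - 1) * (s' - S) - r * S ^ (r - 1) * (s - S) := by
      ring
    linarith

/-- Doob's maximal inequality in `L^r`. -/
theorem IsMDS.doob [IsFiniteMeasure μ] (h : IsMDS μ G x) (hr : 1 < r)
    (hx : ∀ k, Integrable (fun ω => |x k ω| ^ r) μ) (n : ℕ) :
    ∫ ω, (runMax (fun k => |psum x k ω|) n) ^ r ∂μ ≤ doobC r * ∫ ω, |psum x n ω| ^ r ∂μ := by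
  set S : ℕ → Ω → ℝ := fun n ω => runMax (fun k => |psum x k ω|) n with hSdef
  have hS0 : ∀ n ω, 0 ≤ S n ω := fun n ω => runMax_nonneg (fun k => abs_nonneg _) n
  have hr0 : 0 < r := by linarith
  have hSm : ∀ n, AEStronglyMeasurable (S n) μ := fun n =>
    ((h.runMax_meas n).mono (h.le n)).aestronglyMeasurable
  have hSi : ∀ n, Integrable (fun ω => |S n ω| ^ r) μ := fun n => by
    simpa only [abs_of_nonneg (hS0 n _)] using h.runMax_int_rpow hr0 hx n
  have hPi := h.psum_int_rpow hr0 hx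
  have hPm : ∀ n, AEStronglyMeasurable (fun ω => |psum x n ω|) μ := fun n =>
    (h.psum_meas' n).norm.aestronglyMeasurable
  have hSP := fun n => by
    simpa only [abs_of_nonneg (hS0 n _)] using
      integrable_rpow_mul hr.le (hSm n) (hPm n) (hSi n) (by simpa using hPi n)
  have hA : ∀ n, Integrable (fun ω => r * |psum x n ω| * S n ω ^ (r - 1)
      - (r - 1) * S n ω ^ r) μ := fun n => by
    refine Integrable.sub ?_ ?_
    · refine ((hSP n).const_mul r).congr (ae_of_all _ fun ω => ?_); simp only; ring
    · simpa only [abs_of_nonneg (hS0 n _)] using (hSi n).const_mul (r - 1)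
  have hstep : ∀ n, 0 ≤ ∫ ω, (r * |psum x n ω| * S n ω ^ (r - 1) - (r - 1) * S n ω ^ r) ∂μ := by
    intro n
    induction n with
    | zero =>
      simp [hSdef, runMax, zero_rpow hr0.ne']
    | succ n ih =>
      refine ih.trans ?_
      rw [← sub_nonneg, ← integral_sub (hA _) (hA _)]
      set W : Ω → ℝ := fun ω => r * S n ω ^ (r - 1) * SignType.sign (psum x n ω) with hW
      have hWm : StronglyMeasurable[G n] W := by
        have h1 := (h.runMax_meas n).measurable
        have h2 : Measurable[G n] (psum x n) := (h.psum_meas le_rfl).measurable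
        have h3 : Measurable (fun t : ℝ => ((SignType.sign t : SignType) : ℝ)) := by
          have : (fun t : ℝ => ((SignType.sign t : SignType) : ℝ))
              = fun t => if 0 < t then 1 else if t < 0 then -1 else 0 := by
            funext t
            rcases lt_trichotomy t 0 with ht | ht | ht
            · simp [ht, not_lt.2 ht.le]
            · simp [ht]
            · simp [ht]
          rw [this]
          exact Measurable.ite measurableSet_Ioi measurable_const
            (Measurable.ite measurableSet_Iio measurable_const measurable_const)
        exact (((h1.pow_const _).const_mul r).mul (h3.comp h2)).stronglyMeasurable
      have hSx := integrable_rpow_mul hr.le (hSm n) (h.meas' n).aestronglyMeasurable (hSi n) (hx n)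
      simp only [abs_of_nonneg (hS0 n _)] at hSx
      have hWi : Integrable (fun ω => W ω * x n ω) μ := by
        refine (hSx.const_mul r).mono
          ((hWm.mono (h.le n)).aestronglyMeasurable.mul (h.meas' n).aestronglyMeasurable)
          (ae_of_all _ fun ω => ?_)
        simp only [hW, norm_mul]
        have : ‖((SignType.sign (psum x n ω) : SignType) : ℝ)‖ ≤ 1 := by
          rcases SignType.sign (psum x n ω) <;> simp
        calc _ ≤ ‖r‖ * ‖S n ω ^ (r - 1)‖ * 1 * ‖x n ω‖ := by gcongr
          _ = _ := by ring
      rw [← integral_mul_eq_zero_of_condExp_eq_zero (h.le n) hWm (h.int n) hWi (h.zero n)]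
      refine integral_mono hWi ((hA _).sub (hA _)) fun ω => ?_
      refine le_trans ?_ (azema_yor_step hr (hS0 n ω))
      have h1 : ((SignType.sign (psum x n ω) : SignType) : ℝ) * x n ω
          ≤ |psum x (n + 1) ω| - |psum x n ω| := by
        rw [psum_succ]
        have e :=
          (sign_mul_self (psum x n ω)).symm
        have : ((SignType.sign (psum x n ω) : SignType) : ℝ) * (psum x n ω + x n ω)
            ≤ |psum x n ω + x n ω| := by
          rcases lt_trichotomy (psum x n ω) 0 with ht | ht | ht
          · simp [ht]; linarith [neg_abs_le (psum x n ω + x n ω)]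
          · simp [ht]
          · simp [ht]; exact le_abs_self _
        linarith
      have h2 : 0 ≤ r * S n ω ^ (r - 1) := by have := hS0 n ω; positivity
      calc W ω * x n ω = r * S n ω ^ (r - 1) * (SignType.sign (psum x n ω) * x n ω) := by
            simp only [hW]; ring
        _ ≤ _ := by gcongr
  have hfin := hstep n
  set ε := (r - 1) / (2 * r) with hε
  have hr1 : 0 < r - 1 := by linarith
  have hε0 : 0 < ε := by positivity
  have hSi' : Integrable (fun ω => S n ω ^ r) μ := by
    simpa only [abs_of_nonneg (hS0 n _)] using hSi n
  have h3 : ∫ ω, (r * |psum x n ω| * S n ω ^ (r - 1) - (r - 1) * S n ω ^ r) ∂μ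
      ≤ ∫ ω, (r * ε ^ (-(r - 1)) * |psum x n ω| ^ r - (r - 1) / 2 * S n ω ^ r) ∂μ := by
    refine integral_mono (hA n) (((hPi n).const_mul _).sub (hSi'.const_mul _)) fun ω => ?_
    have := mul_rpow_le_young hr1 hε0 (abs_nonneg (psum x n ω)) (hS0 n ω) one_pos
    rw [rpow_one, div_one, sub_add_cancel] at this
    have h4 := mul_le_mul_of_nonneg_left this hr0.le
    have h5 : r * (ε * S n ω ^ r) = (r - 1) / 2 * S n ω ^ r := by rw [hε]; field_simp
    simp only
    rw [mul_add, h5] at h4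
    linarith
  rw [integral_sub ((hPi n).const_mul _) (hSi'.const_mul _), integral_const_mul,
    integral_const_mul] at h3
  have h4 : (r - 1) / 2 * ∫ ω, S n ω ^ r ∂μ ≤ r * ε ^ (-(r - 1)) * ∫ ω, |psum x n ω| ^ r ∂μ := by
    linarith
  have h5 : doobC r * ∫ ω, |psum x n ω| ^ r ∂μ
      = 2 / (r - 1) * (r * ε ^ (-(r - 1)) * ∫ ω, |psum x n ω| ^ r ∂μ) := by
    unfold doobC; rw [← hε]; ring
  rw [h5]
  calc ∫ ω, S n ω ^ r ∂μ = 2 / (r - 1) * ((r - 1) / 2 * ∫ ω, S n ω ^ r ∂μ) := by field_simp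
    _ ≤ _ := by gcongr

/-! ### Moment inequalities for martingales -/

lemma IsMDS.integrable_cross (h : IsMDS μ G x) (hr : 1 < r)
    (hx : ∀ k, Integrable (fun ω => |x k ω| ^ r) μ) (n : ℕ) :
    Integrable (fun ω => r * |psum x n ω| ^ (r - 2) * psum x n ω * x n ω) μ := by
  have h1 := integrable_rpow_mul hr.le (h.psum_meas' n).aestronglyMeasurable
    (h.meas' n).aestronglyMeasurable (h.psum_int_rpow (by linarith) hx n) (hx n)
  have hm := (h.psum_meas' n).measurable
  refine (h1.const_mul r).mono ?_ (ae_of_all _ fun ω => le_of_eq ?_)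
  · exact ((((hm.abs.pow_const _).const_mul r).mul hm).mul
      (h.meas' n).measurable).aestronglyMeasurable
  · have := abs_rpow_sub_two_mul_self hr (psum x n ω)
    rw [← this]
    simp
    ring

lemma IsMDS.integral_cross [IsFiniteMeasure μ] (h : IsMDS μ G x) (hr : 1 < r)
    (hx : ∀ k, Integrable (fun ω => |x k ω| ^ r) μ) (n : ℕ) :
    ∫ ω, r * |psum x n ω| ^ (r - 2) * psum x n ω * x n ω ∂μ = 0 := by
  have hm := (h.psum_meas (le_refl n)).measurable
  exact integral_mul_eq_zero_of_condExp_eq_zero (h.le n)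
   
    ((((measurable_norm.comp hm).pow_const _).const_mul r).mul hm).stronglyMeasurable (h.int n)
    (h.integrable_cross hr hx n) (h.zero n)

/-- The von Bahr–Esseen inequality. -/
theorem IsMDS.vonBahr_esseen [IsFiniteMeasure μ] (h : IsMDS μ G x) (hq : 1 < q) (hq2 : q ≤ 2)
    (hx : ∀ k, Integrable (fun ω => |x k ω| ^ q) μ) (n : ℕ) :
    ∫ ω, |psum x n ω| ^ q ∂μ ≤ 39 * ∑ k ∈ range n, ∫ ω, |x k ω| ^ q ∂μ := by
  induction n with
  | zero => simp [zero_rpow (by linarith : q ≠ 0)]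
  | succ n ih =>
    rw [sum_range_succ, mul_add]
    have hP := h.psum_int_rpow (by linarith) hx n
    have hc := h.integrable_cross hq hx n
    have hPc : Integrable (fun ω => |psum x n ω| ^ q
      + q * |psum x n ω| ^ (q - 2) * psum x n ω * x n ω) μ := hP.add hc
    calc ∫ ω, |psum x (n + 1) ω| ^ q ∂μ
        ≤ ∫ ω, (|psum x n ω| ^ q + q * |psum x n ω| ^ (q - 2) * psum x n ω * x n ω
            + 39 * |x n ω| ^ q) ∂μ := by
          refine integral_mono (h.psum_int_rpow (by linarith) hx _)
            (hPc.add ((hx n).const_mul 39)) fun ω => ?_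
          simp only [psum_succ]
          exact abs_add_rpow_le_two hq hq2 _ _
      _ = ∫ ω, |psum x n ω| ^ q ∂μ + 0 + 39 * ∫ ω, |x n ω| ^ q ∂μ := by
          rw [integral_add hPc ((hx n).const_mul 39), integral_add hP hc,
            h.integral_cross hq hx n, integral_const_mul]
      _ ≤ _ := by linarith

/-- The sum of squares `∑_{k<n} x_k²`. -/
def sqSum (x : ℕ → Ω → ℝ) (n : ℕ) (ω : Ω) : ℝ := ∑ k ∈ range n, x k ω ^ 2

lemma sqSum_nonneg (n : ℕ) (ω : Ω) : 0 ≤ sqSum x n ω := sum_nonneg fun _ _ => sq_nonneg _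

lemma sq_rpow_half (a : ℝ) : (a ^ 2) ^ (p / 2) = |a| ^ p := by
  rw [← sq_abs, ← rpow_natCast, ← rpow_mul (abs_nonneg a)]
  congr 1; push_cast; ring

lemma sum_abs_rpow_le_sqSum (hp : 2 ≤ p) (n : ℕ) (ω : Ω) :
    ∑ k ∈ range n, |x k ω| ^ p ≤ sqSum x n ω ^ (p / 2) := by
  have e : sqSum x n ω ^ (p / 2) = sqSum x n ω * sqSum x n ω ^ (p / 2 - 1) := by
    conv_rhs => rw [← rpow_one (sqSum x n ω)]
    rw [← rpow_mul (sqSum_nonneg n ω), ← rpow_add_of_nonneg (sqSum_nonneg n ω)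
      (by norm_num) (by linarith)]
    congr 1; ring
  rw [e]
  conv_rhs => rw [sqSum, sum_mul]
  refine sum_le_sum fun k hk => ?_
  have h1 :=
    single_le_sum (f := fun k => x k ω ^ 2) (fun i _ => sq_nonneg _) hk
  have e3 : |x k ω| ^ p = x k ω ^ 2 * (x k ω ^ 2) ^ (p / 2 - 1) := by
    rw [← sq_rpow_half]
    conv_rhs => rw [← rpow_one (x k ω ^ 2)]
    rw [← rpow_mul (sq_nonneg _), ← rpow_add_of_nonneg (sq_nonneg _)
      (by norm_num) (by linarith)]
    congr 1; ring
  rw [e3]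
  exact mul_le_mul_of_nonneg_left (rpow_le_rpow (sq_nonneg _) h1 (by linarith)) (sq_nonneg _)

lemma IsMDS.sqSum_int (h : IsMDS μ G x) (hp : 0 < p) (hx : ∀ k, Integrable (fun ω => |x k ω| ^ p) μ)
    (n : ℕ) :
    Integrable (fun ω => sqSum x n ω ^ (p / 2)) μ := by
  have := integrable_abs_sum_rpow (f := fun k ω => x k ω ^ 2) (r := p / 2) (by linarith)
    (range n) (fun i _ => ((h.meas' i).pow 2).aestronglyMeasurable)
    (fun i _ => by simpa only [abs_pow, sq_abs, sq_rpow_half] using hx i)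
  refine this.congr (ae_of_all _ fun ω => ?_)
  simp only
  rw [abs_of_nonneg (sum_nonneg fun i _ => sq_nonneg _)]
  rfl

/-- Constant in the Burkholder inequality. -/
def bdgC (p : ℝ) : ℝ :=
  doobC p * (78 * ((1 / (78 * (doobC p + 1))) ^ (-((p - 2) / 2)) + 1))

lemma bdgC_nonneg (hp : 2 < p) : 0 ≤ bdgC p := by
  have := doobC_nonneg (by linarith : 1 < p)
  unfold bdgC; positivity

/-- The Burkholder inequality for exponents in `(2, 3]`. -/
theorem IsMDS.burkholder [IsFiniteMeasure μ] (h : IsMDS μ G x) (hp : 2 < p) (hp3 : p ≤ 3)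
    (hx : ∀ k, Integrable (fun ω => |x k ω| ^ p) μ) (n : ℕ) :
    ∫ ω, (runMax (fun k => |psum x k ω|) n) ^ p ∂μ
      ≤ bdgC p * ∫ ω, sqSum x n ω ^ (p / 2) ∂μ := by
  have hp1 : 1 < p := by linarith
  have hp0 : 0 < p := by linarith
  have hPi := h.psum_int_rpow hp0 hx
  have hPm : ∀ k, AEStronglyMeasurable (psum x k) μ := fun k =>
    (h.psum_meas' k).aestronglyMeasurable
  have hxm : ∀ k, AEStronglyMeasurable (x k) μ := fun k => (h.meas' k).aestronglyMeasurable
  have hmix : ∀ k j, Integrable (fun ω => |psum x k ω| ^ (p - 2) * x j ω ^ 2) μ := fun k j => by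
    have := integrable_rpow_mul_rpow (r := p - 2) (t := 2) (by linarith) (by norm_num) (hPm k)
      (hxm j) (by simpa using hPi k) (by simpa using hx j)
    refine this.congr (ae_of_all _ fun ω => ?_)
    simp
  have hstep : ∀ n, ∫ ω, |psum x n ω| ^ p ∂μ ≤ ∑ k ∈ range n,
      ∫ ω, 39 * (|psum x k ω| ^ (p - 2) * x k ω ^ 2 + |x k ω| ^ p) ∂μ := by
    intro n
    induction n with
    | zero => simp [zero_rpow hp0.ne']
    | succ n ih =>
      rw [sum_range_succ]
      have hc := h.integrable_cross hp1 hx n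
      have hr : Integrable (fun ω => 39 * (|psum x n ω| ^ (p - 2) * x n ω ^ 2 + |x n ω| ^ p)) μ :=
        ((hmix n n).add (hx n)).const_mul 39
      have hPc : Integrable (fun ω => |psum x n ω| ^ p
        + p * |psum x n ω| ^ (p - 2) * psum x n ω * x n ω) μ := (hPi n).add hc
      calc ∫ ω, |psum x (n + 1) ω| ^ p ∂μ
          ≤ ∫ ω, (|psum x n ω| ^ p + p * |psum x n ω| ^ (p - 2) * psum x n ω * x n ω
              + 39 * (|psum x n ω| ^ (p - 2) * x n ω ^ 2 + |x n ω| ^ p)) ∂μ := by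
            refine integral_mono (hPi _) (hPc.add hr) fun ω => ?_
            simp only [psum_succ]
            exact abs_add_rpow_le_three hp hp3 _ _
        _ = ∫ ω, |psum x n ω| ^ p ∂μ + 0
              + ∫ ω, 39 * (|psum x n ω| ^ (p - 2) * x n ω ^ 2 + |x n ω| ^ p) ∂μ := by
            rw [integral_add hPc hr, integral_add (hPi n) hc,
              h.integral_cross hp1 hx n]
        _ ≤ _ := by linarith
  set S : Ω → ℝ := fun ω => runMax (fun k => |psum x k ω|) n
  have hS0 : ∀ ω, 0 ≤ S ω := fun ω => runMax_nonneg (fun k => abs_nonneg _) n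
  have hSi := h.runMax_int_rpow hp0 hx n
  have hQi := h.sqSum_int hp0 hx n
  have hd := doobC_nonneg hp1
  set ε : ℝ := 1 / (78 * (doobC p + 1)) with hε
  have hε0 : 0 < ε := by positivity
  set c : ℝ := ε ^ (-((p - 2) / 2))
  have hc0 : 0 ≤ c := by positivity
  have h1 : ∫ ω, |psum x n ω| ^ p ∂μ
      ≤ 39 * ε * ∫ ω, S ω ^ p ∂μ + 39 * (c + 1) * ∫ ω, sqSum x n ω ^ (p / 2) ∂μ := by
    refine (hstep n).trans ?_
    have hi : ∀ i, Integrable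
        (fun ω => 39 * (|psum x i ω| ^ (p - 2) * x i ω ^ 2 + |x i ω| ^ p)) μ := fun i =>
      ((hmix i i).add (hx i)).const_mul 39
    rw [← integral_finsetSum _ fun i _ => hi i,
      ← integral_const_mul, ← integral_const_mul,
      ← integral_add (hSi.const_mul _) (hQi.const_mul _)]
    refine integral_mono (integrable_finsetSum _ fun i _ => hi i)
      ((hSi.const_mul _).add (hQi.const_mul _)) fun ω => ?_
    simp only
    rw [← mul_sum, sum_add_distrib]
    have h2 : ∑ k ∈ range n, |psum x k ω| ^ (p - 2) * x k ω ^ 2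
        ≤ S ω ^ (p - 2) * sqSum x n ω := by
      rw [sqSum, mul_sum]
      refine sum_le_sum fun k hk => ?_
      have := le_runMax (fun k => |psum x k ω|) (mem_range.1 hk).le
      exact mul_le_mul_of_nonneg_right
        (rpow_le_rpow (abs_nonneg _) this (by linarith)) (sq_nonneg _)
    have h3 := mul_rpow_le_young (r := p - 2) (by linarith) hε0
      (sqrt_nonneg (sqSum x n ω)) (hS0 ω) two_pos
    have e1 : sqrt (sqSum x n ω) ^ (2 : ℝ) = sqSum x n ω := by
      rw [show 2 = ((2 : ℕ) : ℝ) by norm_num, rpow_natCast,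
        sq_sqrt (sqSum_nonneg n ω)]
    have e2 : sqrt (sqSum x n ω) ^ p = sqSum x n ω ^ (p / 2) := by
      rw [sqrt_eq_rpow, ← rpow_mul (sqSum_nonneg n ω)]; congr 1; ring
    rw [sub_add_cancel, e1, e2] at h3
    have h4 := sum_abs_rpow_le_sqSum (x := x) hp.le n ω
    calc 39 * (∑ k ∈ range n, |psum x k ω| ^ (p - 2) * x k ω ^ 2
          + ∑ k ∈ range n, |x k ω| ^ p)
        ≤ 39 * (sqSum x n ω * S ω ^ (p - 2) + sqSum x n ω ^ (p / 2)) := by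
          gcongr; linarith
      _ ≤ 39 * (ε * S ω ^ p + c * sqSum x n ω ^ (p / 2) + sqSum x n ω ^ (p / 2)) := by gcongr
      _ = _ := by ring
  have h2 := h.doob hp1 hx n
  have hP0 : 0 ≤ ∫ ω, |psum x n ω| ^ p ∂μ := integral_nonneg fun ω => by positivity
  have h3 : 39 * ε * ∫ ω, S ω ^ p ∂μ ≤ 1 / 2 * ∫ ω, |psum x n ω| ^ p ∂μ := by
    calc 39 * ε * ∫ ω, S ω ^ p ∂μ ≤ 39 * ε * (doobC p * ∫ ω, |psum x n ω| ^ p ∂μ) := by gcongr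
      _ = (doobC p / (doobC p + 1)) * (1 / 2 * ∫ ω, |psum x n ω| ^ p ∂μ) := by
          rw [hε]; field_simp; ring
      _ ≤ 1 * (1 / 2 * ∫ ω, |psum x n ω| ^ p ∂μ) := by
          gcongr
          rw [div_le_one (by positivity)]; linarith
      _ = _ := one_mul _
  have h4 : ∫ ω, |psum x n ω| ^ p ∂μ ≤ 78 * (c + 1) * ∫ ω, sqSum x n ω ^ (p / 2) ∂μ := by linarith
  calc _ ≤ doobC p * ∫ ω, |psum x n ω| ^ p ∂μ := h2
    _ ≤ doobC p * (78 * (c + 1) * ∫ ω, sqSum x n ω ^ (p / 2) ∂μ) := by gcongr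
    _ = _ := by rw [bdgC]; ring

/-! ### Self-normalized exponential bounds -/

lemma exp_sub_sq_le (y : ℝ) : exp (y - y ^ 2) ≤ 1 + y + y ^ 2 := by
  have h1 : 0 < 1 - y + y ^ 2 := by nlinarith
  have h2 : 1 - y + y ^ 2 ≤ exp (-(y - y ^ 2)) := by
    have := add_one_le_exp (-(y - y ^ 2)); linarith
  have h3 : exp (y - y ^ 2) * exp (-(y - y ^ 2)) = 1 := by
    rw [← exp_add]; simp
  have h4 : 0 < exp (y - y ^ 2) := exp_pos _
  have h5 : exp (y - y ^ 2) * (1 - y + y ^ 2) ≤ 1 := by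
    have := mul_le_mul_of_nonneg_left h2 h4.le
    linarith [h3]
  have h6 : 1 ≤ (1 - y + y ^ 2) * (1 + y + y ^ 2) := by nlinarith
  by_contra hcon
  push Not at hcon
  have := mul_lt_mul_of_pos_right hcon h1
  nlinarith

/-- Maximal inequality for nonnegative supermartingales. -/
lemma supermartingale_maximal [IsFiniteMeasure μ] (hmono : Monotone G) (hle : ∀ n, G n ≤ mΩ)
    (hL : ∀ n, StronglyMeasurable[G n] (L n)) (hLi : ∀ n, Integrable (L n) μ)
    (hL0 : ∀ n ω, 0 ≤ L n ω)
    (hsup : ∀ n s, MeasurableSet[G n] s → ∫ ω in s, L (n + 1) ω ∂μ ≤ ∫ ω in s, L n ω ∂μ)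
    (a : ℝ) (n : ℕ) : a * μ.real {ω | ∃ k < n, a ≤ L k ω} ≤ ∫ ω, L 0 ω ∂μ := by
  set H : ℕ → Set Ω := fun n => {ω | ∃ k < n, a ≤ L k ω} with hH
  have hHm : ∀ n, MeasurableSet[G n] (H n) := by
    intro n
    have : H n = ⋃ k ∈ range n, {ω | a ≤ L k ω} := by ext ω; simp [hH]
    rw [this]
    refine Finset.measurableSet_biUnion _ fun k hk => ?_
    exact hmono (mem_range.1 hk).le _ ((hL k).measurable measurableSet_Ici)
  have hsucc : ∀ n, H (n + 1) = H n ∪ {ω | a ≤ L n ω} := by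
    intro n; ext ω; simp
    constructor
    · rintro ⟨k, hk, h⟩
      rcases Nat.lt_succ_iff_lt_or_eq.1 hk with h' | rfl
      · exact Or.inl ⟨k, h', h⟩
      · exact Or.inr h
    · rintro (⟨k, hk, h⟩ | h)
      · exact ⟨k, by omega, h⟩
      · exact ⟨n, by omega, h⟩
  have hH1 : ∀ n, MeasurableSet[G n] (H (n + 1)) := fun n => by
    rw [hsucc]; exact (hHm n).union ((hL n).measurable measurableSet_Ici)
  have key : ∀ n, ∫ ω in (H n)ᶜ, L n ω ∂μ + a * μ.real (H n) ≤ ∫ ω, L 0 ω ∂μ := by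
    intro n
    induction n with
    | zero => simp [hH]
    | succ n ih =>
      refine le_trans ?_ ih
      have h1 := hsup n _ (hH1 n).compl
      have hsub : (H (n + 1))ᶜ ⊆ (H n)ᶜ := by rw [hsucc]; intro ω; simp; tauto
      have hA := hle n _ (hH1 n)
      have hB := hle n _ (hHm n)
      set T := H (n + 1) \ H n with hT
      have hTm := hA.diff hB
      have hd : (H n)ᶜ = (H (n + 1))ᶜ ∪ T := by
        ext ω; simp only [hT, Set.mem_compl_iff, mem_union, Set.mem_sdiff]; tauto
      have hdis : Disjoint ((H (n + 1))ᶜ) T := by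
        rw [disjoint_left]; intro ω h1 h2; exact h1 h2.1
      have h2 : ∫ ω in (H n)ᶜ, L n ω ∂μ
          = ∫ ω in (H (n + 1))ᶜ, L n ω ∂μ + ∫ ω in T, L n ω ∂μ := by
        rw [hd, setIntegral_union hdis hTm (hLi n).integrableOn (hLi n).integrableOn]
      have h3 : a * μ.real T ≤ ∫ ω in T, L n ω ∂μ := by
        rw [mul_comm, ← smul_eq_mul, ← setIntegral_const]
        refine setIntegral_mono_on (by simp) (hLi n).integrableOn hTm fun ω hω => ?_
        have := hω.1
        rw [hsucc] at this
        exact this.resolve_left hω.2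
      have h4 : μ.real (H (n + 1)) = μ.real (H n) + μ.real T := by
        have e : H (n + 1) = H n ∪ T := by
          ext ω; simp only [hT, hsucc, mem_union, Set.mem_sdiff]; tauto
        conv_lhs => rw [e]
        exact measureReal_union disjoint_sdiff_self_right hTm
      rw [h2, h4, mul_add]; linarith
  have := key n
  have h0 : 0 ≤ ∫ ω in (H n)ᶜ, L n ω ∂μ := integral_nonneg fun ω => hL0 n ω
  linarith

/-- The self-normalizing process `∑_{j<k} (x_j² + v_j)`. -/
def selfNorm (x v : ℕ → Ω → ℝ) (n : ℕ) (ω : Ω) : ℝ :=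
  ∑ k ∈ range n, (x k ω ^ 2 + v k ω)

lemma selfNorm_meas (h : IsMDS μ G x) (hv : ∀ k, StronglyMeasurable[G k] (v k)) (hk : k ≤ n) :
    StronglyMeasurable[G n] (selfNorm x v k) :=
  stronglyMeasurable_fun_sum _ fun i hi => by
    have := mem_range.1 hi
    exact (((h.meas i).mono (h.mono (by omega))).pow 2).add ((hv i).mono (h.mono (by omega)))

lemma selfNorm_tail_one_sided [IsProbabilityMeasure μ] (h : IsMDS μ G x)
    (hx2 : ∀ k, Integrable (fun ω => x k ω ^ 2) μ) (hv : ∀ k, StronglyMeasurable[G k] (v k))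
    (hv0 : ∀ k ω, 0 ≤ v k ω) (hvx : ∀ k, v k =ᵐ[μ] μ[fun ω => x k ω ^ 2 | G k]) (n : ℕ) (hV : 0 < V)
    :
    μ.real {ω | ∃ k < n, y ≤ psum x k ω ∧ selfNorm x v k ω ≤ V}
      ≤ exp (-(y ^ 2 / (4 * V))) ∨ y < 0 := by
  rcases lt_or_ge y 0 with hy | hy
  · exact Or.inr hy
  left
  set l : ℝ := y / (2 * V) with hl
  have hl0 : 0 ≤ l := by positivity
  set L : ℕ → Ω → ℝ := fun n ω => exp (l * psum x n ω - l ^ 2 * selfNorm x v n ω) with hLdef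
  have hLm : ∀ n, StronglyMeasurable[G n] (L n) := fun n =>
    Real.continuous_exp.comp_stronglyMeasurable
      (((h.psum_meas le_rfl).const_mul l).sub ((selfNorm_meas h hv le_rfl).const_mul (l ^ 2)))
  have hLb : ∀ n ω, L n ω ≤ exp (n / 4) := by
    intro n ω
    refine exp_le_exp.2 ?_
    have : l * psum x n ω - l ^ 2 * selfNorm x v n ω
        = ∑ k ∈ range n, (l * x k ω - l ^ 2 * (x k ω ^ 2 + v k ω)) := by
      rw [sum_sub_distrib, ← mul_sum, ← mul_sum]; rfl
    rw [this]
    calc _ ≤ ∑ k ∈ range n, (1 / 4 : ℝ) := sum_le_sum fun k _ => by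
          have := mul_nonneg (sq_nonneg l) (hv0 k ω)
          nlinarith [sq_nonneg (l * x k ω - 1 / 2)]
      _ = _ := by simp; ring
  have hLi : ∀ n, Integrable (L n) μ := fun n =>
    Integrable.of_bound ((hLm n).mono (h.le n)).aestronglyMeasurable (exp (n / 4))
      (ae_of_all _ fun ω => by
        rw [norm_of_nonneg (exp_pos _).le]; exact hLb n ω)
  have hsup : ∀ n s, MeasurableSet[G n] s →
      ∫ ω in s, L (n + 1) ω ∂μ ≤ ∫ ω in s, L n ω ∂μ := by
    intro n s hs
    have hs' := h.le n _ hs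
    set W : Ω → ℝ := s.indicator (fun ω => L n ω * exp (-(l ^ 2 * v n ω))) with hW
    have hWm : StronglyMeasurable[G n] W :=
      ((hLm n).mul (Real.continuous_exp.comp_stronglyMeasurable
        ((hv n).const_mul (l ^ 2)).neg)).indicator hs
    have hW0 : ∀ ω, 0 ≤ W ω := fun ω => Set.indicator_nonneg (fun ω _ => by positivity) ω
    have hWb : ∀ ω, ‖W ω‖ ≤ exp (n / 4) := fun ω => by
      rw [norm_of_nonneg (hW0 ω)]
      refine Set.indicator_le' (fun ω _ => ?_) (fun ω _ => (exp_pos _).le) ω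
      have : exp (-(l ^ 2 * v n ω)) ≤ 1 := by
        rw [Real.exp_le_one_iff]
        have := mul_nonneg (sq_nonneg l) (hv0 n ω); linarith
      calc L n ω * exp (-(l ^ 2 * v n ω)) ≤ L n ω * 1 :=
            mul_le_mul_of_nonneg_left this (exp_pos _).le
        _ ≤ _ := by rw [mul_one]; exact hLb n ω
    have hWae := (hWm.mono (h.le n)).aestronglyMeasurable (μ := μ)
    have hWi := Integrable.of_bound hWae _ (ae_of_all _ hWb)
    have hWx :=
      (h.int n).bdd_mul hWae (ae_of_all _ hWb)
    have hWx2 :=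
      (hx2 n).bdd_mul hWae (ae_of_all _ hWb)
    have hvi := (integrable_condExp).congr (hvx n).symm
    have hWv := hvi.bdd_mul hWae (ae_of_all _ hWb)
    have e1 := integral_mul_eq_zero_of_condExp_eq_zero (h.le n) hWm (h.int n) hWx (h.zero n)
    have e2 : ∫ ω, W ω * x n ω ^ 2 ∂μ = ∫ ω, W ω * v n ω ∂μ := by
      rw [← integral_mul_condExp (h.le n) hWm (hx2 n) hWx2]
      refine integral_congr_ae ?_
      filter_upwards [hvx n] with ω hω
      rw [hω]
    have step1 : ∫ ω in s, L (n + 1) ω ∂μ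
        ≤ ∫ ω, (W ω + l * (W ω * x n ω) + l ^ 2 * (W ω * x n ω ^ 2)) ∂μ := by
      rw [← integral_indicator hs']
      refine integral_mono ((hLi _).indicator hs')
        ((hWi.add (hWx.const_mul l)).add (hWx2.const_mul _)) fun ω => ?_
      simp only [indicator, hW]
      split_ifs with hω
      · have : L (n + 1) ω = L n ω * exp (-(l ^ 2 * v n ω))
            * exp (l * x n ω - (l * x n ω) ^ 2) := by
          simp only [hLdef, ← exp_add, psum_succ, selfNorm, sum_range_succ]
          congr 1; ring
        rw [this]
        have h2 := mul_le_mul_of_nonneg_left (exp_sub_sq_le (l * x n ω))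
          (by positivity : 0 ≤ L n ω * exp (-(l ^ 2 * v n ω)))
        refine h2.trans (le_of_eq ?_); ring
      · simp
    have hWxa : Integrable (fun ω => W ω + l * (W ω * x n ω)) μ := hWi.add (hWx.const_mul l)
    rw [integral_add hWxa (hWx2.const_mul _), integral_add hWi (hWx.const_mul l),
      integral_const_mul, integral_const_mul, e1, e2, ← integral_const_mul, mul_zero, add_zero,
      ← integral_add hWi (hWv.const_mul _)] at step1
    refine step1.trans ?_
    rw [← integral_indicator hs']
    refine integral_mono (hWi.add (hWv.const_mul _)) ((hLi _).indicator hs') fun ω => ?_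
    simp only [indicator, hW]
    split_ifs with hω
    · have h2 : 1 + l ^ 2 * v n ω ≤ exp (l ^ 2 * v n ω) := by
        have := add_one_le_exp (l ^ 2 * v n ω); linarith
      calc L n ω * exp (-(l ^ 2 * v n ω))
            + l ^ 2 * (L n ω * exp (-(l ^ 2 * v n ω)) * v n ω)
          = L n ω * exp (-(l ^ 2 * v n ω)) * (1 + l ^ 2 * v n ω) := by ring
        _ ≤ L n ω * exp (-(l ^ 2 * v n ω)) * exp (l ^ 2 * v n ω) := by
            have : 0 ≤ L n ω * exp (-(l ^ 2 * v n ω)) := by positivity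
            gcongr
        _ = L n ω := by rw [mul_assoc, ← exp_add]; simp
    · simp
  have hmax := supermartingale_maximal h.mono h.le hLm hLi (fun n ω => (exp_pos _).le) hsup
    (exp (y ^ 2 / (4 * V))) n
  have hL0 : ∫ ω, L 0 ω ∂μ = 1 := by simp [hLdef, selfNorm]
  rw [hL0] at hmax
  have hsub : μ.real {ω | ∃ k < n, y ≤ psum x k ω ∧ selfNorm x v k ω ≤ V}
      ≤ μ.real {ω | ∃ k < n, exp (y ^ 2 / (4 * V)) ≤ L k ω} := by
    refine measureReal_mono ?_
    rintro ω ⟨k, hk, h1, h2⟩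
    refine ⟨k, hk, exp_le_exp.2 ?_⟩
    calc y ^ 2 / (4 * V) = l * y - l ^ 2 * V := by rw [hl]; field_simp; ring
      _ ≤ _ := by gcongr
  rw [exp_neg, ← one_div, le_div_iff₀ (exp_pos _), mul_comm]
  exact (mul_le_mul_of_nonneg_left hsub (exp_pos _).le).trans hmax

lemma IsMDS.neg (h : IsMDS μ G x) : IsMDS μ G (fun n ω => -x n ω) where
  mono := h.mono
  le := h.le
  meas n := (h.meas n).neg
  int n := (h.int n).neg
  zero n := by
    have := condExp_neg (μ := μ) (x n) (G n)
    filter_upwards [this, h.zero n] with ω h1 h2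
    have h3 : (μ[fun ω => -x n ω | G n]) ω = -(μ[x n | G n]) ω := h1
    rw [h3, h2]; simp

lemma selfNorm_tail [IsProbabilityMeasure μ] (h : IsMDS μ G x)
    (hx2 : ∀ k, Integrable (fun ω => x k ω ^ 2) μ) (hv : ∀ k, StronglyMeasurable[G k] (v k))
    (hv0 : ∀ k ω, 0 ≤ v k ω) (hvx : ∀ k, v k =ᵐ[μ] μ[fun ω => x k ω ^ 2 | G k]) (n : ℕ) (hV : 0 < V)
    (hy : 0 ≤ y) :
    μ.real {ω | ∃ k < n, y ≤ |psum x k ω| ∧ selfNorm x v k ω ≤ V}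
      ≤ 2 * exp (-(y ^ 2 / (4 * V))) := by
  have h1 := (selfNorm_tail_one_sided h hx2 hv hv0 hvx n hV).resolve_right (not_lt.2 hy)
  have h2 := (selfNorm_tail_one_sided h.neg (by simpa using hx2) hv hv0 (by simpa using hvx) n
    hV).resolve_right (not_lt.2 hy)
  have e1 : ∀ k ω, psum (fun n ω => -x n ω) k ω = -psum x k ω := fun k ω => by simp [psum]
  have e2 : ∀ k ω, selfNorm (fun n ω => -x n ω) v k ω = selfNorm x v k ω := fun k ω => by
    simp [selfNorm]
  simp only [e1, e2] at h2
  have : {ω | ∃ k < n, y ≤ |psum x k ω| ∧ selfNorm x v k ω ≤ V}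
      ⊆ {ω | ∃ k < n, y ≤ psum x k ω ∧ selfNorm x v k ω ≤ V}
        ∪ {ω | ∃ k < n, y ≤ -psum x k ω ∧ selfNorm x v k ω ≤ V} := by
    rintro ω ⟨k, hk, h1, h2⟩
    rcases le_abs.1 h1 with h3 | h3
    · exact Or.inl ⟨k, hk, h3, h2⟩
    · exact Or.inr ⟨k, hk, h3, h2⟩
  calc _ ≤ _ := measureReal_mono this
    _ ≤ _ := measureReal_union_le _ _
    _ ≤ _ := by linarith

/-- The class of random variables with a fixed bound on the sub-Gaussian exponential moment. -/
def SubG (μ : Measure Ω) (Y : Ω → ℝ) : Prop :=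
  ∫⁻ ω, ofReal (exp (Y ω ^ 2)) ∂μ ≤ 100

lemma subG_of_tail [IsProbabilityMeasure μ] (hYm : Measurable Y) (hY0 : ∀ ω, 0 ≤ Y ω)
    (ht : ∀ y, 0 ≤ y → μ.real {ω | y ≤ Y ω} ≤ 2 * exp (-(y ^ 2 / 16))) :
    SubG μ (fun ω => Y ω / 8) := by
  have hpt : ∀ ω, ofReal (exp ((Y ω / 8) ^ 2))
      ≤ ∑' n : ℕ, indicator {ω | n ≤ Y ω}
          (fun _ => ofReal (exp ((n + 1) ^ 2 / 64))) ω := by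
    intro ω
    refine le_trans ?_ (ENNReal.le_tsum ⌊Y ω⌋₊)
    rw [indicator_of_mem (by exact Nat.floor_le (hY0 ω))]
    refine ofReal_le_ofReal (exp_le_exp.2 ?_)
    have := (Nat.lt_floor_add_one (Y ω)).le
    rw [div_pow, show (8 : ℝ) ^ 2 = 64 by norm_num]
    have := hY0 ω
    gcongr
  have hterm : ∀ n : ℕ, ∫⁻ ω, indicator {ω | n ≤ Y ω}
      (fun _ => ofReal (exp ((n + 1) ^ 2 / 64))) ω ∂μ
      ≤ ofReal (2.2 * exp (-(1 / 32)) ^ n) := by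
    intro n
    have hms : MeasurableSet {ω | n ≤ Y ω} := hYm measurableSet_Ici
    rw [lintegral_indicator_const hms]
    rw [← ofReal_measureReal, ← ofReal_mul (exp_pos _).le]
    refine ofReal_le_ofReal ?_
    have h1 := ht n (cast_nonneg n)
    have hn : n ≤ (n : ℝ) ^ 2 := by exact_mod_cast Nat.le_self_pow two_ne_zero n
    calc _ ≤ exp ((n + 1) ^ 2 / 64) * (2 * exp (-(n ^ 2 / 16))) := by gcongr
      _ = 2 * exp ((n + 1) ^ 2 / 64 - n ^ 2 / 16) := by
          rw [sub_eq_add_neg, exp_add]; ring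
      _ ≤ 2 * exp (1 / 32 + n * (-(1 / 32))) := by
          gcongr; nlinarith
      _ = 2 * exp (1 / 32) * exp (-(1 / 32)) ^ n := by
          rw [exp_add, Real.exp_nat_mul]; ring
      _ ≤ _ := by
          gcongr
          have : exp (1 / 32) ≤ 1.1 := by
            have := Real.exp_bound_div_one_sub_of_interval (x := 1 / 32) (by norm_num) (by norm_num)
            exact this.trans (by norm_num)
          linarith
  have hexp : exp (-(1 / 32)) ≤ 32 / 33 := by
    rw [exp_neg, inv_le_comm₀ (exp_pos _) (by norm_num)]
    have := add_one_le_exp (1 / 32 : ℝ)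
    norm_num at this ⊢; linarith
  have hlt : exp (-(1 / 32 : ℝ)) < 1 := by linarith
  have hg := (hasSum_geometric_of_lt_one (exp_pos _).le hlt).mul_left 2.2
  unfold SubG
  calc ∫⁻ ω, ofReal (exp ((Y ω / 8) ^ 2)) ∂μ
      ≤ ∫⁻ ω, ∑' n : ℕ, indicator {ω | n ≤ Y ω}
          (fun _ => ofReal (exp ((n + 1) ^ 2 / 64))) ω ∂μ :=
        lintegral_mono hpt
    _ = ∑' n : ℕ, ∫⁻ ω, indicator {ω | n ≤ Y ω}
          (fun _ => ofReal (exp ((n + 1) ^ 2 / 64))) ω ∂μ :=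
        lintegral_tsum fun n =>
          (measurable_const.indicator (hYm measurableSet_Ici)).aemeasurable
    _ ≤ ∑' n : ℕ, ofReal (2.2 * exp (-(1 / 32)) ^ n) := tsum_le_tsum hterm
    _ = ofReal (2.2 * (1 - exp (-(1 / 32)))⁻¹) := by
        rw [← ENNReal.ofReal_tsum_of_nonneg (fun n => by positivity) hg.summable, hg.tsum_eq]
    _ ≤ 100 := by
        rw [show 100 = ofReal 100 by norm_num]
        refine ofReal_le_ofReal ?_
        have : (1 - exp (-(1 / 32)))⁻¹ ≤ 33 := by
          rw [inv_le_comm₀ (by linarith) (by norm_num)]; norm_num at hexp ⊢; linarith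
        linarith

/-! ### Moment bounds from dyadic conditional expectations -/

lemma IsMDS.shift (h : IsMDS μ G x) (c : ℕ) :
    IsMDS μ (fun n => G (c + n)) (fun n => x (c + n)) where
  mono := fun _ _ hij => h.mono (by omega)
  le n := h.le _
  meas n := h.meas (c + n)
  int n := h.int _
  zero n := h.zero _

lemma integral_abs_rpow_le_of_eLpNorm_le (hq : 0 < q) (hB : 0 ≤ B) (hf : AEStronglyMeasurable f μ)
    (h : eLpNorm f (ofReal q) μ ≤ ofReal B) :
    Integrable (fun ω => |f ω| ^ q) μ ∧ ∫ ω, |f ω| ^ q ∂μ ≤ B ^ q := by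
  have hm : MemLp f (ofReal q) μ := ⟨hf, h.trans_lt ofReal_lt_top⟩
  have hq0 : ofReal q ≠ 0 := by simpa using hq
  have e := hm.eLpNorm_eq_integral_rpow_norm hq0 ofReal_ne_top
  have hi := hm.integrable_norm_rpow hq0 ofReal_ne_top
  rw [toReal_ofReal hq.le] at e hi
  refine ⟨by simpa using hi, ?_⟩
  have h0 : 0 ≤ ∫ ω, |f ω| ^ q ∂μ := integral_nonneg fun ω => by positivity
  simp at e
  rw [e, ENNReal.ofReal_le_ofReal_iff hB] at h
  have := rpow_le_rpow (by positivity) h hq.le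
  rwa [← rpow_mul h0, inv_mul_cancel₀ hq.ne', rpow_one] at this

lemma eLpNorm_le_of_integral_abs_rpow_le (hq : 0 < q) (hB : 0 ≤ B) (hf : AEStronglyMeasurable f μ)
    (hi : Integrable (fun ω => |f ω| ^ q) μ) (h : ∫ ω, |f ω| ^ q ∂μ ≤ B ^ q) :
    eLpNorm f (ofReal q) μ ≤ ofReal B := by
  have hq0 : ofReal q ≠ 0 := by simpa using hq
  have hm : MemLp f (ofReal q) μ := by
    rw [← integrable_norm_rpow_iff hf hq0 ofReal_ne_top, toReal_ofReal hq.le]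
    simpa using hi
  rw [hm.eLpNorm_eq_integral_rpow_norm hq0 ofReal_ne_top, toReal_ofReal hq.le]
  refine ofReal_le_ofReal ?_
  have h0 : 0 ≤ ∫ ω, |f ω| ^ q ∂μ := integral_nonneg fun ω => by positivity
  have := rpow_le_rpow h0 h (inv_nonneg.2 hq.le)
  rwa [← rpow_mul hB, mul_inv_cancel₀ hq.ne', rpow_one] at this

lemma IsMDS.eLpNorm_psum_le [IsFiniteMeasure μ] (h : IsMDS μ G x) {b : ℝ} (hq : 1 < q) (hq2 : q ≤ 2)
    (hb : 0 ≤ b) (hx : ∀ k, eLpNorm (x k) (ofReal q) μ ≤ ofReal b) (n : ℕ) :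
    eLpNorm (psum x (2 ^ n)) (ofReal q) μ
      ≤ ofReal (39 * ((2 : ℝ) ^ (1 / q)) ^ n * b) := by
  have hq0 : 0 < q := by linarith
  have hx' := fun k => integral_abs_rpow_le_of_eLpNorm_le hq0 hb (h.meas' k).aestronglyMeasurable
    (hx k)
  refine eLpNorm_le_of_integral_abs_rpow_le hq0 (by positivity)
    (h.psum_meas' _).aestronglyMeasurable (h.psum_int_rpow hq0 (fun k => (hx' k).1) _) ?_
  refine (h.vonBahr_esseen hq hq2 (fun k => (hx' k).1) _).trans ?_
  have h1 : ∑ k ∈ range (2 ^ n), ∫ ω, |x k ω| ^ q ∂μ ≤ 2 ^ n * b ^ q := by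
    refine (sum_le_sum fun k _ => (hx' k).2).trans ?_
    simp
  have h2 : (((2 : ℝ) ^ (1 / q)) ^ n) ^ q = 2 ^ n := by
    rw [← rpow_natCast, ← rpow_mul (by positivity), ← rpow_mul (by norm_num),
      mul_left_comm, one_div, inv_mul_cancel₀ hq0.ne', mul_one, rpow_natCast]
  rw [mul_rpow (by positivity) hb, mul_rpow (by norm_num) (by positivity), h2, mul_assoc]
  have h3 : (39 : ℝ) ≤ 39 ^ q := by
    conv_lhs => rw [← rpow_one 39]
    exact rpow_le_rpow_of_exponent_le (by norm_num) hq.le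
  have := rpow_nonneg hb q
  gcongr

lemma condExp_sub_condExp_self [IsFiniteMeasure μ] {m : MeasurableSpace Ω} (hm : m ≤ mΩ)
    (hf : Integrable f μ) : μ[fun ω => f ω - (μ[f | m]) ω | m] =ᵐ[μ] 0 := by
  have h1 := condExp_sub hf (integrable_condExp : Integrable (μ[f | m]) μ) m
  have h2 := condExp_condExp_of_le (μ := μ) (f := f) (le_refl m) hm
  filter_upwards [h1, h2] with ω h1 h2
  have h3 : (μ[fun ω => f ω - (μ[f | m]) ω | m]) ω = _ := h1
  rw [h3, Pi.sub_apply, h2]; simp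

/-- The conditional expectation of a dyadic block sum given the past of the block. -/
def condBlock (μ : Measure Ω) (G : ℕ → MeasurableSpace Ω) (X : ℕ → Ω → ℝ) (c i : ℕ) : Ω → ℝ :=
  μ[fun ω => ∑ j ∈ range (2 ^ i), X (c + j) ω | G c]

lemma condBlock_meas (c i : ℕ) : StronglyMeasurable[G c] (condBlock μ G X c i) :=
  stronglyMeasurable_condExp

lemma condBlock_int (c i : ℕ) : Integrable (condBlock μ G X c i) μ := integrable_condExp

lemma condBlock_succ [IsFiniteMeasure μ] (hmono : Monotone G) (hle : ∀ n, G n ≤ mΩ)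
    (hX : ∀ j, Integrable (X j) μ) (c i : ℕ) :
    condBlock μ G X c (i + 1)
      =ᵐ[μ] fun ω => condBlock μ G X c i ω + (μ[condBlock μ G X (c + 2 ^ i) i | G c]) ω := by
  have hI : ∀ c i, Integrable (fun ω => ∑ j ∈ range (2 ^ i), X (c + j) ω) μ := fun c i =>
    integrable_finsetSum _ fun j _ => hX _
  have e : (fun ω => ∑ j ∈ range (2 ^ (i + 1)), X (c + j) ω)
      = (fun ω => ∑ j ∈ range (2 ^ i), X (c + j) ω)
        + fun ω => ∑ j ∈ range (2 ^ i), X (c + 2 ^ i + j) ω := by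
    ext ω
    rw [pow_succ, mul_two, sum_range_add]
    simp [add_assoc]
  have h1 := condExp_add (hI c i) (hI (c + 2 ^ i) i) (G c)
  have h2 := condExp_condExp_of_le (μ := μ)
    (f := fun ω => ∑ j ∈ range (2 ^ i), X (c + 2 ^ i + j) ω)
    (hmono (Nat.le_add_right c (2 ^ i))) (hle _)
  unfold condBlock
  rw [e]
  filter_upwards [h1, h2] with ω h1 h2
  rw [h1, Pi.add_apply, h2]

lemma eLpNorm_sum_condBlock_le [IsFiniteMeasure μ] (hmono : Monotone G) (hle : ∀ n, G n ≤ mΩ)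
    (hX : ∀ j, Integrable (X j) μ) (hq : 1 < q) (hq2 : q ≤ 2) (hb0 : ∀ i, 0 ≤ b i)
    (hb : ∀ c i, eLpNorm (condBlock μ G X c i) (ofReal q) μ ≤ ofReal (b i))
    (n : ℕ) : ∀ i c : ℕ,
    eLpNorm (fun ω => ∑ l ∈ range (2 ^ n), condBlock μ G X (c + l * 2 ^ i) i ω)
        (ofReal q) μ
      ≤ ofReal (78 * ((2 : ℝ) ^ (1 / q)) ^ (n + i)
          * ∑ k ∈ range (n + 1), b (i + k) / ((2 : ℝ) ^ (1 / q)) ^ (i + k)) := by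
  set β : ℝ := 2 ^ (1 / q)
  have hβ0 : 0 < β := by positivity
  have hβ1 : 1 ≤ β := one_le_rpow (by norm_num) (by positivity)
  have hq1 : 1 ≤ ofReal q := by rw [← ofReal_one]; exact ofReal_le_ofReal hq.le
  induction n with
  | zero =>
    intro i c
    simp
    refine (hb c i).trans (ofReal_le_ofReal ?_)
    have := hb0 i
    field_simp
    linarith
  | succ n ih =>
    intro i c
    set D : ℕ → Ω → ℝ := fun l ω => condBlock μ G X (c + (2 * l + 1) * 2 ^ i) i ω
      - (μ[condBlock μ G X (c + (2 * l + 1) * 2 ^ i) i | G (c + 2 * l * 2 ^ i)]) ω with hD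
    have hDm : IsMDS μ (fun l => G (c + 2 * l * 2 ^ i)) D :=
      { mono := fun s t hst => hmono (by gcongr)
        le := fun l => hle _
        meas := fun l => ((condBlock_meas _ _).mono (hmono (by gcongr; omega))).sub
          (stronglyMeasurable_condExp.mono (hmono (by gcongr; omega)))
        int := fun l => (condBlock_int _ _).sub integrable_condExp
        zero := fun l => condExp_sub_condExp_self (hle _) (condBlock_int _ _) }
    have hDb : ∀ l, eLpNorm (D l) (ofReal q) μ ≤ ofReal (2 * b i) := by
      intro l
      refine (eLpNorm_sub_le (condBlock_int _ _).aestronglyMeasurable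
        integrable_condExp.aestronglyMeasurable hq1).trans ?_
      rw [two_mul (b i), ofReal_add (hb0 i) (hb0 i)]
      exact add_le_add (hb _ _) ((eLpNorm_condExp_le_eLpNorm _ hq1).trans (hb _ _))
    have hsplit : (fun ω => ∑ l ∈ range (2 ^ (n + 1)), condBlock μ G X (c + l * 2 ^ i) i ω)
        =ᵐ[μ] fun ω => (∑ l ∈ range (2 ^ n), condBlock μ G X (c + l * 2 ^ (i + 1)) (i + 1) ω)
          + psum D (2 ^ n) ω := by
      have hall : ∀ᵐ ω ∂μ, ∀ l : ℕ, condBlock μ G X (c + 2 * l * 2 ^ i) (i + 1) ω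
          = condBlock μ G X (c + 2 * l * 2 ^ i) i ω
            + (μ[condBlock μ G X (c + 2 * l * 2 ^ i + 2 ^ i) i | G (c + 2 * l * 2 ^ i)]) ω :=
        ae_all_iff.2 fun l => condBlock_succ hmono hle hX _ _
      filter_upwards [hall] with ω hω
      have hpair : ∀ (f : ℕ → ℝ) N, ∑ l ∈ range (N * 2), f l
          = ∑ l ∈ range N, (f (2 * l) + f (2 * l + 1)) := by
        intro f N
        induction N with
        | zero => simp
        | succ N ihN =>
          rw [sum_range_succ, ← ihN, show (N + 1) * 2 = N * 2 + 1 + 1 by ring,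
            sum_range_succ, sum_range_succ, mul_comm N 2]; ring
      rw [pow_succ, hpair, psum, ← sum_add_distrib]
      refine sum_congr rfl fun l _ => ?_
      have := hω l
      rw [show c + l * 2 ^ (i + 1) = c + 2 * l * 2 ^ i by ring, this]
      simp only [hD]
      rw [show c + (2 * l + 1) * 2 ^ i = c + 2 * l * 2 ^ i + 2 ^ i by ring]
      ring
    rw [eLpNorm_congr_ae hsplit]
    have hmeas : AEStronglyMeasurable (fun ω => ∑ l ∈ range (2 ^ n),
        condBlock μ G X (c + l * 2 ^ (i + 1)) (i + 1) ω) μ :=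
      (stronglyMeasurable_fun_sum _ fun l _ =>
        (condBlock_meas _ _).mono (hle _)).aestronglyMeasurable
    refine (eLpNorm_add_le hmeas (hDm.psum_meas' _).aestronglyMeasurable hq1).trans ?_
    refine (add_le_add (ih (i + 1) c) (hDm.eLpNorm_psum_le hq hq2 (by have := hb0 i; positivity)
      hDb n)).trans ?_
    have hs0 : 0 ≤ ∑ k ∈ range (n + 1), b (i + 1 + k) / β ^ (i + 1 + k) :=
      sum_nonneg fun k _ => div_nonneg (hb0 _) (by positivity)
    have := hb0 i
    rw [← ofReal_add (by positivity) (by positivity)]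
    refine ofReal_le_ofReal ?_
    rw [Finset.sum_range_succ' _ (n + 1)]
    simp only [add_zero]
    rw [show ∑ k ∈ range (n + 1), b (i + (k + 1)) / β ^ (i + (k + 1))
      = ∑ k ∈ range (n + 1), b (i + 1 + k) / β ^ (i + 1 + k) from
      sum_congr rfl fun k _ => by rw [show i + (k + 1) = i + 1 + k by ring]]
    rw [mul_add, show n + (i + 1) = n + 1 + i by ring]
    have h5 : 39 * β ^ n * (2 * b i) ≤ 78 * β ^ (n + 1 + i) * (b i / β ^ i) := by
      rw [show 78 * β ^ (n + 1 + i) * (b i / β ^ i) = 78 * (β ^ n * β) * b i by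
        field_simp; ring]
      have : β ^ n * 1 ≤ β ^ n * β := by gcongr
      nlinarith
    linarith

/-- Moment bounds for a block sum of an adapted sequence and for its compensator. -/
lemma eLpNorm_block_le [IsFiniteMeasure μ] (hmono : Monotone G) (hle : ∀ n, G n ≤ mΩ)
    (hXm : ∀ j, StronglyMeasurable[G (j + 1)] (X j)) (hX : ∀ j, Integrable (X j) μ) (hq : 1 < q)
    (hq2 : q ≤ 2) (hb0 : ∀ i, 0 ≤ b i)
    (hb : ∀ c i, eLpNorm (condBlock μ G X c i) (ofReal q) μ ≤ ofReal (b i)) (hK0 : 0 ≤ K)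
    (hK : ∀ j, eLpNorm (X j) (ofReal q) μ ≤ ofReal K)
    (hB : ∀ n, ∑ k ∈ range n, b k / ((2 : ℝ) ^ (1 / q)) ^ k ≤ B) (c n : ℕ) :
    eLpNorm (fun ω => ∑ j ∈ range (2 ^ n), (μ[X (c + j) | G (c + j)]) ω)
        (ofReal q) μ ≤ ofReal (((2 : ℝ) ^ (1 / q)) ^ n * (78 * B)) ∧
    eLpNorm (fun ω => ∑ j ∈ range (2 ^ n), X (c + j) ω)
        (ofReal q) μ ≤ ofReal (((2 : ℝ) ^ (1 / q)) ^ n * (78 * B + 78 * K)) := by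
  set β : ℝ := 2 ^ (1 / q) with hβ
  have hβ0 : 0 < β := by positivity
  have hq1 : 1 ≤ ofReal q := by rw [← ofReal_one]; exact ofReal_le_ofReal hq.le
  have hB0 : 0 ≤ B := by simpa using hB 0
  have h1 : eLpNorm (fun ω => ∑ j ∈ range (2 ^ n), (μ[X (c + j) | G (c + j)]) ω)
      (ofReal q) μ ≤ ofReal (β ^ n * (78 * B)) := by
    have := eLpNorm_sum_condBlock_le hmono hle hX hq hq2 hb0 hb n 0 c
    simp only [condBlock, pow_zero, range_one, Finset.sum_singleton, add_zero, mul_one,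
      zero_add] at this
    refine this.trans (ofReal_le_ofReal ?_)
    rw [← hβ]
    have := hB (n + 1)
    calc _ ≤ 78 * β ^ n * B := by gcongr
      _ = _ := by ring
  refine ⟨h1, ?_⟩
  set D : ℕ → Ω → ℝ := fun j ω => X (c + j) ω - (μ[X (c + j) | G (c + j)]) ω with hD
  have hDm : IsMDS μ (fun j => G (c + j)) D :=
    { mono := fun s t hst => hmono (by omega)
      le := fun l => hle _
      meas := fun l => (hXm (c + l)).sub (stronglyMeasurable_condExp.mono (hmono (by omega)))
      int := fun l => (hX _).sub integrable_condExp
      zero := fun l => condExp_sub_condExp_self (hle _) (hX _) }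
  have hDb : ∀ l, eLpNorm (D l) (ofReal q) μ ≤ ofReal (2 * K) := by
    intro l
    refine (eLpNorm_sub_le (hX _).aestronglyMeasurable
      integrable_condExp.aestronglyMeasurable hq1).trans ?_
    rw [two_mul, ofReal_add hK0 hK0]
    exact add_le_add (hK _) ((eLpNorm_condExp_le_eLpNorm _ hq1).trans (hK _))
  have h2 := hDm.eLpNorm_psum_le hq hq2 (by positivity) hDb n
  have e : (fun ω => ∑ j ∈ range (2 ^ n), X (c + j) ω)
      = (fun ω => ∑ j ∈ range (2 ^ n), (μ[X (c + j) | G (c + j)]) ω) + psum D (2 ^ n) := by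
    ext ω; simp [hD, psum]
  have hm1 : AEStronglyMeasurable
      (fun ω => ∑ j ∈ range (2 ^ n), (μ[X (c + j) | G (c + j)]) ω) μ :=
    (stronglyMeasurable_fun_sum _ fun l _ =>
      stronglyMeasurable_condExp.mono (hle _)).aestronglyMeasurable
  have hm2 : AEStronglyMeasurable (psum D (2 ^ n)) μ := (hDm.psum_meas' _).aestronglyMeasurable
  rw [e]
  refine (eLpNorm_add_le hm1 hm2 hq1).trans ((add_le_add h1 h2).trans ?_)
  rw [← ofReal_add (by positivity) (by positivity)]
  refine ofReal_le_ofReal (le_of_eq ?_)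
  ring

/-! ### Running maxima of martingales: sub-Gaussian part plus a small remainder -/

lemma exists_runMax_eq (a : ℕ → ℝ) (n : ℕ) : ∃ k ≤ n, runMax a n = a k := by
  induction n with
  | zero => exact ⟨0, le_rfl, rfl⟩
  | succ n ih =>
    obtain ⟨k, hk, e⟩ := ih
    rcases max_choice (runMax a n) (a (n + 1)) with h | h
    · exact ⟨k, by omega, h.trans e⟩
    · exact ⟨n + 1, le_rfl, h⟩

lemma add_rpow_le_eight {a b : ℝ} (hp : 0 ≤ p) (hp3 : p ≤ 3) (ha : 0 ≤ a) (hb : 0 ≤ b) :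
    (a + b) ^ p ≤ 8 * (a ^ p + b ^ p) := by
  refine (add_rpow_le_two_rpow hp ha hb).trans ?_
  have : (2 : ℝ) ^ p ≤ 8 := by
    calc 2 ^ p ≤ 2 ^ 3 := rpow_le_rpow_of_exponent_le (by norm_num) hp3
      _ = 8 := by norm_num
  have := rpow_nonneg ha p
  have := rpow_nonneg hb p
  gcongr

lemma selfNorm_succ (n : ℕ) (ω : Ω) :
    selfNorm x v (n + 1) ω = selfNorm x v n ω + (x n ω ^ 2 + v n ω) :=
  sum_range_succ _ _

lemma selfNorm_mono (hv0 : ∀ k ω, 0 ≤ v k ω) (ω : Ω) : Monotone fun n => selfNorm x v n ω :=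
  monotone_nat_of_le_succ fun n => by
    rw [selfNorm_succ]; have := hv0 n ω; have := sq_nonneg (x n ω); linarith

/-- The martingale differences past the time when the self-normalizing process exceeds `V`. -/
def lateDiff (x v : ℕ → Ω → ℝ) (V : ℝ) (n : ℕ) (ω : Ω) : ℝ :=
  {ω | V < selfNorm x v n ω}.indicator (x n) ω

lemma lateDiff_of_le (h : selfNorm x v n ω ≤ V) :
    lateDiff x v V n ω = 0 := by
  simp [lateDiff, h]

lemma lateDiff_of_lt (h : V < selfNorm x v n ω) :
    lateDiff x v V n ω = x n ω := by
  simp [lateDiff, h]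

lemma abs_lateDiff_le (V : ℝ) (n : ℕ) (ω : Ω) : |lateDiff x v V n ω| ≤ |x n ω| := by
  unfold lateDiff indicator
  split_ifs <;> simp

lemma IsMDS.lateDiff [IsFiniteMeasure μ] (h : IsMDS μ G x)
    (hv : ∀ k, StronglyMeasurable[G k] (v k)) (V : ℝ) : IsMDS μ G (lateDiff x v V) where
  mono := h.mono
  le := h.le
  meas n := (h.meas n).indicator (h.mono (Nat.le_succ n) _
    ((selfNorm_meas h hv le_rfl).measurable measurableSet_Ioi))
  int n := (h.int n).indicator (h.le n _ ((selfNorm_meas h hv le_rfl).measurable measurableSet_Ioi))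
  zero n := by
    have hs : MeasurableSet[G n] {ω | V < selfNorm x v n ω} :=
      (selfNorm_meas h hv le_rfl).measurable measurableSet_Ioi
    have h1 := condExp_indicator (μ := μ) (h.int n) hs
    filter_upwards [h1, h.zero n] with ω h1 h2
    have h3 : (μ[_root_.lateDiff x v V n | G n]) ω = _ := h1
    rw [h3, Set.indicator_apply, h2]; simp

lemma psum_lateDiff_of_le (hv0 : ∀ k ω, 0 ≤ v k ω) (h : selfNorm x v n ω ≤ V) :
    psum (lateDiff x v V) n ω = 0 :=
  sum_eq_zero fun _ hi =>
    lateDiff_of_le ((selfNorm_mono hv0 ω (mem_range.1 hi).le).trans h)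

/-- The running maximum stopped when the self-normalizing process exceeds `V`. -/
def earlyMax (x v : ℕ → Ω → ℝ) (V : ℝ) (n : ℕ) (ω : Ω) : ℝ :=
  runMax (fun k => {ω | selfNorm x v k ω ≤ V}.indicator (fun ω => |psum x k ω|) ω) n

lemma earlyMax_nonneg (V : ℝ) (n : ℕ) (ω : Ω) : 0 ≤ earlyMax x v V n ω :=
  runMax_nonneg (fun k => Set.indicator_nonneg (fun _ _ => abs_nonneg _) ω) n

lemma abs_psum_sub_le (hv0 : ∀ k ω, 0 ≤ v k ω) (hr0 : 0 ≤ r) (hr : ∀ k < n, |x k ω| ≤ r) : ∀ k ≤ n,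
    |psum x k ω - psum (lateDiff x v V) k ω| ≤ earlyMax x v V n ω + r := by
  have hE0 := earlyMax_nonneg (x := x) (v := v) V n ω
  have hE : ∀ k ≤ n, selfNorm x v k ω ≤ V → |psum x k ω| ≤ earlyMax x v V n ω := by
    intro k hk hkV
    have := le_runMax
      (fun k => {ω | selfNorm x v k ω ≤ V}.indicator (fun ω => |psum x k ω|) ω) hk
    rwa [indicator_of_mem (show ω ∈ {ω | selfNorm x v k ω ≤ V} from hkV)] at this
  intro k
  induction k with
  | zero => intro _; simp; positivity
  | succ k ih =>
    intro hk
    by_cases h1 : selfNorm x v k ω ≤ V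
    · have : psum (lateDiff x v V) (k + 1) ω = 0 := by
        rw [psum_succ, psum_lateDiff_of_le hv0 h1, lateDiff_of_le h1, add_zero]
      rw [this, sub_zero, psum_succ]
      exact (abs_add_le _ _).trans (add_le_add (hE k (by omega) h1) (hr k (by omega)))
    · have := lateDiff_of_lt (not_le.1 h1)
      rw [psum_succ, psum_succ, this, add_sub_add_right_eq_sub]
      exact ih (by omega)

lemma sqSum_lateDiff_le (hv0 : ∀ k ω, 0 ≤ v k ω) (n : ℕ) (ω : Ω) :
    sqSum (lateDiff x v V) n ω ≤ 2 * |selfNorm x v n ω - V / 2| := by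
  rcases le_or_gt (selfNorm x v n ω) V with h | h
  · have : sqSum (lateDiff x v V) n ω = 0 := by
      refine sum_eq_zero fun i hi => ?_
      rw [lateDiff_of_le ((selfNorm_mono hv0 ω (mem_range.1 hi).le).trans h)]
      simp
    rw [this]; positivity
  · have h1 : sqSum (lateDiff x v V) n ω ≤ selfNorm x v n ω := by
      refine sum_le_sum fun i _ => ?_
      have h2 : (lateDiff x v V i ω) ^ 2 ≤ x i ω ^ 2 := sq_le_sq.2 (abs_lateDiff_le V i ω)
      linarith [hv0 i ω]
    have := le_abs_self (selfNorm x v n ω - V / 2)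
    linarith

/-- If the self-normalizing process is close to `2 m` in `L^{p/2}`, the running maximum is the sum
of a sub-Gaussian variable of order `√m` and of a remainder with `p`-th moment of order `m`. -/
theorem IsMDS.exists_max_decomp [IsProbabilityMeasure μ] (h : IsMDS μ G x) (hp : 2 < p)
    (hp3 : p ≤ 3) {K' : ℝ} (hx : ∀ k, Integrable (fun ω => |x k ω| ^ p) μ)
    (hK : ∀ k, ∫ ω, |x k ω| ^ p ∂μ ≤ K) (hv : ∀ k, StronglyMeasurable[G k] (v k))
    (hv0 : ∀ k ω, 0 ≤ v k ω) (hvx : ∀ k, v k =ᵐ[μ] μ[fun ω => x k ω ^ 2 | G k]) (m : ℕ) (hm : 0 < m)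
    (hQi : Integrable (fun ω => |selfNorm x v m ω - 2 * m| ^ (p / 2)) μ)
    (hQ : ∫ ω, |selfNorm x v m ω - 2 * m| ^ (p / 2) ∂μ ≤ K' * m) :
    ∃ Y R : Ω → ℝ, StronglyMeasurable[G m] Y ∧ StronglyMeasurable[G m] R ∧ (∀ ω, 0 ≤ Y ω) ∧
      (∀ ω, 0 ≤ R ω) ∧ SubG μ Y ∧ (∀ ω, ∀ k ≤ m, |psum x k ω| ≤ 8 * √m * Y ω + R ω) ∧
      Integrable (fun ω => R ω ^ p) μ ∧
      ∫ ω, R ω ^ p ∂μ ≤ 8 * (K + bdgC p * (4 * K')) * m := by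
  have hp0 : 0 < p := by linarith
  have hm' : (0 : ℝ) < m := by exact_mod_cast hm
  have hsm := sqrt_pos.2 hm'
  have hx2 := fun k => by
    have := integrable_abs_rpow_of_exponent_le (by norm_num : (0 : ℝ) ≤ 2) hp.le
      (h.meas' k).aestronglyMeasurable (hx k)
    simpa using this
  have hQm : ∀ k ≤ m, MeasurableSet[G m] {ω | selfNorm x v k ω ≤ 4 * m} := fun k hk =>
    (selfNorm_meas h hv hk).measurable measurableSet_Iic
  set Y0 : Ω → ℝ := fun ω => earlyMax x v (4 * m) m ω / √m with hY0
  have hY0m : StronglyMeasurable[G m] Y0 := by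
    have :=
      stronglyMeasurable_runMax (f := fun k ω =>
        {ω | selfNorm x v k ω ≤ 4 * m}.indicator (fun ω => |psum x k ω|) ω)
        fun k hk => (h.psum_meas hk).norm.indicator (hQm k hk)
    exact (this.measurable.div_const _).stronglyMeasurable
  have hY00 : ∀ ω, 0 ≤ Y0 ω := fun ω => div_nonneg (earlyMax_nonneg _ _ _) hsm.le
  set Rx : Ω → ℝ := fun ω => (∑ k ∈ range m, |x k ω| ^ p) ^ p⁻¹ with hRx
  have hS0 : ∀ ω, 0 ≤ ∑ k ∈ range m, |x k ω| ^ p := fun ω =>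
    sum_nonneg fun _ _ => by positivity
  set L := _root_.lateDiff x v (4 * m)
  have hLm : IsMDS μ G L := h.lateDiff hv _
  set Rn : Ω → ℝ := fun ω => runMax (fun k => |psum L k ω|) m
  have hRn0 : ∀ ω, 0 ≤ Rn ω := fun ω => runMax_nonneg (fun _ => abs_nonneg _) _
  have hRx0 : ∀ ω, 0 ≤ Rx ω := fun ω => rpow_nonneg (hS0 ω) _
  have hRxm : StronglyMeasurable[G m] Rx := by
    have : StronglyMeasurable[G m] (fun ω => ∑ k ∈ range m, |x k ω| ^ p) :=
      stronglyMeasurable_fun_sum _ fun i hi =>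
        (((h.meas i).mono (h.mono (mem_range.1 hi))).norm.measurable.pow_const
          p).stronglyMeasurable
    exact (this.measurable.pow_const _).stronglyMeasurable
  have hRnm := hLm.runMax_meas m
  have hRxp : ∀ ω, Rx ω ^ p = ∑ k ∈ range m, |x k ω| ^ p := fun ω => by
    rw [hRx, ← rpow_mul (hS0 ω), inv_mul_cancel₀ hp0.ne', rpow_one]
  have hLp := fun k =>
    integrable_abs_rpow_of_le hp0.le (hLm.meas' k).aestronglyMeasurable (hx k)
      fun ω => by rw [one_mul]; exact abs_lateDiff_le _ _ _
  have hRni := hLm.runMax_int_rpow hp0 hLp m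
  have hRxi : Integrable (fun ω => Rx ω ^ p) μ := by
    simp only [hRxp]; exact integrable_finsetSum _ fun k _ => hx k
  have hRxb : ∫ ω, Rx ω ^ p ∂μ ≤ K * m := by
    simp only [hRxp]
    rw [integral_finsetSum _ fun k _ => hx k]
    refine (sum_le_sum fun k _ => hK k).trans ?_
    simp [mul_comm]
  have hRnb : ∫ ω, Rn ω ^ p ∂μ ≤ bdgC p * (4 * K') * m := by
    refine (hLm.burkholder hp hp3 hLp m).trans ?_
    rw [mul_assoc]
    refine mul_le_mul_of_nonneg_left ?_ (bdgC_nonneg hp)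
    have h4 : (2 : ℝ) ^ (p / 2) ≤ 4 := by
      calc 2 ^ (p / 2) ≤ 2 ^ 2 := rpow_le_rpow_of_exponent_le (by norm_num)
            (by linarith)
        _ = 4 := by norm_num
    calc ∫ ω, sqSum L m ω ^ (p / 2) ∂μ
        ≤ ∫ ω, 4 * |selfNorm x v m ω - 2 * m| ^ (p / 2) ∂μ := by
          refine integral_mono (hLm.sqSum_int hp0 hLp m) (hQi.const_mul 4) fun ω => ?_
          have h1 := sqSum_lateDiff_le hv0 (x := x) (V := 4 * m) m ω
          rw [show (4 : ℝ) * m / 2 = 2 * m by ring] at h1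
          refine (rpow_le_rpow (sqSum_nonneg _ _) h1 (by positivity)).trans ?_
          rw [mul_rpow (by norm_num) (abs_nonneg _)]
          gcongr
      _ ≤ 4 * K' * m := by rw [integral_const_mul]; linarith
  refine ⟨fun ω => Y0 ω / 8, fun ω => Rx ω + Rn ω, (hY0m.measurable.div_const 8).stronglyMeasurable,
    hRxm.add hRnm,
    fun ω => by have := hY00 ω; positivity, fun ω => add_nonneg (hRx0 ω) (hRn0 ω), ?_, ?_, ?_, ?_⟩
  · refine subG_of_tail (hY0m.mono (h.le m)).measurable hY00 fun y hy => ?_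
    rcases hy.eq_or_lt with rfl | hy
    · simp
      exact measureReal_le_one.trans (by norm_num)
    · have ht := selfNorm_tail h hx2 hv hv0 hvx (m + 1) (y := y * √m) (V := 4 * m)
        (by positivity) (by positivity)
      rw [mul_pow, sq_sqrt hm'.le, show y ^ 2 * m / (4 * (4 * m)) = y ^ 2 / 16 by
        field_simp; norm_num] at ht
      refine (measureReal_mono fun ω hω => ?_).trans ht
      by_contra hcon
      simp only [Set.mem_ofPred_eq, not_exists, not_and] at hcon hω
      rw [hY0, le_div_iff₀ hsm] at hω
      have : earlyMax x v (4 * m) m ω < y * √m := by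
        obtain ⟨k, hk, e⟩ : ∃ k ≤ m, earlyMax x v (4 * m) m ω
            = {ω | selfNorm x v k ω ≤ 4 * m}.indicator (fun ω => |psum x k ω|) ω := by
          unfold earlyMax
          exact exists_runMax_eq _ _
        rw [e, Set.indicator_apply]
        split_ifs with hs
        · by_contra hc
          exact hcon k (by omega) (not_lt.1 hc) hs
        · positivity
      linarith
  · intro ω k hk
    have hxr := fun k hk => by
      have : |x k ω| ^ p ≤ Rx ω ^ p := by
        rw [hRxp]
        exact single_le_sum (f := fun k => |x k ω| ^ p) (fun i _ => by positivity)
          (mem_range.2 hk)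
      exact (Real.rpow_le_rpow_iff (abs_nonneg _) (hRx0 ω) hp0).1 this
    have h1 := abs_psum_sub_le hv0 (V := 4 * m) (hRx0 ω) hxr k hk
    have h2 := le_runMax (fun k => |psum L k ω|) hk
    have h3 : 8 * √m * (Y0 ω / 8) = earlyMax x v (4 * m) m ω := by
      rw [hY0]; field_simp
    rw [h3]
    have h4 : |psum x k ω| ≤ |psum x k ω - psum L k ω| + |psum L k ω| := by
      have := abs_add_le (psum x k ω - psum L k ω) (psum L k ω)
      rwa [sub_add_cancel] at this
    linarith
  · refine ((hRxi.add hRni).const_mul 8).mono' ?_ (ae_of_all _ fun ω => ?_)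
    · exact (((hRxm.add hRnm).mono (h.le m)).measurable.pow_const p).aestronglyMeasurable
    · rw [norm_of_nonneg (rpow_nonneg (add_nonneg (hRx0 ω) (hRn0 ω)) _)]
      exact add_rpow_le_eight hp0.le hp3 (hRx0 ω) (hRn0 ω)
  · have h1 : ∫ ω, (Rx ω + Rn ω) ^ p ∂μ ≤ ∫ ω, 8 * (Rx ω ^ p + Rn ω ^ p) ∂μ :=
      integral_mono_of_nonneg
        (ae_of_all _ fun ω => rpow_nonneg (add_nonneg (hRx0 ω) (hRn0 ω)) _)
        ((hRxi.add hRni).const_mul 8)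
        (ae_of_all _ fun ω => add_rpow_le_eight hp0.le hp3 (hRx0 ω) (hRn0 ω))
    rw [integral_const_mul, integral_add hRxi hRni] at h1
    refine h1.trans ?_
    nlinarith

/-- The constant in the remainder bound of `IsMDS.exists_dyadic_max_decomp`. -/
def remC (p K B : ℝ) : ℝ :=
  8 * (K + bdgC p * (4 * (156 * B + 78 * (K ^ (2 / p) + 1)) ^ (p / 2)))

lemma remC_nonneg (hp : 2 < p) (hK : 0 ≤ K) (hB : 0 ≤ B) : 0 ≤ remC p K B := by
  have := bdgC_nonneg hp
  unfold remC; positivity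

/-- Dyadic block maxima under the conditional variance hypothesis. -/
theorem IsMDS.exists_dyadic_max_decomp [IsProbabilityMeasure μ] (h : IsMDS μ G x) (hp : 2 < p)
    (hp3 : p ≤ 3) (hx : ∀ k, Integrable (fun ω => |x k ω| ^ p) μ)
    (hK : ∀ k, ∫ ω, |x k ω| ^ p ∂μ ≤ K) (hb0 : ∀ i, 0 ≤ b i)
    (hb : ∀ c i, eLpNorm (condBlock μ G (fun j ω => x j ω ^ 2 - 1) c i) (ofReal (p / 2)) μ
      ≤ ofReal (b i))
    (hB : ∀ n, ∑ k ∈ range n, b k / ((2 : ℝ) ^ (1 / (p / 2))) ^ k ≤ B) (c n : ℕ) :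
    ∃ Y R : Ω → ℝ, StronglyMeasurable[G (c + 2 ^ n)] Y ∧ StronglyMeasurable[G (c + 2 ^ n)] R ∧
      (∀ ω, 0 ≤ Y ω) ∧ (∀ ω, 0 ≤ R ω) ∧ SubG μ Y ∧
      (∀ ω, ∀ k ≤ 2 ^ n, |(∑ j ∈ range k, x (c + j) ω)| ≤ 8 * √(2 ^ n) * Y ω + R ω) ∧
      Integrable (fun ω => R ω ^ p) μ ∧ ∫ ω, R ω ^ p ∂μ ≤ remC p K B * 2 ^ n := by
  have hp0 : 0 < p := by linarith
  have hK0 := (integral_nonneg fun ω => by positivity).trans (hK 0)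
  have hB0 : 0 ≤ B := by simpa using hB 0
  have hq1 : 1 ≤ ofReal (p / 2) := by
    rw [← ofReal_one]; exact ofReal_le_ofReal (by linarith)
  have hx2 := fun k => by
    have := integrable_abs_rpow_of_exponent_le (by norm_num : (0 : ℝ) ≤ 2) hp.le
      (h.meas' k).aestronglyMeasurable (hx k)
    simpa using this
  set X : ℕ → Ω → ℝ := fun j ω => x j ω ^ 2 - 1 with hX
  have hXi := fun j => (hx2 j).sub (integrable_const 1)
  have hXK : ∀ j, eLpNorm (X j) (ofReal (p / 2)) μ
      ≤ ofReal (K ^ (2 / p) + 1) := by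
    intro j
    refine (eLpNorm_sub_le (hx2 j).aestronglyMeasurable
      (integrable_const 1).aestronglyMeasurable hq1).trans ?_
    rw [ofReal_add (by positivity) zero_le_one]
    refine add_le_add ?_ ?_
    · refine eLpNorm_le_of_integral_abs_rpow_le (by linarith) (by positivity)
        (hx2 j).aestronglyMeasurable ?_ ?_
      · simp only [abs_pow, sq_abs, sq_rpow_half]; exact hx j
      · simp only [abs_pow, sq_abs, sq_rpow_half]
        rw [← rpow_mul hK0, show 2 / p * (p / 2) = 1 by field_simp, rpow_one]
        exact hK j
    · rw [eLpNorm_const _ (by positivity) (IsProbabilityMeasure.ne_zero μ)]; simp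
  set v : ℕ → Ω → ℝ := fun k ω => max ((μ[fun ω => x (c + k) ω ^ 2 | G (c + k)]) ω) 0
  have hvm : ∀ k, StronglyMeasurable[G (c + k)] (v k) := fun k =>
    (stronglyMeasurable_condExp.measurable.max measurable_const).stronglyMeasurable
  have hvx : ∀ k, v k =ᵐ[μ] μ[fun ω => x (c + k) ω ^ 2 | G (c + k)] := fun k => by
    have := condExp_nonneg (μ := μ) (m := G (c + k)) (f := fun ω => x (c + k) ω ^ 2)
      (ae_of_all _ fun ω => sq_nonneg _)
    filter_upwards [this] with ω hω
    exact max_eq_left hω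
  have hQ : (fun ω => selfNorm (fun k => x (c + k)) v (2 ^ n) ω - 2 * ((2 ^ n : ℕ) : ℝ)) =ᵐ[μ]
      fun ω => (∑ j ∈ range (2 ^ n), (μ[X (c + j) | G (c + j)]) ω)
        + ∑ j ∈ range (2 ^ n), X (c + j) ω := by
    have h1 : ∀ᵐ ω ∂μ, ∀ j, (μ[X (c + j) | G (c + j)]) ω = v j ω - 1 := ae_all_iff.2 fun j => by
      have h1 := condExp_sub (hx2 (c + j)) (integrable_const 1) (G (c + j))
      filter_upwards [h1, hvx j] with ω h1 h2
      have h3 : (μ[X (c + j) | G (c + j)]) ω = _ := h1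
      rw [h3, Pi.sub_apply, h2, condExp_const (h.le _)]
    filter_upwards [h1] with ω h1
    simp only [h1]
    simp only [hX, selfNorm, sum_add_distrib]
    simp
    ring
  have hE := eLpNorm_block_le h.mono h.le
    (fun j => (((h.meas j).pow 2).sub stronglyMeasurable_const)) hXi
    (by linarith : 1 < p / 2) (by linarith) hb0 hb (by positivity) hXK hB c n
  have hm1 : AEStronglyMeasurable
      (fun ω => ∑ j ∈ range (2 ^ n), (μ[X (c + j) | G (c + j)]) ω) μ :=
    (stronglyMeasurable_fun_sum _ fun l _ =>
      stronglyMeasurable_condExp.mono (h.le _)).aestronglyMeasurable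
  have hm2 : AEStronglyMeasurable (fun ω => ∑ j ∈ range (2 ^ n), X (c + j) ω) μ :=
    (integrable_finsetSum _ fun j _ => hXi _).aestronglyMeasurable
  set β : ℝ := 2 ^ (1 / (p / 2)) with hβ
  have hβ0 : 0 < β := by positivity
  have hEQ : eLpNorm (fun ω => selfNorm (fun k => x (c + k)) v (2 ^ n) ω - 2 * ((2 ^ n : ℕ) : ℝ))
      (ofReal (p / 2)) μ
      ≤ ofReal (β ^ n * (156 * B + 78 * (K ^ (2 / p) + 1))) := by
    rw [eLpNorm_congr_ae hQ]
    refine (eLpNorm_add_le hm1 hm2 hq1).trans ((add_le_add hE.1 hE.2).trans ?_)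
    rw [← ofReal_add (by positivity) (by positivity)]
    exact ofReal_le_ofReal (le_of_eq (by ring))
  have hQae :=
    (hm1.add hm2).congr hQ.symm
  have hfin := integral_abs_rpow_le_of_eLpNorm_le (by linarith) (by positivity) hQae hEQ
  have hβn : (β ^ n) ^ (p / 2) = 2 ^ n := by
    rw [hβ, ← rpow_natCast, ← rpow_mul (by positivity), ← rpow_mul (by norm_num),
      mul_left_comm, one_div, inv_mul_cancel₀ (by positivity), mul_one, rpow_natCast]
  rw [mul_rpow (by positivity) (by positivity), hβn] at hfin
  obtain ⟨Y, R, hY, hR, hY0, hR0, hYs, hle, hRi, hRb⟩ := (h.shift c).exists_max_decomp hp hp3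
    (K' := (156 * B + 78 * (K ^ (2 / p) + 1)) ^ (p / 2))
    (fun k => hx (c + k)) (fun k => hK (c + k)) hvm (fun k ω => le_max_right _ _) hvx (2 ^ n)
    (by positivity) hfin.1 (hfin.2.trans (le_of_eq (by push_cast; ring)))
  refine ⟨Y, R, hY, hR, hY0, hR0, hYs, fun ω k hk => ?_, hRi, hRb.trans (le_of_eq ?_)⟩
  · have := hle ω k hk
    push_cast at this
    exact this
  · unfold remC; push_cast; ring

/-- The weighted moment of a past-measurable variable against the previous dyadic block. -/
theorem IsMDS.lintegral_block_rpow_mul_le [IsProbabilityMeasure μ] (h : IsMDS μ G x) (hp : 2 < p)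
    (hp3 : p ≤ 3) (hx : ∀ k, Integrable (fun ω => |x k ω| ^ p) μ)
    (hK : ∀ k, ∫ ω, |x k ω| ^ p ∂μ ≤ K) (hb0 : ∀ i, 0 ≤ b i)
    (hb : ∀ c i, eLpNorm (condBlock μ G (fun j ω => x j ω ^ 2 - 1) c i) (ofReal (p / 2)) μ
      ≤ ofReal (b i))
    (hB : ∀ n, ∑ k ∈ range n, b k / ((2 : ℝ) ^ (1 / (p / 2))) ^ k ≤ B) (c n : ℕ)
    {Z : Ω → ℝ} (hZm : Measurable Z) {a' b' : ℝ}
    (ha' : 0 ≤ a') (hb' : 0 ≤ b')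
    (hZa : ∀ Y : Ω → ℝ, StronglyMeasurable[G (c + 2 ^ n)] Y → (∀ ω, 0 ≤ Y ω) → SubG μ Y →
      ∫⁻ ω, ofReal (Y ω ^ (p - 2) * |Z ω|) ∂μ ≤ ofReal a')
    (hZb : eLpNorm Z (ofReal (p / 2)) μ ≤ ofReal b') :
    ∫⁻ ω, ofReal (|(∑ j ∈ range (2 ^ n), x (c + j) ω)| ^ (p - 2) * |Z ω|) ∂μ
      ≤ ofReal (8 * ((2 : ℝ) ^ n) ^ ((p - 2) / 2) * a'
          + (remC p K B * 2 ^ n) ^ ((p - 2) / p) * b') := by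
  have hp0 : 0 < p := by linarith
  have hK0 := (integral_nonneg fun ω => by positivity).trans (hK 0)
  have hB0 : 0 ≤ B := by simpa using hB 0
  obtain ⟨Y, R, hYm, hRm, hY0, hR0, hYs, hYR, hRi, hRI⟩ :=
    h.exists_dyadic_max_decomp hp hp3 hx hK hb0 hb hB c n
  have hRm' := (hRm.mono (h.le _)).measurable
  have hYm' := (hYm.mono (h.le _)).measurable
  have hpt : ∀ ω, ofReal (|(∑ j ∈ range (2 ^ n), x (c + j) ω)| ^ (p - 2) * |Z ω|)
      ≤ ofReal (8 * (2 ^ n) ^ ((p - 2) / 2))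
          * ofReal (Y ω ^ (p - 2) * |Z ω|)
        + ofReal (R ω ^ (p - 2)) * ofReal |Z ω| := by
    intro ω
    rw [← ofReal_mul (by positivity), ← ofReal_mul (by have := hR0 ω; positivity),
      ← ofReal_add (by have := hY0 ω; positivity) (by have := hR0 ω; positivity)]
    refine ofReal_le_ofReal ?_
    have h1 : |(∑ j ∈ range (2 ^ n), x (c + j) ω)| ^ (p - 2)
        ≤ (8 * √(2 ^ n) * Y ω + R ω) ^ (p - 2) :=
      rpow_le_rpow (abs_nonneg _) (hYR ω _ le_rfl) (by linarith)
    have h2 : (8 * √(2 ^ n) * Y ω + R ω) ^ (p - 2)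
        ≤ (8 * √(2 ^ n) * Y ω) ^ (p - 2) + R ω ^ (p - 2) :=
      Real.rpow_add_le_add_rpow (by have := hY0 ω; positivity) (hR0 ω) (by linarith) (by linarith)
    have h3 : (8 * √(2 ^ n) * Y ω) ^ (p - 2)
        ≤ 8 * (2 ^ n) ^ ((p - 2) / 2) * Y ω ^ (p - 2) := by
      rw [mul_rpow (by positivity) (hY0 ω), mul_rpow (by norm_num) (by positivity),
        sqrt_eq_rpow, ← rpow_mul (by positivity),
        show 1 / 2 * (p - 2) = (p - 2) / 2 by ring]
      have : (8 : ℝ) ^ (p - 2) ≤ 8 := by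
        conv_rhs => rw [← rpow_one 8]
        exact rpow_le_rpow_of_exponent_le (by norm_num) (by linarith)
      have := hY0 ω
      gcongr
    nlinarith [mul_le_mul_of_nonneg_right (h1.trans (h2.trans (add_le_add_left h3 _)))
      (abs_nonneg (Z ω))]
  have hconj : (p / (p - 2)).HolderConjugate (p / 2) := by
    refine (Real.holderConjugate_iff).2 ⟨by rw [lt_div_iff₀ (by linarith)]; linarith, ?_⟩
    rw [inv_div, inv_div]; field_simp; ring
  have hR2 : ∫⁻ ω, ofReal (R ω ^ (p - 2)) * ofReal |Z ω| ∂μ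
      ≤ ofReal ((remC p K B * 2 ^ n) ^ ((p - 2) / p) * b') := by
    refine (ENNReal.lintegral_mul_le_Lp_mul_Lq μ hconj
      (by fun_prop) (by fun_prop)).trans ?_
    rw [ofReal_mul (by have := remC_nonneg hp hK0 hB0; positivity)]
    refine mul_le_mul' ?_ ?_
    · have : ∀ ω, ofReal (R ω ^ (p - 2)) ^ (p / (p - 2)) = ofReal (R ω ^ p) := by
        intro ω
        rw [ENNReal.ofReal_rpow_of_nonneg (by have := hR0 ω; positivity)
          (div_nonneg hp0.le (by linarith)), ← rpow_mul (hR0 ω),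
          mul_div_cancel₀ _ (by linarith : p - 2 ≠ 0)]
      simp only [this]
      rw [← ofReal_integral_eq_lintegral_ofReal hRi
        (ae_of_all _ fun ω => rpow_nonneg (hR0 ω) _), one_div_div,
        ENNReal.ofReal_rpow_of_nonneg (integral_nonneg fun ω => rpow_nonneg (hR0 ω) _)
          (div_nonneg (by linarith) hp0.le)]
      exact ofReal_le_ofReal (rpow_le_rpow
        (integral_nonneg fun ω => rpow_nonneg (hR0 ω) _) hRI
        (div_nonneg (by linarith) hp0.le))
    · rw [eLpNorm_eq_lintegral_rpow_enorm_toReal (by simp; linarith) (by simp),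
        toReal_ofReal (by linarith)] at hZb
      simpa only [← Real.enorm_eq_ofReal_abs] using hZb
  calc _ ≤ _ := lintegral_mono hpt
    _ = ofReal (8 * (2 ^ n) ^ ((p - 2) / 2))
          * (∫⁻ ω, ofReal (Y ω ^ (p - 2) * |Z ω|) ∂μ)
        + ∫⁻ ω, ofReal (R ω ^ (p - 2)) * ofReal |Z ω| ∂μ := by
        rw [lintegral_add_left (by fun_prop), lintegral_const_mul _ (by fun_prop)]
    _ ≤ ofReal (8 * (2 ^ n) ^ ((p - 2) / 2)) * ofReal a'
        + ofReal ((remC p K B * 2 ^ n) ^ ((p - 2) / p) * b') := by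
        gcongr
        exact hZa Y hYm hY0 hYs
    _ = _ := by
        rw [← ofReal_mul (by positivity), ← ofReal_add (by positivity)
          (by have := remC_nonneg hp hK0 hB0; positivity)]

/-- The standard Gaussian law on `ℝ^ι`. -/
abbrev stdG (ι : Type*) [Fintype ι] : Measure (𝔼 ι) :=
  stdGaussian (𝔼 ι)

/-- A weight that dominates every Gaussian integrand of the smoothing estimates. -/
def gWeight {E : Type*} [Norm E] (z : E) : ℝ := (‖z‖ + 1) ^ 4 * exp (‖z‖ + 1)

lemma integrable_gWeight : Integrable (fun z : 𝔼 ι => gWeight z) (stdG ι) := by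
  obtain ⟨C, hC, hCi⟩ := IsGaussian.exists_integrable_exp_sq (stdG ι)
  refine (hCi.const_mul (24 * exp (2 + 1 / C))).mono'
    (by unfold gWeight; fun_prop) (ae_of_all _ fun z => ?_)
  have h0 : 0 ≤ ‖z‖ + 1 := by positivity
  have h1 : (‖z‖ + 1) ^ 4 ≤ 24 * exp (‖z‖ + 1) := by
    have := Real.pow_div_factorial_le_exp (‖z‖ + 1) h0 4
    norm_num at this
    linarith
  rw [gWeight, norm_of_nonneg (by positivity)]
  calc (‖z‖ + 1) ^ 4 * exp (‖z‖ + 1)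
      ≤ 24 * exp (‖z‖ + 1) * exp (‖z‖ + 1) := by gcongr
    _ = 24 * exp (2 + 2 * ‖z‖) := by rw [mul_assoc, ← exp_add]; ring_nf
    _ ≤ 24 * exp (2 + 1 / C + C * ‖z‖ ^ 2) := by
        refine mul_le_mul_of_nonneg_left (exp_le_exp.2 ?_) (by norm_num)
        have : 2 * ‖z‖ ≤ 1 / C + C * ‖z‖ ^ 2 := by
          have := mul_nonneg (one_div_pos.2 hC).le (sq_nonneg (C * ‖z‖ - 1))
          field_simp at this ⊢
          nlinarith
        linarith
    _ = _ := by rw [exp_add, mul_assoc]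

/-- The dimensional constant of the smoothing estimates. -/
def gConst (ι : Type*) [Fintype ι] : ℝ := ∫ z, gWeight z ∂(stdG ι)

lemma one_le_gWeight {E : Type*} [SeminormedAddGroup E] (z : E) : 1 ≤ gWeight z := by
  unfold gWeight
  have h := norm_nonneg z
  have h1 : 1 ≤ (‖z‖ + 1) ^ 4 := one_le_pow₀ (by linarith)
  have h2 : 1 ≤ exp (‖z‖ + 1) := one_le_exp (by linarith)
  nlinarith

lemma pow_le_gWeight {E : Type*} [SeminormedAddGroup E] (z : E) (hk : k ≤ 4) :
    (‖z‖ + 1) ^ k ≤ gWeight z := by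
  unfold gWeight
  have h := norm_nonneg z
  have h1 : (‖z‖ + 1) ^ k ≤ (‖z‖ + 1) ^ 4 := pow_le_pow_right₀ (by linarith) hk
  have h2 : 1 ≤ exp (‖z‖ + 1) := one_le_exp (by linarith)
  exact h1.trans (le_mul_of_one_le_right (by positivity) h2)

lemma one_le_gConst : 1 ≤ gConst ι := by
  have := integral_mono (μ := stdG ι) (integrable_const 1) integrable_gWeight one_le_gWeight
  simpa [gConst] using this

lemma integrable_of_le_gWeight {g : 𝔼 ι → ℝ} (hg : Measurable g) (h : ∀ z, |g z| ≤ C * gWeight z) :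
    Integrable g (stdG ι) :=
  (integrable_gWeight.const_mul C).mono' hg.aestronglyMeasurable
    (ae_of_all _ fun z => (norm_eq_abs _).le.trans (h z))

lemma abs_integral_le_gConst {g : 𝔼 ι → ℝ} (h : ∀ z, |g z| ≤ C * gWeight z) :
    |(∫ z, g z ∂(stdG ι))| ≤ C * gConst ι := by
  rw [gConst, ← integral_const_mul]
  exact norm_integral_le_of_norm_le (integrable_gWeight.const_mul C)
    (ae_of_all _ fun z => (norm_eq_abs _).le.trans (h z))

lemma abs_coord_le_norm (z : 𝔼 ι) (u : ι) : |z u| ≤ ‖z‖ :=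
  PiLp.norm_apply_le z u

open Complex in
lemma integral_cexp_stdG (a : ι → ℂ) :
    ∫ z : 𝔼 ι, cexp (∑ u, a u * z u) ∂(stdG ι) = cexp (∑ u, a u ^ 2 / 2) := by
  rw [stdG, ← map_pi_eq_stdGaussian, integral_map (by fun_prop) (by fun_prop)]
  simp_rw [exp_sum]
  rw [integral_fintype_prod_eq_prod (f := fun u (x : ℝ) => cexp (a u * x))]
  refine Finset.prod_congr rfl fun u _ => ?_
  have := complexMGF_id_gaussianReal (μ := 0) (v := 1) (a u)
  simpa [complexMGF] using this

/-- The Cameron–Martin density. -/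
def cmDensity (w z : 𝔼 ι) : ℝ := exp (inner ℝ z w - ‖w‖ ^ 2 / 2)

lemma integral_cexp_inner_stdG (t w : 𝔼 ι) :
    ∫ z : 𝔼 ι, Complex.exp (inner ℝ z t * Complex.I) * (cmDensity w z : ℂ) ∂(stdG ι)
      = Complex.exp (inner ℝ w t * Complex.I - ‖t‖ ^ 2 / 2) := by
  have h : ∀ z : 𝔼 ι, Complex.exp (inner ℝ z t * Complex.I) * (cmDensity w z : ℂ)
      = Complex.exp (-(‖w‖ ^ 2 / 2 : ℝ)) *
        Complex.exp (∑ u, ((t u : ℂ) * Complex.I + w u) * z u) := by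
    intro z
    rw [cmDensity, Complex.ofReal_exp, ← Complex.exp_add, ← Complex.exp_add]
    congr 1
    rw [inner_eq_star_dotProduct, inner_eq_star_dotProduct]
    simp only [dotProduct, star_trivial]
    push_cast
    simp only [add_mul, sum_add_distrib, sum_mul]
    have e : ∀ u, (t u : ℂ) * Complex.I * z u = t u * z u * Complex.I := fun u => by ring
    simp only [e]
    ring
  simp_rw [h]
  rw [integral_const_mul, integral_cexp_stdG, ← Complex.exp_add]
  congr 1
  rw [inner_eq_star_dotProduct, real_norm_sq_eq]
  have ht : ((‖t‖ : ℝ) : ℂ) ^ 2 = ∑ u, (t u : ℂ) ^ 2 := by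
    rw [← Complex.ofReal_pow, real_norm_sq_eq]; push_cast; rfl
  rw [ht]
  simp only [dotProduct, star_trivial]
  push_cast
  have : ∀ u, ((t u : ℂ) * Complex.I + w u) ^ 2 / 2
      = (w u : ℂ) ^ 2 / 2 + t u * w u * Complex.I - (t u : ℂ) ^ 2 / 2 := by
    intro u
    ring_nf
    rw [Complex.I_sq]; ring
  simp only [this, sum_add_distrib, sum_sub_distrib, sum_mul, sum_div]
  ring

lemma stdG_map_add (w : 𝔼 ι) :
    (stdG ι).map (fun z => z + w)
      = (stdG ι).withDensity (fun z => ofReal (cmDensity w z)) := by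
  have hm : Measurable (cmDensity w) := by unfold cmDensity; fun_prop
  have hcm : ∀ z, 0 ≤ cmDensity w z := fun z => (exp_pos _).le
  have hint : Integrable (cmDensity w) (stdG ι) := by
    have hne : Integrable (fun z => (cmDensity w z : ℂ)) (stdG ι) := by
      by_contra hcon
      have := integral_cexp_inner_stdG (0 : 𝔼 ι) w
      simp only [inner_zero_right, Complex.ofReal_zero, zero_mul, Complex.exp_zero, one_mul] at this
      rw [integral_undef hcon] at this
      exact Complex.exp_ne_zero _ this.symm
    exact hne.re
  have :=
    isFiniteMeasure_withDensity_ofReal hint.2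
  have : IsFiniteMeasure ((stdG ι).map (fun z => z + w)) := by infer_instance
  refine Measure.ext_of_charFun ?_
  ext t
  rw [charFun_map_add_const, charFun_stdGaussian, charFun_apply,
    integral_withDensity_eq_integral_toReal_smul hm.ennreal_ofReal (by simp)]
  have := integral_cexp_inner_stdG t w
  simp only [toReal_ofReal (hcm _), Complex.real_smul]
  simp_rw [mul_comm ((cmDensity w _ : ℝ) : ℂ)]
  rw [this, ← Complex.exp_add]
  congr 1
  ring

lemma integral_stdG_add (w : 𝔼 ι) {g : 𝔼 ι → ℝ} (hg : Measurable g) :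
    ∫ z, g (z + w) ∂(stdG ι) = ∫ z, cmDensity w z * g z ∂(stdG ι) := by
  have hm : Measurable (cmDensity w) := by unfold cmDensity; fun_prop
  rw [← integral_map (by fun_prop) hg.aestronglyMeasurable,
    stdG_map_add, integral_withDensity_eq_integral_toReal_smul hm.ennreal_ofReal (by simp)]
  simp only [toReal_ofReal (exp_pos _).le, cmDensity, smul_eq_mul]

section

variable {f g : 𝔼 ι → ℝ}

/-- Gaussian average of the increments of `f` at scale `√t` against the weight `g`. -/
def smoothH (f g : 𝔼 ι → ℝ) (t : ℝ) (x : 𝔼 ι) : ℝ :=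
  ∫ z, (f (x + √t • z) - f x) * g z ∂(stdG ι)

lemma LipschitzWith.abs_sub_le {E : Type*} [SeminormedAddCommGroup E] {f : E → ℝ}
    (hf : LipschitzWith 1 f) (x y : E) : |f x - f y| ≤ ‖x - y‖ := by
  simpa [dist_eq_norm] using hf.dist_le_mul x y

lemma abs_smooth_integrand_le (hf : LipschitzWith 1 f) (hg : ∀ z, |g z| ≤ (‖z‖ + 1) ^ 2)
    (x z : 𝔼 ι) : |(f (x + √t • z) - f x) * g z| ≤ √t * gWeight z := by
  have h1 := hf.abs_sub_le (x + √t • z) x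
  rw [add_sub_cancel_left, norm_smul, norm_of_nonneg (sqrt_nonneg t)] at h1
  have h0 := norm_nonneg z
  calc |(f (x + √t • z) - f x) * g z| = |f (x + √t • z) - f x| * |g z| := abs_mul _ _
    _ ≤ √t * ‖z‖ * (‖z‖ + 1) ^ 2 := by gcongr; exact hg z
    _ ≤ √t * (‖z‖ + 1) ^ 3 := by
        rw [mul_assoc]
        gcongr
        nlinarith
    _ ≤ _ := by gcongr; exact pow_le_gWeight z (by norm_num)

lemma smooth_integrable (hf : LipschitzWith 1 f) (hgm : Measurable g)
    (hg : ∀ z, |g z| ≤ (‖z‖ + 1) ^ 2) (x : 𝔼 ι) :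
    Integrable (fun z => (f (x + √t • z) - f x) * g z) (stdG ι) := by
  have := hf.continuous.measurable
  exact integrable_of_le_gWeight (by fun_prop) (abs_smooth_integrand_le hf hg x)

lemma abs_smoothH_le (hf : LipschitzWith 1 f) (hg : ∀ z, |g z| ≤ (‖z‖ + 1) ^ 2)
    (x : 𝔼 ι) : |smoothH f g t x| ≤ √t * gConst ι :=
  abs_integral_le_gConst (abs_smooth_integrand_le hf hg x)

lemma abs_smoothH_sub_le (hf : LipschitzWith 1 f) (hgm : Measurable g)
    (hg : ∀ z, |g z| ≤ (‖z‖ + 1) ^ 2) (x y : 𝔼 ι) :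
    |smoothH f g t x - smoothH f g t y| ≤ 2 * ‖x - y‖ * gConst ι := by
  rw [smoothH, smoothH, ← integral_sub (smooth_integrable hf hgm hg x)
    (smooth_integrable hf hgm hg y)]
  refine abs_integral_le_gConst fun z => ?_
  have h1 := hf.abs_sub_le (x + √t • z) (y + √t • z)
  have h2 := hf.abs_sub_le x y
  rw [add_sub_add_right_eq_sub] at h1
  have h3 : |(f (x + √t • z) - f (y + √t • z)) - (f x - f y)| ≤ 2 * ‖x - y‖ :=
    (abs_sub _ _).trans (by linarith)
  rw [← sub_mul, abs_mul, show f (x + √t • z) - f x - (f (y + √t • z) - f y)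
    = (f (x + √t • z) - f (y + √t • z)) - (f x - f y) by ring]
  exact mul_le_mul h3 ((hg z).trans (pow_le_gWeight z (by norm_num))) (abs_nonneg _)
    (by positivity)

lemma abs_smoothH_sub_time_le (hf : LipschitzWith 1 f) (hgm : Measurable g)
    (hg : ∀ z, |g z| ≤ (‖z‖ + 1) ^ 2) (hst : s ≤ t) (x : 𝔼 ι) :
    |smoothH f g t x - smoothH f g s x| ≤ (√t - √s) * gConst ι := by
  rw [smoothH, smoothH, ← integral_sub (smooth_integrable hf hgm hg x)
    (smooth_integrable hf hgm hg x)]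
  have hs := sub_nonneg.2 (sqrt_le_sqrt hst)
  refine abs_integral_le_gConst fun z => ?_
  have h1 := hf.abs_sub_le (x + √t • z) (x + √s • z)
  rw [add_sub_add_left_eq_sub, ← sub_smul, norm_smul, norm_of_nonneg hs] at h1
  have h0 := norm_nonneg z
  rw [← sub_mul, abs_mul, show f (x + √t • z) - f x - (f (x + √s • z) - f x)
    = f (x + √t • z) - f (x + √s • z) by ring]
  calc |f (x + √t • z) - f (x + √s • z)| * |g z| ≤ (√t - √s) * ‖z‖ * (‖z‖ + 1) ^ 2 := by
        gcongr; exact hg z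
    _ ≤ (√t - √s) * (‖z‖ + 1) ^ 3 := by
        rw [mul_assoc]
        gcongr
        nlinarith
    _ ≤ _ := by gcongr; exact pow_le_gWeight z (by norm_num)

lemma continuous_smoothH (hf : LipschitzWith 1 f) (hgm : Measurable g)
    (hg : ∀ z, |g z| ≤ (‖z‖ + 1) ^ 2) : Continuous (smoothH f g t) :=
  (LipschitzWith.of_dist_le_mul (K := 2 * (gConst ι).toNNReal) fun x y => by
    rw [dist_eq, dist_eq_norm]
    refine (abs_smoothH_sub_le hf hgm hg x y).trans (le_of_eq ?_)
    have := one_le_gConst (ι := ι)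
    simp [Real.coe_toNNReal _ (zero_le_one.trans this)]
    ring).continuous

/-- First order weight. -/
def gCoord (u : ι) (z : 𝔼 ι) : ℝ := z u

open Classical in
/-- Second order (Hermite) weight. -/
def gHerm (u v : ι) (z : 𝔼 ι) : ℝ := z u * z v - if u = v then 1 else 0

lemma measurable_gCoord (u : ι) : Measurable (gCoord u) := by unfold gCoord; fun_prop

lemma measurable_gHerm (u v : ι) : Measurable (gHerm u v) := by unfold gHerm; fun_prop

lemma abs_gCoord_le (u : ι) (z : 𝔼 ι) : |gCoord u z| ≤ (‖z‖ + 1) ^ 2 := by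
  have := abs_coord_le_norm z u
  unfold gCoord
  nlinarith

lemma abs_gHerm_le (u v : ι) (z : 𝔼 ι) : |gHerm u v z| ≤ (‖z‖ + 1) ^ 2 := by
  have hu := abs_coord_le_norm z u
  have hv := abs_coord_le_norm z v
  have h0 := norm_nonneg z
  have h1 : |z u * z v| ≤ ‖z‖ * ‖z‖ := by rw [abs_mul]; gcongr
  unfold gHerm
  split_ifs
  · have := abs_sub (z u * z v) 1
    rw [abs_one] at this
    nlinarith
  · rw [sub_zero]; nlinarith

lemma abs_one_le_weight (z : 𝔼 ι) : |(1 : ℝ)| ≤ (‖z‖ + 1) ^ 2 := by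
  rw [abs_one]; nlinarith [norm_nonneg z]

/-- Gaussian smoothing of `f` with variance `t`. -/
def gF (f : 𝔼 ι → ℝ) (t : ℝ) (x : 𝔼 ι) : ℝ :=
  f x + smoothH f (fun _ => 1) t x

/-- The gradient of `gF f t`. -/
def gL (f : 𝔼 ι → ℝ) (t : ℝ) (u : ι) (x : 𝔼 ι) : ℝ :=
  smoothH f (gCoord u) t x / √t

/-- The Hessian of `gF f t`. -/
def gB (f : 𝔼 ι → ℝ) (t : ℝ) (u v : ι) (x : 𝔼 ι) : ℝ :=
  smoothH f (gHerm u v) t x / t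

lemma gF_integrand_int (hf : LipschitzWith 1 f) (x : 𝔼 ι) :
    Integrable (fun z => f (x + √t • z)) (stdG ι) := by
  have := (smooth_integrable (t := t) hf measurable_const abs_one_le_weight x).add
    (integrable_const (f x))
  refine this.congr (ae_of_all _ fun z => ?_)
  simp

lemma gF_eq (hf : LipschitzWith 1 f) (x : 𝔼 ι) :
    gF f t x = ∫ z, f (x + √t • z) ∂(stdG ι) := by
  simp only [gF, smoothH, mul_one]
  rw [integral_sub (gF_integrand_int hf x) (integrable_const _)]
  simp

lemma gF_lipschitz (hf : LipschitzWith 1 f) : LipschitzWith 1 (gF f t) := by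
  refine LipschitzWith.of_dist_le_mul fun x y => ?_
  rw [dist_eq, dist_eq_norm, gF_eq hf, gF_eq hf, ← integral_sub (gF_integrand_int hf x)
    (gF_integrand_int hf y), coe_one, one_mul]
  have := norm_integral_le_of_norm_le_const (μ := stdG ι)
    (f := fun z => f (x + √t • z) - f (y + √t • z)) (ae_of_all _ fun z => by
      have := hf.abs_sub_le (x + √t • z) (y + √t • z)
      rwa [add_sub_add_right_eq_sub] at this)
  simpa using this

lemma abs_gF_sub_self_le (hf : LipschitzWith 1 f) (x : 𝔼 ι) :
    |gF f t x - f x| ≤ √t * gConst ι := by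
  rw [gF, add_sub_cancel_left]
  exact abs_smoothH_le hf abs_one_le_weight x

lemma abs_gF_sub_le (hf : LipschitzWith 1 f) (hst : s ≤ t) (x : 𝔼 ι) :
    |gF f t x - gF f s x| ≤ (√t - √s) * gConst ι := by
  rw [gF, gF, add_sub_add_left_eq_sub]
  exact abs_smoothH_sub_time_le hf measurable_const abs_one_le_weight hst x

lemma continuous_gL (hf : LipschitzWith 1 f) (u : ι) : Continuous (gL f t u) :=
  (continuous_smoothH hf (measurable_gCoord u) (abs_gCoord_le u)).div_const _

lemma continuous_gB (hf : LipschitzWith 1 f) (u v : ι) : Continuous (gB f t u v) :=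
  (continuous_smoothH hf (measurable_gHerm u v) (abs_gHerm_le u v)).div_const _

lemma abs_gL_le (hf : LipschitzWith 1 f) (ht : 0 < t) (u : ι) (x : 𝔼 ι) :
    |gL f t u x| ≤ gConst ι := by
  have h := abs_smoothH_le (t := t) hf (abs_gCoord_le u) x
  have hs := sqrt_pos.2 ht
  rw [gL, abs_div, abs_of_pos hs, div_le_iff₀ hs]
  linarith

lemma abs_gB_le (hf : LipschitzWith 1 f) (ht : 0 < t) (u v : ι) (x : 𝔼 ι) :
    |gB f t u v x| ≤ gConst ι / √t := by
  have h := abs_smoothH_le (t := t) hf (abs_gHerm_le u v) x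
  have hs := sqrt_pos.2 ht
  rw [gB, abs_div, abs_of_pos ht, div_le_div_iff₀ ht hs]
  calc _ ≤ √t * gConst ι * √t := by gcongr
    _ = _ := by rw [mul_right_comm, mul_self_sqrt ht.le, mul_comm]

/-- Hölder regularity in space of the Hessian. -/
lemma abs_gB_sub_le (hf : LipschitzWith 1 f) (ht : 0 < t) (u v : ι) (hr0 : 0 ≤ r) (hr : r ≤ 1)
    (x y : 𝔼 ι) :
    |gB f t u v x - gB f t u v y| ≤ 2 * gConst ι / √t * (‖x - y‖ / √t) ^ r := by
  have hs := sqrt_pos.2 ht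
  have hc := one_le_gConst (ι := ι)
  rcases le_total (‖x - y‖ / √t) 1 with h1 | h1
  · have h := abs_smoothH_sub_le (t := t) hf (measurable_gHerm u v) (abs_gHerm_le u v) x y
    have h2 : ‖x - y‖ / √t ≤ (‖x - y‖ / √t) ^ r := by
      rcases (div_nonneg (norm_nonneg (x - y)) hs.le).eq_or_lt with h0 | h0
      · rw [← h0]; exact rpow_nonneg le_rfl _
      · conv_lhs => rw [← rpow_one (‖x - y‖ / √t)]
        exact Real.rpow_le_rpow_of_exponent_ge h0 h1 hr
    rw [gB, gB, ← sub_div, abs_div, abs_of_pos ht]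
    calc _ ≤ 2 * ‖x - y‖ * gConst ι / t := by gcongr
      _ = 2 * gConst ι / √t * (‖x - y‖ / √t) := by
        rw [div_mul_div_comm, mul_self_sqrt ht.le]; ring
      _ ≤ _ := by gcongr
  · have ha := abs_gB_le hf ht u v x
    have hb := abs_gB_le hf ht u v y
    have h2 := one_le_rpow h1 hr0
    calc _ ≤ |gB f t u v x| + |gB f t u v y| := abs_sub _ _
      _ ≤ 2 * gConst ι / √t * 1 := by rw [mul_one, mul_div_assoc]; linarith
      _ ≤ _ := by gcongr

/-- Hölder regularity in time of the Hessian. -/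
lemma abs_gB_sub_time_le (hf : LipschitzWith 1 f) (ht : 0 < t) (hs0 : 0 ≤ s) (hst : s ≤ t) (u v : ι)
    (hr : r ≤ 1) (x : 𝔼 ι) :
    |gB f (t + s) u v x - gB f t u v x| ≤ 2 * gConst ι / √t * (s / t) ^ r := by
  have hs := sqrt_pos.2 ht
  have hc := one_le_gConst (ι := ι)
  have hc0 : 0 ≤ gConst ι := by linarith
  have h1 := (div_le_one ht).2 hst
  have h2 : s / t ≤ (s / t) ^ r := by
    rcases (div_nonneg hs0 ht.le).eq_or_lt with h0 | h0
    · rw [← h0]; exact rpow_nonneg le_rfl _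
    · conv_lhs => rw [← rpow_one (s / t)]
      exact Real.rpow_le_rpow_of_exponent_ge h0 h1 hr
  refine le_trans ?_ (mul_le_mul_of_nonneg_left h2 (by positivity))
  have hA := abs_smoothH_sub_time_le hf (measurable_gHerm u v) (abs_gHerm_le u v)
    (by linarith : t ≤ t + s) x
  have hB := abs_smoothH_le (t := t + s) hf (abs_gHerm_le u v) x
  set a := smoothH f (gHerm u v) (t + s) x
  set b := smoothH f (gHerm u v) t x
  have hts : 0 < t + s := by linarith
  have e : gB f (t + s) u v x - gB f t u v x = (a - b) / t - a * s / (t * (t + s)) := by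
    simp only [gB]
    field_simp
    ring
  set σ := √t
  set τ := √(t + s)
  have hσ2 := mul_self_sqrt ht.le
  have hτ2 : τ * τ = t + s := mul_self_sqrt hts.le
  have hστ : σ ≤ τ := sqrt_le_sqrt (by linarith)
  have hτ0 := hs.trans_le hστ
  have hdiff : τ - σ ≤ s / σ := by
    rw [le_div_iff₀ hs]; nlinarith
  have h3 : |(a - b) / t| ≤ gConst ι / σ * (s / t) := by
    rw [abs_div, abs_of_pos ht]
    calc _ ≤ s / σ * gConst ι / t := by gcongr; exact hA.trans (by gcongr)
      _ = _ := by ring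
  have h4 : |a * s / (t * (t + s))| ≤ gConst ι / σ * (s / t) := by
    rw [abs_div, abs_mul, abs_of_nonneg hs0, abs_of_pos (by positivity : 0 < t * (t + s))]
    calc _ ≤ τ * gConst ι * s / (t * (t + s)) := by gcongr
      _ = gConst ι / τ * (s / t) := by rw [← hτ2]; field_simp
      _ ≤ _ := by gcongr
  rw [e]
  calc _ ≤ _ := abs_sub _ _
    _ ≤ _ := add_le_add h3 h4
    _ = _ := by ring

end

section

lemma abs_exp_sub_taylor_le : |exp y - 1 - y - y ^ 2 / 2| ≤ |y| ^ 3 * exp |y| := by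
  have := Complex.norm_exp_sub_sum_le_norm_mul_exp (y : ℂ) 3
  rw [← Complex.ofReal_exp] at this
  have e : ((exp y : ℝ) : ℂ) - ∑ m ∈ range 3, (y : ℂ) ^ m / (m.factorial : ℂ)
      = ((exp y - 1 - y - y ^ 2 / 2 : ℝ) : ℂ) := by
    simp [sum_range_succ]
    ring
  rw [e, Complex.norm_real, Complex.norm_real, norm_eq_abs, norm_eq_abs] at this
  exact this

/-- Expansion of the Cameron–Martin density. -/
lemma abs_exp_sub_hermite_le {a b n : ℝ} (hb0 : 0 ≤ b) (hb : b ≤ 1) (hn : 0 ≤ n)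
    (ha : |a| ≤ n * b) :
    |exp (a - b ^ 2 / 2) - 1 - a - (a ^ 2 - b ^ 2) / 2|
      ≤ 2 * b ^ 3 * ((n + 1) ^ 3 * exp (n + 1)) := by
  set y := a - b ^ 2 / 2 with hy
  have hyb : |y| ≤ b * (n + 1) := by
    have : |y| ≤ |a| + |b ^ 2 / 2| := abs_sub _ _
    rw [abs_of_nonneg (by positivity : 0 ≤ b ^ 2 / 2)] at this
    nlinarith
  have hy1 : |y| ≤ n + 1 := hyb.trans (by nlinarith)
  have h1 : |y| ^ 3 * exp |y| ≤ b ^ 3 * ((n + 1) ^ 3 * exp (n + 1)) := by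
    calc _ ≤ (b * (n + 1)) ^ 3 * exp (n + 1) := by gcongr
      _ = _ := by ring
  have h2 : |-(a * b ^ 2 / 2) + b ^ 4 / 8| ≤ b ^ 3 * ((n + 1) ^ 3 * exp (n + 1)) := by
    have h3 : |-(a * b ^ 2 / 2) + b ^ 4 / 8| ≤ b ^ 3 * (n + 1) := by
      refine (abs_add_le _ _).trans ?_
      rw [abs_neg, abs_div, abs_mul, abs_of_nonneg (by positivity : 0 ≤ b ^ 2),
        abs_of_nonneg (by positivity : 0 ≤ b ^ 4 / 8), abs_of_pos (by norm_num : (0 : ℝ) < 2)]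
      have : |a| * b ^ 2 ≤ n * b * b ^ 2 := by gcongr
      have h4 : b ^ 4 ≤ b ^ 3 := pow_le_pow_of_le_one hb0 hb (by norm_num)
      have : 0 ≤ n * b ^ 3 := by positivity
      have : 0 ≤ b ^ 3 := by positivity
      nlinarith
    refine h3.trans (mul_le_mul_of_nonneg_left ?_ (by positivity))
    have h5 : 1 ≤ exp (n + 1) := one_le_exp (by linarith)
    have h6 : n + 1 ≤ (n + 1) ^ 3 := le_self_pow₀ (by linarith) (by norm_num)
    exact h6.trans (le_mul_of_one_le_right (by positivity) h5)
  have e : exp y - 1 - a - (a ^ 2 - b ^ 2) / 2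
      = (exp y - 1 - y - y ^ 2 / 2) + (-(a * b ^ 2 / 2) + b ^ 4 / 8) := by
    rw [hy]; ring
  rw [e]
  refine (abs_add_le _ _).trans ?_
  have := abs_exp_sub_taylor_le (y := y)
  linarith

variable {f : 𝔼 ι → ℝ}

lemma inner_eq_sum (z w : 𝔼 ι) : inner ℝ z w = ∑ u, z u * w u := by
  rw [inner_eq_star_dotProduct]
  simp [dotProduct, mul_comm]

/-- The linear and quadratic terms as one Gaussian integral. -/
lemma sum_gL_gB_eq (hf : LipschitzWith 1 f) (ht : 0 < t) (x w : 𝔼 ι) :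
    ∑ u, gL f t u x * (√t • w) u + (∑ u, ∑ v, gB f t u v x * ((√t • w) u * (√t • w) v)) / 2
      = ∫ z, (f (x + √t • z) - f x)
          * (inner ℝ z w + (inner ℝ z w ^ 2 - ‖w‖ ^ 2) / 2) ∂(stdG ι) := by
  have hs := sqrt_pos.2 ht
  have h1 : ∀ u, gL f t u x * (√t • w) u
      = ∫ z, (f (x + √t • z) - f x) * gCoord u z * w u ∂(stdG ι) := by
    intro u
    rw [integral_mul_const, gL, PiLp.smul_apply, smul_eq_mul, ← mul_assoc, div_mul_cancel₀ _ hs.ne',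
      smoothH]
  have h2 : ∀ u v, gB f t u v x * ((√t • w) u * (√t • w) v)
      = ∫ z, (f (x + √t • z) - f x) * gHerm u v z * (w u * w v) ∂(stdG ι) := by
    intro u v
    rw [integral_mul_const, gB, PiLp.smul_apply, PiLp.smul_apply, smul_eq_mul, smul_eq_mul,
      show √t * w u * (√t * w v) = √t * √t * (w u * w v) by ring, mul_self_sqrt ht.le,
      ← mul_assoc, div_mul_cancel₀ _ ht.ne', smoothH]
  have i1 : ∀ u, Integrable (fun z => (f (x + √t • z) - f x) * gCoord u z * w u) (stdG ι) :=
    fun u => (smooth_integrable hf (measurable_gCoord u) (abs_gCoord_le u) x).mul_const _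
  have i2 : ∀ u v, Integrable
      (fun z => (f (x + √t • z) - f x) * gHerm u v z * (w u * w v)) (stdG ι) :=
    fun u v => (smooth_integrable hf (measurable_gHerm u v) (abs_gHerm_le u v) x).mul_const _
  simp_rw [h1, h2]
  rw [← integral_finsetSum _ fun u _ => i1 u]
  simp_rw [← integral_finsetSum _ fun v _ => i2 _ v]
  rw [← integral_finsetSum _ fun u _ => integrable_finsetSum _ fun v _ => i2 u v,
    ← integral_div, ← integral_add (integrable_finsetSum _ fun u _ => i1 u)
      ((integrable_finsetSum _ fun u _ => integrable_finsetSum _ fun v _ => i2 u v).div_const _)]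
  congr 1
  funext z
  have e1 : inner ℝ z w = ∑ u, gCoord u z * w u := by simp [inner_eq_sum, gCoord]
  have e2 : inner ℝ z w ^ 2 - ‖w‖ ^ 2 = ∑ u, ∑ v, gHerm u v z * (w u * w v) := by
    simp only [gHerm, sub_mul, sum_sub_distrib]
    rw [inner_eq_sum, real_norm_sq_eq, sq, sum_mul_sum]
    congr 1
    · exact sum_congr rfl fun u _ => sum_congr rfl fun v _ => by ring
    · refine sum_congr rfl fun u _ => ?_
      rw [Finset.sum_eq_single u (by intro v _ hv; simp [hv.symm]) (by simp)]
      simp [sq]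
  rw [e1, mul_add, mul_sum]
  rw [← e1, mul_div_assoc', e2, mul_sum]
  simp only [mul_sum, mul_assoc]

/-- Second order expansion of the Gaussian smoothing of a Lipschitz function. -/
theorem gF_taylor (hf : LipschitzWith 1 f) (ht : 0 < t) (hp : 2 ≤ p) (hp3 : p ≤ 3)
    (x h : 𝔼 ι) :
    |gF f t (x + h) - gF f t x - (∑ u, gL f t u x * h u
        + (∑ u, ∑ v, gB f t u v x * (h u * h v)) / 2)|
      ≤ 3 * gConst ι * √t * (‖h‖ / √t) ^ p := by
  have hs := sqrt_pos.2 ht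
  have hc := one_le_gConst (ι := ι)
  obtain ⟨w, rfl⟩ : ∃ w : 𝔼 ι, h = √t • w :=
    ⟨(√t)⁻¹ • h, by rw [smul_smul, mul_inv_cancel₀ hs.ne', one_smul]⟩
  have hw : ‖√t • w‖ / √t = ‖w‖ := by
    rw [norm_smul, norm_of_nonneg hs.le, mul_div_cancel_left₀ _ hs.ne']
  rw [hw, sum_gL_gB_eq hf ht]
  have hfm := hf.continuous.measurable
  have hin :=
    fun z => abs_real_inner_le_norm z w
  have hfz : ∀ z : 𝔼 ι, |f (x + √t • z) - f x| ≤ √t * ‖z‖ := by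
    intro z
    have h1 := hf.abs_sub_le (x + √t • z) x
    rwa [add_sub_cancel_left, norm_smul, norm_of_nonneg hs.le] at h1
  have hL : ∀ z, |(f (x + √t • z) - f x) * (inner ℝ z w + (inner ℝ z w ^ 2 - ‖w‖ ^ 2) / 2)|
      ≤ √t * (‖w‖ + ‖w‖ ^ 2) * gWeight z := by
    intro z
    have h1 : |inner ℝ z w + (inner ℝ z w ^ 2 - ‖w‖ ^ 2) / 2|
        ≤ (‖w‖ + ‖w‖ ^ 2) * (‖z‖ + 1) ^ 2 := by
      have hi := hin z
      have hi2 := sq_le_sq' (by linarith [neg_abs_le (inner ℝ z w)])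
        ((le_abs_self _).trans hi)
      have hA : |(inner ℝ z w ^ 2 - ‖w‖ ^ 2) / 2| ≤ ‖w‖ ^ 2 * (‖z‖ ^ 2 + 1) / 2 := by
        rw [abs_le]
        constructor <;> nlinarith
      refine (abs_add_le _ _).trans ((add_le_add hi hA).trans ?_)
      have : 0 ≤ ‖w‖ * ‖z‖ := by positivity
      have : 0 ≤ ‖w‖ * ‖z‖ ^ 2 := by positivity
      have : 0 ≤ ‖w‖ ^ 2 * ‖z‖ := by positivity
      have : 0 ≤ ‖w‖ ^ 2 * ‖z‖ ^ 2 := by positivity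
      nlinarith [norm_nonneg w]
    rw [abs_mul]
    calc _ ≤ √t * ‖z‖ * ((‖w‖ + ‖w‖ ^ 2) * (‖z‖ + 1) ^ 2) := by gcongr; exact hfz z
      _ = √t * (‖w‖ + ‖w‖ ^ 2) * (‖z‖ * (‖z‖ + 1) ^ 2) := by ring
      _ ≤ √t * (‖w‖ + ‖w‖ ^ 2) * (‖z‖ + 1) ^ 3 := by
          gcongr
          nlinarith
      _ ≤ _ := by gcongr; exact pow_le_gWeight z (by norm_num)
  rcases le_total ‖w‖ 1 with hw1 | hw1
  · have i1 := smooth_integrable (t := t) hf measurable_const abs_one_le_weight x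
    have i2 : Integrable (fun z => cmDensity w z * (f (x + √t • z) - f x)) (stdG ι) := by
      have hm : Measurable (cmDensity w) := by unfold cmDensity; fun_prop
      refine integrable_of_le_gWeight (C := √t) (by fun_prop) fun z => ?_
      rw [abs_mul, mul_comm]
      have h2 : |cmDensity w z| ≤ exp (‖z‖ + 1) := by
        rw [cmDensity, abs_of_pos (exp_pos _)]
        refine exp_le_exp.2 ?_
        have := (le_abs_self _).trans (hin z)
        have := mul_le_mul_of_nonneg_left hw1 (norm_nonneg z)
        nlinarith
      calc _ ≤ √t * ‖z‖ * exp (‖z‖ + 1) := by gcongr; exact hfz z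
        _ ≤ √t * (‖z‖ + 1) ^ 4 * exp (‖z‖ + 1) := by
          gcongr
          exact (le_add_of_nonneg_right zero_le_one).trans
            (le_self_pow₀ (by linarith [norm_nonneg z]) (by norm_num))
        _ = _ := by unfold gWeight; ring
    have hC : ∀ z, (f (x + √t • z) - f x) * (cmDensity w z - 1) =
        cmDensity w z * (f (x + √t • z) - f x) - (f (x + √t • z) - f x) * 1 := fun z => by ring
    have hcm : gF f t (x + √t • w) - gF f t x
        = ∫ z, (f (x + √t • z) - f x) * (cmDensity w z - 1) ∂(stdG ι) := by
      have ha : ∀ z, x + √t • w + √t • z = x + √t • (z + w) := fun z => by rw [smul_add]; abel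
      have hi := gF_integrand_int (t := t) hf (x + √t • w)
      have e1 : gF f t (x + √t • w) =
          f x + ∫ z, cmDensity w z * (f (x + √t • z) - f x) ∂(stdG ι) := by
        rw [← integral_stdG_add w (by fun_prop), gF_eq hf]
        simp only [ha] at hi ⊢
        rw [integral_sub hi (integrable_const _)]
        simp
      simp_rw [e1, gF, smoothH, add_sub_add_left_eq_sub, hC, integral_sub i2 i1]
    have iC : Integrable (fun z => (f (x + √t • z) - f x) * (cmDensity w z - 1)) (stdG ι) :=
      (i2.sub i1).congr (ae_of_all _ fun z => (hC z).symm)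
    have iL := integrable_of_le_gWeight (by fun_prop) hL
    rw [hcm, ← integral_sub iC iL]
    have hpw : ‖w‖ ^ 3 ≤ ‖w‖ ^ p := by
      rcases (norm_nonneg w).eq_or_lt with h0 | h0
      · rw [← h0, zero_rpow (by linarith)]; norm_num
      · rw [← rpow_natCast]
        exact Real.rpow_le_rpow_of_exponent_ge h0 hw1 (by exact_mod_cast hp3)
    refine (abs_integral_le_gConst (C := 2 * √t * ‖w‖ ^ 3) fun z => ?_).trans ?_
    · rw [← mul_sub, abs_mul]
      have := abs_exp_sub_hermite_le (norm_nonneg w) hw1 (norm_nonneg z) (hin z)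
      calc _ ≤ √t * ‖z‖ * (2 * ‖w‖ ^ 3 * ((‖z‖ + 1) ^ 3 * exp (‖z‖ + 1))) := by
            gcongr
            · exact hfz z
            · refine le_trans (le_of_eq ?_) this
              unfold cmDensity
              congr 1; ring
        _ = 2 * √t * ‖w‖ ^ 3 * (‖z‖ * ((‖z‖ + 1) ^ 3 * exp (‖z‖ + 1))) := by ring
        _ ≤ 2 * √t * ‖w‖ ^ 3 * ((‖z‖ + 1) * ((‖z‖ + 1) ^ 3 * exp (‖z‖ + 1))) := by
            gcongr; linarith
        _ = _ := by unfold gWeight; ring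
    · have : 0 ≤ gConst ι * √t * ‖w‖ ^ p := by positivity
      calc _ = 2 * (gConst ι * √t * ‖w‖ ^ 3) := by ring
        _ ≤ 2 * (gConst ι * √t * ‖w‖ ^ p) := by gcongr
        _ ≤ _ := by linarith
  · have hpw : ‖w‖ ^ 2 ≤ ‖w‖ ^ p := by
      rw [← rpow_natCast]
      exact rpow_le_rpow_of_exponent_le hw1 (by exact_mod_cast hp)
    have hlip := (gF_lipschitz (t := t) hf).abs_sub_le (x + √t • w) x
    rw [add_sub_cancel_left, norm_smul, norm_of_nonneg hs.le] at hlip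
    have h2 : |(∫ z, (f (x + √t • z) - f x)
        * (inner ℝ z w + (inner ℝ z w ^ 2 - ‖w‖ ^ 2) / 2) ∂(stdG ι))|
        ≤ 2 * √t * ‖w‖ ^ 2 * gConst ι := by
      refine abs_integral_le_gConst fun z => ?_
      refine (hL z).trans ?_
      have : 0 ≤ gWeight z := by unfold gWeight; positivity
      calc _ ≤ √t * (‖w‖ ^ 2 + ‖w‖ ^ 2) * gWeight z := by
            gcongr
            exact le_self_pow₀ hw1 (by norm_num)
        _ = _ := by ring
    have h3 : √t * ‖w‖ ≤ gConst ι * √t * ‖w‖ ^ 2 := by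
      have : ‖w‖ ≤ ‖w‖ ^ 2 := le_self_pow₀ hw1 (by norm_num)
      calc √t * ‖w‖ ≤ √t * ‖w‖ ^ 2 := by gcongr
        _ ≤ _ := by
          rw [mul_assoc]
          exact le_mul_of_one_le_left (by positivity) hc
    calc _ ≤ _ := abs_sub _ _
      _ ≤ √t * ‖w‖ + 2 * √t * ‖w‖ ^ 2 * gConst ι := add_le_add hlip h2
      _ ≤ 3 * (gConst ι * √t * ‖w‖ ^ 2) := by linarith
      _ ≤ 3 * (gConst ι * √t * ‖w‖ ^ p) := by gcongr
      _ = _ := by ring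

lemma stdG_conv_smul (ht : 0 ≤ t) :
    (stdG ι) ∗ ((stdG ι).map (fun z => √t • z)) = (stdG ι).map (fun z => √(t + 1) • z) := by
  refine Measure.ext_of_charFun ?_
  ext y
  have e : ∀ r : ℝ, charFun ((stdG ι).map (fun z => r • z)) y = charFun (stdG ι) (r • y) :=
    fun r => charFun_map_smul r y
  rw [charFun_conv, e, e, charFun_stdGaussian, charFun_stdGaussian, charFun_stdGaussian,
    ← Complex.exp_add, norm_smul, norm_smul, norm_of_nonneg (sqrt_nonneg _),
    norm_of_nonneg (sqrt_nonneg _)]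
  congr 1
  rw [← Complex.ofReal_pow, ← Complex.ofReal_pow, ← Complex.ofReal_pow, mul_pow, mul_pow,
    sq_sqrt ht, sq_sqrt (by linarith)]
  push_cast
  ring

/-- Semigroup property of the smoothing. -/
lemma gF_add_one (hf : LipschitzWith 1 f) (ht : 0 ≤ t) (x : 𝔼 ι) :
    gF f (t + 1) x = ∫ z, gF f t (x + z) ∂(stdG ι) := by
  have hfc := hf.continuous
  have h1 : gF f (t + 1) x
      = ∫ y, f (x + y) ∂((stdG ι) ∗ ((stdG ι).map (fun z => √t • z))) := by
    rw [stdG_conv_smul ht, integral_map (by fun_prop) (by fun_prop), gF_eq hf]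
  have hi : Integrable (fun y => f (x + y)) ((stdG ι) ∗ ((stdG ι).map (fun z => √t • z))) := by
    rw [stdG_conv_smul ht, integrable_map_measure (by fun_prop) (by fun_prop)]
    exact gF_integrand_int hf x
  rw [h1, Measure.conv, integral_map (by fun_prop) (by fun_prop), integral_prod]
  · congr 1
    funext z
    rw [gF_eq hf, integral_map (by fun_prop) (by fun_prop)]
    simp only [add_assoc]
  · rw [Measure.conv, integrable_map_measure (by fun_prop) (by fun_prop)] at hi
    exact hi

end

section

variable {f : 𝔼 ι → ℝ}

lemma integrable_gHerm (u v : ι) : Integrable (gHerm u v) (stdG ι) :=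
  integrable_of_le_gWeight (measurable_gHerm u v) fun z => by
    rw [one_mul]; exact (abs_gHerm_le u v z).trans (pow_le_gWeight z (by norm_num))

lemma integrable_gCoord (u : ι) : Integrable (gCoord u) (stdG ι) :=
  integrable_of_le_gWeight (measurable_gCoord u) fun z => by
    rw [one_mul]; exact (abs_gCoord_le u z).trans (pow_le_gWeight z (by norm_num))

lemma integral_gCoord (u : ι) : ∫ z, gCoord u z ∂(stdG ι) = 0 := by
  have := integral_strongDual_stdGaussian (proj u)
  simpa [gCoord] using this

lemma integral_gHerm (u v : ι) : ∫ z, gHerm u v z ∂(stdG ι) = 0 := by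
  classical
  have h := covarianceBilin_apply (μ := stdG ι) IsGaussian.memLp_two_id
    (single u 1) (single v 1)
  rw [covarianceBilin_stdGaussian] at h
  simp only [integral_id_stdGaussian, id, sub_zero, innerSL_apply_apply ℝ,
    EuclideanSpace.inner_single_left, map_one, one_mul] at h
  have hi : Integrable (fun z : 𝔼 ι => z u * z v) (stdG ι) := by
    refine ((integrable_gHerm u v).add (integrable_const (if u = v then 1 else 0))).congr
      (ae_of_all _ fun z => ?_)
    simp [gHerm]
  have e : ∀ z, gHerm u v z = z u * z v - if u = v then 1 else 0 := fun z => by simp [gHerm]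
  simp only [e]
  rw [integral_sub hi (integrable_const _), ← h]
  simp

/-- One step of the Lindeberg replacement. -/
lemma gF_step_le (hf : LipschitzWith 1 f) (ht : 0 < t) (hp : 2 ≤ p) (hp3 : p ≤ 3)
    (x h : 𝔼 ι) :
    gF f t (x + h) - gF f (t + 1) x ≤ ∑ u, gL f t u x * h u
      + (∑ u, ∑ v, gB f t u v x * gHerm u v h) / 2
      + 3 * gConst ι * t ^ (-((p - 1) / 2)) * (‖h‖ ^ p + gConst ι) := by
  have hs := sqrt_pos.2 ht
  have hc := one_le_gConst (ι := ι)
  have hpow : ∀ y : 𝔼 ι, 3 * gConst ι * √t * (‖y‖ / √t) ^ p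
      = 3 * gConst ι * t ^ (-((p - 1) / 2)) * ‖y‖ ^ p := by
    intro y
    rw [div_rpow (norm_nonneg _) hs.le, sqrt_eq_rpow, ← rpow_mul ht.le,
      show -((p - 1) / 2) = 1 / 2 - 1 / 2 * p by ring, rpow_sub ht]
    ring
  set Q : 𝔼 ι → ℝ := fun y => ∑ u, gL f t u x * y u
    + (∑ u, ∑ v, gB f t u v x * gHerm u v y) / 2 with hQ
  classical
  set δ : ℝ := (∑ u, ∑ v, gB f t u v x * if u = v then 1 else 0) / 2 with hδ
  have hT : ∀ y, |gF f t (x + y) - gF f t x - (Q y + δ)|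
      ≤ 3 * gConst ι * t ^ (-((p - 1) / 2)) * ‖y‖ ^ p := by
    intro y
    rw [← hpow]
    refine le_trans (le_of_eq ?_) (gF_taylor hf ht hp hp3 x y)
    congr 2
    rw [hQ, hδ, add_assoc, ← add_div, ← sum_add_distrib]
    simp only [← sum_add_distrib, ← mul_add]
    congr 4
    funext u
    refine sum_congr rfl fun v _ => ?_
    simp [gHerm]
  have i1 : ∀ u, Integrable (fun y : 𝔼 ι => gL f t u x * y u) (stdG ι) :=
    fun u => (integrable_gCoord u).const_mul _
  have i2 : ∀ u v, Integrable (fun y => gB f t u v x * gHerm u v y) (stdG ι) :=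
    fun u v => (integrable_gHerm u v).const_mul _
  have i3 : ∀ u, Integrable (fun y => ∑ v, gB f t u v x * gHerm u v y) (stdG ι) :=
    fun u => integrable_finsetSum _ fun v _ => i2 u v
  have i4 : Integrable (fun y : 𝔼 ι => ∑ u, gL f t u x * y u) (stdG ι) :=
    integrable_finsetSum _ fun u _ => i1 u
  have i5 : Integrable (fun y => (∑ u, ∑ v, gB f t u v x * gHerm u v y) / 2) (stdG ι) :=
    (integrable_finsetSum _ fun u _ => i3 u).div_const _
  have hQi : Integrable Q (stdG ι) := i4.add i5
  have hQ0 : ∫ y, Q y ∂(stdG ι) = 0 := by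
    have hz : ∀ u, ∫ z : 𝔼 ι, z u ∂(stdG ι) = 0 := integral_gCoord
    simp only [hQ]
    rw [integral_add i4 i5, integral_div, integral_finsetSum _ fun u _ => i1 u,
      integral_finsetSum _ fun u _ => i3 u]
    simp [integral_finsetSum _ fun v _ => i2 _ v, integral_const_mul, integral_gHerm, hz]
  have hFc : Continuous (gF f t) := (gF_lipschitz hf).continuous
  have hFi : Integrable (fun z => gF f t (x + z) - gF f t x) (stdG ι) := by
    refine integrable_of_le_gWeight (C := 1) (by fun_prop) fun z => ?_
    have := (gF_lipschitz (t := t) hf).abs_sub_le (x + z) x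
    rw [add_sub_cancel_left] at this
    rw [one_mul]
    exact this.trans ((by linarith : ‖z‖ ≤ (‖z‖ + 1) ^ 1).trans (pow_le_gWeight z (by norm_num)))
  have hFi' : Integrable (fun z => gF f t (x + z)) (stdG ι) := by
    refine (hFi.add (integrable_const (gF f t x))).congr (ae_of_all _ fun z => ?_)
    simp
  have hG : |(∫ z, (gF f t (x + z) - gF f t x - (Q z + δ)) ∂(stdG ι))|
      ≤ 3 * gConst ι * t ^ (-((p - 1) / 2)) * gConst ι := by
    refine abs_integral_le_gConst fun z => (hT z).trans ?_
    gcongr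
    calc ‖z‖ ^ p ≤ (‖z‖ + 1) ^ p :=
          rpow_le_rpow (norm_nonneg _) (by linarith) (by linarith)
      _ ≤ (‖z‖ + 1) ^ 3 :=
          rpow_le_rpow_of_exponent_le (by linarith [norm_nonneg z]) hp3
      _ = (‖z‖ + 1) ^ 3 := by exact_mod_cast rpow_natCast _ 3
      _ ≤ _ := pow_le_gWeight z (by norm_num)
  have hG' : ∫ z, (gF f t (x + z) - gF f t x - (Q z + δ)) ∂(stdG ι)
      = gF f (t + 1) x - gF f t x - δ := by
    have hQδ : Integrable (fun z => Q z + δ) (stdG ι) := hQi.add (integrable_const _)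
    rw [integral_sub hFi hQδ, integral_sub hFi' (integrable_const _),
      integral_add hQi (integrable_const _), hQ0, gF_add_one hf ht.le]
    simp
  rw [hG'] at hG
  have h1 := (abs_le.1 (hT h)).2
  have h2 := (abs_le.1 hG).1
  have : gF f t (x + h) - gF f (t + 1) x ≤ Q h
      + 3 * gConst ι * t ^ (-((p - 1) / 2)) * ‖h‖ ^ p
      + 3 * gConst ι * t ^ (-((p - 1) / 2)) * gConst ι := by linarith
  rw [mul_add, ← add_assoc]
  exact this

lemma sum_range_two_mul {M : Type*} [AddCommMonoid M] (g : ℕ → M) (N : ℕ) :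
    ∑ l ∈ range (2 * N), g l = ∑ l ∈ range N, (g (2 * l) + g (2 * l + 1)) := by
  induction N with
  | zero => simp
  | succ N ih =>
    rw [show 2 * (N + 1) = 2 * N + 1 + 1 by ring, sum_range_succ, sum_range_succ, ih,
      sum_range_succ, add_assoc]

/-- Dyadic summation by parts. -/
lemma sum_mul_dyadic (β X : ℕ → ℝ) (n : ℕ) :
    ∑ j ∈ range (2 ^ n), β j * X j = β 0 * ∑ j ∈ range (2 ^ n), X j
      + ∑ i ∈ range n, ∑ l ∈ range (2 ^ (n - 1 - i)),
        (β ((2 * l + 1) * 2 ^ i) - β (2 * l * 2 ^ i))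
          * ∑ j ∈ range (2 ^ i), X ((2 * l + 1) * 2 ^ i + j) := by
  set Q : ℕ → ℝ := fun i => ∑ l ∈ range (2 ^ (n - i)),
    β (l * 2 ^ i) * ∑ j ∈ range (2 ^ i), X (l * 2 ^ i + j) with hQ
  have h0 : Q 0 = ∑ j ∈ range (2 ^ n), β j * X j := by simp [hQ]
  have hn : Q n = β 0 * ∑ j ∈ range (2 ^ n), X j := by simp [hQ]
  have hd : ∀ i ∈ range n, Q i - Q (i + 1) = ∑ l ∈ range (2 ^ (n - 1 - i)),
        (β ((2 * l + 1) * 2 ^ i) - β (2 * l * 2 ^ i))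
          * ∑ j ∈ range (2 ^ i), X ((2 * l + 1) * 2 ^ i + j) := by
    intro i hi
    rw [mem_range] at hi
    have e1 : 2 ^ (n - i) = 2 * 2 ^ (n - 1 - i) := by
      rw [← pow_succ']; congr 1; omega
    simp only [hQ, e1, show n - (i + 1) = n - 1 - i by omega]
    rw [sum_range_two_mul, ← sum_sub_distrib]
    refine sum_congr rfl fun l _ => ?_
    rw [show l * 2 ^ (i + 1) = 2 * l * 2 ^ i by ring, show 2 ^ (i + 1) = 2 ^ i + 2 ^ i by ring,
      sum_range_add,
      sum_congr rfl fun j (_ : j ∈ range (2 ^ i)) =>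
        show X (2 * l * 2 ^ i + (2 ^ i + j)) = X ((2 * l + 1) * 2 ^ i + j) by congr 1; ring]
    ring
  rw [← sum_congr rfl hd, Finset.sum_range_sub', h0, hn]
  ring

/-- The error rate of the Lindeberg scheme. -/
def omegaRate (p : ℝ) (ℓ : ℕ) : ℝ := ∑ j ∈ range ℓ, ((j : ℝ) + 1) ^ (-((p - 1) / 2))

lemma rpow_neg_mul_le_sum {α : ℝ} (hα : 0 ≤ α) {m : ℕ} :
    (m : ℝ) * ((m : ℝ) * ((k : ℝ) + 1)) ^ (-α)
      ≤ ∑ j ∈ range m, (((m * k + j : ℕ) : ℝ) + 1) ^ (-α) := by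
  have : ∀ j ∈ range m, (m * (k + 1)) ^ (-α)
      ≤ (((m * k + j : ℕ) : ℝ) + 1) ^ (-α) := by
    intro j hj
    rw [mem_range] at hj
    refine rpow_le_rpow_of_nonpos (by positivity) ?_ (by linarith)
    have : (j : ℝ) + 1 ≤ m := by exact_mod_cast hj
    push_cast
    linarith
  have h := sum_le_sum this
  simpa using h

/-- Riemann-sum comparison of the rate along a coarser grid. -/
lemma sum_grid_le_omegaRate (hp : 1 ≤ p) (m N : ℕ) (hm : 0 < m) :
    ∑ k ∈ range N, ((m : ℝ) * ((k : ℝ) + 1)) ^ (-((p - 1) / 2))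
      ≤ omegaRate p (m * N) / m := by
  rw [le_div_iff₀ (by exact_mod_cast hm), sum_mul]
  induction N with
  | zero => simp [omegaRate]
  | succ N ih =>
    rw [sum_range_succ, omegaRate, mul_add m N 1, mul_one, sum_range_add]
    refine add_le_add ih ?_
    rw [mul_comm]
    exact rpow_neg_mul_le_sum (by linarith)

end

/-- Normalised martingale differences satisfying dyadic forms of the projective conditions. -/
structure CoreHyp (μ : Measure Ω) (G : ℕ → MeasurableSpace Ω) (e : ℕ → Ω → 𝔼 ι) (p K B : ℝ)
    (a b : ℕ → ℝ) :
    Prop where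
  mono : Monotone G
  le : ∀ k, G k ≤ mΩ
  mds : ∀ u, IsMDS μ G (fun k ω => e k ω u)
  mom : ∀ k, Integrable (fun ω => ‖e k ω‖ ^ p) μ
  mom_le : ∀ k, ∫ ω, ‖e k ω‖ ^ p ∂μ ≤ K
  a_nonneg : ∀ i, 0 ≤ a i
  b_nonneg : ∀ i, 0 ≤ b i
  a_le : ∀ c i u v, ∀ Y : Ω → ℝ, StronglyMeasurable[G c] Y → (∀ ω, 0 ≤ Y ω) → SubG μ Y →
    ∫⁻ ω, ofReal (Y ω ^ (p - 2)
      * |condBlock μ G (fun j ω => gHerm u v (e j ω)) c i ω|) ∂μ ≤ ofReal (a i)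
  b_le : ∀ c i u v, eLpNorm (condBlock μ G (fun j ω => gHerm u v (e j ω)) c i)
    (ofReal (p / 2)) μ ≤ ofReal (b i)
  a_sum : ∀ n, ∑ i ∈ range n, a i / ((2 : ℝ) ^ (2 - p / 2)) ^ i ≤ B
  b_sum : ∀ n, ∑ i ∈ range n, b i / ((2 : ℝ) ^ (1 / (p / 2))) ^ i ≤ B

lemma integrable_of_lintegral_le (hg : AEStronglyMeasurable g μ) (h0 : ∀ ω, 0 ≤ g ω) (hC : 0 ≤ C)
    (h : ∫⁻ ω, ofReal (g ω) ∂μ ≤ ofReal C) :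
    Integrable g μ ∧ ∫ ω, g ω ∂μ ≤ C := by
  constructor
  · refine ⟨hg, ?_⟩
    rw [hasFiniteIntegral_iff_ofReal (ae_of_all _ h0)]
    exact h.trans_lt ofReal_lt_top
  · rw [integral_eq_lintegral_of_nonneg_ae (ae_of_all _ h0) hg]
    exact toReal_le_of_le_ofReal hC h

lemma measurable_of_coord {m : MeasurableSpace Ω} {g : Ω → 𝔼 ι}
    (h : ∀ u, Measurable fun ω => g ω u) : Measurable g :=
  (MeasurableEquiv.toLp 2 (ι → ℝ)).measurable.comp (measurable_pi_iff.2 h)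

namespace CoreHyp

lemma K_nonneg (H : CoreHyp μ G e p K B a b) : 0 ≤ K :=
  (integral_nonneg fun ω => by positivity).trans (H.mom_le 0)

lemma B_nonneg (H : CoreHyp μ G e p K B a b) : 0 ≤ B := by simpa using H.a_sum 0

lemma meas (H : CoreHyp μ G e p K B a b) (k : ℕ) : StronglyMeasurable[G (k + 1)] (e k) :=
  (measurable_of_coord fun u => ((H.mds u).meas k).measurable).stronglyMeasurable

lemma meas' (H : CoreHyp μ G e p K B a b) (k : ℕ) : StronglyMeasurable (e k) :=
  (H.meas k).mono (H.le _)

lemma coord_mom (H : CoreHyp μ G e p K B a b) (hp : 2 < p) (u : ι) (k : ℕ) :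
    Integrable (fun ω => |e k ω u| ^ p) μ ∧ ∫ ω, |e k ω u| ^ p ∂μ ≤ K := by
  have hle : ∀ ω, |e k ω u| ^ p ≤ ‖e k ω‖ ^ p := fun ω =>
    rpow_le_rpow (abs_nonneg _) (abs_coord_le_norm _ u) (by linarith)
  have hi : Integrable (fun ω => |e k ω u| ^ p) μ := by
    refine (H.mom k).mono' ?_ (ae_of_all _ fun ω => ?_)
    · exact (((H.mds u).meas' k).measurable.abs.pow_const p).aestronglyMeasurable
    · rw [norm_of_nonneg (by positivity)]
      exact hle ω
  exact ⟨hi, (integral_mono hi (H.mom k) hle).trans (H.mom_le k)⟩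

lemma b_le_sq (H : CoreHyp μ G e p K B a b) (u : ι) (c i : ℕ) :
    eLpNorm (condBlock μ G (fun j ω => e j ω u ^ 2 - 1) c i) (ofReal (p / 2)) μ
      ≤ ofReal (b i) := by
  have h : (fun (j : ℕ) ω => e j ω u ^ 2 - 1) = fun j ω => gHerm u u (e j ω) := by
    funext j ω; simp [gHerm, sq]
  rw [h]
  exact H.b_le c i u u

end CoreHyp

/-- Sum of the vectors `e (s + j)`, `j < k`. -/
def vsum (e : ℕ → Ω → 𝔼 ι) (s k : ℕ) (ω : Ω) : 𝔼 ι :=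
  ∑ j ∈ range k, e (s + j) ω

lemma vsum_apply (s k : ℕ) (ω : Ω) (u : ι) :
    vsum e s k ω u = ∑ j ∈ range k, e (s + j) ω u := by
  simp [vsum, WithLp.ofLp_sum]

lemma vsum_add (s k m : ℕ) (ω : Ω) : vsum e s (k + m) ω = vsum e s k ω + vsum e (s + k) m ω := by
  simp [vsum, sum_range_add, add_assoc]

lemma norm_le_sum_abs (x : 𝔼 ι) : ‖x‖ ≤ ∑ u, |x u| := by
  classical
  have h := basisFun ι ℝ |>.sum_repr x
  calc ‖x‖ = ‖∑ u, x u • basisFun ι ℝ u‖ := by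
        congr 1; exact h.symm
    _ ≤ ∑ u, ‖x u • basisFun ι ℝ u‖ := norm_sum_le _ _
    _ = _ := by simp [norm_smul]

lemma sum_rpow_le (s : Finset κ) {g : κ → ℝ} (hg : ∀ i, 0 ≤ g i) (hr0 : 0 ≤ r) (hr : r ≤ 1)
    (hs : 0 < r ∨ s.Nonempty) : (∑ i ∈ s, g i) ^ r ≤ ∑ i ∈ s, g i ^ r := by
  classical
  induction s using induction_on with
  | empty => 
    rcases hs with h | h
    · simp [zero_rpow h.ne']
    · simp at h
  | insert i s hi ih =>
    rcases s.eq_empty_or_nonempty with rfl | hne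
    · simp
    rw [sum_insert hi, sum_insert hi]
    exact (Real.rpow_add_le_add_rpow (hg i) (sum_nonneg fun i _ => hg i) hr0 hr).trans
      (add_le_add le_rfl (ih (Or.inr hne)))

namespace CoreHyp

lemma vsum_meas (H : CoreHyp μ G e p K B a b) {s : ℕ} (h : s + k ≤ n) :
    StronglyMeasurable[G n] (vsum e s k) := by
  have : ∀ j ∈ range k, StronglyMeasurable[G n] (e (s + j)) := fun j hj =>
    (H.meas _).mono (H.mono (by have := mem_range.1 hj; omega))
  exact stronglyMeasurable_fun_sum _ this

end CoreHyp

lemma norm_rpow_le_sum (x : 𝔼 ι) (hr0 : 0 < r) (hr : r ≤ 1) :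
    ‖x‖ ^ r ≤ ∑ u, |x u| ^ r :=
  (rpow_le_rpow (norm_nonneg _) (norm_le_sum_abs x) hr0.le).trans
    (sum_rpow_le _ (fun u => abs_nonneg _) hr0.le hr (Or.inl hr0))

/-- Joint space-time regularity of the Hessian. -/
lemma abs_gB_sub_space_time_le {f : 𝔼 ι → ℝ} {m : ℝ} (hf : LipschitzWith 1 f) (hp : 2 < p)
    (hp3 : p ≤ 3) (hm : 0 < m) (hmt : m ≤ t) (u v : ι) (x y : 𝔼 ι) :
    |gB f t u v (x + y) - gB f (t + m) u v x|
      ≤ 2 * gConst ι * t ^ (-((p - 1) / 2)) * (‖y‖ ^ (p - 2) + m ^ ((p - 2) / 2)) := by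
  have ht := hm.trans_le hmt
  have hs := sqrt_pos.2 ht
  have h1 := abs_gB_sub_le hf ht u v (r := p - 2) (by linarith) (by linarith) (x + y) x
  have h2 := abs_gB_sub_time_le hf ht hm.le hmt u v (r := (p - 2) / 2) (by linarith) x
  rw [add_sub_cancel_left] at h1
  have e1 : 2 * gConst ι / √t * (‖y‖ / √t) ^ (p - 2)
      = 2 * gConst ι * t ^ (-((p - 1) / 2)) * ‖y‖ ^ (p - 2) := by
    rw [div_rpow (norm_nonneg _) hs.le, sqrt_eq_rpow, ← rpow_mul ht.le,
      show -((p - 1) / 2) = -(1 / 2) + -(1 / 2 * (p - 2)) by ring, rpow_add ht,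
      rpow_neg ht.le, rpow_neg ht.le]
    ring
  have e2 : 2 * gConst ι / √t * (m / t) ^ ((p - 2) / 2)
      = 2 * gConst ι * t ^ (-((p - 1) / 2)) * m ^ ((p - 2) / 2) := by
    rw [div_rpow hm.le ht.le, sqrt_eq_rpow,
      show -((p - 1) / 2) = -(1 / 2) + -((p - 2) / 2) by ring, rpow_add ht,
      rpow_neg ht.le, rpow_neg ht.le]
    ring
  rw [e1] at h1
  rw [e2] at h2
  calc _ ≤ |gB f t u v (x + y) - gB f t u v x| + |gB f t u v x - gB f (t + m) u v x| :=
        abs_sub_le _ _ _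
    _ ≤ _ := by rw [mul_add]; rw [abs_sub_comm] at h2; exact add_le_add h1 h2

/-- Bound on the covariance-error contribution of a block of length `2 ^ i`. -/
def zetaB (ι : Type*) [Fintype ι] (p K B : ℝ) (a b : ℕ → ℝ) (i : ℕ) : ℝ :=
  Fintype.card ι * (8 * ((2 : ℝ) ^ i) ^ ((p - 2) / 2) * a i
    + (remC p K B * 2 ^ i) ^ ((p - 2) / p) * b i) + ((2 : ℝ) ^ i) ^ ((p - 2) / 2) * a i

namespace CoreHyp

lemma integral_abs_condBlock_le [IsProbabilityMeasure μ] (H : CoreHyp μ G e p K B a b)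
    (u v : ι) (c i : ℕ) :
    ∫ ω, |condBlock μ G (fun j ω => gHerm u v (e j ω)) c i ω| ∂μ ≤ a i := by
  refine (integrable_of_lintegral_le
    (condBlock_int c i).abs.aestronglyMeasurable (fun ω => abs_nonneg _)
    (H.a_nonneg i) ?_).2
  have h := H.a_le c i u v (fun _ => 1) stronglyMeasurable_const (fun _ => zero_le_one) (by
    rw [SubG, lintegral_const, measure_univ, mul_one, ← ofReal_ofNat]
    refine ofReal_le_ofReal ?_
    have := Real.exp_one_lt_d9
    norm_num
    linarith)
  simpa using h

lemma block_rpow_mul (H : CoreHyp μ G e p K B a b) [IsProbabilityMeasure μ] (hp : 2 < p)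
    (hp3 : p ≤ 3) (u v w : ι) (c i : ℕ) :
    Integrable (fun ω => |vsum e c (2 ^ i) ω w| ^ (p - 2)
      * |condBlock μ G (fun j ω => gHerm u v (e j ω)) (c + 2 ^ i) i ω|) μ ∧
    ∫ ω, |vsum e c (2 ^ i) ω w| ^ (p - 2)
      * |condBlock μ G (fun j ω => gHerm u v (e j ω)) (c + 2 ^ i) i ω| ∂μ
      ≤ 8 * ((2 : ℝ) ^ i) ^ ((p - 2) / 2) * a i
        + (remC p K B * 2 ^ i) ^ ((p - 2) / p) * b i := by
  have hZm : Measurable (condBlock μ G (fun j ω => gHerm u v (e j ω)) (c + 2 ^ i) i) :=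
    ((condBlock_meas _ _).mono (H.le _)).measurable
  have hr := remC_nonneg hp H.K_nonneg H.B_nonneg
  have ha := H.a_nonneg i
  have hb := H.b_nonneg i
  refine integrable_of_lintegral_le ?_ (fun ω => by positivity) (by positivity) ?_
  · have hv : Measurable fun ω => vsum e c (2 ^ i) ω w := by
      have := ((H.vsum_meas (n := c + 2 ^ i) le_rfl).mono (H.le _)).measurable
      fun_prop
    exact ((hv.abs.pow_const _).mul hZm.abs).aestronglyMeasurable
  · have := (H.mds w).lintegral_block_rpow_mul_le hp hp3 (fun k => (H.coord_mom hp w k).1)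
      (fun k => (H.coord_mom hp w k).2) H.b_nonneg (H.b_le_sq w) H.b_sum c i hZm ha hb
      (H.a_le _ i u v) (H.b_le _ i u v)
    simpa only [vsum_apply] using this

lemma space_time_mul (H : CoreHyp μ G e p K B a b) [IsProbabilityMeasure μ] (hp : 2 < p)
    (hp3 : p ≤ 3) (u v : ι) (c i : ℕ) :
    Integrable (fun ω => (‖vsum e c (2 ^ i) ω‖ ^ (p - 2) + ((2 : ℝ) ^ i) ^ ((p - 2) / 2))
      * |condBlock μ G (fun j ω => gHerm u v (e j ω)) (c + 2 ^ i) i ω|) μ ∧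
    ∫ ω, (‖vsum e c (2 ^ i) ω‖ ^ (p - 2) + ((2 : ℝ) ^ i) ^ ((p - 2) / 2))
      * |condBlock μ G (fun j ω => gHerm u v (e j ω)) (c + 2 ^ i) i ω| ∂μ
      ≤ zetaB ι p K B a b i := by
  set Z := condBlock μ G (fun j ω => gHerm u v (e j ω)) (c + 2 ^ i) i with hZ
  have hZi : Integrable (fun ω => |Z ω|) μ := (condBlock_int _ _).abs
  have hZm : Measurable Z := ((condBlock_meas _ _).mono (H.le _)).measurable
  have h := fun w => H.block_rpow_mul hp hp3 u v w c i
  simp at h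
  have h1 : Integrable (fun ω => ∑ w, |vsum e c (2 ^ i) ω w| ^ (p - 2) * |Z ω|) μ :=
    integrable_finsetSum _ fun w _ => (h w).1
  have h2 : Integrable (fun ω => (2 ^ i) ^ ((p - 2) / 2) * |Z ω|) μ := hZi.const_mul _
  have h3 : Integrable (fun ω => (∑ w, |vsum e c (2 ^ i) ω w| ^ (p - 2) * |Z ω|)
      + (2 ^ i) ^ ((p - 2) / 2) * |Z ω|) μ := h1.add h2
  have hle : ∀ ω, (‖vsum e c (2 ^ i) ω‖ ^ (p - 2) + (2 ^ i) ^ ((p - 2) / 2)) * |Z ω|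
      ≤ (∑ w, |vsum e c (2 ^ i) ω w| ^ (p - 2) * |Z ω|)
        + (2 ^ i) ^ ((p - 2) / 2) * |Z ω| := by
    intro ω
    rw [← sum_mul, add_mul]
    gcongr
    exact norm_rpow_le_sum _ (by linarith) (by linarith)
  have hv :=
    ((H.vsum_meas (n := c + 2 ^ i) le_rfl).mono (H.le _)).measurable
  have hi : Integrable (fun ω => (‖vsum e c (2 ^ i) ω‖ ^ (p - 2) + (2 ^ i) ^ ((p - 2) / 2))
      * |Z ω|) μ := by
    refine h3.mono' (((hv.norm.pow_const _).add_const _).mul hZm.abs).aestronglyMeasurable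
      (ae_of_all _ fun ω => ?_)
    rw [norm_of_nonneg (by positivity)]
    exact hle ω
  refine ⟨hi, (integral_mono hi h3 hle).trans ?_⟩
  rw [integral_add h1 h2, integral_finsetSum _ fun w _ => (h w).1, integral_const_mul, zetaB]
  refine add_le_add ?_ ?_
  · refine (sum_le_sum fun w _ => (h w).2).trans (le_of_eq ?_)
    simp [mul_add]
  · exact mul_le_mul_of_nonneg_left (H.integral_abs_condBlock_le u v _ i) (by positivity)

lemma gHerm_int (H : CoreHyp μ G e p K B a b) [IsProbabilityMeasure μ] (hp : 2 < p) (u v : ι)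
    (j : ℕ) : Integrable (fun ω => gHerm u v (e j ω)) μ := by
  have hm := (H.meas' j).measurable
  refine ((integrable_const 4).add ((H.mom j).const_mul 2)).mono'
    ((measurable_gHerm u v).comp hm).aestronglyMeasurable (ae_of_all _ fun ω => ?_)
  rw [norm_eq_abs]
  refine (abs_gHerm_le u v _).trans ?_
  have h1 := mul_rpow_le_add (r := 2) (t := p - 2) (by norm_num) (by linarith)
    (norm_nonneg (e j ω)) zero_le_one
  simp at h1
  simp
  nlinarith [sq_nonneg (‖e j ω‖ - 1)]

/-- Replacing a block of centred products by its conditional expectation. -/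
lemma setIntegral_mul_block_le (H : CoreHyp μ G e p K B a b) [IsProbabilityMeasure μ] (hp : 2 < p)
    (u v : ι) (c i : ℕ) {s : Set Ω} (hs : MeasurableSet[G c] s) {W D : Ω → ℝ}
    (hW : StronglyMeasurable[G c] W) (hWC : ∀ ω, |W ω| ≤ C) (hWD : ∀ ω, |W ω| ≤ D ω)
    (hD : Integrable (fun ω => D ω * |condBlock μ G (fun j ω => gHerm u v (e j ω)) c i ω|) μ) :
    ∫ ω in s, W ω * ∑ j ∈ range (2 ^ i), gHerm u v (e (c + j) ω) ∂μ
      ≤ ∫ ω in s, D ω * |condBlock μ G (fun j ω => gHerm u v (e j ω)) c i ω| ∂μ := by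
  set X : Ω → ℝ := fun ω => ∑ j ∈ range (2 ^ i), gHerm u v (e (c + j) ω)
  have hX : Integrable X μ := integrable_finsetSum _ fun j _ => H.gHerm_int hp u v _
  have hs' := H.le _ _ hs
  set W' : Ω → ℝ := s.indicator W with hW'
  have hWm := hW.indicator hs
  have hb : ∀ ω, |W' ω| ≤ C := by
    intro ω
    rw [hW', indicator]
    split_ifs
    · exact hWC ω
    · simpa using (abs_nonneg _).trans (hWC ω)
  have hWX :=
    hX.bdd_mul (hWm.mono (H.le _)).aestronglyMeasurable (ae_of_all _ fun ω => hb ω)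
  have hWZ : Integrable (fun ω => W' ω * condBlock μ G (fun j ω => gHerm u v (e j ω)) c i ω) μ :=
    (condBlock_int _ _).bdd_mul (hWm.mono (H.le _)).aestronglyMeasurable
      (ae_of_all _ fun ω => hb ω)
  calc ∫ ω in s, W ω * X ω ∂μ = ∫ ω, W' ω * X ω ∂μ := by
        rw [← integral_indicator hs']
        congr 1; ext ω; by_cases h : ω ∈ s <;> simp [hW', h]
    _ = ∫ ω, W' ω * condBlock μ G (fun j ω => gHerm u v (e j ω)) c i ω ∂μ :=
        (integral_mul_condExp (H.le _) hWm hX hWX).symm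
    _ ≤ _ := by
        rw [← integral_indicator hs']
        refine integral_mono hWZ (hD.indicator hs') fun ω => ?_
        by_cases h : ω ∈ s
        · simp only [hW', indicator_of_mem h]
          calc _ ≤ |W ω * _| := le_abs_self _
            _ ≤ _ := by rw [abs_mul]; gcongr; exact hWD ω
        · simp [hW', h]

end CoreHyp

lemma omegaRate_ge {ℓ : ℕ} (hp : 1 ≤ p) (hℓ : 0 < ℓ) : (ℓ : ℝ) ^ ((3 - p) / 2) ≤ omegaRate p ℓ := by
  have h0 : (0 : ℝ) < ℓ := by exact_mod_cast hℓ
  have h := rpow_neg_mul_le_sum (α := (p - 1) / 2) (by linarith) (m := ℓ) (k := 0)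
  simp at h
  rw [omegaRate]
  refine le_trans (le_of_eq ?_) h
  rw [show (3 - p) / 2 = 1 + -((p - 1) / 2) by ring, rpow_add h0, rpow_one]

lemma one_le_omegaRate {ℓ : ℕ} (hp : 1 ≤ p) (hp3 : p ≤ 3) (hℓ : 0 < ℓ) : 1 ≤ omegaRate p ℓ :=
  (one_le_rpow (by exact_mod_cast hℓ) (by linarith)).trans (omegaRate_ge hp hℓ)

lemma omegaRate_mono {m : ℕ} (h : m ≤ n) : omegaRate p m ≤ omegaRate p n :=
  Finset.sum_le_sum_of_subset_of_nonneg (Finset.range_mono h) fun _ _ _ => by positivity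

lemma sum_rev_eq_omegaRate (ℓ : ℕ) :
    ∑ j ∈ range ℓ, ((ℓ : ℝ) - j) ^ (-((p - 1) / 2)) = omegaRate p ℓ := by
  rw [omegaRate, ← sum_range_reflect]
  refine sum_congr rfl fun j hj => ?_
  rw [mem_range] at hj
  rw [show ℓ - 1 - j = ℓ - (j + 1) by omega, Nat.cast_sub hj]
  push_cast
  ring_nf

/-- Sum of the Hessian time weights along one dyadic level. -/
lemma sum_level_le {i : ℕ} (hp : 1 ≤ p) (hi : i < n) :
    ∑ l ∈ range (2 ^ (n - 1 - i)),
      ((2 : ℝ) ^ n - (2 * l + 1) * 2 ^ i) ^ (-((p - 1) / 2)) ≤ omegaRate p (2 ^ n) / 2 ^ i := by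
  set N := 2 ^ (n - 1 - i) with hN
  have h2 : 2 ^ n = 2 ^ i * (2 * N) := by
    rw [hN, ← pow_succ', ← pow_add]; congr 1; omega
  have h2' : (2 : ℝ) ^ n = 2 ^ i * (2 * N) := by exact_mod_cast h2
  rw [← sum_range_reflect]
  have h := sum_grid_le_omegaRate hp (2 ^ i) N (by positivity)
  refine (sum_le_sum fun k hk => ?_).trans (h.trans ?_)
  · rw [mem_range] at hk
    refine rpow_le_rpow_of_nonpos (by positivity) ?_ (by linarith)
    have : ((N - 1 - k : ℕ) : ℝ) = N - 1 - k := by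
      rw [show N - 1 - k = N - (k + 1) by omega, Nat.cast_sub hk]; push_cast; ring
    rw [this, h2']
    push_cast
    have : (0 : ℝ) < 2 ^ i := by positivity
    have hk0 : (0 : ℝ) ≤ k := by positivity
    nlinarith
  · push_cast
    gcongr
    exact omegaRate_mono (by rw [h2]; nlinarith [pow_pos (two_pos : 0 < 2) i])

lemma sum_zetaB_le (hp : 2 < p) (H : CoreHyp μ G e p K B a b) (n : ℕ) :
    ∑ i ∈ range n, zetaB ι p K B a b i / 2 ^ i
      ≤ (Fintype.card ι * (8 + remC p K B ^ ((p - 2) / p)) + 1) * B := by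
  have hr := remC_nonneg hp H.K_nonneg H.B_nonneg
  have e1 : ∀ i : ℕ, (2 ^ i) ^ ((p - 2) / 2) / 2 ^ i = 1 / ((2 : ℝ) ^ (2 - p / 2)) ^ i := by
    intro i
    rw [← rpow_natCast, ← rpow_natCast, ← rpow_mul (by norm_num),
      ← rpow_mul (by norm_num), ← rpow_sub (by norm_num), one_div,
      ← rpow_neg (by norm_num)]
    congr 1; ring
  have e2 : ∀ i : ℕ, (2 ^ i) ^ ((p - 2) / p) / 2 ^ i
      = 1 / ((2 : ℝ) ^ (1 / (p / 2))) ^ i := by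
    intro i
    rw [← rpow_natCast, ← rpow_natCast, ← rpow_mul (by norm_num),
      ← rpow_mul (by norm_num), ← rpow_sub (by norm_num), one_div (_ ^ _),
      ← rpow_neg (by norm_num)]
    congr 1; field_simp; ring
  have e : ∀ i, zetaB ι p K B a b i / 2 ^ i
      = (8 * Fintype.card ι + 1) * (a i / (2 ^ (2 - p / 2)) ^ i)
        + Fintype.card ι * remC p K B ^ ((p - 2) / p)
          * (b i / (2 ^ (1 / (p / 2))) ^ i) := by
    intro i
    rw [zetaB, mul_rpow hr (by positivity), div_eq_mul_one_div (a i), ← e1,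
      div_eq_mul_one_div (b i), ← e2]
    ring
  simp only [e, sum_add_distrib, ← mul_sum]
  calc _ ≤ (8 * Fintype.card ι + 1) * B + Fintype.card ι * remC p K B ^ ((p - 2) / p) * B := by
        gcongr
        · exact H.a_sum n
        · exact H.b_sum n
    _ = _ := by ring

lemma a_div_sqrt_le (hp : 2 < p) (H : CoreHyp μ G e p K B a b) (n : ℕ) :
    a n / √(2 ^ n) ≤ B * omegaRate p (2 ^ n) := by
  have h1 :=
    (single_le_sum (f := fun i => a i / (2 ^ (2 - p / 2)) ^ i)
      (fun i _ => div_nonneg (H.a_nonneg i) (by positivity))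
      (Finset.self_mem_range_succ n)).trans (H.a_sum (n + 1))
  have h2 := omegaRate_ge (p := p) (ℓ := 2 ^ n) (by linarith) (by positivity)
  have h3 : a n / √(2 ^ n)
      = a n / (2 ^ (2 - p / 2)) ^ n * (((2 ^ n : ℕ) : ℝ) ^ ((3 - p) / 2)) := by
    push_cast
    rw [sqrt_eq_rpow, ← rpow_natCast, ← rpow_natCast, ← rpow_mul (by norm_num),
      ← rpow_mul (by norm_num), ← rpow_mul (by norm_num), div_mul_eq_mul_div, mul_div_assoc,
      ← rpow_sub (by norm_num), div_eq_mul_inv, ← rpow_neg (by norm_num)]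
    congr 2; ring
  rw [h3]
  exact mul_le_mul h1 h2 (by positivity) H.B_nonneg

/-- Deterministic Lindeberg expansion along a path. -/
lemma lindeberg_path {f : 𝔼 ι → ℝ} (hf : LipschitzWith 1 f) (hp : 2 ≤ p) (hp3 : p ≤ 3) (y : ℕ → 𝔼 ι)
    (ℓ : ℕ) :
    f (∑ j ∈ range ℓ, y j) - gF f ℓ 0
      ≤ (2 * gConst ι + ∑ j ∈ range ℓ,
          3 * gConst ι * ((ℓ : ℝ) - j) ^ (-((p - 1) / 2)) * (‖y j‖ ^ p + gConst ι))
        + (∑ j ∈ range ℓ, ∑ u, gL f (ℓ - j) u (∑ i ∈ range j, y i) * y j u)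
        + (∑ u, ∑ v, ∑ j ∈ range ℓ,
            gB f (ℓ - j) u v (∑ i ∈ range j, y i) * gHerm u v (y j)) / 2 := by
  have hc := one_le_gConst (ι := ι)
  set Φ : ℕ → ℝ := fun j => gF f (ℓ - j + 1) (∑ i ∈ range j, y i) with hΦ
  have hstep : ∀ j ∈ range ℓ, Φ (j + 1) - Φ j
      ≤ ∑ u, gL f (ℓ - j) u (∑ i ∈ range j, y i) * y j u
      + (∑ u, ∑ v, gB f (ℓ - j) u v (∑ i ∈ range j, y i) * gHerm u v (y j)) / 2
      + 3 * gConst ι * (ℓ - j) ^ (-((p - 1) / 2)) * (‖y j‖ ^ p + gConst ι) := by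
    intro j hj
    have hj' : (j : ℝ) < ℓ := by exact_mod_cast mem_range.1 hj
    have h := gF_step_le hf (sub_pos.2 hj') hp hp3 (∑ i ∈ range j, y i) (y j)
    simp only [hΦ, sum_range_succ]
    push_cast
    rw [show (ℓ : ℝ) - (j + 1) + 1 = ℓ - j by ring]
    exact h
  have htel := (Finset.sum_range_sub Φ ℓ).symm.le.trans (sum_le_sum hstep)
  rw [sum_add_distrib, sum_add_distrib, ← sum_div, sum_comm] at htel
  have hcomm : ∀ F : ℕ → ι → ι → ℝ, ∑ u, ∑ j ∈ range ℓ, ∑ v, F j u v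
      = ∑ u, ∑ v, ∑ j ∈ range ℓ, F j u v := fun F =>
    sum_congr rfl fun u _ => sum_comm
  have hcomm' : ∀ F : ℕ → ι → ι → ℝ, ∑ j ∈ range ℓ, ∑ u, ∑ v, F j u v
      = ∑ u, ∑ v, ∑ j ∈ range ℓ, F j u v := fun F => by
    rw [sum_comm]; exact hcomm F
  rw [sum_comm, hcomm'] at htel
  have h1 : f (∑ j ∈ range ℓ, y j) ≤ Φ ℓ + gConst ι := by
    have h := (abs_le.1 (abs_gF_sub_self_le (t := 1) hf (∑ j ∈ range ℓ, y j))).1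
    simp at h
    simp only [hΦ, sub_self, zero_add]
    linarith
  have h2 : Φ 0 ≤ gF f ℓ 0 + gConst ι := by
    have h := (abs_le.1 (abs_gF_sub_le (s := ℓ) (t := ℓ + 1) hf (by linarith) 0)).2
    have h3 : √(ℓ + 1) ≤ √ℓ + 1 := by
      refine Real.sqrt_le_iff.2 ⟨by positivity, ?_⟩
      nlinarith [sq_sqrt (cast_nonneg ℓ), sqrt_nonneg ℓ]
    simp only [hΦ, range_zero, sum_empty, Nat.cast_zero, sub_zero]
    nlinarith
  linarith

/-- Taylor remainder of the Lindeberg scheme. -/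
def lindRem (p : ℝ) (e : ℕ → Ω → 𝔼 ι) (s ℓ : ℕ) (ω : Ω) : ℝ :=
  2 * gConst ι + ∑ j ∈ range ℓ,
    3 * gConst ι * ((ℓ : ℝ) - j) ^ (-((p - 1) / 2)) * (‖e (s + j) ω‖ ^ p + gConst ι)

/-- Covariance error of the Lindeberg scheme. -/
def lindCov (μ : Measure Ω) (G : ℕ → MeasurableSpace Ω) (p : ℝ)
    (e : ℕ → Ω → 𝔼 ι) (s n : ℕ) (u v : ι) (ω : Ω) : ℝ :=
  gConst ι / √(2 ^ n) * |condBlock μ G (fun j ω => gHerm u v (e j ω)) s n ω|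
    + ∑ i ∈ range n, ∑ l ∈ range (2 ^ (n - 1 - i)),
      2 * gConst ι * ((2 : ℝ) ^ n - (2 * l + 1) * 2 ^ i) ^ (-((p - 1) / 2))
        * ((‖vsum e (s + 2 * l * 2 ^ i) (2 ^ i) ω‖ ^ (p - 2) + ((2 : ℝ) ^ i) ^ ((p - 2) / 2))
          * |condBlock μ G (fun j ω => gHerm u v (e j ω)) (s + 2 * l * 2 ^ i + 2 ^ i) i ω|)

/-- Constant of the Lindeberg bound. -/
def lindC (ι : Type*) [Fintype ι] (p K B : ℝ) : ℝ :=
  2 * gConst ι + 3 * gConst ι * (K + gConst ι)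
    + (Fintype.card ι : ℝ) ^ 2 * (gConst ι * B
      + 2 * gConst ι * ((Fintype.card ι * (8 + remC p K B ^ ((p - 2) / p)) + 1) * B))

lemma odd_mul_lt {i l : ℕ} (hi : i < n) (hl : l < 2 ^ (n - 1 - i)) :
    (2 * l + 1) * 2 ^ i + 2 ^ i ≤ 2 ^ n := by
  have : 2 ^ n = 2 * 2 ^ (n - 1 - i) * 2 ^ i := by
    rw [← pow_succ', ← pow_add]; congr 1; omega
  rw [this]
  nlinarith [pow_pos (two_pos : 0 < 2) i]

namespace CoreHyp

lemma lindRem_int (H : CoreHyp μ G e p K B a b) [IsProbabilityMeasure μ] (s ℓ : ℕ) :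
    Integrable (lindRem p e s ℓ) μ :=
  (integrable_const _).add (integrable_finsetSum _ fun _ _ =>
    ((H.mom _).add (integrable_const _)).const_mul _)

lemma integral_lindRem_le (H : CoreHyp μ G e p K B a b) [IsProbabilityMeasure μ] (s ℓ : ℕ) :
    ∫ ω, lindRem p e s ℓ ω ∂μ ≤ 2 * gConst ι + 3 * gConst ι * (K + gConst ι) * omegaRate p ℓ := by
  have hc := one_le_gConst (ι := ι)
  have h1 : ∀ j, Integrable (fun ω => ‖e (s + j) ω‖ ^ p + gConst ι) μ := fun j =>
    (H.mom _).add (integrable_const _)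
  have h2 : ∀ j, Integrable (fun ω => 3 * gConst ι * (ℓ - j) ^ (-((p - 1) / 2))
      * (‖e (s + j) ω‖ ^ p + gConst ι)) μ := fun j => (h1 j).const_mul _
  simp only [lindRem]
  rw [integral_add (integrable_const _) (integrable_finsetSum _ fun j _ => h2 j),
    integral_finsetSum _ fun j _ => h2 j, ← sum_rev_eq_omegaRate, mul_sum]
  refine add_le_add (by simp) (sum_le_sum fun j hj => ?_)
  have hj' : (0 : ℝ) < ℓ - j := sub_pos.2 (by exact_mod_cast mem_range.1 hj)
  rw [integral_const_mul, integral_add (H.mom _) (integrable_const _), integral_const,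
    probReal_univ, one_smul]
  calc _ ≤ 3 * gConst ι * (ℓ - j) ^ (-((p - 1) / 2)) * (K + gConst ι) := by
        gcongr; exact H.mom_le _
    _ = _ := by ring

lemma lindCov_int (H : CoreHyp μ G e p K B a b) [IsProbabilityMeasure μ] (hp : 2 < p)
    (hp3 : p ≤ 3) (s n : ℕ) (u v : ι) : Integrable (lindCov μ G p e s n u v) μ :=
  ((condBlock_int _ _).abs.const_mul _).add (integrable_finsetSum _ fun _ _ =>
    integrable_finsetSum _ fun _ _ => (H.space_time_mul hp hp3 u v _ _).1.const_mul _)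

lemma integral_lindCov_le (H : CoreHyp μ G e p K B a b) [IsProbabilityMeasure μ] (hp : 2 < p)
    (hp3 : p ≤ 3) (s n : ℕ) (u v : ι) :
    ∫ ω, lindCov μ G p e s n u v ω ∂μ ≤ (gConst ι * B
      + 2 * gConst ι * ((Fintype.card ι * (8 + remC p K B ^ ((p - 2) / p)) + 1) * B))
        * omegaRate p (2 ^ n) := by
  have hc := one_le_gConst (ι := ι)
  have h1 := (condBlock_int (μ := μ) (G := G) (X := fun j ω => gHerm u v (e j ω)) s n).abs.const_mul
    (gConst ι / √(2 ^ n))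
  have h2 := fun i l : ℕ => (H.space_time_mul hp hp3 u v (s + 2 * l * 2 ^ i) i).1.const_mul
    (2 * gConst ι * (2 ^ n - (2 * l + 1) * 2 ^ i) ^ (-((p - 1) / 2)))
  have h3 := fun i : ℕ => integrable_finsetSum (range (2 ^ (n - 1 - i))) fun l _ => h2 i l
  have h4 := integrable_finsetSum (range n) fun i _ => h3 i
  simp only [lindCov]
  rw [integral_add h1 h4, integral_finsetSum _ fun i _ => h3 i, add_mul]
  refine add_le_add ?_ ?_
  · rw [integral_const_mul]
    calc _ ≤ gConst ι / √(2 ^ n) * a n := by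
          gcongr; exact H.integral_abs_condBlock_le u v s n
      _ = gConst ι * (a n / √(2 ^ n)) := by ring
      _ ≤ gConst ι * (B * omegaRate p (2 ^ n)) := by gcongr; exact a_div_sqrt_le hp H n
      _ = _ := by ring
  · have hω : 0 ≤ omegaRate p (2 ^ n) := by unfold omegaRate; positivity
    have hr := remC_nonneg hp H.K_nonneg H.B_nonneg
    have hz : ∀ i, 0 ≤ zetaB ι p K B a b i := fun i => by
      have := H.a_nonneg i
      have := H.b_nonneg i
      unfold zetaB; positivity
    calc _ ≤ ∑ i ∈ range n,
          2 * gConst ι * omegaRate p (2 ^ n) * (zetaB ι p K B a b i / 2 ^ i) := by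
          refine sum_le_sum fun i hi => ?_
          rw [integral_finsetSum _ fun l _ => h2 i l]
          calc _ ≤ ∑ l ∈ range (2 ^ (n - 1 - i)),
                2 * gConst ι * (2 ^ n - (2 * l + 1) * 2 ^ i) ^ (-((p - 1) / 2))
                  * zetaB ι p K B a b i := by
                refine sum_le_sum fun l hl => ?_
                rw [integral_const_mul]
                have h := odd_mul_lt (mem_range.1 hi) (mem_range.1 hl)
                have h' : ((2 * l + 1) * 2 ^ i + 2 ^ i : ℝ) ≤ 2 ^ n := by exact_mod_cast h
                have h0 : (0 : ℝ) ≤ 2 ^ n - (2 * l + 1) * 2 ^ i := by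
                  have : (0 : ℝ) < 2 ^ i := by positivity
                  linarith
                gcongr
                exact (H.space_time_mul hp hp3 u v _ i).2
            _ = 2 * gConst ι * zetaB ι p K B a b i * ∑ l ∈ range (2 ^ (n - 1 - i)),
                ((2 : ℝ) ^ n - (2 * l + 1) * 2 ^ i) ^ (-((p - 1) / 2)) := by
                rw [mul_sum]; exact sum_congr rfl fun l _ => by ring
            _ ≤ 2 * gConst ι * zetaB ι p K B a b i * (omegaRate p (2 ^ n) / 2 ^ i) := by
                have := hz i
                gcongr
                exact sum_level_le (by linarith) (mem_range.1 hi)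
            _ = _ := by ring
      _ ≤ _ := by
          rw [← mul_sum]
          calc _ ≤ 2 * gConst ι * omegaRate p (2 ^ n)
                * ((Fintype.card ι * (8 + remC p K B ^ ((p - 2) / p)) + 1) * B) := by
                gcongr; exact sum_zetaB_le hp H n
            _ = _ := by ring

/-- Second-order terms of the Lindeberg scheme. -/
lemma setIntegral_second_order_le (H : CoreHyp μ G e p K B a b) [IsProbabilityMeasure μ]
    (hp : 2 < p) (hp3 : p ≤ 3) {f : 𝔼 ι → ℝ} (hf : LipschitzWith 1 f) (s n : ℕ)
    (u v : ι) {A : Set Ω} (hA : MeasurableSet[G s] A) :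
    ∫ ω in A, ∑ j ∈ range (2 ^ n), gB f (2 ^ n - j) u v (vsum e s j ω)
        * gHerm u v (e (s + j) ω) ∂μ
      ≤ ∫ ω in A, lindCov μ G p e s n u v ω ∂μ := by
  have hc := one_le_gConst (ι := ι)
  set X : ℕ → Ω → ℝ := fun j ω => gHerm u v (e (s + j) ω) with hX
  set β : ℕ → Ω → ℝ := fun j ω => gB f (2 ^ n - j) u v (vsum e s j ω) with hβ
  have hβm : ∀ j, StronglyMeasurable[G (s + j)] (β j) := fun j =>
    (continuous_gB hf u v).comp_stronglyMeasurable (H.vsum_meas le_rfl)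
  have hXi : ∀ j, Integrable (X j) μ := fun j => H.gHerm_int hp u v _
  have hXs : ∀ c i, Integrable (fun ω => ∑ j ∈ range (2 ^ i), X (c + j) ω) μ := fun c i =>
    integrable_finsetSum _ fun j _ => hXi _
  have hβb : ∀ j < 2 ^ n, ∀ ω, |β j ω| ≤ gConst ι / √(2 ^ n - j) := fun j hj ω =>
    abs_gB_le hf (sub_pos.2 (by exact_mod_cast hj)) u v _
  have hT : ∀ i < n, ∀ l < 2 ^ (n - 1 - i),
      Integrable (fun ω => (β ((2 * l + 1) * 2 ^ i) ω - β (2 * l * 2 ^ i) ω)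
        * ∑ j ∈ range (2 ^ i), X ((2 * l + 1) * 2 ^ i + j) ω) μ ∧
      ∫ ω in A, (β ((2 * l + 1) * 2 ^ i) ω - β (2 * l * 2 ^ i) ω)
        * ∑ j ∈ range (2 ^ i), X ((2 * l + 1) * 2 ^ i + j) ω ∂μ
      ≤ ∫ ω in A, 2 * gConst ι * (2 ^ n - (2 * l + 1) * 2 ^ i) ^ (-((p - 1) / 2))
        * ((‖vsum e (s + 2 * l * 2 ^ i) (2 ^ i) ω‖ ^ (p - 2) + (2 ^ i) ^ ((p - 2) / 2))
          * |condBlock μ G (fun j ω => gHerm u v (e j ω)) (s + 2 * l * 2 ^ i + 2 ^ i) i ω|) ∂μ := by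
    intro i hi l hl
    have hle := odd_mul_lt hi hl
    have hle' : ((2 * l + 1) * 2 ^ i + 2 ^ i : ℝ) ≤ 2 ^ n := by exact_mod_cast hle
    have h2i : 0 < 2 ^ i := by positivity
    have e1 : (2 * l + 1) * 2 ^ i = 2 * l * 2 ^ i + 2 ^ i := by ring
    have hWm : StronglyMeasurable[G (s + 2 * l * 2 ^ i + 2 ^ i)]
        (fun ω => β ((2 * l + 1) * 2 ^ i) ω - β (2 * l * 2 ^ i) ω) := by
      refine ((hβm _).mono (H.mono ?_)).sub ((hβm _).mono (H.mono ?_)) <;> rw [add_assoc] <;> omega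
    have hWC : ∀ ω, |β ((2 * l + 1) * 2 ^ i) ω - β (2 * l * 2 ^ i) ω|
        ≤ gConst ι / √(2 ^ n - ((2 * l + 1) * 2 ^ i : ℕ))
          + gConst ι / √(2 ^ n - (2 * l * 2 ^ i : ℕ)) := fun ω =>
      (abs_sub _ _).trans (add_le_add (hβb _ (by omega) ω) (hβb _ (by omega) ω))
    refine ⟨(hXs _ _).bdd_mul (hWm.mono (H.le _)).aestronglyMeasurable
      (ae_of_all _ fun ω => hWC ω), ?_⟩
    have key := H.setIntegral_mul_block_le hp u v (s + 2 * l * 2 ^ i + 2 ^ i) i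
      (H.mono (by rw [add_assoc]; omega) _ hA) hWm hWC
      (D := fun ω => 2 * gConst ι * (2 ^ n - (2 * l + 1) * 2 ^ i) ^ (-((p - 1) / 2))
        * (‖vsum e (s + 2 * l * 2 ^ i) (2 ^ i) ω‖ ^ (p - 2) + (2 ^ i) ^ ((p - 2) / 2)))
      (fun ω => by
        have h := abs_gB_sub_space_time_le (t := 2 ^ n - (2 * l + 1) * 2 ^ i)
          (m := 2 ^ i) hf hp hp3 (by positivity) (by linarith) u v (vsum e s (2 * l * 2 ^ i) ω)
          (vsum e (s + 2 * l * 2 ^ i) (2 ^ i) ω)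
        rw [← vsum_add, ← e1] at h
        simp only [hβ]
        push_cast
        rw [show (2 : ℝ) ^ n - 2 * l * 2 ^ i = 2 ^ n - (2 * l + 1) * 2 ^ i + 2 ^ i by ring]
        exact h)
      (by
        simp only [mul_assoc (2 * gConst ι * _)]
        exact (H.space_time_mul hp hp3 u v _ i).1.const_mul _)
    simp only [mul_assoc (2 * gConst ι * _)] at key
    refine le_trans (le_of_eq ?_) key
    simp only [hX, e1, add_assoc]
  have hlead : ∫ ω in A, β 0 ω * ∑ j ∈ range (2 ^ n), X j ω ∂μ
      ≤ ∫ ω in A, gConst ι / √(2 ^ n)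
        * |condBlock μ G (fun j ω => gHerm u v (e j ω)) s n ω| ∂μ := by
    have hb := fun ω => by
      simpa using hβb 0 (by positivity) ω
    exact H.setIntegral_mul_block_le hp u v s n hA (by simpa using hβm 0) hb
      hb ((condBlock_int _ _).abs.const_mul _)
  have hleadi : Integrable (fun ω => β 0 ω * ∑ j ∈ range (2 ^ n), X j ω) μ := by
    have := hXs 0 n
    simp at this
    exact this.bdd_mul ((hβm 0).mono (H.le _)).aestronglyMeasurable
      (ae_of_all _ fun ω => hβb 0 (by positivity) ω)
  have e0 := fun ω =>
    sum_mul_dyadic (fun j => β j ω) (fun j => X j ω) n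
  have h2 := fun i l : ℕ => (H.space_time_mul hp hp3 u v (s + 2 * l * 2 ^ i) i).1.const_mul
    (2 * gConst ι * (2 ^ n - (2 * l + 1) * 2 ^ i) ^ (-((p - 1) / 2)))
  have h3 := fun i : ℕ => integrable_finsetSum (range (2 ^ (n - 1 - i))) fun l _ => h2 i l
  have h4 := integrable_finsetSum (range n) fun i _ => h3 i
  have hTi := fun i hi =>
    integrable_finsetSum _ fun l hl => (hT i (mem_range.1 hi) l (mem_range.1 hl)).1
  change ∫ ω in A, ∑ j ∈ range (2 ^ n), β j ω * X j ω ∂μ ≤ _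
  simp only [e0, lindCov]
  rw [integral_add hleadi.integrableOn (integrable_finsetSum _ hTi).integrableOn,
    integral_add ((condBlock_int _ _).abs.const_mul _).integrableOn h4.integrableOn,
    integral_finsetSum _ fun i hi => (hTi i hi).integrableOn,
    integral_finsetSum _ fun i _ => (h3 i).integrableOn]
  refine add_le_add hlead (sum_le_sum fun i hi => ?_)
  rw [integral_finsetSum _ fun l hl =>
      (hT i (mem_range.1 hi) l (mem_range.1 hl)).1.integrableOn,
    integral_finsetSum _ fun l _ => (h2 i l).integrableOn]
  exact sum_le_sum fun l hl => (hT i (mem_range.1 hi) l (mem_range.1 hl)).2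

end CoreHyp

lemma LipschitzWith.integrable_comp {E : Type*} [NormedAddCommGroup E] {f : E → ℝ}
    (hf : LipschitzWith 1 f) [IsFiniteMeasure μ] {g : Ω → E} (hg : Integrable g μ) :
    Integrable (fun ω => f (g ω)) μ := by
  refine ((integrable_const |f 0|).add hg.norm).mono'
    (hf.continuous.comp_aestronglyMeasurable hg.aestronglyMeasurable) (ae_of_all _ fun ω => ?_)
  have := hf.dist_le_mul (g ω) 0
  rw [dist_zero_right, dist_eq, coe_one, one_mul] at this
  rw [norm_eq_abs]
  simp
  linarith [abs_sub_abs_le_abs_sub (f (g ω)) (f 0)]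

namespace CoreHyp

lemma int (H : CoreHyp μ G e p K B a b) [IsProbabilityMeasure μ] (hp : 2 < p) (k : ℕ) :
    Integrable (e k) μ := by
  have h := integrable_of_abs_rpow (by linarith)
    (H.meas' k).norm.aestronglyMeasurable (by simpa using H.mom k)
  exact (integrable_norm_iff (H.meas' k).aestronglyMeasurable).1 h

lemma vsum_int (H : CoreHyp μ G e p K B a b) [IsProbabilityMeasure μ] (hp : 2 < p) (s k : ℕ) :
    Integrable (vsum e s k) μ := integrable_finsetSum _ fun _ _ => H.int hp _

/-- Conditional Lindeberg bound for a dyadic block. -/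
theorem lindeberg (H : CoreHyp μ G e p K B a b) [IsProbabilityMeasure μ]
    (hp : 2 < p) (hp3 : p ≤ 3) (s n : ℕ) :
    ∃ Ξ : Ω → ℝ, Integrable Ξ μ ∧ ∫ ω, Ξ ω ∂μ ≤ lindC ι p K B * omegaRate p (2 ^ n) ∧
      ∀ f : 𝔼 ι → ℝ, LipschitzWith 1 f → ∀ A, MeasurableSet[G s] A →
        ∫ ω in A, (f (vsum e s (2 ^ n) ω) - gF f (2 ^ n) 0) ∂μ ≤ ∫ ω in A, Ξ ω ∂μ := by
  have hc := one_le_gConst (ι := ι)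
  have hK := H.K_nonneg
  have hci := fun u v =>
    H.lindCov_int hp hp3 s n u v
  have hci1 : ∀ u, Integrable (fun ω => ∑ v, lindCov μ G p e s n u v ω) μ := fun u =>
    integrable_finsetSum _ fun v _ => hci u v
  have hci2 : Integrable (fun ω => (∑ u, ∑ v, lindCov μ G p e s n u v ω) / 2) μ :=
    (integrable_finsetSum _ fun u _ => hci1 u).div_const _
  have hri : Integrable (lindRem p e s (2 ^ n)) μ := H.lindRem_int s _
  refine ⟨fun ω => lindRem p e s (2 ^ n) ω + (∑ u, ∑ v, lindCov μ G p e s n u v ω) / 2,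
    hri.add hci2, ?_, ?_⟩
  · rw [integral_add hri hci2, integral_div, integral_finsetSum _ fun u _ => hci1 u]
    simp only [integral_finsetSum _ fun v _ => hci _ v]
    have h1 := H.integral_lindRem_le s (2 ^ n)
    have hω : 1 ≤ omegaRate p (2 ^ n) := one_le_omegaRate (by linarith) hp3 (by positivity)
    set c2 := gConst ι * B + 2 * gConst ι
      * ((Fintype.card ι * (8 + remC p K B ^ ((p - 2) / p)) + 1) * B) with hc2
    have h2 : ∑ u : ι, ∑ v : ι, ∫ ω, lindCov μ G p e s n u v ω ∂μ
        ≤ ∑ u : ι, ∑ v : ι, c2 * omegaRate p (2 ^ n) :=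
      sum_le_sum fun u _ => sum_le_sum fun v _ =>
        H.integral_lindCov_le hp hp3 s n u v
    simp at h2
    have h3 : 0 ≤ c2 * omegaRate p (2 ^ n) := by
      have hr := remC_nonneg hp hK H.B_nonneg
      have hB := H.B_nonneg
      positivity
    have h4 : 0 ≤ Fintype.card ι * (Fintype.card ι * (c2 * omegaRate p (2 ^ n))) := by
      positivity
    rw [lindC, ← hc2]
    nlinarith
  intro f hf A hA
  have hA' := H.le _ _ hA
  have hgL : ∀ j : ℕ, j < 2 ^ n → ∀ u, Integrable (fun ω => gL f (2 ^ n - j) u (vsum e s j ω)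
      * e (s + j) ω u) μ ∧ ∫ ω in A, gL f (2 ^ n - j) u (vsum e s j ω) * e (s + j) ω u ∂μ = 0 := by
    intro j hj u
    have hm : StronglyMeasurable[G (s + j)] fun ω => gL f (2 ^ n - j) u (vsum e s j ω) :=
      (continuous_gL hf u).comp_stronglyMeasurable (H.vsum_meas le_rfl)
    have hb : ∀ ω, |gL f (2 ^ n - j) u (vsum e s j ω)| ≤ gConst ι := fun ω =>
      abs_gL_le hf (sub_pos.2 (by exact_mod_cast hj)) u _
    refine ⟨((H.mds u).int _).bdd_mul (hm.mono (H.le _)).aestronglyMeasurable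
      (ae_of_all _ fun ω => hb ω), ?_⟩
    have hm' := hm.indicator (H.mono (Nat.le_add_right s j) _ hA)
    have h := integral_mul_eq_zero_of_condExp_eq_zero (H.le _) hm' ((H.mds u).int (s + j))
      (((H.mds u).int _).bdd_mul (hm'.mono (H.le _)).aestronglyMeasurable
        (ae_of_all _ fun ω => by
          rw [indicator]
          split_ifs
          · exact hb ω
          · simp; linarith)) ((H.mds u).zero _)
    rw [← h, ← integral_indicator hA']
    congr 1; ext ω; by_cases h : ω ∈ A <;> simp [h]
  have hgB : ∀ u v, Integrable (fun ω => ∑ j ∈ range (2 ^ n),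
      gB f (2 ^ n - j) u v (vsum e s j ω) * gHerm u v (e (s + j) ω)) μ := fun u v =>
    integrable_finsetSum _ fun j hj => (H.gHerm_int hp u v _).bdd_mul
      (((continuous_gB hf u v).comp_stronglyMeasurable
        (H.vsum_meas le_rfl)).mono (H.le _)).aestronglyMeasurable
      (ae_of_all _ fun ω => abs_gB_le hf
        (sub_pos.2 (by exact_mod_cast mem_range.1 hj)) u v _)
  have i1 : Integrable (fun ω => f (vsum e s (2 ^ n) ω) - gF f (2 ^ n) 0) μ :=
    (hf.integrable_comp (H.vsum_int hp s _)).sub (integrable_const _)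
  have i2 : ∀ j ∈ range (2 ^ n), Integrable (fun ω =>
      ∑ u, gL f (2 ^ n - j) u (vsum e s j ω) * e (s + j) ω u) μ := fun j hj =>
    integrable_finsetSum _ fun u _ => (hgL j (mem_range.1 hj) u).1
  have i2' := integrable_finsetSum _ i2
  have i3 : ∀ u, Integrable (fun ω => ∑ v, ∑ j ∈ range (2 ^ n),
      gB f (2 ^ n - j) u v (vsum e s j ω) * gHerm u v (e (s + j) ω)) μ := fun u =>
    integrable_finsetSum _ fun v _ => hgB u v
  have i3' : Integrable (fun ω => (∑ u, ∑ v, ∑ j ∈ range (2 ^ n),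
      gB f (2 ^ n - j) u v (vsum e s j ω) * gHerm u v (e (s + j) ω)) / 2) μ :=
    (integrable_finsetSum _ fun u _ => i3 u).div_const _
  have i4 : Integrable (fun ω => lindRem p e s (2 ^ n) ω + ∑ j ∈ range (2 ^ n),
      ∑ u, gL f (2 ^ n - j) u (vsum e s j ω) * e (s + j) ω u) μ := hri.add i2'
  have hpath : ∀ ω, f (vsum e s (2 ^ n) ω) - gF f (2 ^ n) 0 ≤ lindRem p e s (2 ^ n) ω
      + (∑ j ∈ range (2 ^ n), ∑ u, gL f (2 ^ n - j) u (vsum e s j ω) * e (s + j) ω u)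
      + (∑ u, ∑ v, ∑ j ∈ range (2 ^ n),
        gB f (2 ^ n - j) u v (vsum e s j ω) * gHerm u v (e (s + j) ω)) / 2 := fun ω => by
    simpa [lindRem, vsum] using lindeberg_path hf hp.le hp3 (fun j => e (s + j) ω) (2 ^ n)
  have i5 : Integrable (fun ω => lindRem p e s (2 ^ n) ω + (∑ j ∈ range (2 ^ n),
      ∑ u, gL f (2 ^ n - j) u (vsum e s j ω) * e (s + j) ω u)
      + (∑ u, ∑ v, ∑ j ∈ range (2 ^ n),
        gB f (2 ^ n - j) u v (vsum e s j ω) * gHerm u v (e (s + j) ω)) / 2) μ := i4.add i3'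
  refine (setIntegral_mono i1.integrableOn i5.integrableOn hpath).trans ?_
  simp
  rw [integral_add i4.integrableOn i3'.integrableOn, integral_add hri.integrableOn
    i2'.integrableOn, integral_add hri.integrableOn hci2.integrableOn,
    integral_finsetSum _ fun j hj => (i2 j hj).integrableOn,
    sum_eq_zero, add_zero, integral_div, integral_div,
    integral_finsetSum _ fun u _ => (i3 u).integrableOn,
    integral_finsetSum _ fun u _ => (hci1 u).integrableOn]
  · refine add_le_add le_rfl (div_le_div_of_nonneg_right
      (sum_le_sum fun u _ => ?_) zero_le_two)
    rw [integral_finsetSum _ fun v _ => (hgB u v).integrableOn,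
      integral_finsetSum _ fun v _ => (hci u v).integrableOn]
    refine sum_le_sum fun v _ => ?_
    exact H.setIntegral_second_order_le hp hp3 hf s n u v hA
  · intro j hj
    rw [integral_finsetSum _ fun u _ => (hgL j (mem_range.1 hj) u).1.integrableOn]
    exact sum_eq_zero fun u _ => (hgL j (mem_range.1 hj) u).2

end CoreHyp

section Kantorovich

variable {X Y E : Type*} [Fintype X] [Fintype Y] [SeminormedAddCommGroup E]

lemma lipschitzWith_inf'_norm_sub [Nonempty Y] (ζ : Y → E) (ψ : Y → ℝ) :
    LipschitzWith 1 fun z =>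
      univ.inf' univ_nonempty fun y => ‖z - ζ y‖ - ψ y := by
  refine LipschitzWith.of_le_add fun z w => ?_
  obtain ⟨y, -, hy⟩ := Finset.exists_mem_eq_inf' univ_nonempty
    fun y => ‖w - ζ y‖ - ψ y
  rw [hy]
  refine (inf'_le _ (mem_univ y)).trans ?_
  have : ‖z - ζ y‖ ≤ ‖w - ζ y‖ + dist z w := by
    rw [dist_eq_norm, add_comm]
    exact norm_sub_le_norm_sub_add_norm_sub z w (ζ y)
  linarith

/-- Kantorovich duality for finitely supported measures. -/
theorem exists_coupling_of_forall_lipschitz [DecidableEq X] [DecidableEq Y]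
    {m L : ℝ} {α : X → ℝ} {β : Y → ℝ} (hα : ∀ x, 0 ≤ α x) (hβ : ∀ y, 0 ≤ β y)
    (hαm : ∑ x, α x = m) (hβm : ∑ y, β y = m) (ξ : X → E) (ζ : Y → E)
    (h : ∀ f : E → ℝ, LipschitzWith 1 f → ∑ x, α x * f (ξ x) - ∑ y, β y * f (ζ y) ≤ L) :
    ∃ π : X → Y → ℝ, (∀ x y, 0 ≤ π x y) ∧ (∀ x, ∑ y, π x y = α x) ∧
      (∀ y, ∑ x, π x y = β y) ∧ ∑ x, ∑ y, π x y * ‖ξ x - ζ y‖ ≤ L := by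
  rcases (hαm ▸ sum_nonneg fun x _ => hα x : 0 ≤ m).eq_or_lt with hm | hm
  · have hα0 := fun x =>
      (sum_eq_zero_iff_of_nonneg fun x _ => hα x).1 (hαm.trans hm.symm) x
        (mem_univ x)
    have hβ0 := fun y =>
      (sum_eq_zero_iff_of_nonneg fun y _ => hβ y).1 (hβm.trans hm.symm) y
        (mem_univ y)
    refine ⟨fun _ _ => 0, by simp, by simp [hα0], by simp [hβ0], ?_⟩
    simpa using h (fun _ => 0) ((LipschitzWith.const (0 : ℝ)).weaken zero_le_one)
  have hY : Nonempty Y := by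
    by_contra hY
    rw [not_nonempty_iff] at hY
    simp at hβm
    linarith
  let T : (X × Y → ℝ) →ₗ[ℝ] (X → ℝ) × (Y → ℝ) × ℝ :=
    { toFun := fun w => (fun x => m * ∑ y, w (x, y), fun y => m * ∑ x, w (x, y),
        m * ∑ x, ∑ y, w (x, y) * ‖ξ x - ζ y‖)
      map_add' := fun w w' => by
        ext <;> simp [sum_add_distrib, mul_add, add_mul]
      map_smul' := fun c w => by
        ext <;> simp [mul_sum, mul_left_comm, mul_assoc] }
  have hTc := T.continuous_of_finiteDimensional
  by_cases hd : Disjoint (T '' stdSimplex ℝ (X × Y))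
    {z | z.1 = α ∧ z.2.1 = β ∧ z.2.2 ≤ L}
  swap
  · obtain ⟨_, ⟨w, hw, rfl⟩, h1, h2, h3⟩ := Set.not_disjoint_iff.1 hd
    refine ⟨fun x y => m * w (x, y), fun x y => mul_nonneg hm.le (hw.1 _),
      fun x => ?_, fun y => ?_, ?_⟩
    · rw [← mul_sum]; exact congrFun h1 x
    · rw [← mul_sum]; exact congrFun h2 y
    · simp only [mul_assoc, ← mul_sum]
      exact h3
  exfalso
  have hD : IsClosed {z : (X → ℝ) × (Y → ℝ) × ℝ | z.1 = α ∧ z.2.1 = β ∧ z.2.2 ≤ L} :=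
    (isClosed_eq continuous_fst continuous_const).inter
      ((isClosed_eq (continuous_fst.comp continuous_snd) continuous_const).inter
        (isClosed_le (continuous_snd.comp continuous_snd) continuous_const))
  have hDc : Convex ℝ {z : (X → ℝ) × (Y → ℝ) × ℝ | z.1 = α ∧ z.2.1 = β ∧ z.2.2 ≤ L} := by
    rintro ⟨a, b, c⟩ ⟨rfl, rfl, hc⟩ ⟨a', b', c'⟩ ⟨h1, h2, hc'⟩ s t hs ht hst
    simp only at h1 h2 hc hc'
    subst h1 h2
    refine ⟨?_, ?_, ?_⟩
    · simp [← add_smul, hst]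
    · simp [← add_smul, hst]
    · simp only [Prod.snd_add, Prod.smul_snd, smul_eq_mul]
      calc s * c + t * c' ≤ s * L + t * L := by gcongr
        _ = L := by rw [← add_mul, hst, one_mul]
  obtain ⟨φ, u, v, hu, huv, hv⟩ := geometric_hahn_banach_compact_closed
    ((convex_stdSimplex ℝ (X × Y)).linear_image T)
    ((isCompact_stdSimplex ℝ (X × Y)).image hTc) hDc hD hd
  set Φ : X → ℝ := fun x => φ (Pi.single x 1, 0, 0) with hΦ
  set Ψ : Y → ℝ := fun y => φ (0, Pi.single y 1, 0) with hΨ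
  set c : ℝ := φ (0, 0, 1) with hc
  have hφ : ∀ a b k, φ (a, b, k) = ∑ x, a x * Φ x + ∑ y, b y * Ψ y + k * c := by
    intro a b k
    have e1 : ((a, b, k) : (X → ℝ) × (Y → ℝ) × ℝ) =
        ∑ x, a x • ((Pi.single x 1, 0, 0) : (X → ℝ) × (Y → ℝ) × ℝ)
          + ∑ y, b y • ((0, Pi.single y 1, 0) : (X → ℝ) × (Y → ℝ) × ℝ)
          + k • ((0, 0, 1) : (X → ℝ) × (Y → ℝ) × ℝ) := by
      ext <;> simp [Prod.fst_sum, Prod.snd_sum, Finset.sum_apply, Pi.single_apply]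
    rw [e1]
    simp only [map_add, map_sum, map_smul, smul_eq_mul, hΦ, hΨ, hc]
  have hvert : ∀ x y, m * (Φ x + Ψ y + ‖ξ x - ζ y‖ * c) < u := by
    intro x y
    have h1 := hu _ ⟨Pi.single (x, y) 1, single_mem_stdSimplex ℝ _, rfl⟩
    simp only [T, LinearMap.coe_mk, AddHom.coe_mk, hφ] at h1
    convert h1 using 1
    simp only [Pi.single_apply, Prod.mk.injEq, ite_and, mul_ite, ite_mul, zero_mul, one_mul,
      mul_zero, mul_one, Finset.sum_ite_irrel, Finset.sum_ite_eq', Finset.sum_const_zero,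
      mem_univ, if_true]
    ring
  have hprod := hu _ ⟨fun z => α z.1 * β z.2 / m ^ 2, ⟨fun z => by
    have := hα z.1; have := hβ z.2; positivity, by
    rw [Fintype.sum_prod_type]
    simp only [← sum_div, ← mul_sum, hβm, ← sum_mul, hαm]
    field_simp⟩, rfl⟩
  simp only [T, LinearMap.coe_mk, AddHom.coe_mk, ← sum_div, ← mul_sum, hβm,
    ← sum_mul, hαm] at hprod
  have e1 : (fun x => m * (α x * m / m ^ 2)) = α := by ext x; field_simp
  have e2 : (fun y => m * (m * β y / m ^ 2)) = β := by ext x; field_simp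
  rw [e1, e2, hφ] at hprod
  set A := ∑ x, α x * Φ x + ∑ y, β y * Ψ y with hA
  have hL := fun k hk => by
    have := hv (α, β, k) ⟨rfl, rfl, hk⟩
    rwa [hφ] at this
  have hcneg : c < 0 := by
    rcases lt_trichotomy c 0 with h0 | h0 | h0
    · exact h0
    · have := hL L le_rfl
      rw [h0] at this hprod
      linarith
    · have := hL (min L ((v - A) / c)) (min_le_left _ _)
      have h2 : min L ((v - A) / c) * c ≤ (v - A) / c * c :=
        mul_le_mul_of_nonneg_right (min_le_right _ _) h0.le
      rw [div_mul_cancel₀ _ h0.ne'] at h2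
      linarith
  set f : E → ℝ := fun z => univ.inf' univ_nonempty
    fun y => ‖z - ζ y‖ - Ψ y / (-c) with hf
  have hfl : LipschitzWith 1 f := lipschitzWith_inf'_norm_sub ζ _
  have h1 := h f hfl
  have h2 : ∀ y, f (ζ y) ≤ -(Ψ y / (-c)) := fun y => by
    refine (inf'_le _ (mem_univ y)).trans ?_
    simp
  have h3 : ∀ x, Φ x / (-c) - u / (m * (-c)) ≤ f (ξ x) := fun x => by
    obtain ⟨y, -, hy⟩ := Finset.exists_mem_eq_inf' univ_nonempty
      fun y => ‖ξ x - ζ y‖ - Ψ y / (-c)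
    simp only [hf]
    rw [hy, div_sub_div _ _ (by linarith) (by nlinarith), ← sub_nonneg]
    have := hvert x y
    have e : ‖ξ x - ζ y‖ - Ψ y / -c - (Φ x * (m * -c) - -c * u) / (-c * (m * -c))
        = (u - m * (Φ x + Ψ y + ‖ξ x - ζ y‖ * c)) / (m * (-c)) := by
      have := hcneg.ne
      field_simp
      ring
    rw [e]
    exact div_nonneg (by linarith) (by nlinarith)
  have h4 : ∑ x, α x * (Φ x / (-c) - u / (m * (-c))) ≤ ∑ x, α x * f (ξ x) :=
    sum_le_sum fun x _ => mul_le_mul_of_nonneg_left (h3 x) (hα x)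
  have h5 : ∑ y, β y * f (ζ y) ≤ ∑ y, β y * (-(Ψ y / (-c))) :=
    sum_le_sum fun y _ => mul_le_mul_of_nonneg_left (h2 y) (hβ y)
  have h6 : ∑ x, α x * (Φ x / (-c) - u / (m * (-c))) - ∑ y, β y * (-(Ψ y / (-c)))
      = (A - u) / (-c) := by
    simp only [mul_sub, sum_sub_distrib, ← sum_mul, hαm, mul_neg,
      Finset.sum_neg_distrib, hA, ← mul_div_assoc, ← sum_div]
    have := hcneg.ne
    field_simp
    ring
  have h7 := hL L le_rfl
  have h8 : L < (A - u) / (-c) := by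
    rw [lt_div_iff₀ (by linarith)]
    linarith
  linarith

end Kantorovich

section StepCoupling

variable {E : Type*} [NormedAddCommGroup E] [MeasurableSpace E] [BorelSpace E]
  [SecondCountableTopology E]

/-- An integrable random vector is close in `L¹` to one taking finitely many values. -/
lemma exists_finite_quantization [IsFiniteMeasure μ] {U : Ω → E} (hU : Measurable U)
    (hi : Integrable U μ) (hε : 0 < ε) :
    ∃ (N : ℕ) (Q : E → Fin N) (pt : Fin N → E), Measurable Q ∧
      ∫⁻ ω, ‖U ω - pt (Q (U ω))‖ₑ ∂μ ≤ ofReal ε := by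
  have hid : MemLp (id : E → E) 1 (μ.map U) := by
    rw [memLp_one_iff_integrable]
    exact (integrable_map_measure aestronglyMeasurable_id hU.aemeasurable).2 hi
  obtain ⟨g, hg, -⟩ := hid.exists_simpleFunc_eLpNorm_sub_lt (by simp)
    (ENNReal.ofReal_pos.2 hε).ne'
  refine ⟨_, fun x => g.range.equivFin ⟨g x, g.mem_range_self x⟩,
    fun i => (g.range.equivFin.symm i : E), ?_, ?_⟩
  · exact (measurable_of_countable _).comp (g.measurable.subtype_mk)
  · rw [eLpNorm_one_eq_lintegral_enorm] at hg
    rw [lintegral_map (by fun_prop (disch := exact g.measurable)) hU] at hg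
    simpa using hg.le

variable {T : Type*} [MeasurableSpace T] {ρ : Measure T}

lemma integrable_comp_fin [IsFiniteMeasure μ] (c : Fin k → ℝ) {r : Ω → Fin k} (hr : Measurable r) :
    Integrable (fun a => c (r a)) μ :=
  .of_bound ((measurable_of_countable c).comp hr).aestronglyMeasurable (∑ i, ‖c i‖)
    (ae_of_all _ fun a => single_le_sum (f := fun i => ‖c i‖) (fun _ _ => norm_nonneg _)
      (mem_univ (r a)))

lemma setIntegral_comp_fin [IsFiniteMeasure μ] (c : Fin k → ℝ) {r : Ω → Fin k} (hr : Measurable r)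
    (H : Set Ω) :
    ∫ a in H, c (r a) ∂μ = ∑ x, μ.real (H ∩ r ⁻¹' {x}) * c x := by
  rw [← integral_map hr.aemeasurable (measurable_of_countable c).aestronglyMeasurable,
    integral_fintype .of_finite]
  simp [map_measureReal_apply hr, measureReal_restrict_apply, hr (measurableSet_singleton _),
    inter_comm]

lemma sum_lintegral_cond [IsProbabilityMeasure ρ] {q : T → Fin N} (hq : Measurable q) (g : T → ℝ≥0∞)
    :
    ∑ y, ρ (q ⁻¹' {y}) * ∫⁻ t, g t ∂(ρ[|q ⁻¹' {y}]) = ∫⁻ t, g t ∂ρ := by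
  conv_rhs => rw [← sum_meas_smul_cond_fiber hq ρ]
  simp

/-- Coupling of a random vector, on an event `H`, with a target law, through a family of
conditional laws indexed by the quantization cell. -/
lemma exists_conditional_laws [IsProbabilityMeasure μ] [IsProbabilityMeasure ρ] {U : Ω → E}
    {S : T → E} {Ξ : Ω → ℝ} {H : Set Ω} {N' : ℕ} {Q : E → Fin N} {Q' : E → Fin N'} {pt : Fin N → E}
    {pt' : Fin N' → E} {ε' : ℝ} (hε' : 0 ≤ ε') (hU : Measurable U) (hUi : Integrable U μ)
    (hS : Measurable S) (hSi : Integrable S ρ) (hΞ : Integrable Ξ μ) (hH : MeasurableSet H)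
    (hQ : Measurable Q) (hQ' : Measurable Q') (hpt : Integrable (fun ω => U ω - pt (Q (U ω))) μ)
    (hpt' : ∫⁻ t, ‖S t - pt' (Q' (S t))‖ₑ ∂ρ ≤ ofReal ε')
    (h : ∀ f : E → ℝ, LipschitzWith 1 f →
      ∫ ω in H, (f (U ω) - ∫ t, f (S t) ∂ρ) ∂μ ≤ ∫ ω in H, Ξ ω ∂μ) :
    ∃ ν : Fin N → Measure T, (∀ x, IsProbabilityMeasure (ν x)) ∧
      (∀ g : T → ℝ≥0∞, ∑ x, μ (H ∩ (fun ω => Q (U ω)) ⁻¹' {x}) * ∫⁻ t, g t ∂(ν x)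
        = μ H * ∫⁻ t, g t ∂ρ) ∧
      ∑ x, μ (H ∩ (fun ω => Q (U ω)) ⁻¹' {x}) * ∫⁻ t, ‖pt x - S t‖ₑ ∂(ν x)
        ≤ ofReal (∫ ω in H, (Ξ ω + ‖U ω - pt (Q (U ω))‖ + 2 * ε') ∂μ) := by
  classical
  set q : Ω → Fin N := fun ω => Q (U ω) with hq
  set q' : T → Fin N' := fun t => Q' (S t) with hq'
  have hqm : Measurable q := hQ.comp hU
  have hqm' : Measurable q' := hQ'.comp hS
  set m : ℝ := μ.real H with hm
  set α : Fin N → ℝ := fun x => μ.real (H ∩ q ⁻¹' {x}) with hα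
  set β : Fin N' → ℝ := fun y => m * ρ.real (q' ⁻¹' {y}) with hβ
  have hHx := fun x =>
    hH.inter (hqm (measurableSet_singleton x))
  have hint : ∀ c : Fin N → ℝ, ∫ ω in H, c (q ω) ∂μ = ∑ x, α x * c x := fun c =>
    setIntegral_comp_fin c hqm H
  have hint' : ∀ c : Fin N' → ℝ, m * ∫ t, c (q' t) ∂ρ = ∑ y, β y * c y := fun c => by
    simpa [hβ, mul_sum, mul_assoc] using
      congrArg (m * ·) (setIntegral_comp_fin (μ := ρ) c hqm' Set.univ)
  have hαm : ∑ x, α x = m := by simpa using (hint fun _ => 1).symm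
  have hβm : ∑ y, β y = m := by simpa using (hint' fun _ => 1).symm
  have hpi : Integrable (fun t => S t - pt' (Q' (S t))) ρ :=
    ⟨(hS.sub ((measurable_of_countable pt').comp hqm')).aestronglyMeasurable,
      hpt'.trans_lt ofReal_lt_top⟩
  have hpr : ∫ t, ‖S t - pt' (Q' (S t))‖ ∂ρ ≤ ε' := by
    rw [integral_norm_eq_lintegral_enorm hpi.1]
    exact toReal_le_of_le_ofReal hε' hpt'
  set L : ℝ := ∫ ω in H, (Ξ ω + ‖U ω - pt (Q (U ω))‖ + ε') ∂μ with hL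
  obtain ⟨π, hπ0, hπα, hπβ, hπ⟩ := exists_coupling_of_forall_lipschitz (L := L)
    (fun x => measureReal_nonneg) (fun y => mul_nonneg measureReal_nonneg measureReal_nonneg)
    hαm hβm pt pt' (fun f hf => by
      rw [← hint, ← hint']
      have hfi := hf.integrable_comp hUi
      have hfi' := hf.integrable_comp hSi
      have hd := fun x y => by
        have := hf.dist_le_mul x y
        rw [dist_eq, coe_one, one_mul, dist_eq_norm] at this
        exact (le_abs_self _).trans this
      have h1 := h f hf
      rw [integral_sub hfi.integrableOn (integrable_const _).integrableOn, setIntegral_const,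
        smul_eq_mul, ← hm] at h1
      have i2 := hfi.add hpt.norm
      have h2 : ∫ ω in H, f (pt (q ω)) ∂μ ≤ ∫ ω in H, (f (U ω) + ‖U ω - pt (Q (U ω))‖) ∂μ := by
        refine setIntegral_mono (integrable_comp_fin (fun i => f (pt i)) hqm).integrableOn
          i2.integrableOn
          fun ω => ?_
        have := hd (pt (q ω)) (U ω)
        rw [norm_sub_rev] at this
        simp only [hq] at this ⊢
        linarith
      rw [integral_add hfi.integrableOn hpt.norm.integrableOn] at h2
      have i3 := hfi'.sub hpi.norm
      have h3 : ∫ t, (f (S t) - ‖S t - pt' (Q' (S t))‖) ∂ρ ≤ ∫ t, f (pt' (q' t)) ∂ρ := by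
        refine integral_mono i3 (integrable_comp_fin (fun i => f (pt' i)) hqm') fun t => ?_
        have := hd (S t) (pt' (q' t))
        simp only [hq'] at this ⊢
        linarith
      rw [integral_sub hfi' hpi.norm] at h3
      have i4 : Integrable (fun ω => Ξ ω + ‖U ω - pt (Q (U ω))‖) μ := hΞ.add hpt.norm
      rw [hL, integral_add i4.integrableOn (integrable_const _).integrableOn,
        integral_add hΞ.integrableOn hpt.norm.integrableOn, setIntegral_const, smul_eq_mul, ← hm]
      have hm0 : 0 ≤ m := measureReal_nonneg
      nlinarith)
  have hπz := fun x hx y =>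
    (sum_eq_zero_iff_of_nonneg fun y _ => hπ0 x y).1 ((hπα x).trans hx) y
      (mem_univ y)
  have hπz' : ∀ y, ρ (q' ⁻¹' {y}) = 0 → ∀ x, π x y = 0 := fun y hy x =>
    (sum_eq_zero_iff_of_nonneg fun x _ => hπ0 x y).1
      ((hπβ y).trans (by simp [measureReal_def, hy])) x (mem_univ x)
  have hαe : ∀ x, μ (H ∩ q ⁻¹' {x}) = ofReal (α x) := fun x => by
    simp [hα, ofReal_measureReal]
  let ν : Fin N → Measure T := fun x => if α x = 0 then ρ else
    ∑ y, ofReal (π x y / α x) • ρ[|q' ⁻¹' {y}]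
  have hstar : ∀ x (g : T → ℝ≥0∞), μ (H ∩ q ⁻¹' {x}) * ∫⁻ t, g t ∂(ν x)
      = ∑ y, ofReal (π x y) * ∫⁻ t, g t ∂(ρ[|q' ⁻¹' {y}]) := by
    intro x g
    rw [hαe]
    by_cases hx : α x = 0
    · simp [hx, hπz x hx]
    have hx' := lt_of_le_of_ne measureReal_nonneg (Ne.symm hx)
    simp only [ν, if_neg hx, lintegral_finsetSum_measure, lintegral_smul_measure, smul_eq_mul,
      mul_sum]
    refine sum_congr rfl fun y _ => ?_
    rw [← mul_assoc, ← ofReal_mul hx'.le, mul_div_cancel₀ _ hx]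
  have hcol : ∀ g : T → ℝ≥0∞,
      ∑ x, ∑ y, ofReal (π x y) * ∫⁻ t, g t ∂(ρ[|q' ⁻¹' {y}]) = μ H * ∫⁻ t, g t ∂ρ := by
    intro g
    rw [sum_comm, ← sum_lintegral_cond hqm' g, mul_sum]
    refine sum_congr rfl fun y _ => ?_
    rw [← sum_mul, ← ofReal_sum_of_nonneg fun x _ => hπ0 x y, hπβ,
      ofReal_mul measureReal_nonneg, ofReal_measureReal, ofReal_measureReal,
      mul_assoc]
  refine ⟨ν, fun x => ?_, fun g => ?_, ?_⟩
  · by_cases hx : α x = 0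
    · simp only [ν, if_pos hx]; infer_instance
    have hx' := lt_of_le_of_ne measureReal_nonneg (Ne.symm hx)
    constructor
    simp only [ν, if_neg hx, Measure.coe_finsetSum, Finset.sum_apply, Measure.smul_apply,
      smul_eq_mul]
    have : ∀ y, ofReal (π x y / α x) * ρ[|q' ⁻¹' {y}] Set.univ
        = ofReal (π x y / α x) := fun y => by
      by_cases hy : ρ (q' ⁻¹' {y}) = 0
      · simp [hπz' y hy x]
      · have := cond_isProbabilityMeasure hy
        simp
    simp only [this]
    rw [← ofReal_sum_of_nonneg fun y _ => div_nonneg (hπ0 x y) hx'.le,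
      ← sum_div, hπα, div_self hx, ofReal_one]
  · simp only [hstar]
    exact hcol g
  · simp only [hstar]
    have h1 : ∀ x y, ofReal (π x y) * ∫⁻ t, ‖pt x - S t‖ₑ ∂(ρ[|q' ⁻¹' {y}])
        ≤ ofReal (π x y * ‖pt x - pt' y‖)
          + ofReal (π x y) * ∫⁻ t, ‖S t - pt' (Q' (S t))‖ₑ ∂(ρ[|q' ⁻¹' {y}]) := by
      intro x y
      rw [ofReal_mul (hπ0 x y), ← mul_add]
      gcongr
      have hae : ∀ᵐ t ∂(ρ[|q' ⁻¹' {y}]),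
          ‖pt x - S t‖ₑ ≤ ‖pt x - pt' y‖ₑ + ‖S t - pt' (Q' (S t))‖ₑ := by
        filter_upwards [ae_cond_mem (μ := ρ) (hqm' (measurableSet_singleton y))] with t ht
        have ht' : Q' (S t) = y := ht
        rw [ht', ← enorm_neg (S t - pt' y), neg_sub]
        calc ‖pt x - S t‖ₑ = ‖(pt x - pt' y) + (pt' y - S t)‖ₑ := by rw [sub_add_sub_cancel]
          _ ≤ _ := enorm_add_le _ _
      refine (lintegral_mono_ae hae).trans ?_
      rw [lintegral_add_left measurable_const, lintegral_const, ← ofReal_norm]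
      gcongr
      exact mul_le_of_le_one_right' prob_le_one
    refine (sum_le_sum fun x _ => sum_le_sum fun y _ => h1 x y).trans ?_
    simp only [sum_add_distrib]
    rw [hcol]
    have h2 : μ H * ∫⁻ t, ‖S t - pt' (Q' (S t))‖ₑ ∂ρ ≤ ofReal (m * ε') := by
      rw [ofReal_mul measureReal_nonneg, ofReal_measureReal]
      gcongr
    have h3 : ∑ x, ∑ y, ofReal (π x y * ‖pt x - pt' y‖)
        = ofReal (∑ x, ∑ y, π x y * ‖pt x - pt' y‖) := by
      have hn : ∀ x y, 0 ≤ π x y * ‖pt x - pt' y‖ := fun x y =>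
        mul_nonneg (hπ0 x y) (norm_nonneg _)
      rw [ofReal_sum_of_nonneg fun x _ => sum_nonneg fun y _ => hn x y]
      exact sum_congr rfl fun x _ =>
        (ofReal_sum_of_nonneg fun y _ => hn x y).symm
    rw [h3]
    refine (add_le_add le_rfl h2).trans ?_
    rw [← ofReal_add (sum_nonneg fun x _ => sum_nonneg fun y _ =>
      mul_nonneg (hπ0 x y) (norm_nonneg _)) (mul_nonneg measureReal_nonneg hε')]
    refine ofReal_le_ofReal ((add_le_add_left hπ _).trans_eq ?_)
    have i4 : Integrable (fun ω => Ξ ω + ‖U ω - pt (Q (U ω))‖) μ := hΞ.add hpt.norm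
    rw [hL, integral_add i4.integrableOn (integrable_const _).integrableOn,
      integral_add i4.integrableOn (integrable_const _).integrableOn, setIntegral_const,
      setIntegral_const, smul_eq_mul, smul_eq_mul, ← hm]
    ring

lemma lintegral_comp_fin {q : Ω → Fin N} (hq : Measurable q) (H : Set Ω) (c : Fin N → ℝ≥0∞) :
    ∫⁻ ω in H, c (q ω) ∂μ = ∑ x, μ (H ∩ q ⁻¹' {x}) * c x := by
  rw [← lintegral_map (measurable_of_countable c) hq, lintegral_fintype]
  simp [Measure.map_apply hq, Measure.restrict_apply, hq (measurableSet_singleton _), inter_comm,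
    mul_comm]

/-- Given a discrete history `h`, the random vector `U` is coupled with the target law `ρ`, so
that the target variable is independent of `h` and close to `U` in mean. -/
theorem exists_step_coupling [StandardBorelSpace T] [Nonempty T] [IsProbabilityMeasure μ]
    [IsProbabilityMeasure ρ] {U : Ω → E} {S : T → E} {Ξ : Ω → ℝ} {Q : E → Fin N} {pt : Fin N → E}
    {h : Ω → ℕ} (hε : 0 < ε) (hU : Measurable U) (hUi : Integrable U μ) (hS : Measurable S)
    (hSi : Integrable S ρ) (hΞ : Integrable Ξ μ) (hh : Measurable h) (hQ : Measurable Q)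
    (hpt : Integrable (fun ω => U ω - pt (Q (U ω))) μ)
    (hf : ∀ f : E → ℝ, LipschitzWith 1 f → ∀ k,
      ∫ ω in h ⁻¹' {k}, (f (U ω) - ∫ t, f (S t) ∂ρ) ∂μ ≤ ∫ ω in h ⁻¹' {k}, Ξ ω ∂μ) :
    ∃ F : ℕ × Fin N → unitInterval → T, Measurable (uncurry F) ∧
      (∀ k B, MeasurableSet B → (μ.prod volume)
        {z : Ω × unitInterval | h z.1 = k ∧ F (h z.1, Q (U z.1)) z.2 ∈ B}
          = μ (h ⁻¹' {k}) * ρ B) ∧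
      ∫⁻ z, ‖pt (Q (U z.1)) - S (F (h z.1, Q (U z.1)) z.2)‖ₑ ∂(μ.prod volume)
        ≤ ofReal (∫ ω, (Ξ ω + ‖U ω - pt (Q (U ω))‖ + 2 * ε) ∂μ) := by
  obtain ⟨N', Q', pt', hQ', hpt'⟩ := exists_finite_quantization hS hSi hε
  have hhk := fun k => hh (measurableSet_singleton k)
  choose ν hν hν1 hν2 using fun k => exists_conditional_laws (H := h ⁻¹' {k}) hε.le hU hUi hS
    hSi hΞ (hhk k) hQ hQ' hpt hpt' (fun f hfl => hf f hfl k)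
  let κ : Kernel (ℕ × Fin N) T := ⟨fun z => ν z.1 z.2, Measurable.of_discrete⟩
  have hκ : IsMarkovKernel κ := ⟨fun z => hν z.1 z.2⟩
  obtain ⟨F, hF, hFκ⟩ := κ.exists_measurable_map_eq_unitInterval
  have hq : Measurable fun ω => Q (U ω) := hQ.comp hU
  have hFz :=
    hF.comp (((hh.comp measurable_fst).prodMk (hq.comp measurable_fst)).prodMk measurable_snd)
  have hFx : ∀ z, Measurable (F z) := fun z => hF.comp measurable_prodMk_left
  have hinner : ∀ (k : ℕ) (x : Fin N) (g : T → ℝ≥0∞), Measurable g →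
      ∫⁻ η, g (F (k, x) η) = ∫⁻ t, g t ∂(ν k x) := fun k x g hg => by
    rw [← lintegral_map hg (hFx _), hFκ]; rfl
  have hslice : ∀ (k : ℕ) (g : Fin N → T → ℝ≥0∞), (∀ x, Measurable (g x)) →
      ∫⁻ ω in h ⁻¹' {k}, (∫⁻ η, g (Q (U ω)) (F (h ω, Q (U ω)) η)) ∂μ
        = ∑ x, μ (h ⁻¹' {k} ∩ (fun ω => Q (U ω)) ⁻¹' {x}) * ∫⁻ t, g x t ∂(ν k x) := by
    intro k g hg
    rw [← lintegral_comp_fin hq (h ⁻¹' {k}) fun x => ∫⁻ t, g x t ∂(ν k x)]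
    refine setLIntegral_congr_fun (hhk k) fun ω hω => ?_
    have hω' : h ω = k := hω
    simp only [hω']
    exact hinner k _ _ (hg _)
  refine ⟨F, hF, fun k B hB => ?_, ?_⟩
  · have hm : MeasurableSet {z : Ω × unitInterval | h z.1 = k ∧ F (h z.1, Q (U z.1)) z.2 ∈ B} :=
      (hh.comp measurable_fst (measurableSet_singleton k)).inter (hFz hB)
    rw [Measure.prod_apply hm]
    have := hslice k (fun _ => B.indicator 1) fun _ => measurable_one.indicator hB
    rw [hν1 k, lintegral_indicator_one hB] at this
    rw [← this, ← lintegral_indicator (hhk k)]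
    refine lintegral_congr fun ω => ?_
    by_cases hω : h ω = k
    · rw [indicator_of_mem (show ω ∈ h ⁻¹' {k} from hω), show Prod.mk ω ⁻¹' _ =
        F (h ω, Q (U ω)) ⁻¹' B by ext; simp [hω], ← lintegral_indicator_one (hFx _ hB)]
      rfl
    · simp [hω]
  · have hmeas : Measurable fun z : Ω × unitInterval =>
        ‖pt (Q (U z.1)) - S (F (h z.1, Q (U z.1)) z.2)‖ₑ :=
      ((((measurable_of_countable pt).comp hq).comp measurable_fst).sub (hS.comp hFz)).enorm
    have hun : ⋃ k, h ⁻¹' {k} = Set.univ := by ext; simp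
    have hdis : Pairwise (onFun Disjoint fun k => h ⁻¹' {k}) := fun i j hij =>
      disjoint_left.2 fun ω h1 h2 => hij (h1.symm.trans h2)
    have hti : Integrable (fun ω => Ξ ω + ‖U ω - pt (Q (U ω))‖ + 2 * ε) μ :=
      (hΞ.add hpt.norm).add (integrable_const _)
    have hnn : ∀ k, 0 ≤ ∫ ω in h ⁻¹' {k}, (Ξ ω + ‖U ω - pt (Q (U ω))‖ + 2 * ε) ∂μ := by
      intro k
      have h0 := hf (fun _ => 0) ((LipschitzWith.const (0 : ℝ)).weaken zero_le_one) k
      simp only [integral_zero, sub_zero] at h0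
      refine h0.trans (setIntegral_mono hΞ.integrableOn hti.integrableOn fun ω => ?_)
      have := norm_nonneg (U ω - pt (Q (U ω)))
      linarith
    have hsum := hasSum_integral_iUnion (μ := μ) hhk hdis hti.integrableOn
    rw [hun, setIntegral_univ] at hsum
    rw [lintegral_prod _ hmeas.aemeasurable, ← setLIntegral_univ, ← hun,
      lintegral_iUnion hhk hdis, ← hsum.tsum_eq, ENNReal.ofReal_tsum_of_nonneg hnn hsum.summable]
    refine tsum_le_tsum fun k => ?_
    rw [hslice k (fun x t => ‖pt x - S t‖ₑ) fun x => (measurable_const.sub hS).enorm]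
    exact hν2 k

end StepCoupling

section

/-- Keep the coordinates with index below `k`. -/
def truncSeq (k : ℕ) (η : 𝕌) : 𝕌 := fun j => if j < k then η j else 0

@[fun_prop]
lemma measurable_truncSeq (k : ℕ) : Measurable (truncSeq k) :=
  measurable_pi_iff.2 fun j => by unfold truncSeq; split_ifs <;> fun_prop

lemma truncSeq_truncSeq (h : k ≤ n) (η : 𝕌) :
    truncSeq k (truncSeq n η) = truncSeq k η := by
  funext j
  grind [truncSeq]

/-- The law of an i.i.d. sequence of uniform variables. -/
abbrev uniformSeq : Measure 𝕌 := Measure.infinitePi fun _ => volume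

lemma indepFun_truncSeq (k : ℕ) :
    IndepFun (truncSeq k) (fun η : 𝕌 => η k) uniformSeq := by
  have h := iIndepFun_infinitePi (P := fun _ : ℕ => (volume : Measure unitInterval))
    (X := fun _ x => x) (fun _ => measurable_id)
  have h2 := h.indepFun_finset (range k) {k} (by simp) (fun i => measurable_pi_apply i)
  have hψ : Measurable fun f : ({k} : Finset ℕ) → unitInterval => f ⟨k, by simp⟩ :=
    measurable_pi_apply _
  convert h2.comp (φ := fun (f : range k → unitInterval) (j : ℕ) =>
      if hj : j ∈ range k then f ⟨j, hj⟩ else 0)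
    (measurable_pi_iff.2 fun j => by split_ifs <;> fun_prop) hψ using 1
  · funext η j
    simp [truncSeq]
  · rfl

lemma prod_uniformSeq_apply (k : ℕ) {C : Set 𝕌} (hC : MeasurableSet C)
    {A : Set (Ω × unitInterval)} (hA : MeasurableSet A) :
    (μ.prod uniformSeq) {z | truncSeq k z.2 ∈ C ∧ (z.1, z.2 k) ∈ A}
      = uniformSeq (truncSeq k ⁻¹' C) * (μ.prod volume) A := by
  have hm : Measurable fun z : Ω × 𝕌 => (z.1, z.2 k) := by fun_prop
  have hms : MeasurableSet {z : Ω × 𝕌 | truncSeq k z.2 ∈ C ∧ (z.1, z.2 k) ∈ A} :=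
    ((measurable_truncSeq k).comp measurable_snd hC).inter (hm hA)
  rw [Measure.prod_apply hms, Measure.prod_apply hA,
    ← lintegral_const_mul _ (measurable_measure_prodMk_left hA)]
  refine lintegral_congr fun ω => ?_
  have hB : MeasurableSet (Prod.mk ω ⁻¹' A) := measurable_prodMk_left hA
  have h := (indepFun_truncSeq k).measure_inter_preimage_eq_mul C _ hC hB
  have h2 : uniformSeq ((fun η : 𝕌 => η k) ⁻¹' (Prod.mk ω ⁻¹' A))
      = volume (Prod.mk ω ⁻¹' A) := by
    rw [← Measure.map_apply (measurable_pi_apply k) hB, Measure.infinitePi_map_eval]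
  rw [h2] at h
  exact h

lemma measurePreserving_fst_eval (k : ℕ) :
    MeasurePreserving (fun z : Ω × 𝕌 => (z.1, z.2 k)) (μ.prod uniformSeq)
      (μ.prod volume) := by
  have hm : Measurable fun z : Ω × 𝕌 => (z.1, z.2 k) := by fun_prop
  refine ⟨hm, Measure.ext fun A hA => ?_⟩
  rw [Measure.map_apply hm hA]
  have h := prod_uniformSeq_apply (μ := μ) k MeasurableSet.univ hA
  simp only [Set.mem_univ, true_and, Set.preimage_univ, measure_univ, one_mul] at h
  exact h

variable [IsProbabilityMeasure μ]

/-- Integer code of the first `k` terms of a sequence of integers. -/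
def historyCode (q : ℕ → Ω → ℕ) : ℕ → Ω → ℕ
  | 0, _ => 0
  | k + 1, ω => pair (historyCode q k ω) (q k ω)

/-- Information carried by the history code and the first `k` uniform variables. -/
abbrev historyAlg (q : ℕ → Ω → ℕ) (k : ℕ) : MeasurableSpace (Ω × 𝕌) :=
  MeasurableSpace.comap (fun z => (historyCode q k z.1, truncSeq k z.2)) inferInstance

lemma measurable_historyCode {𝒢 : ℕ → MeasurableSpace Ω} (hmono : Monotone 𝒢) {q : ℕ → Ω → ℕ}
    (hq : ∀ k, Measurable[𝒢 (k + 1)] (q k)) : ∀ k, Measurable[𝒢 k] (historyCode q k)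
  | 0 => measurable_const
  | k + 1 => by
    have h1 : Measurable[𝒢 (k + 1)] (historyCode q k) :=
      (measurable_historyCode hmono hq k).mono (hmono k.le_succ) le_rfl
    exact (Measurable.of_discrete (f := fun x : ℕ × ℕ => pair x.1 x.2)).comp (h1.prodMk (hq k))

lemma historyAlg_le_succ (q : ℕ → Ω → ℕ) (k : ℕ) : historyAlg q k ≤ historyAlg q (k + 1) := by
  rintro _ ⟨D, hD, rfl⟩
  refine ⟨(fun x : ℕ × 𝕌 => (x.1.unpair.1, truncSeq k x.2)) ⁻¹' D, ?_, ?_⟩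
  · exact ((Measurable.of_discrete (f := fun x : ℕ => x.unpair.1)).comp measurable_fst).prodMk
      (by fun_prop) hD
  · ext z
    simp [historyCode, truncSeq_truncSeq k.le_succ]

lemma historyAlg_mono (q : ℕ → Ω → ℕ) : Monotone (historyAlg q) :=
  monotone_nat_of_le_succ (historyAlg_le_succ q)

lemma historyAlg_le {q : ℕ → Ω → ℕ} (hq : ∀ k, Measurable (historyCode q k)) (k : ℕ) :
    historyAlg q k ≤ Prod.instMeasurableSpace := by
  rw [historyAlg, ← measurable_iff_comap_le]
  exact ((hq k).comp measurable_fst).prodMk (by fun_prop)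

lemma measurable_historyAlg_code (q : ℕ → Ω → ℕ) (k : ℕ) :
    Measurable[historyAlg q (k + 1)] fun z : Ω × 𝕌 =>
      ((historyCode q k z.1, q k z.1), z.2 k) := by
  have h : Measurable[historyAlg q (k + 1)] fun z : Ω × 𝕌 =>
      (historyCode q (k + 1) z.1, truncSeq (k + 1) z.2) := comap_measurable _
  have h2 : Measurable fun x : ℕ × 𝕌 => ((x.1.unpair.1, x.1.unpair.2), x.2 k) :=
    ((Measurable.of_discrete (f := fun x : ℕ => (x.unpair.1, x.unpair.2))).comp
      measurable_fst).prodMk (by fun_prop)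
  convert h2.comp h using 1
  funext z
  simp [historyCode, truncSeq]

/-- Integrals of centred variables over the history vanish. -/
lemma setIntegral_historyAlg_eq_zero {𝒢 : ℕ → MeasurableSpace Ω} {q : ℕ → Ω → ℕ} (hle : 𝒢 k ≤ mΩ)
    (hq : Measurable[𝒢 k] (historyCode q k)) (hg : Integrable g μ)
    (h0 : ∀ A, MeasurableSet[𝒢 k] A → ∫ ω in A, g ω ∂μ = 0) {A : Set (Ω × 𝕌)}
    (hA : MeasurableSet[historyAlg q k] A) :
    ∫ z in A, g z.1 ∂(μ.prod uniformSeq) = 0 := by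
  obtain ⟨D, hD, rfl⟩ := hA
  have hmeas : Measurable fun z : Ω × 𝕌 =>
      (historyCode q k z.1, truncSeq k z.2) :=
    ((hq.mono hle le_rfl).comp measurable_fst).prodMk (by fun_prop)
  have hgi : Integrable (fun z : Ω × 𝕌 => g z.1) (μ.prod uniformSeq) := hg.comp_fst _
  rw [← integral_indicator (hmeas hD), integral_prod_symm _ (hgi.indicator (hmeas hD))]
  refine integral_eq_zero_of_ae (ae_of_all _ fun η => ?_)
  have hs : MeasurableSet[𝒢 k] {ω | (historyCode q k ω, truncSeq k η) ∈ D} :=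
    (hq.prodMk measurable_const) hD
  have := h0 _ hs
  rw [← integral_indicator (hle _ hs)] at this
  exact this

/-- Successive couplings of the variables `U k` with independent copies of `ρ`. -/
theorem exists_gluing {E : Type*} [NormedAddCommGroup E] [MeasurableSpace E]
    [BorelSpace E] [SecondCountableTopology E] {T : Type*} [MeasurableSpace T]
    [StandardBorelSpace T] [Nonempty T] {ρ : Measure T} [IsProbabilityMeasure ρ]
    {𝒢 : ℕ → MeasurableSpace Ω} (hmono : Monotone 𝒢) (hle : ∀ k, 𝒢 k ≤ mΩ)
    {U : ℕ → Ω → E} {S : ℕ → T → E} {Ξ : ℕ → Ω → ℝ} {ε : ℕ → ℝ} (hε : ∀ k, 0 < ε k)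
    (hU : ∀ k, Measurable[𝒢 (k + 1)] (U k)) (hUi : ∀ k, Integrable (U k) μ)
    (hS : ∀ k, Measurable (S k)) (hSi : ∀ k, Integrable (S k) ρ) (hΞ : ∀ k, Integrable (Ξ k) μ)
    (hf : ∀ k, ∀ f : E → ℝ, LipschitzWith 1 f → ∀ A, MeasurableSet[𝒢 k] A →
      ∫ ω in A, (f (U k ω) - ∫ t, f (S k t) ∂ρ) ∂μ ≤ ∫ ω in A, Ξ k ω ∂μ) :
    ∃ (H : ℕ → MeasurableSpace (Ω × 𝕌))
      (V : ℕ → Ω × 𝕌 → T) (W : ℕ → Ω × 𝕌 → E),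
      Monotone H ∧ (∀ k, H k ≤ Prod.instMeasurableSpace) ∧
      (∀ k, Measurable[H (k + 1)] (V k)) ∧ (∀ k, Measurable[H (k + 1)] (W k)) ∧
      (∀ k A B, MeasurableSet[H k] A → MeasurableSet B →
        (μ.prod uniformSeq) (A ∩ V k ⁻¹' B) = (μ.prod uniformSeq) A * ρ B) ∧
      (∀ k, ∀ g : Ω → ℝ, Integrable g μ → (∀ A, MeasurableSet[𝒢 k] A → ∫ ω in A, g ω ∂μ = 0) →
        ∀ A, MeasurableSet[H k] A → ∫ z in A, g z.1 ∂(μ.prod uniformSeq) = 0) ∧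
      (∀ k, ∫⁻ z, ‖U k z.1 - W k z‖ₑ ∂(μ.prod uniformSeq) ≤ ofReal (ε k)) ∧
      (∀ k, ∫⁻ z, ‖W k z - S k (V k z)‖ₑ ∂(μ.prod uniformSeq)
        ≤ ofReal (∫ ω, Ξ k ω ∂μ + 3 * ε k)) := by
  have hU' := fun k => (hU k).mono (hle _) le_rfl
  choose N Q pt hQ hpt using fun k => exists_finite_quantization (hU' k) (hUi k) (hε k)
  let q : ℕ → Ω → ℕ := fun k ω => Q k (U k ω)
  have hval : ∀ n, Measurable fun i : Fin n => (i : ℕ) := fun n => Measurable.of_discrete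
  have hq := fun k => (hval _).comp ((hQ k).comp (hU k))
  have hh := measurable_historyCode hmono hq
  have hh' : ∀ k, Measurable (historyCode q k) := fun k => (hh k).mono (hle k) le_rfl
  have hpti : ∀ k, Integrable (fun ω => U k ω - pt k (Q k (U k ω))) μ := fun k =>
    ⟨((hUi k).aestronglyMeasurable.sub ((Measurable.of_discrete (f := pt k)).comp
      ((hQ k).comp (hU' k))).aestronglyMeasurable), (hpt k).trans_lt ofReal_lt_top⟩
  choose F hF hF1 hF2 using fun k => exists_step_coupling (hε k) (hU' k) (hUi k) (hS k) (hSi k)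
    (hΞ k) (hh' k) (hQ k) (hpti k)
    (fun f hfl i => hf k f hfl _ (hh k (measurableSet_singleton i)))
  have hFU := fun k =>
    (hF k).comp ((((hh' k).comp measurable_fst).prodMk
      (((hQ k).comp (hU' k)).comp measurable_fst)).prodMk measurable_snd)
  have hcode := measurable_historyAlg_code q
  have hQm : ∀ k, Measurable[historyAlg q (k + 1)] fun z : Ω × 𝕌 =>
      Q k (U k z.1) := fun k s _ => by
    convert (measurable_snd.comp measurable_fst).comp (hcode k) (t := Fin.val '' s) .of_discrete
      using 1
    ext z
    simp [q, Fin.val_inj]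
  have hWint : ∀ k, ∫ ω, (Ξ k ω + ‖U k ω - pt k (Q k (U k ω))‖ + 2 * ε k) ∂μ
      ≤ ∫ ω, Ξ k ω ∂μ + 3 * ε k := fun k => by
    have h1 : Integrable (fun ω => Ξ k ω + ‖U k ω - pt k (Q k (U k ω))‖) μ :=
      (hΞ k).add (hpti k).norm
    rw [integral_add h1 (integrable_const _), integral_add (hΞ k) (hpti k).norm]
    have h2 : ∫ ω, ‖U k ω - pt k (Q k (U k ω))‖ ∂μ ≤ ε k := by
      rw [integral_norm_eq_lintegral_enorm (hpti k).aestronglyMeasurable]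
      exact toReal_le_of_le_ofReal (hε k).le (hpt k)
    simp
    linarith
  refine ⟨historyAlg q, fun k z => F k (historyCode q k z.1, Q k (U k z.1)) (z.2 k),
    fun k z => pt k (Q k (U k z.1)), historyAlg_mono q, historyAlg_le hh', ?_, ?_, ?_, ?_, ?_, ?_⟩
  · intro k
    exact (hF k).comp ((((measurable_fst.comp measurable_fst).comp (hcode k)).prodMk
      (hQm k)).prodMk (measurable_snd.comp (hcode k)))
  · intro k
    exact (Measurable.of_discrete (f := pt k)).comp (hQm k)
  · rintro k _ B ⟨D, hD, rfl⟩ hB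
    have hDi : ∀ i, MeasurableSet (Prod.mk i ⁻¹' D) := fun i => measurable_prodMk_left hD
    have key : ∀ B : Set T, MeasurableSet B → (μ.prod uniformSeq)
        ((fun z => (historyCode q k z.1, truncSeq k z.2)) ⁻¹' D ∩
          (fun z => F k (historyCode q k z.1, Q k (U k z.1)) (z.2 k)) ⁻¹' B)
        = ∑' i, uniformSeq (truncSeq k ⁻¹' (Prod.mk i ⁻¹' D))
            * (μ (historyCode q k ⁻¹' {i}) * ρ B) := by
      intro B hB
      have hAi : ∀ i, MeasurableSet {z : Ω × unitInterval | historyCode q k z.1 = i ∧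
          F k (historyCode q k z.1, Q k (U k z.1)) z.2 ∈ B} := fun i =>
        (measurable_fst (hh' k (measurableSet_singleton i))).inter (hFU k hB)
      simp_rw [← hF1 k _ B hB, ← prod_uniformSeq_apply (μ := μ) k (hDi _) (hAi _)]
      rw [← measure_iUnion]
      · congr 1
        ext z
        simp
      · intro i j hij
        exact disjoint_left.2 fun z hz hz' => hij (hz.2.1.symm.trans hz'.2.1)
      · intro i
        exact ((measurable_truncSeq k).comp measurable_snd (hDi i)).inter
          ((measurePreserving_fst_eval (μ := μ) k).measurable (hAi i))
    have h1 := key Set.univ MeasurableSet.univ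
    simp only [Set.preimage_univ, Set.inter_univ, measure_univ, mul_one] at h1
    rw [key B hB, h1, ← ENNReal.tsum_mul_right]
    simp_rw [mul_assoc]
  · intro k g hg h0 A hA
    exact setIntegral_historyAlg_eq_zero (hle k) (hh k) hg h0 hA
  · intro k
    exact (measurePreserving_fst.lintegral_comp ((hU' k).sub ((Measurable.of_discrete
      (f := pt k)).comp ((hQ k).comp (hU' k)))).enorm).trans_le (hpt k)
  · intro k
    have hmm := (((Measurable.of_discrete (f := pt k)).comp
      (((hQ k).comp (hU' k)).comp measurable_fst)).sub ((hS k).comp (hFU k))).enorm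
    exact (((measurePreserving_fst_eval k).lintegral_comp hmm).trans_le (hF2 k)).trans
      (ofReal_le_ofReal (hWint k))

end

/-- The law of an i.i.d. sequence of standard Gaussian vectors. -/
abbrev gaussSeq (ι : Type*) [Fintype ι] : Measure (ℕ → 𝔼 ι) :=
  Measure.infinitePi fun _ => stdG ι

/-- The σ-algebra of the coordinates with index below `n`. -/
abbrev coordAlg (ι : Type*) [Fintype ι] (n : ℕ) : MeasurableSpace (ℕ → 𝔼 ι) :=
  MeasurableSpace.comap (fun t (j : range n) => t j) inferInstance

lemma coordAlg_le (n : ℕ) : coordAlg ι n ≤ MeasurableSpace.pi := by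
  rw [coordAlg, ← measurable_iff_comap_le]
  exact measurable_pi_iff.2 fun j => measurable_pi_apply _

lemma measurable_coordAlg (h : j < n) :
    Measurable[coordAlg ι n] fun t : ℕ → 𝔼 ι => t j := by
  have h1 : Measurable[coordAlg ι n] fun (t : ℕ → 𝔼 ι) (j : range n) => t j :=
    comap_measurable _
  have h2 : Measurable fun f : range n → 𝔼 ι =>
      f ⟨j, mem_range.2 h⟩ := measurable_pi_apply _
  exact h2.comp h1

lemma coordAlg_mono : Monotone (coordAlg ι) := by
  intro m n h
  have h1 : Measurable[coordAlg ι n] fun (t : ℕ → 𝔼 ι) (j : range m) => t j :=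
    @measurable_pi_lambda _ _ _ (coordAlg ι n) _ _ fun j =>
      measurable_coordAlg ((mem_range.1 j.2).trans_le h)
  exact measurable_iff_comap_le.1 h1

lemma measurePreserving_eval_gaussSeq (j : ℕ) :
    MeasurePreserving (fun t : ℕ → 𝔼 ι => t j) (gaussSeq ι) (stdG ι) :=
  ⟨measurable_pi_apply j, Measure.infinitePi_map_eval (fun _ : ℕ => stdG ι) j⟩

lemma indep_coordAlg (h : n ≤ j) :
    Indep (MeasurableSpace.comap (fun t : ℕ → 𝔼 ι => t j) inferInstance)
      (coordAlg ι n) (gaussSeq ι) := by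
  have h1 := iIndepFun_infinitePi (P := fun _ : ℕ => stdG ι)
    (X := fun _ x => x) (fun _ => measurable_id)
  have h2 := h1.indepFun_finset (range n) {j}
    (by simpa using h) (fun i => measurable_pi_apply i)
  have hψ : Measurable fun f : ({j} : Finset ℕ) → 𝔼 ι => f ⟨j, by simp⟩ :=
    measurable_pi_apply _
  exact (h2.comp measurable_id hψ).symm

lemma integrable_comp_eval {g : 𝔼 ι → ℝ} (hg : Integrable g (stdG ι)) (j : ℕ) :
    Integrable (fun t : ℕ → 𝔼 ι => g (t j)) (gaussSeq ι) :=
  (measurePreserving_eval_gaussSeq j).integrable_comp_of_integrable hg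

lemma integral_comp_eval {g : 𝔼 ι → ℝ} (hg : StronglyMeasurable g) (j : ℕ) :
    ∫ t, g (t j) ∂(gaussSeq ι) = ∫ z, g z ∂(stdG ι) := by
  rw [← (measurePreserving_eval_gaussSeq (ι := ι) j).map_eq,
    integral_map (measurable_pi_apply j).aemeasurable hg.aestronglyMeasurable]

lemma condExp_comp_eval {g : 𝔼 ι → ℝ} (hg : Measurable g) (h : n ≤ j) :
    (gaussSeq ι)[fun t => g (t j) | coordAlg ι n] =ᵐ[gaussSeq ι] fun _ => ∫ z, g z ∂(stdG ι) := by
  rw [← integral_comp_eval hg.stronglyMeasurable j]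
  refine condExp_indep_eq (m₁ := MeasurableSpace.comap
      (fun t : ℕ → 𝔼 ι => t j) inferInstance) ?_ (coordAlg_le n) ?_
    (indep_coordAlg h)
  · rw [← measurable_iff_comap_le]; exact measurable_pi_apply j
  · exact (hg.comp (comap_measurable _)).stronglyMeasurable

lemma integrable_coord_sq_sub_one (u : ι) :
    Integrable (fun z : 𝔼 ι => z u ^ 2 - 1) (stdG ι) := by
  have h := integrable_gHerm u u
  convert h using 2 with z
  simp [gHerm, sq]

lemma integral_coord_sq_sub_one (u : ι) :
    ∫ z : 𝔼 ι, (z u ^ 2 - 1) ∂(stdG ι) = 0 := by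
  have h := integral_gHerm u u
  simpa [gHerm, sq] using h

lemma isMDS_gaussSeq (u : ι) :
    IsMDS (gaussSeq ι) (coordAlg ι) (fun n (t : ℕ → 𝔼 ι) => t n u) where
  mono := coordAlg_mono
  le := coordAlg_le
  meas n := by
    have h : Measurable fun z : 𝔼 ι => z u := by fun_prop
    exact (h.comp (measurable_coordAlg n.lt_succ_self)).stronglyMeasurable
  int n := integrable_comp_eval (g := fun z => z u) (integrable_gCoord u) n
  zero n := by
    have h := condExp_comp_eval (ι := ι) (g := fun z => z u) (by fun_prop) (le_refl n)
    have h2 : ∫ z : 𝔼 ι, z u ∂(stdG ι) = 0 := integral_gCoord u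
    rw [h2] at h
    exact h

lemma condBlock_gaussSeq (u : ι) (c i : ℕ) :
    condBlock (gaussSeq ι) (coordAlg ι)
      (fun j (t : ℕ → 𝔼 ι) => t j u ^ 2 - 1) c i =ᵐ[gaussSeq ι] 0 := by
  have h1 : ∀ j ∈ range (2 ^ i), (gaussSeq ι)[fun t => t (c + j) u ^ 2 - 1 | coordAlg ι c]
      =ᵐ[gaussSeq ι] 0 := fun j _ => by
    have h := condExp_comp_eval (ι := ι) (g := fun z => z u ^ 2 - 1) (by fun_prop)
      (Nat.le_add_right c j)
    rw [integral_coord_sq_sub_one] at h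
    exact h
  have h2 := condExp_finsetSum (μ := gaussSeq ι) (s := range (2 ^ i))
    (f := fun j (t : ℕ → 𝔼 ι) => t (c + j) u ^ 2 - 1)
    (fun j _ => integrable_comp_eval (integrable_coord_sq_sub_one u) (c + j)) (coordAlg ι c)
  have h3 : condBlock (gaussSeq ι) (coordAlg ι)
      (fun j (t : ℕ → 𝔼 ι) => t j u ^ 2 - 1) c i
      = (gaussSeq ι)[∑ j ∈ range (2 ^ i),
        fun t : ℕ → 𝔼 ι => t (c + j) u ^ 2 - 1 | coordAlg ι c] := by
    unfold condBlock
    congr 1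
    funext t
    simp
  rw [h3]
  refine h2.trans ?_
  have h4 :=
    (Finset.eventually_all _).2 fun j hj => h1 j hj
  filter_upwards [h4] with t ht
  simp only [Finset.sum_apply, Pi.zero_apply]
  exact sum_eq_zero ht

/-- The `p`-th absolute moment of a standard Gaussian vector. -/
def gaussMoment (ι : Type*) [Fintype ι] (p : ℝ) : ℝ := ∫ z, ‖z‖ ^ p ∂(stdG ι)

lemma gaussMoment_nonneg (p : ℝ) : 0 ≤ gaussMoment ι p :=
  integral_nonneg fun z => by positivity

lemma integrable_norm_rpow_stdG (hp : 0 ≤ p) :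
    Integrable (fun z => ‖z‖ ^ p) (stdG ι) := by
  have h : MemLp (id : 𝔼 ι → _) (ofReal p) (stdG ι) :=
    IsGaussian.memLp_id _ _ (by simp)
  rcases hp.eq_or_lt with rfl | hp
  · simp
  · have := h.integrable_norm_rpow (by simpa using hp) (by simp)
    simpa [toReal_ofReal hp.le] using this

/-- Dyadic maxima of Gaussian random walks. -/
lemma exists_gaussSeq_max_decomp (hp : 2 < p) (hp3 : p ≤ 3) (u : ι) (n : ℕ) :
    ∃ Y R : (ℕ → 𝔼 ι) → ℝ, Measurable Y ∧ Measurable R ∧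
      (∀ t, 0 ≤ Y t) ∧ (∀ t, 0 ≤ R t) ∧ SubG (gaussSeq ι) Y ∧
      (∀ t : ℕ → 𝔼 ι, ∀ k ≤ 2 ^ n,
        |(∑ j ∈ range k, t j u)| ≤ 8 * √(2 ^ n) * Y t + R t) ∧
      Integrable (fun t => R t ^ p) (gaussSeq ι) ∧
      ∫ t, R t ^ p ∂(gaussSeq ι) ≤ remC p (gaussMoment ι p) 0 * 2 ^ n := by
  have hle : ∀ z : 𝔼 ι, |z u| ^ p ≤ ‖z‖ ^ p := fun z =>
    rpow_le_rpow (abs_nonneg _) (abs_coord_le_norm _ u) (by linarith)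
  have hm : Measurable fun z : 𝔼 ι => |z u| ^ p := by fun_prop
  have hi : Integrable (fun z : 𝔼 ι => |z u| ^ p) (stdG ι) := by
    refine (integrable_norm_rpow_stdG (by linarith)).mono' hm.aestronglyMeasurable
      (ae_of_all _ fun z => ?_)
    rw [norm_of_nonneg (by positivity)]
    exact hle z
  obtain ⟨Y, R, hY, hR, hY0, hR0, hsub, hmax, hRi, hRb⟩ :=
    (isMDS_gaussSeq (ι := ι) u).exists_dyadic_max_decomp (K := gaussMoment ι p) (b := 0) (B := 0)
      hp hp3 (fun k => integrable_comp_eval hi k)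
      (fun k => by
        rw [integral_comp_eval hm.stronglyMeasurable]
        exact integral_mono hi (integrable_norm_rpow_stdG (by linarith)) hle)
      (fun i => le_rfl)
      (fun c i => by
        rw [eLpNorm_congr_ae (condBlock_gaussSeq u c i)]
        simp)
      (fun n => by simp) 0 n
  exact ⟨Y, R, (hY.mono (coordAlg_le _)).measurable, (hR.mono (coordAlg_le _)).measurable, hY0, hR0,
    hsub, fun t k hk => by simpa using hmax t k hk, hRi, hRb⟩

/-- Sum of the first `n` terms. -/
def seqSum (n : ℕ) (t : ℕ → 𝔼 ι) : 𝔼 ι := ∑ j ∈ range n, t j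

lemma measurable_seqSum (n : ℕ) : Measurable (seqSum (ι := ι) n) :=
  measurable_sum _ fun j _ => measurable_pi_apply j

lemma map_seqSum (n : ℕ) :
    (gaussSeq ι).map (seqSum n) = (stdG ι).map (fun z => √(n : ℝ) • z) := by
  induction n with
  | zero =>
    have e : seqSum (ι := ι) 0 = fun _ => 0 := by funext t; simp [seqSum]
    simp [e]
  | succ n ih =>
    have hind : IndepFun (fun t : ℕ → 𝔼 ι => t n) (seqSum n) (gaussSeq ι) := by
      have h : Measurable[coordAlg ι n] (seqSum (ι := ι) n) :=
        measurable_sum _ fun j hj => measurable_coordAlg (mem_range.1 hj)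
      exact indep_of_indep_of_le_right (indep_coordAlg le_rfl) (measurable_iff_comap_le.1 h)
    have h := hind.map_add_eq_map_conv_map (measurable_pi_apply n) (measurable_seqSum n)
    rw [ih, (measurePreserving_eval_gaussSeq n).map_eq, stdG_conv_smul (cast_nonneg n)] at h
    have e : seqSum (ι := ι) (n + 1) = (fun t : ℕ → 𝔼 ι => t n) + seqSum n := by
      funext t
      simp [seqSum, sum_range_succ, add_comm]
    rw [e, h]
    push_cast
    rfl

lemma integral_comp_seqSum {f : 𝔼 ι → ℝ} (hf : LipschitzWith 1 f) (n : ℕ) :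
    ∫ t, f (seqSum n t) ∂(gaussSeq ι) = gF f n 0 := by
  have hfc := hf.continuous
  rw [gF_eq hf, ← integral_map (measurable_seqSum n).aemeasurable (by fun_prop), map_seqSum,
    integral_map (by fun_prop) (by fun_prop)]
  simp

lemma integrable_eval_gaussSeq (j : ℕ) :
    Integrable (fun t : ℕ → 𝔼 ι => t j) (gaussSeq ι) :=
  (measurePreserving_eval_gaussSeq j).integrable_comp_of_integrable
    (IsGaussian.integrable_id (μ := stdG ι))

lemma integrable_seqSum (n : ℕ) : Integrable (seqSum (ι := ι) n) (gaussSeq ι) :=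
  integrable_finsetSum _ fun j _ => integrable_eval_gaussSeq j

lemma integral_seqSum_coord (n : ℕ) (u : ι) : ∫ t, seqSum n t u ∂(gaussSeq ι) = 0 := by
  have e : ∀ t : ℕ → 𝔼 ι, seqSum n t u = ∑ j ∈ range n, t j u := fun t => by
    simp [seqSum]
  simp_rw [e]
  rw [integral_finsetSum _ fun j _ => (isMDS_gaussSeq u).int j]
  refine sum_eq_zero fun j _ => ?_
  rw [integral_comp_eval (g := fun z => z u) (Measurable.stronglyMeasurable (by fun_prop))]
  exact integral_gCoord u

section

variable [IsProbabilityMeasure ν] {H : ℕ → MeasurableSpace Ω}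

lemma integral_le_sqrt {R : Ω → ℝ} (hR : Integrable R ν) (hR2 : Integrable (fun ω => R ω ^ 2) ν) :
    ∫ ω, R ω ∂ν ≤ √(∫ ω, R ω ^ 2 ∂ν) := by
  refine Real.le_sqrt_of_sq_le ?_
  set m := ∫ ω, R ω ∂ν with hm
  have h : 0 ≤ ∫ ω, (R ω - m) ^ 2 ∂ν := integral_nonneg fun ω => sq_nonneg _
  have e : ∀ ω, (R ω - m) ^ 2 = R ω ^ 2 + (-2 * m) * R ω + m ^ 2 := fun ω => by ring
  simp_rw [e] at h
  have h1 : Integrable (fun ω => R ω ^ 2 + (-2 * m) * R ω) ν := hR2.add (hR.const_mul _)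
  rw [integral_add h1 (integrable_const _), integral_add hR2 (hR.const_mul _),
    integral_const_mul, ← hm] at h
  simp at h
  nlinarith

/-- Conditioning on the next σ-algebra turns a nearly adapted centred sequence into a martingale
difference sequence. -/
lemma exists_isMDS_near (hmono : Monotone H) (hle : ∀ k, H k ≤ mΩ) {Δ w : ℕ → Ω → ℝ} {ε : ℕ → ℝ}
    (hΔ : ∀ k, Integrable (Δ k) ν) (hΔ2 : ∀ k, Integrable (fun ω => Δ k ω ^ 2) ν)
    (hw : ∀ k, StronglyMeasurable[H (k + 1)] (w k)) (hwi : ∀ k, Integrable (w k) ν)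
    (hε : ∀ k, ∫ ω, |Δ k ω - w k ω| ∂ν ≤ ε k)
    (h0 : ∀ k A, MeasurableSet[H k] A → ∫ ω in A, Δ k ω ∂ν = 0) :
    ∃ D : ℕ → Ω → ℝ, IsMDS ν H D ∧ (∀ k, ∫ ω, |Δ k ω - D k ω| ∂ν ≤ 2 * ε k) ∧
      (∀ k, Integrable (fun ω => |D k ω| ^ (2 : ℝ)) ν) ∧
      (∀ k, ∫ ω, |D k ω| ^ (2 : ℝ) ∂ν ≤ ∫ ω, Δ k ω ^ 2 ∂ν) := by
  have hz := fun k => by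
    refine (ae_eq_condExp_of_forall_setIntegral_eq (hle k) (hΔ k)
      (fun s _ _ => (integrable_zero _ _ _).integrableOn) (fun s hs _ => ?_)
      aestronglyMeasurable_zero).symm
    simp [h0 k s hs]
  have h2 : ∀ k, Integrable (fun ω => |ν[Δ k | H (k + 1)] ω| ^ (2 : ℝ)) ν ∧
      ∫ ω, |ν[Δ k | H (k + 1)] ω| ^ (2 : ℝ) ∂ν ≤ ∫ ω, Δ k ω ^ 2 ∂ν := fun k => by
    have hI : 0 ≤ ∫ ω, Δ k ω ^ 2 ∂ν := integral_nonneg fun ω => sq_nonneg _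
    have hle1 : eLpNorm (Δ k) (ofReal 2) ν ≤ ofReal (√(∫ ω, Δ k ω ^ 2 ∂ν)) :=
      eLpNorm_le_of_integral_abs_rpow_le two_pos (sqrt_nonneg _)
        (hΔ k).aestronglyMeasurable (by simpa using hΔ2 k)
        (by simp [sq_sqrt hI])
    have := integral_abs_rpow_le_of_eLpNorm_le two_pos (sqrt_nonneg _)
      (stronglyMeasurable_condExp.mono (hle (k + 1))).aestronglyMeasurable
      ((eLpNorm_condExp_le_eLpNorm (m := H (k + 1)) (Δ k)
        (by simp)).trans hle1)
    refine ⟨this.1, this.2.trans_eq ?_⟩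
    rw [rpow_two, sq_sqrt hI]
  refine ⟨fun k => ν[Δ k | H (k + 1)], ⟨hmono, hle, fun n => stronglyMeasurable_condExp,
    fun n => integrable_condExp, fun n => ?_⟩, fun k => ?_, fun k => (h2 k).1, fun k => (h2 k).2⟩
  · exact (condExp_condExp_of_le (hmono n.le_succ) (hle _)).trans (hz n)
  · have hd : Integrable (fun ω => Δ k ω - w k ω) ν := (hΔ k).sub (hwi k)
    have h3 : ν[fun ω => Δ k ω - w k ω | H (k + 1)] =ᵐ[ν]
        fun ω => ν[Δ k | H (k + 1)] ω - w k ω := by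
      have := condExp_sub (hΔ k) (hwi k) (H (k + 1))
      rw [condExp_of_stronglyMeasurable (hle _) (hw k) (hwi k)] at this
      exact this
    have h4 : ∫ ω, |ν[fun ω => Δ k ω - w k ω | H (k + 1)] ω| ∂ν ≤ ∫ ω, |Δ k ω - w k ω| ∂ν :=
      integral_abs_condExp_le _
    have h5 : ∫ ω, |Δ k ω - ν[Δ k | H (k + 1)] ω| ∂ν
        ≤ ∫ ω, (|Δ k ω - w k ω| + |ν[fun ω => Δ k ω - w k ω | H (k + 1)] ω|) ∂ν := by
      refine integral_mono_ae ((hΔ k).sub integrable_condExp).abs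
        (hd.abs.add integrable_condExp.abs) ?_
      filter_upwards [h3] with ω hω
      rw [hω, show Δ k ω - ν[Δ k | H (k + 1)] ω
        = (Δ k ω - w k ω) - (ν[Δ k | H (k + 1)] ω - w k ω) by ring]
      exact abs_sub _ _
    rw [integral_add hd.abs integrable_condExp.abs] at h5
    linarith [hε k]

/-- Maximal inequality for a nearly adapted centred sequence. -/
lemma exists_max_bound (hmono : Monotone H) (hle : ∀ k, H k ≤ mΩ) {Δ w : ℕ → Ω → ℝ} {ε : ℕ → ℝ}
    (hΔ : ∀ k, Integrable (Δ k) ν) (hΔ2 : ∀ k, Integrable (fun ω => Δ k ω ^ 2) ν)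
    (hw : ∀ k, StronglyMeasurable[H (k + 1)] (w k)) (hwi : ∀ k, Integrable (w k) ν)
    (hε : ∀ k, ∫ ω, |Δ k ω - w k ω| ∂ν ≤ ε k)
    (h0 : ∀ k A, MeasurableSet[H k] A → ∫ ω in A, Δ k ω ∂ν = 0) (c n : ℕ) :
    ∃ M : Ω → ℝ, Integrable M ν ∧ (∀ ω, ∀ k ≤ n, |(∑ j ∈ range k, Δ (c + j) ω)| ≤ M ω) ∧
      ∫ ω, M ω ∂ν ≤ √(doobC 2 * (39 * ∑ j ∈ range n, ∫ ω, Δ (c + j) ω ^ 2 ∂ν))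
        + 2 * ∑ j ∈ range n, ε (c + j) := by
  obtain ⟨D, hD, hDε, hDi, hDb⟩ := exists_isMDS_near hmono hle hΔ hΔ2 hw hwi hε h0
  have hS := hD.shift c
  set X : Ω → ℝ := fun ω => runMax (fun k => |psum (fun n => D (c + n)) k ω|) n with hX
  have hX0 : ∀ ω, 0 ≤ X ω := fun ω => runMax_nonneg (fun _ => abs_nonneg _) n
  have hXm := (hS.runMax_meas n).mono (hS.le n)
  have hX2 :=
    hS.runMax_int_rpow two_pos (fun k => hDi _) n
  have hXi : Integrable X ν := integrable_of_abs_rpow one_le_two hXm.aestronglyMeasurable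
    (by simpa only [abs_of_nonneg (hX0 _)] using hX2)
  have hXb : ∫ ω, X ω ^ 2 ∂ν ≤ doobC 2 * (39 * ∑ j ∈ range n, ∫ ω, Δ (c + j) ω ^ 2 ∂ν) := by
    have h1 := hS.doob one_lt_two (fun k => hDi _) n
    have h2 := hS.vonBahr_esseen one_lt_two le_rfl (fun k => hDi _) n
    have h3 : ∑ k ∈ range n, ∫ ω, |D (c + k) ω| ^ (2 : ℝ) ∂ν
        ≤ ∑ j ∈ range n, ∫ ω, Δ (c + j) ω ^ 2 ∂ν := sum_le_sum fun k _ => hDb _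
    have h4 := doobC_nonneg one_lt_two
    simp only [rpow_two] at h1 h2 h3
    calc _ ≤ _ := h1
      _ ≤ _ := mul_le_mul_of_nonneg_left (h2.trans (by linarith)) h4
  have hdi : ∀ k, Integrable (fun ω => |Δ k ω - D k ω|) ν := fun k => ((hΔ k).sub (hD.int k)).abs
  have hsi : Integrable (fun ω => ∑ j ∈ range n, |Δ (c + j) ω - D (c + j) ω|) ν :=
    integrable_finsetSum _ fun j _ => hdi _
  refine ⟨fun ω => X ω + ∑ j ∈ range n, |Δ (c + j) ω - D (c + j) ω|, hXi.add hsi,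
    fun ω k hk => ?_, ?_⟩
  · have e : ∑ j ∈ range k, Δ (c + j) ω = psum (fun n => D (c + n)) k ω
        + ∑ j ∈ range k, (Δ (c + j) ω - D (c + j) ω) := by
      rw [psum, ← sum_add_distrib]
      simp
    rw [e]
    refine (abs_add_le _ _).trans (add_le_add ?_ ?_)
    · exact le_runMax (fun k => |psum (fun n => D (c + n)) k ω|) hk
    · refine (Finset.abs_sum_le_sum_abs _ _).trans ?_
      exact Finset.sum_le_sum_of_subset_of_nonneg (Finset.range_subset_range.2 hk)
        fun _ _ _ => abs_nonneg _
  · rw [integral_add hXi hsi, integral_finsetSum _ fun j _ => hdi _, mul_sum _ _ (2 : ℝ)]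
    refine add_le_add ?_ (sum_le_sum fun j _ => hDε _)
    exact (integral_le_sqrt hXi (by simpa using hX2)).trans (sqrt_le_sqrt hXb)

variable {T : Type*} [MeasurableSpace T] {ρ : Measure T} [IsProbabilityMeasure ρ] {V : ℕ → Ω → T}

lemma measurePreserving_of_fresh (hle : ∀ k, H k ≤ mΩ) (hV : ∀ k, Measurable[H (k + 1)] (V k))
    (hfresh : ∀ k A B, MeasurableSet[H k] A → MeasurableSet B →
      ν (A ∩ V k ⁻¹' B) = ν A * ρ B) (k : ℕ) : MeasurePreserving (V k) ν ρ := by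
  have hm := (hV k).mono (hle _) le_rfl
  refine ⟨hm, Measure.ext fun B hB => ?_⟩
  rw [Measure.map_apply hm hB]
  simpa using hfresh k Set.univ B MeasurableSet.univ hB

lemma iIndepFun_of_fresh (hmono : Monotone H) (hle : ∀ k, H k ≤ mΩ)
    (hV : ∀ k, Measurable[H (k + 1)] (V k))
    (hfresh : ∀ k A B, MeasurableSet[H k] A → MeasurableSet B →
      ν (A ∩ V k ⁻¹' B) = ν A * ρ B) : iIndepFun V ν := by
  rw [iIndepFun_iff_measure_inter_preimage_eq_mul]
  intro S
  induction S using Finset.induction_on_max with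
  | empty => intro _ _; simp
  | insert a S ha ih =>
    intro sets hsets
    have haS := fun h => lt_irrefl _ (ha a h)
    have hm :=
      @Finset.measurableSet_biInter _ _ (H a) _ S fun i hi =>
        hmono (Nat.succ_le_of_lt (ha i hi)) _ (hV i (hsets i (Finset.mem_insert_of_mem hi)))
    rw [Finset.prod_insert haS, Finset.set_biInter_insert, inter_comm,
      hfresh a _ _ hm (hsets a (Finset.mem_insert_self _ _)),
      ih fun i hi => hsets i (Finset.mem_insert_of_mem hi), mul_comm]
    congr 1
    exact ((measurePreserving_of_fresh hle hV hfresh a).measure_preimage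
      (hsets a (Finset.mem_insert_self _ _)).nullMeasurableSet).symm

lemma setIntegral_fresh (hle : ∀ k, H k ≤ mΩ) (hV : ∀ k, Measurable[H (k + 1)] (V k))
    (hfresh : ∀ k A B, MeasurableSet[H k] A → MeasurableSet B →
      ν (A ∩ V k ⁻¹' B) = ν A * ρ B)
    {g : T → ℝ} (hg : Measurable g) {A : Set Ω} (hA : MeasurableSet[H k] A) :
    ∫ ω in A, g (V k ω) ∂ν = ν.real A * ∫ t, g t ∂ρ := by
  have hm := (hV k).mono (hle _) le_rfl
  have e : (ν.restrict A).map (V k) = ν A • ρ := by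
    refine Measure.ext fun B hB => ?_
    rw [Measure.map_apply hm hB, Measure.restrict_apply (hm hB), inter_comm,
      hfresh k A B hA hB]
    simp
  rw [← integral_map hm.aemeasurable hg.aestronglyMeasurable, e, integral_smul_measure]
  rfl

end

section

variable [IsProbabilityMeasure ν] {V : ℕ → Ω → ℕ → 𝔼 ι}

lemma iIndepFun_eval (hV : iIndepFun V ν) (hVρ : ∀ k, MeasurePreserving (V k) ν (gaussSeq ι))
    {φ : ℕ → ℕ × ℕ} (hφ : Injective φ) :
    iIndepFun (fun n ω => V (φ n).1 ω (φ n).2) ν := by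
  have hm : ∀ k j, Measurable fun ω => V k ω j := fun k j =>
    (measurable_pi_apply j).comp (hVρ k).measurable
  have h2 : ∀ k, iIndepFun (fun j ω => V k ω j) ν := fun k => by
    rw [iIndepFun_iff_map_fun_eq_infinitePi_map (hm k)]
    have e : ∀ j, ν.map (fun ω => V k ω j) = stdG ι := fun j =>
      ((measurePreserving_eval_gaussSeq j).comp (hVρ k)).map_eq
    simp_rw [e]
    exact (hVρ k).map_eq
  exact (iIndepFun_uncurry' hm hV h2).precomp hφ

lemma measurePreserving_eval (hVρ : ∀ k, MeasurePreserving (V k) ν (gaussSeq ι)) (k j : ℕ) :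
    MeasurePreserving (fun ω => V k ω j) ν (stdG ι) :=
  (measurePreserving_eval_gaussSeq j).comp (hVρ k)

end

lemma SubG.integrable (h : SubG ν Y) (hY : Measurable Y) :
    Integrable (fun ω => exp (Y ω ^ 2)) ν ∧ ∫ ω, exp (Y ω ^ 2) ∂ν ≤ 100 := by
  have hm : Measurable fun ω => exp (Y ω ^ 2) := by fun_prop
  refine integrable_of_lintegral_le hm.aestronglyMeasurable (fun ω => (exp_pos _).le)
    (by norm_num) ?_
  unfold SubG at h
  simpa using h

lemma two_pow_le_exp (l : ℕ) : (2 : ℝ) ^ l ≤ exp ((l : ℝ) + 1) := by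
  have h1 : (2 : ℝ) ≤ exp 1 := by linarith [add_one_le_exp (1 : ℝ)]
  calc (2 : ℝ) ^ l ≤ exp 1 ^ l := pow_le_pow_left₀ (by norm_num) h1 l
    _ = exp l := by rw [← Real.exp_nat_mul]; simp
    _ ≤ _ := exp_le_exp.2 (by linarith)

lemma sq_le_of_large {a : ℝ} (ha : 0 ≤ a) (h : a ≤ y) :
    y ^ 2 ≤ 2 * exp (-(a ^ 2 / 2)) * exp (y ^ 2) := by
  have h1 := add_one_le_exp (y ^ 2 / 2)
  have h2 : exp (y ^ 2 / 2) ≤ exp (-(a ^ 2 / 2)) * exp (y ^ 2) := by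
    rw [← exp_add]
    exact exp_le_exp.2 (by nlinarith)
  nlinarith

lemma le_add_exp {a : ℝ} (ha : 1 ≤ a) :
    y ≤ a + exp (-a ^ 2) * exp (y ^ 2) := by
  rcases le_or_gt y a with h | h
  · have := exp_pos (-a ^ 2)
    have := exp_pos (y ^ 2)
    nlinarith [mul_pos ‹0 < exp (-a ^ 2)› this]
  · rw [← exp_add]
    have := add_one_le_exp (-a ^ 2 + y ^ 2)
    nlinarith

lemma sq_le_rpow_mul {a : ℝ} (hp : 2 ≤ p) (ha : 0 < a) (h : a ≤ r) :
    r ^ 2 ≤ a ^ (2 - p) * r ^ p := by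
  have hr := ha.trans_le h
  calc r ^ 2 = r ^ (2 - p) * r ^ p := by
        rw [← rpow_add hr, sub_add_cancel, rpow_two]
    _ ≤ _ := mul_le_mul_of_nonneg_right (rpow_le_rpow_of_nonpos ha h (by linarith))
        (by positivity)

lemma le_add_rpow_mul {a : ℝ} (hp : 1 ≤ p) (ha : 0 < a) (hr : 0 ≤ r) :
    r ≤ a + a ^ (1 - p) * r ^ p := by
  rcases le_or_gt r a with h | h
  · have : 0 ≤ a ^ (1 - p) * r ^ p := by positivity
    linarith
  · have hr := ha.trans h
    have : r = r ^ (1 - p) * r ^ p := by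
      rw [← rpow_add hr, sub_add_cancel, rpow_one]
    have h2 : r ^ (1 - p) * r ^ p ≤ a ^ (1 - p) * r ^ p :=
      mul_le_mul_of_nonneg_right (rpow_le_rpow_of_nonpos ha h.le (by linarith))
        (by positivity)
    linarith

lemma sq_le_truncated {L x y₁ y₂ r₁ r₂ : ℝ} (hp : 2 < p) (hp3 : p ≤ 3) (hq : 0 < q) (hL : 1 ≤ L)
    (hy₁ : 0 ≤ y₁) (hy₂ : 0 ≤ y₂) (hr₁ : 0 ≤ r₁) (hr₂ : 0 ≤ r₂)
    (hx : |x| ≤ 8 * q * (y₁ + y₂) + (r₁ + r₂)) :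
    x ^ 2 ≤ 64 * (q * √L) * |x|
      + 2048 * q ^ 2 * exp (-(2 * L)) * (exp (y₁ ^ 2) + exp (y₂ ^ 2))
      + 32 * q ^ (2 - p) * (r₁ ^ p + r₂ ^ p) := by
  have hsL := one_le_sqrt.2 hL
  have hsq : √L ^ 2 = L := sq_sqrt (by linarith)
  have t1 : 0 ≤ 64 * (q * √L) * |x| := by positivity
  have t2 : ∀ y, 0 ≤ 2048 * q ^ 2 * exp (-(2 * L)) * exp (y ^ 2) := fun y => by positivity
  have t3 : 0 ≤ 32 * q ^ (2 - p) * (r₁ ^ p + r₂ ^ p) := by positivity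
  rcases le_or_gt |x| (64 * (q * √L)) with h | h
  · have : x ^ 2 ≤ 64 * (q * √L) * |x| := by
      rw [← sq_abs]; nlinarith [abs_nonneg x]
    linarith [t2 y₁, t2 y₂]
  have key : ∀ y, 0 ≤ y → |x| ≤ 32 * q * y →
      x ^ 2 ≤ 2048 * q ^ 2 * exp (-(2 * L)) * exp (y ^ 2) := fun y hy hxy => by
    have h1 : 2 * √L ≤ y := by
      by_contra hc
      push Not at hc
      have : 32 * q * y < 32 * q * (2 * √L) := mul_lt_mul_of_pos_left hc (by positivity)
      linarith
    have h2 := sq_le_of_large (by positivity) h1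
    have h3 : (2 * √L) ^ 2 / 2 = 2 * L := by rw [mul_pow, hsq]; ring
    rw [h3] at h2
    calc x ^ 2 = |x| ^ 2 := (sq_abs x).symm
      _ ≤ (32 * q * y) ^ 2 := by gcongr
      _ = 1024 * q ^ 2 * y ^ 2 := by ring
      _ ≤ 1024 * q ^ 2 * (2 * exp (-(2 * L)) * exp (y ^ 2)) := by gcongr
      _ = _ := by ring
  rcases le_total (r₁ + r₂) (8 * q * (y₁ + y₂)) with hc | hc
  · rcases le_total y₁ y₂ with hy | hy
    · have := key y₂ hy₂ (by nlinarith)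
      linarith [t2 y₁]
    · have := key y₁ hy₁ (by nlinarith)
      linarith [t2 y₂]
  · have h1 : |x| ≤ 2 * (r₁ + r₂) := by linarith
    have h2 : q ≤ r₁ + r₂ := by nlinarith
    have h3 := sq_le_rpow_mul hp.le hq h2
    have h4 : (r₁ + r₂) ^ p ≤ 8 * (r₁ ^ p + r₂ ^ p) := by
      refine (add_rpow_le_two_rpow (by linarith) hr₁ hr₂).trans ?_
      gcongr
      calc (2 : ℝ) ^ p ≤ 2 ^ (3 : ℝ) := rpow_le_rpow_of_exponent_le (by norm_num) hp3
        _ = 8 := by norm_num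
    have h5 : x ^ 2 ≤ 4 * (q ^ (2 - p) * (8 * (r₁ ^ p + r₂ ^ p))) := by
      calc x ^ 2 = |x| ^ 2 := (sq_abs x).symm
        _ ≤ (2 * (r₁ + r₂)) ^ 2 := by gcongr
        _ = 4 * (r₁ + r₂) ^ 2 := by ring
        _ ≤ 4 * (q ^ (2 - p) * (r₁ + r₂) ^ p) := by gcongr
        _ ≤ _ := by gcongr
    linarith [t2 y₁, t2 y₂]

/-- Second moments from first moments, by truncation. -/
lemma integral_sq_le_of_max {C₁ C₂ : ℝ} (hp : 2 < p) (hp3 : p ≤ 3) {m l : ℕ} (hC₂ : 0 ≤ C₂)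
    (hml : m ≤ l) {X Y₁ Y₂ R₁ R₂ : Ω → ℝ} (hX : Integrable X ν)
    (hXb : ∫ ω, |X ω| ∂ν ≤ C₁ * omegaRate p (2 ^ m)) (hY₁ : Measurable Y₁) (hY₂ : Measurable Y₂)
    (hY₁0 : ∀ ω, 0 ≤ Y₁ ω) (hY₂0 : ∀ ω, 0 ≤ Y₂ ω) (hR₁0 : ∀ ω, 0 ≤ R₁ ω) (hR₂0 : ∀ ω, 0 ≤ R₂ ω)
    (hs₁ : SubG ν Y₁) (hs₂ : SubG ν Y₂) (hR₁i : Integrable (fun ω => R₁ ω ^ p) ν)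
    (hR₂i : Integrable (fun ω => R₂ ω ^ p) ν) (hR₁ : ∫ ω, R₁ ω ^ p ∂ν ≤ C₂ * 2 ^ m)
    (hR₂ : ∫ ω, R₂ ω ^ p ∂ν ≤ C₂ * 2 ^ m)
    (hle : ∀ ω, |X ω| ≤ 8 * √(2 ^ m) * (Y₁ ω + Y₂ ω) + (R₁ ω + R₂ ω)) :
    Integrable (fun ω => X ω ^ 2) ν ∧
      ∫ ω, X ω ^ 2 ∂ν ≤ (64 * C₁ + 409600 + 64 * C₂)
        * (√(2 ^ m) * √((l : ℝ) + 1) * omegaRate p (2 ^ m)) := by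
  set q : ℝ := √(2 ^ m) with hq
  have hq0 : 0 < q := by positivity
  have hq2 : q ^ 2 = 2 ^ m := sq_sqrt (by positivity)
  have hL : (1 : ℝ) ≤ (l : ℝ) + 1 := by linarith [(cast_nonneg l : (0 : ℝ) ≤ l)]
  obtain ⟨hi₁, hb₁⟩ := hs₁.integrable hY₁
  obtain ⟨hi₂, hb₂⟩ := hs₂.integrable hY₂
  have hpt := fun ω => sq_le_truncated hp hp3 hq0 hL (hY₁0 ω) (hY₂0 ω) (hR₁0 ω) (hR₂0 ω) (hle ω)
  have I1 : Integrable (fun ω => 64 * (q * √((l : ℝ) + 1)) * |X ω|) ν := hX.abs.const_mul _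
  have I2' := hi₁.add hi₂
  have I2 : Integrable (fun ω => 2048 * q ^ 2 * exp (-(2 * ((l : ℝ) + 1)))
    * (exp (Y₁ ω ^ 2) + exp (Y₂ ω ^ 2))) ν := I2'.const_mul _
  have I3' := hR₁i.add hR₂i
  have I3 : Integrable (fun ω => 32 * q ^ (2 - p) * (R₁ ω ^ p + R₂ ω ^ p)) ν := I3'.const_mul _
  have I12 : Integrable (fun ω => 64 * (q * √((l : ℝ) + 1)) * |X ω|
    + 2048 * q ^ 2 * exp (-(2 * ((l : ℝ) + 1)))
    * (exp (Y₁ ω ^ 2) + exp (Y₂ ω ^ 2))) ν := I1.add I2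
  have hXi : Integrable (fun ω => X ω ^ 2) ν := by
    refine (I12.add I3).mono' (hX.aestronglyMeasurable.pow 2) (ae_of_all _ fun ω => ?_)
    rw [norm_of_nonneg (sq_nonneg _)]
    exact hpt ω
  refine ⟨hXi, (integral_mono hXi (I12.add I3) hpt).trans ?_⟩
  simp only [Pi.add_apply]
  rw [integral_add I12 I3, integral_add I1 I2, integral_const_mul, integral_const_mul,
    integral_const_mul, integral_add hi₁ hi₂, integral_add hR₁i hR₂i]
  have hω1 : 1 ≤ omegaRate p (2 ^ m) := one_le_omegaRate (by linarith) hp3 (by positivity)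
  have hω2 : ((2 ^ m : ℕ) : ℝ) ^ ((3 - p) / 2) ≤ omegaRate p (2 ^ m) :=
    omegaRate_ge (by linarith) (by positivity)
  have hsL := one_le_sqrt.2 hL
  have hq1 : 1 ≤ q := one_le_sqrt.2 (one_le_pow₀ (by norm_num))
  have hqL := one_le_mul_of_one_le_of_one_le hq1 hsL
  have e1 : q ^ 2 * exp (-(2 * ((l : ℝ) + 1))) ≤ 1 := by
    have h1 : q ^ 2 ≤ exp (2 * ((l : ℝ) + 1)) := by
      rw [hq2]
      refine (pow_le_pow_right₀ (by norm_num) hml).trans ((two_pow_le_exp l).trans ?_)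
      exact exp_le_exp.2 (by linarith)
    calc _ ≤ exp (2 * ((l : ℝ) + 1)) * exp (-(2 * ((l : ℝ) + 1))) := by gcongr
      _ = 1 := by rw [← exp_add]; simp
  have e2 : q ^ (2 - p) * 2 ^ m ≤ q * omegaRate p (2 ^ m) := by
    have h1 : ((2 ^ m : ℕ) : ℝ) ^ ((3 - p) / 2) = q ^ (3 - p) := by
      have : ((2 ^ m : ℕ) : ℝ) = q ^ (2 : ℝ) := by push_cast; rw [rpow_two, hq2]
      rw [this, ← rpow_mul hq0.le]
      congr 1
      ring
    rw [h1] at hω2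
    calc q ^ (2 - p) * 2 ^ m = q ^ (2 - p) * q ^ (2 : ℝ) := by rw [rpow_two, hq2]
      _ = q ^ (1 : ℝ) * q ^ (3 - p) := by
        rw [← rpow_add hq0, ← rpow_add hq0]; congr 1; ring
      _ ≤ _ := by rw [rpow_one]; gcongr
  have b1 : 64 * (q * √((l : ℝ) + 1)) * ∫ ω, |X ω| ∂ν
      ≤ 64 * C₁ * (q * √((l : ℝ) + 1) * omegaRate p (2 ^ m)) := by
    calc _ ≤ 64 * (q * √((l : ℝ) + 1)) * (C₁ * omegaRate p (2 ^ m)) := by gcongr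
      _ = _ := by ring
  have hbig :=
    one_le_mul_of_one_le_of_one_le hqL hω1
  have b2 : 2048 * q ^ 2 * exp (-(2 * ((l : ℝ) + 1)))
      * (∫ ω, exp (Y₁ ω ^ 2) ∂ν + ∫ ω, exp (Y₂ ω ^ 2) ∂ν)
      ≤ 409600 * (q * √((l : ℝ) + 1) * omegaRate p (2 ^ m)) := by
    have h0 : 0 ≤ q ^ 2 * exp (-(2 * ((l : ℝ) + 1))) := by positivity
    have h1 : 0 ≤ ∫ ω, exp (Y₁ ω ^ 2) ∂ν := integral_nonneg fun ω => (exp_pos _).le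
    have h2 : 0 ≤ ∫ ω, exp (Y₂ ω ^ 2) ∂ν := integral_nonneg fun ω => (exp_pos _).le
    nlinarith
  have b3 : 32 * q ^ (2 - p) * (∫ ω, R₁ ω ^ p ∂ν + ∫ ω, R₂ ω ^ p ∂ν)
      ≤ 64 * C₂ * (q * √((l : ℝ) + 1) * omegaRate p (2 ^ m)) := by
    calc _ ≤ 32 * q ^ (2 - p) * (C₂ * 2 ^ m + C₂ * 2 ^ m) := by gcongr
      _ = 64 * C₂ * (q ^ (2 - p) * 2 ^ m) := by ring
      _ ≤ 64 * C₂ * (q * omegaRate p (2 ^ m)) := by gcongr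
      _ ≤ 64 * C₂ * (q * √((l : ℝ) + 1) * omegaRate p (2 ^ m)) := by
        gcongr
        exact le_mul_of_one_le_right hq0.le hsL
  linarith

/-- Maximum over the blocks of a dyadic level of the within-block fluctuations. -/
lemma exists_block_max_bound [IsProbabilityMeasure ν] (hp : 2 < p) {m l : ℕ}
    (hn : n * 2 ^ m = 2 ^ l) {Y R : ℕ → Ω → ℝ} (hY : ∀ b, Measurable (Y b)) (hR0 : ∀ b ω, 0 ≤ R b ω)
    (hs : ∀ b, SubG ν (Y b)) (hRi : ∀ b, Integrable (fun ω => R b ω ^ p) ν)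
    (hR : ∀ b < n, ∫ ω, R b ω ^ p ∂ν ≤ C * 2 ^ m) :
    ∃ M : Ω → ℝ, Integrable M ν ∧ (∀ b < n, ∀ ω, 8 * √(2 ^ m) * Y b ω + R b ω ≤ M ω) ∧
      ∫ ω, M ω ∂ν ≤ 808 * (√(2 ^ m) * √((l : ℝ) + 1)) + (1 + C) * (2 : ℝ) ^ ((l : ℝ) / p) := by
  set q : ℝ := √(2 ^ m) with hq
  have hq0 : 0 < q := by positivity
  set a : ℝ := √((l : ℝ) + 1) with ha
  have ha1 : 1 ≤ a := one_le_sqrt.2 (by linarith [(cast_nonneg l : (0 : ℝ) ≤ l)])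
  have ha2 : a ^ 2 = (l : ℝ) + 1 := sq_sqrt (by positivity)
  set r : ℝ := (2 : ℝ) ^ ((l : ℝ) / p) with hr
  have hr0 : 0 < r := by positivity
  have hi := fun b => (hs b).integrable (hY b)
  have I1 : Integrable (fun ω => ∑ b ∈ range n, exp (Y b ω ^ 2)) ν :=
    integrable_finsetSum _ fun b _ => (hi b).1
  have I2 : Integrable (fun ω => ∑ b ∈ range n, R b ω ^ p) ν :=
    integrable_finsetSum _ fun b _ => hRi b
  have J1 : Integrable (fun ω => 8 * q * a + 8 * q * exp (-a ^ 2) *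
    ∑ b ∈ range n, exp (Y b ω ^ 2)) ν := (integrable_const _).add (I1.const_mul _)
  have J2 : Integrable (fun ω => r + r ^ (1 - p) * ∑ b ∈ range n, R b ω ^ p) ν :=
    (integrable_const _).add (I2.const_mul _)
  have hnr : (n : ℝ) * 2 ^ m = 2 ^ l := by exact_mod_cast hn
  have hnl : (n : ℝ) ≤ 2 ^ l := by
    rw [← hnr]
    exact le_mul_of_one_le_right (cast_nonneg n) (one_le_pow₀ (by norm_num))
  refine ⟨fun ω => (8 * q * a + 8 * q * exp (-a ^ 2) *
      ∑ b ∈ range n, exp (Y b ω ^ 2))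
    + (r + r ^ (1 - p) * ∑ b ∈ range n, R b ω ^ p), J1.add J2, fun b hb ω => ?_, ?_⟩
  · have h1 :=
      single_le_sum (f := fun b => exp (Y b ω ^ 2)) (fun i _ => (exp_pos _).le)
        (mem_range.2 hb)
    have h2 :=
      single_le_sum (f := fun b => R b ω ^ p) (fun i _ => rpow_nonneg (hR0 i ω) _)
        (mem_range.2 hb)
    refine add_le_add ?_ ?_
    · calc 8 * q * Y b ω ≤ 8 * q * (a + exp (-a ^ 2) * exp (Y b ω ^ 2)) := by
            gcongr; exact le_add_exp ha1
        _ ≤ 8 * q * (a + exp (-a ^ 2) * ∑ b ∈ range n, exp (Y b ω ^ 2)) := by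
            gcongr
        _ = _ := by ring
    · calc R b ω ≤ r + r ^ (1 - p) * R b ω ^ p := le_add_rpow_mul (by linarith) hr0 (hR0 b ω)
        _ ≤ _ := by gcongr
  · rw [integral_add J1 J2, integral_add (integrable_const _) (I1.const_mul _),
      integral_add (integrable_const _) (I2.const_mul _),
      integral_const_mul (8 * q * exp (-a ^ 2)), integral_const_mul (r ^ (1 - p)),
      integral_finsetSum _ fun b _ => (hi b).1, integral_finsetSum _ fun b _ => hRi b]
    simp only [integral_const, probReal_univ, one_smul]
    have s1 : ∑ b ∈ range n, ∫ ω, exp (Y b ω ^ 2) ∂ν ≤ n * 100 := by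
      refine (sum_le_sum fun b _ => (hi b).2).trans ?_
      simp
    have s2 : ∑ b ∈ range n, ∫ ω, R b ω ^ p ∂ν ≤ C * 2 ^ l := by
      refine (sum_le_sum fun b hb => hR b (mem_range.1 hb)).trans ?_
      rw [← hnr]
      simp
      nlinarith
    have s3 : exp (-a ^ 2) * (n * 100) ≤ 100 := by
      have : (n : ℝ) ≤ exp (a ^ 2) := by
        rw [ha2]; exact hnl.trans (two_pow_le_exp l)
      calc _ ≤ exp (-a ^ 2) * (exp (a ^ 2) * 100) := by gcongr
        _ = 100 := by rw [← mul_assoc, ← exp_add]; simp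
    have s4 : r ^ (1 - p) * (C * 2 ^ l) = C * r := by
      have : (2 : ℝ) ^ l = r ^ p := by
        rw [hr, ← rpow_mul (by norm_num), div_mul_cancel₀ _ (by linarith), rpow_natCast]
      rw [this, mul_left_comm, ← rpow_add hr0, sub_add_cancel, rpow_one]
    have t1 : 8 * q * exp (-a ^ 2) * ∑ b ∈ range n, ∫ ω, exp (Y b ω ^ 2) ∂ν
        ≤ 8 * q * 100 := by
      rw [mul_assoc (8 * q)]
      gcongr
      exact (mul_le_mul_of_nonneg_left s1 (exp_pos _).le).trans s3
    have t2 : r ^ (1 - p) * ∑ b ∈ range n, ∫ ω, R b ω ^ p ∂ν ≤ C * r := by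
      rw [← s4]
      gcongr
    nlinarith

/-! ### The block structure: level `[2 ^ l, 2 ^ (l + 1))` is cut into blocks of length `2 ^ m l` -/

/-- Left end point of the `κ`-th block. -/
def blockStart (m : ℕ → ℕ) : ℕ → ℕ
  | 0 => 1
  | κ + 1 => blockStart m κ + 2 ^ m (Nat.log 2 (blockStart m κ))

/-- The logarithm of the length of the `κ`-th block. -/
abbrev blockExp (m : ℕ → ℕ) (κ : ℕ) : ℕ := m (Nat.log 2 (blockStart m κ))

/-- Index of the first block of level `l`. -/
def levelStart (m : ℕ → ℕ) : ℕ → ℕ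
  | 0 => 0
  | l + 1 => levelStart m l + 2 ^ (l - m l)

/-- The block containing `i ≥ 1` together with the position of `i` inside the block; the index `0`
is sent to an unused position. -/
def blockIndex (m : ℕ → ℕ) (i : ℕ) : ℕ × ℕ :=
  if i = 0 then (0, 1)
  else (levelStart m (Nat.log 2 i) + (i - 2 ^ Nat.log 2 i) / 2 ^ m (Nat.log 2 i),
    (i - 2 ^ Nat.log 2 i) % 2 ^ m (Nat.log 2 i))

section blocks

variable {m : ℕ → ℕ}

lemma log_two_pow_add {l i : ℕ} (h : i < 2 ^ l) : Nat.log 2 (2 ^ l + i) = l := by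
  rw [Nat.log_eq_iff (Or.inr ⟨by norm_num, by positivity⟩), pow_succ]
  omega

lemma two_pow_sub_mul (hm : ∀ l, m l ≤ l) (l : ℕ) : 2 ^ (l - m l) * 2 ^ m l = 2 ^ l := by
  rw [← pow_add, Nat.sub_add_cancel (hm l)]

lemma block_offset_lt (hm : ∀ l, m l ≤ l) {l b : ℕ} (hb : b < 2 ^ (l - m l)) (hj : j < 2 ^ m l) :
    b * 2 ^ m l + j < 2 ^ l := by
  have h := two_pow_sub_mul hm l
  have : (b + 1) * 2 ^ m l ≤ 2 ^ (l - m l) * 2 ^ m l := Nat.mul_le_mul_right _ hb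
  rw [add_mul] at this
  omega

lemma blockStart_level_of_start (hm : ∀ l, m l ≤ l) {l : ℕ}
    (h : blockStart m (levelStart m l) = 2 ^ l) (b : ℕ) (hb : b ≤ 2 ^ (l - m l)) :
    blockStart m (levelStart m l + b) = 2 ^ l + b * 2 ^ m l := by
  induction b with
  | zero => simpa using h
  | succ b ih =>
    have hlt := block_offset_lt hm (Nat.lt_of_succ_le hb) (two_pow_pos (m l))
    rw [← add_assoc, blockStart, ih (Nat.le_of_succ_le hb), log_two_pow_add (by omega)]
    ring

lemma blockStart_levelStart (hm : ∀ l, m l ≤ l) (l : ℕ) :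
    blockStart m (levelStart m l) = 2 ^ l := by
  induction l with
  | zero => simp [levelStart, blockStart]
  | succ l ih =>
    rw [levelStart, blockStart_level_of_start hm ih _ le_rfl, two_pow_sub_mul hm, pow_succ]
    ring

lemma blockStart_level (hm : ∀ l, m l ≤ l) {l b : ℕ} (hb : b ≤ 2 ^ (l - m l)) :
    blockStart m (levelStart m l + b) = 2 ^ l + b * 2 ^ m l :=
  blockStart_level_of_start hm (blockStart_levelStart hm l) b hb

lemma log_blockStart_level (hm : ∀ l, m l ≤ l) {l b : ℕ} (hb : b < 2 ^ (l - m l)) :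
    Nat.log 2 (blockStart m (levelStart m l + b)) = l := by
  have hlt := block_offset_lt hm hb (two_pow_pos (m l))
  rw [blockStart_level hm hb.le, log_two_pow_add (by omega)]

lemma blockExp_level (hm : ∀ l, m l ≤ l) {l b : ℕ} (hb : b < 2 ^ (l - m l)) :
    blockExp m (levelStart m l + b) = m l := by
  rw [blockExp, log_blockStart_level hm hb]

lemma blockIndex_level (hm : ∀ l, m l ≤ l) {l b : ℕ} (hb : b < 2 ^ (l - m l)) (hj : j < 2 ^ m l) :
    blockIndex m (2 ^ l + (b * 2 ^ m l + j)) = (levelStart m l + b, j) := by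
  have h0 := two_pow_pos l
  have hN := two_pow_pos (m l)
  rw [blockIndex, if_neg (by omega), log_two_pow_add (block_offset_lt hm hb hj),
    Nat.add_sub_cancel_left, mul_comm b, Nat.mul_add_div hN, Nat.mul_add_mod, Nat.div_eq_of_lt hj,
    Nat.mod_eq_of_lt hj, add_zero]

lemma blockIndex_injective (hm : ∀ l, m l ≤ l) : Injective (blockIndex m) := by
  refine Function.LeftInverse.injective
    (g := fun x => if x.2 < 2 ^ blockExp m x.1 then blockStart m x.1 + x.2 else 0) fun i => ?_
  rcases Nat.eq_zero_or_pos i with rfl | hi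
  · have : m 0 = 0 := by have := hm 0; omega
    simp [blockIndex, blockExp, blockStart, this]
  · set l := Nat.log 2 i with hl
    have h1 : 2 ^ l ≤ i := Nat.pow_log_le_self 2 hi.ne'
    have h2 : i < 2 ^ (l + 1) := Nat.lt_pow_succ_log_self (by norm_num) i
    have hN := two_pow_pos (m l)
    have hj := mod_lt (i - 2 ^ l) hN
    have hdm := Nat.div_add_mod (i - 2 ^ l) (2 ^ m l)
    have hb : (i - 2 ^ l) / 2 ^ m l < 2 ^ (l - m l) := by
      rw [Nat.div_lt_iff_lt_mul hN, two_pow_sub_mul hm]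
      rw [pow_succ] at h2
      omega
    have e : i = 2 ^ l + ((i - 2 ^ l) / 2 ^ m l * 2 ^ m l + (i - 2 ^ l) % 2 ^ m l) := by
      rw [mul_comm]; omega
    have he := blockIndex_level hm hb hj
    rw [← e] at he
    simp only [he, blockExp_level hm hb, hj, if_true, blockStart_level hm hb.le]
    omega

lemma sum_range_mul_eq (g : ℕ → ℝ) (b : ℕ) :
    ∑ i ∈ range (b * N), g i
      = ∑ c ∈ range b, ∑ i ∈ range N, g (c * N + i) := by
  induction b with
  | zero => simp
  | succ b ih => rw [add_mul, one_mul, sum_range_add, ih, sum_range_succ]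

/-- Splitting a partial sum of `x - y` into full blocks and a remaining incomplete block. -/
lemma abs_sum_le_of_blocks (hn : 0 < n) (hN : 0 < N) {x y : ℕ → ℝ} {M₀ M₁ M₂ : ℝ}
    (h₀ : ∀ k ≤ n, |(∑ b ∈ range k, (∑ i ∈ range N, x (b * N + i)
      - ∑ i ∈ range N, y (b * N + i)))| ≤ M₀)
    (h₁ : ∀ b < n, ∀ k ≤ N, |(∑ i ∈ range k, x (b * N + i))| ≤ M₁)
    (h₂ : ∀ b < n, ∀ k ≤ N, |(∑ i ∈ range k, y (b * N + i))| ≤ M₂) (hk : k ≤ n * N) :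
    |(∑ i ∈ range k, (x i - y i))| ≤ M₀ + M₁ + M₂ := by
  have hM₁ := (abs_nonneg _).trans (h₁ 0 hn 0 hN.le)
  have hM₂ := (abs_nonneg _).trans (h₂ 0 hn 0 hN.le)
  have hb : k / N ≤ n := Nat.div_le_of_le_mul (by rwa [mul_comm])
  have e : k = k / N * N + k % N := by rw [mul_comm]; exact (Nat.div_add_mod k N).symm
  have hj := mod_lt k hN
  set b := k / N
  set j := k % N
  have hsplit : ∑ i ∈ range k, (x i - y i)
      = ∑ c ∈ range b, (∑ i ∈ range N, x (c * N + i)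
        - ∑ i ∈ range N, y (c * N + i))
        + (∑ i ∈ range j, x (b * N + i) - ∑ i ∈ range j, y (b * N + i)) := by
    rw [e, sum_range_add, sum_range_mul_eq]
    simp only [sum_sub_distrib]
  rw [hsplit]
  have hlast : |(∑ i ∈ range j, x (b * N + i)) - ∑ i ∈ range j, y (b * N + i)|
      ≤ M₁ + M₂ := by
    rcases hb.lt_or_eq with hlt | heq
    · exact (abs_sub _ _).trans (add_le_add (h₁ b hlt j hj.le) (h₂ b hlt j hj.le))
    · have : j = 0 := by
        have : n * N + j ≤ n * N := by rw [← heq, ← e, heq]; exact hk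
        omega
      rw [this]
      simpa using add_nonneg hM₁ hM₂
  calc _ ≤ _ := abs_add_le _ _
    _ ≤ M₀ + (M₁ + M₂) := add_le_add (h₀ b hb) hlast
    _ = _ := by ring

end blocks

lemma SubG.comp {Ω' : Type*} {mΩ' : MeasurableSpace Ω'} {ν : Measure Ω'} {g : Ω' → Ω} (h : SubG μ Y)
    (hg : MeasurePreserving g ν μ) (hY : Measurable Y) :
    SubG ν fun ω => Y (g ω) := by
  unfold SubG at h ⊢
  rwa [hg.lintegral_comp (f := fun ω => ofReal (exp (Y ω ^ 2))) (by fun_prop)]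

lemma MeasureTheory.MeasurePreserving.integral_comp_eq {Ω' : Type*} {mΩ' : MeasurableSpace Ω'}
    {ν : Measure Ω'} {g : Ω' → Ω} (hg : MeasurePreserving g ν μ) (hf : AEStronglyMeasurable f μ) :
    ∫ z, f (g z) ∂ν = ∫ ω, f ω ∂μ := by
  rw [← hg.map_eq, integral_map hg.aemeasurable (by rwa [hg.map_eq])]

lemma IsMDS.setIntegral_sum [IsProbabilityMeasure μ] (h : IsMDS μ G x) (s k : ℕ) {A : Set Ω}
    (hA : MeasurableSet[G s] A) :
    ∫ ω in A, ∑ j ∈ range k, x (s + j) ω ∂μ = 0 := by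
  rw [integral_finsetSum _ fun j _ => (h.int _).integrableOn]
  refine sum_eq_zero fun j _ => ?_
  have hA' := h.mono (Nat.le_add_right s j) A hA
  rw [← setIntegral_condExp (h.le _) (h.int _) hA',
    setIntegral_congr_ae (g := fun _ => 0) (h.le _ _ hA')
      ((h.zero (s + j)).mono fun ω hω _ => hω)]
  simp

/-- The bound for the coupling error of one dyadic level. -/
def levelRate (p : ℝ) (m l : ℕ) : ℝ :=
  √(2 ^ (l - m) * (√(2 ^ m) * √((l : ℝ) + 1) * omegaRate p (2 ^ m)))
    + √(2 ^ m) * √((l : ℝ) + 1) + (2 : ℝ) ^ ((l : ℝ) / p)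

def levelC (ι : Type*) [Fintype ι] (p K B : ℝ) : ℝ :=
  √(doobC 2 * (39 * (64 * (lindC ι p K B + 4) + 409600
    + 64 * (remC p K B + remC p (gaussMoment ι p) 0))))
    + 2000 + 2 * (remC p K B + remC p (gaussMoment ι p) 0)

/-- Approximation of the partial sums of `e`, level by level, by those of an iid Gaussian
sequence. -/
theorem CoreHyp.exists_level_coupling (H : CoreHyp μ G e p K B a b) [IsProbabilityMeasure μ]
    (hp : 2 < p) (hp3 : p ≤ 3) {m : ℕ → ℕ} (hm : ∀ l, m l ≤ l) :
    ∃ N : ℕ → Ω × 𝕌 → 𝔼 ι,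
      iIndepFun N (μ.prod uniformSeq) ∧
      (∀ i, MeasurePreserving (N i) (μ.prod uniformSeq) (stdG ι)) ∧
      ∀ l u, ∃ M : Ω × 𝕌 → ℝ, Integrable M (μ.prod uniformSeq) ∧
        (∀ z, ∀ k ≤ 2 ^ l, |(∑ j ∈ range k, (e (2 ^ l + j) z.1 u - N (2 ^ l + j) z u))|
          ≤ M z) ∧
        ∫ z, M z ∂(μ.prod uniformSeq) ≤ levelC ι p K B * levelRate p (m l) l := by
  set s := blockStart m with hs
  set E := blockExp m with hE
  choose Ξ hΞi hΞb hΞ using fun κ => H.lindeberg hp hp3 (s κ) (E κ)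
  set ε : ℕ → ℝ := fun κ => (1 / 2) ^ (κ + 1) with hε
  have hε0 : ∀ κ, 0 < ε κ := fun κ => by positivity
  have hε1 : ∀ κ, ε κ ≤ 1 := fun κ => pow_le_one₀ (by norm_num) (by norm_num)
  set ρ : Measure (ℕ → 𝔼 ι) := gaussSeq ι with hρ
  set P := μ.prod uniformSeq with hP
  obtain ⟨A, V, W, hAmono, hAle, hV, hW, hfresh, hzero, hUW, hWS⟩ :=
    exists_gluing (μ := μ) (ρ := ρ) (𝒢 := fun κ => G (s κ))
      (U := fun κ => vsum e (s κ) (2 ^ E κ)) (S := fun κ => seqSum (2 ^ E κ)) (Ξ := Ξ) (ε := ε)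
      (fun i j h => H.mono (monotone_nat_of_le_succ (fun κ => Nat.le_add_right _ _) h))
      (fun κ => H.le _) hε0
      (fun κ => (H.vsum_meas le_rfl).measurable) (fun κ => H.vsum_int hp _ _)
      (fun κ => measurable_seqSum _) (fun κ => integrable_seqSum _) hΞi
      (fun κ f hf A hA => by
        simp_rw [hρ, integral_comp_seqSum hf]
        exact_mod_cast hΞ κ f hf A hA)
  set U : ℕ → Ω × 𝕌 → 𝔼 ι := fun κ z => vsum e (s κ) (2 ^ E κ) z.1 with hU
  set S : ℕ → Ω × 𝕌 → 𝔼 ι := fun κ z => seqSum (2 ^ E κ) (V κ z) with hS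
  have hVρ := measurePreserving_of_fresh hAle hV hfresh
  have hfst : MeasurePreserving (Prod.fst : Ω × 𝕌 → Ω) P μ :=
    measurePreserving_fst
  have hN := measurePreserving_eval hVρ
  refine ⟨fun i z => V (blockIndex m i).1 z (blockIndex m i).2,
    iIndepFun_eval (iIndepFun_of_fresh hAmono hAle hV hfresh) hVρ (blockIndex_injective hm),
    fun i => hN _ _, fun l u => ?_⟩
  set C₁ := lindC ι p K B + 4 with hC₁
  set C₂ := remC p K B + remC p (gaussMoment ι p) 0 with hC₂
  have hr1 := remC_nonneg hp H.K_nonneg H.B_nonneg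
  have hr2 : 0 ≤ remC p (gaussMoment ι p) 0 := remC_nonneg hp (gaussMoment_nonneg p) le_rfl
  -- maximal inequalities inside the blocks
  choose Y R hYm hRm hY0 hR0 hYs hmax hRi hRb using fun κ =>
    (H.mds u).exists_dyadic_max_decomp hp hp3 (fun k => (H.coord_mom hp u k).1)
      (fun k => (H.coord_mom hp u k).2) H.b_nonneg (fun c i => H.b_le_sq u c i) H.b_sum (s κ) (E κ)
  choose Y' R' hYm' hRm' hY0' hR0' hYs' hmax' hRi' hRb' using fun κ =>
    exists_gaussSeq_max_decomp (ι := ι) hp hp3 u (E κ)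
  have hYm2 := fun κ => ((hYm κ).mono (H.le _)).measurable
  have hRm2 := fun κ => ((hRm κ).mono (H.le _)).measurable
  have hYe := fun κ => (hYs κ).comp hfst (hYm2 κ)
  have hYn := fun κ => (hYs' κ).comp (hVρ κ) (hYm' κ)
  have hRei := fun κ =>
    hfst.integrable_comp_of_integrable (hRi κ)
  have hRni := fun κ =>
    (hVρ κ).integrable_comp_of_integrable (hRi' κ)
  have hReb : ∀ κ, ∫ z, R κ z.1 ^ p ∂P ≤ C₂ * 2 ^ E κ := fun κ => by
    rw [hfst.integral_comp_eq (f := fun ω => R κ ω ^ p) (hRi κ).aestronglyMeasurable]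
    exact (hRb κ).trans (by rw [hC₂]; gcongr; linarith)
  have hRnb : ∀ κ, ∫ z, R' κ (V κ z) ^ p ∂P ≤ C₂ * 2 ^ E κ := fun κ => by
    rw [(hVρ κ).integral_comp_eq (f := fun ω => R' κ ω ^ p) (hRi' κ).aestronglyMeasurable]
    exact (hRb' κ).trans (by rw [hC₂]; gcongr; linarith)
  -- the differences of the block sums
  have hUi : ∀ κ, Integrable (U κ) P := fun κ =>
    hfst.integrable_comp_of_integrable (H.vsum_int hp _ _)
  have hSi : ∀ κ, Integrable (S κ) P := fun κ =>
    (hVρ κ).integrable_comp_of_integrable (integrable_seqSum _)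
  have hWm := fun κ =>
    ((hW κ).mono (hAle _) le_rfl).stronglyMeasurable
  have hUWi : ∀ κ, Integrable (fun z => U κ z - W κ z) P := fun κ =>
    ⟨(hUi κ).1.sub (hWm κ).aestronglyMeasurable, (hUW κ).trans_lt ofReal_lt_top⟩
  have hWi : ∀ κ, Integrable (W κ) P := fun κ => by
    refine ((hUi κ).sub (hUWi κ)).congr (ae_of_all _ fun z => ?_)
    simp
  have hWSi : ∀ κ, Integrable (fun z => W κ z - S κ z) P := fun κ =>
    (hWi κ).sub (hSi κ)
  have hUWb : ∀ κ, ∫ z, ‖U κ z - W κ z‖ ∂P ≤ ε κ := fun κ => by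
    rw [integral_norm_eq_lintegral_enorm (hUWi κ).1]
    exact toReal_le_of_le_ofReal (hε0 κ).le (hUW κ)
  have hΞ0 := fun κ => by
    have h := hΞ κ (fun _ => 0) ((LipschitzWith.const (0:ℝ)).weaken zero_le_one) Set.univ .univ
    have h' := integral_comp_seqSum (ι := ι) (f := fun _ => 0)
      ((LipschitzWith.const (0:ℝ)).weaken zero_le_one) (2 ^ E κ)
    push_cast at h'
    rw [← h'] at h
    simpa using h
  have hWSb : ∀ κ, ∫ z, ‖W κ z - S κ z‖ ∂P ≤ ∫ ω, Ξ κ ω ∂μ + 3 * ε κ :=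
    fun κ => by
      rw [integral_norm_eq_lintegral_enorm (hWSi κ).1]
      exact toReal_le_of_le_ofReal
        (add_nonneg (hΞ0 κ) (mul_nonneg (by norm_num) (hε0 κ).le)) (hWS κ)
  set Δ : ℕ → Ω × 𝕌 → ℝ := fun κ z =>
    U κ z u - S κ z u with hΔ
  set w : ℕ → Ω × 𝕌 → ℝ := fun κ z =>
    W κ z u - S κ z u with hw
  have hUui : ∀ κ, Integrable (fun ω => vsum e (s κ) (2 ^ E κ) ω u) μ := fun κ =>
    (H.vsum_int hp _ _).eval_piLp u
  have hΔi : ∀ κ, Integrable (Δ κ) P := fun κ => ((hUi κ).sub (hSi κ)).eval_piLp u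
  have hwi : ∀ κ, Integrable (w κ) P := fun κ => (hWSi κ).eval_piLp u
  have hΔ1 : ∀ κ, ∫ z, |Δ κ z| ∂P ≤ C₁ * omegaRate p (2 ^ E κ) := fun κ => by
    have h1 : ∫ z, |Δ κ z| ∂P ≤ ∫ z, (‖U κ z - W κ z‖
        + ‖W κ z - S κ z‖) ∂P := by
      refine integral_mono (hΔi κ).abs ((hUWi κ).norm.add (hWSi κ).norm) fun z => ?_
      refine le_trans ?_ (norm_add_le _ _)
      rw [sub_add_sub_cancel]
      exact abs_coord_le_norm (U κ z - S κ z) u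
    rw [integral_add (hUWi κ).norm (hWSi κ).norm] at h1
    have h2 := one_le_omegaRate (p := p) (ℓ := 2 ^ E κ) (by linarith) hp3 (by positivity)
    rw [hC₁]
    linarith [hUWb κ, hWSb κ, hΞb κ, hε1 κ]
  have hwε := fun κ => by
    refine (integral_mono ((hΔi κ).sub (hwi κ)).abs (hUWi κ).norm fun z => ?_).trans (hUWb κ)
    have : Δ κ z - w κ z = (U κ z - W κ z) u := by
      simp [hΔ, hw]
    simp only [Pi.sub_apply, this]
    exact abs_coord_le_norm _ u
  have h0 : ∀ κ D, MeasurableSet[A κ] D → ∫ z in D, Δ κ z ∂P = 0 := fun κ D hD => by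
    have h1 := hzero κ (fun ω => vsum e (s κ) (2 ^ E κ) ω u) (hUui κ) (fun D hD => by
      simp_rw [vsum_apply]
      exact (H.mds u).setIntegral_sum _ _ hD) D hD
    have h2 := setIntegral_fresh hAle hV hfresh (k := κ) (g := fun t => seqSum (2 ^ E κ) t u)
      (by have := measurable_seqSum (ι := ι) (2 ^ E κ); fun_prop) hD
    rw [integral_seqSum_coord, mul_zero] at h2
    rw [integral_sub ((hUi κ).eval_piLp u).integrableOn ((hSi κ).eval_piLp u).integrableOn, h1, h2,
      sub_zero]
  have hn : ∀ b < 2 ^ (l - m l), s (levelStart m l + b) = 2 ^ l + b * 2 ^ m l ∧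
      E (levelStart m l + b) = m l := fun b hb =>
    ⟨blockStart_level hm hb.le, blockExp_level hm hb⟩
  have hΔ2 : ∀ κ l', E κ ≤ l' → Integrable (fun z => Δ κ z ^ 2) P ∧ ∫ z, Δ κ z ^ 2 ∂P ≤
      (64 * C₁ + 409600 + 64 * C₂) * (√(2 ^ E κ) * √((l' : ℝ) + 1) * omegaRate p (2 ^ E κ)) :=
    fun κ l' hl' => by
      refine integral_sq_le_of_max hp hp3 (by positivity) hl' (hΔi κ) (hΔ1 κ)
        ((hYm2 κ).comp measurable_fst) ((hYm' κ).comp (hVρ κ).measurable)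
        (fun z => hY0 κ z.1) (fun z => hY0' κ _) (fun z => hR0 κ z.1) (fun z => hR0' κ _)
        (hYe κ) (hYn κ) (hRei κ) (hRni κ) (hReb κ) (hRnb κ) fun z => ?_
      have h1 := hmax κ z.1 _ le_rfl
      have h2 := hmax' κ (V κ z) _ le_rfl
      simp only [hΔ, hU, hS, vsum_apply, seqSum, WithLp.ofLp_sum, Finset.sum_apply]
      refine (abs_sub _ _).trans ((add_le_add h1 h2).trans (le_of_eq ?_))
      simp only [comp_apply]
      ring
  have hwm := fun κ => by
    have hc : Measurable fun x : 𝔼 ι => x u := by fun_prop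
    have h1 := hc.comp (hW κ)
    have h2 : Measurable[A (κ + 1)] fun z => S κ z u :=
      hc.comp ((measurable_seqSum _).comp (hV κ))
    exact (h1.sub h2).stronglyMeasurable
  obtain ⟨M₀, hM₀i, hM₀, hM₀b⟩ := exists_max_bound hAmono hAle hΔi (fun κ => (hΔ2 κ _ le_rfl).1)
    (fun κ => hwm κ) hwi hwε h0 (levelStart m l) (2 ^ (l - m l))
  obtain ⟨M₁, hM₁i, hM₁, hM₁b⟩ := exists_block_max_bound (ν := P) (C := C₂) hp
    (two_pow_sub_mul hm l) (fun b => (hYm2 (levelStart m l + b)).comp measurable_fst)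
    (fun b z => hR0 (levelStart m l + b) z.1) (fun b => hYe _) (fun b => hRei _)
    (fun b hb => by rw [← (hn b hb).2]; exact hReb _)
  obtain ⟨M₂, hM₂i, hM₂, hM₂b⟩ := exists_block_max_bound (ν := P) (C := C₂) hp
    (two_pow_sub_mul hm l) (fun b => (hYm' (levelStart m l + b)).comp (hVρ _).measurable)
    (fun b z => hR0' (levelStart m l + b) _) (fun b => hYn _) (fun b => hRni _)
    (fun b hb => by rw [← (hn b hb).2]; exact hRnb _)
  have hM01 : Integrable (fun z => M₀ z + M₁ z) P := hM₀i.add hM₁i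
  have hNsum : ∀ b < 2 ^ (l - m l), ∀ k ≤ 2 ^ m l, ∀ z, ∑ i ∈ range k,
      V (blockIndex m (2 ^ l + (b * 2 ^ m l + i))).1 z
        (blockIndex m (2 ^ l + (b * 2 ^ m l + i))).2 u
        = ∑ i ∈ range k, V (levelStart m l + b) z i u := fun b hb k hk z =>
    sum_congr rfl fun i hi => by rw [blockIndex_level hm hb ((mem_range.1 hi).trans_le hk)]
  have hesum : ∀ b < 2 ^ (l - m l), ∀ k z, ∑ i ∈ range k,
      e (2 ^ l + (b * 2 ^ m l + i)) z u
        = ∑ i ∈ range k, e (s (levelStart m l + b) + i) z u := fun b hb k z => by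
    simp_rw [(hn b hb).1, add_assoc]
  refine ⟨fun z => M₀ z + M₁ z + M₂ z, hM01.add hM₂i, fun z k hk => ?_, ?_⟩
  · refine abs_sum_le_of_blocks (n := 2 ^ (l - m l)) (N := 2 ^ m l) (by positivity) (by positivity)
      (x := fun j => e (2 ^ l + j) z.1 u) ?_ ?_ ?_ (by rwa [two_pow_sub_mul hm])
    · intro k hk
      refine le_trans (le_of_eq ?_) (hM₀ z k hk)
      congr 1
      refine sum_congr rfl fun b hb => ?_
      have hb' := (mem_range.1 hb).trans_le hk
      rw [hNsum b hb' _ le_rfl, hesum b hb']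
      simp [hΔ, hU, hS, vsum_apply, seqSum, (hn b hb').2]
    · intro b hb k hk
      rw [hesum b hb]
      refine le_trans ?_ (hM₁ b hb z)
      have := hmax (levelStart m l + b) z.1 k (by rwa [(hn b hb).2])
      rwa [(hn b hb).2] at this
    · intro b hb k hk
      rw [hNsum b hb k hk]
      refine le_trans ?_ (hM₂ b hb z)
      have := hmax' (levelStart m l + b) (V (levelStart m l + b) z) k (by rwa [(hn b hb).2])
      rwa [(hn b hb).2] at this
  · rw [integral_add hM01 hM₂i, integral_add hM₀i hM₁i]
    set C₃ := 64 * C₁ + 409600 + 64 * C₂ with hC₃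
    have hω : 0 ≤ omegaRate p (2 ^ m l) := sum_nonneg fun _ _ => by positivity
    set r : ℝ := √(2 ^ m l) * √((l : ℝ) + 1) * omegaRate p (2 ^ m l) with hr
    have s1 : ∑ b ∈ range (2 ^ (l - m l)), ∫ z, Δ (levelStart m l + b) z ^ 2 ∂P
        ≤ 2 ^ (l - m l) * (C₃ * r) := by
      refine (sum_le_sum (g := fun _ => C₃ * r) fun b hb => ?_).trans (by simp)
      have hb' := (hn b (mem_range.1 hb)).2
      have := (hΔ2 (levelStart m l + b) l (by rw [hb']; exact hm l)).2
      rwa [hb'] at this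
    have s2 : ∑ b ∈ range (2 ^ (l - m l)), ε (levelStart m l + b) ≤ 1 := by
      have h := sum_geometric_two_le (2 ^ (l - m l))
      have h' : ∑ b ∈ range (2 ^ (l - m l)), ε (levelStart m l + b)
          ≤ ∑ b ∈ range (2 ^ (l - m l)), (1 / 2 : ℝ) ^ b * (1 / 2) :=
        sum_le_sum fun b _ => by
          rw [← pow_succ]
          exact pow_le_pow_of_le_one (by norm_num) (by norm_num) (by omega)
      rw [← sum_mul] at h'
      linarith
    have s3 : √(doobC 2 * (39 * ∑ b ∈ range (2 ^ (l - m l)),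
        ∫ z, Δ (levelStart m l + b) z ^ 2 ∂P))
        ≤ √(doobC 2 * (39 * C₃)) * √(2 ^ (l - m l) * r) := by
      have := doobC_nonneg one_lt_two
      rw [← Real.sqrt_mul' _ (by positivity)]
      refine sqrt_le_sqrt ?_
      calc _ ≤ doobC 2 * (39 * (2 ^ (l - m l) * (C₃ * r))) := by gcongr
        _ = _ := by ring
    have s4 : 1 ≤ (2 : ℝ) ^ ((l : ℝ) / p) :=
      one_le_rpow (by norm_num) (by positivity)
    have s5 : 0 ≤ √(2 ^ (l - m l) * r) := sqrt_nonneg _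
    have s6 : 0 ≤ √(2 ^ m l) * √((l : ℝ) + 1) := by positivity
    have s7 : 0 ≤ √(doobC 2 * (39 * C₃)) := sqrt_nonneg _
    have s8 : 0 ≤ C₂ := by positivity
    unfold levelC levelRate
    rw [← hC₂, ← hC₁, ← hC₃, ← hr]
    have t1 : 0 ≤ √(doobC 2 * (39 * C₃)) * (√(2 ^ m l) * √((l : ℝ) + 1)
      + (2 : ℝ) ^ ((l : ℝ) / p)) := by positivity
    have t2 : 0 ≤ C₂ * (√(2 ^ (l - m l) * r) + √(2 ^ m l) * √((l : ℝ) + 1)) := by positivity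
    linarith

lemma omegaRate_le (hp : 1 ≤ p) (hp3 : p < 3) (ℓ : ℕ) :
    omegaRate p ℓ ≤ 2 / (3 - p) * (ℓ : ℝ) ^ ((3 - p) / 2) := by
  have h3 : 0 < 3 - p := by linarith
  induction ℓ with
  | zero => simp only [omegaRate, range_zero, sum_empty]; positivity
  | succ n ih =>
    have h0 : (0 : ℝ) < (n : ℝ) + 1 := by positivity
    have hB := rpow_one_add_le_one_add_mul_self (s := -1 / ((n : ℝ) + 1))
      (p := (3 - p) / 2) (by rw [le_div_iff₀ h0]; linarith [(cast_nonneg n : (0 : ℝ) ≤ n)])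
      (by linarith) (by linarith)
    have h1 : 1 + -1 / ((n : ℝ) + 1) = n / (n + 1) := by field_simp; ring
    have e : (n : ℝ) ^ ((3 - p) / 2)
        = ((n : ℝ) + 1) ^ ((3 - p) / 2) * (1 + -1 / ((n : ℝ) + 1)) ^ ((3 - p) / 2) := by
      rw [← mul_rpow h0.le (by rw [h1]; positivity), h1, mul_div_cancel₀ _ h0.ne']
    have e2 : ((n : ℝ) + 1) ^ (-((p - 1) / 2)) = ((n : ℝ) + 1) ^ ((3 - p) / 2) / ((n : ℝ) + 1) := by
      rw [show -((p - 1) / 2) = (3 - p) / 2 - 1 by ring, rpow_sub h0, rpow_one]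
    rw [omegaRate, sum_range_succ, ← omegaRate, e2]
    rw [e] at ih
    push_cast
    set y := ((n : ℝ) + 1) ^ ((3 - p) / 2)
    have hy : 0 ≤ y := by positivity
    calc _ ≤ 2 / (3 - p) * (y * (1 + (3 - p) / 2 * (-1 / ((n : ℝ) + 1)))) + y / ((n : ℝ) + 1) := by
          gcongr
          refine ih.trans ?_
          gcongr
      _ = _ := by field_simp; ring

lemma omegaRate_three_le (m : ℕ) : omegaRate 3 (2 ^ m) ≤ (m : ℝ) + 1 := by
  induction m with
  | zero => simp [omegaRate]
  | succ m ih =>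
    have h : ∑ x ∈ range (2 ^ m), (((2 ^ m + x : ℕ) : ℝ) + 1) ^ (-((3 - 1 : ℝ) / 2)) ≤ 1 := by
      calc _ ≤ ∑ x ∈ range (2 ^ m), (2 ^ m : ℝ)⁻¹ := by
            refine sum_le_sum fun x _ => ?_
            rw [show -((3 - 1 : ℝ) / 2) = -1 by norm_num, rpow_neg_one]
            gcongr
            push_cast
            linarith [(cast_nonneg x : (0 : ℝ) ≤ x)]
        _ = 1 := by simp
    rw [omegaRate, pow_succ, mul_two, sum_range_add, ← omegaRate]
    push_cast at h ⊢
    linarith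

/-- The rate of one dyadic level for blocks of length of order
`(2 ^ (2 * l) * (l + 1) ^ θ) ^ (1 / p)`. -/
lemma exists_levelRate_le {θ τ θ' : ℝ} (hp : 2 < p) (hC : 0 ≤ C) (h1 : θ / (2 * p) + 1 / 2 = θ')
    (h2 : 1 / 2 + τ + θ * ((2 - p) / (2 * p)) = 2 * θ') (hθ' : 0 ≤ θ') (l : ℕ)
    (hlow : 1 ≤ (2 : ℝ) ^ (2 * l) * ((l : ℝ) + 1) ^ θ)
    (hup : (2 : ℝ) ^ (2 * l) * ((l : ℝ) + 1) ^ θ ≤ (2 : ℝ) ^ (p * l))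
    (hω : ∀ m ≤ l, omegaRate p (2 ^ m) ≤ C * (2 ^ m : ℝ) ^ ((3 - p) / 2) * ((l : ℝ) + 1) ^ τ) :
    ∃ m ≤ l, levelRate p m l
      ≤ (√(C * 2 ^ ((p - 2) / 2)) + 2) * ((2 : ℝ) ^ ((l : ℝ) / p) * ((l : ℝ) + 1) ^ θ') := by
  have hp0 : 0 < p := by linarith
  set L : ℝ := (l : ℝ) + 1 with hL
  have hL1 : 1 ≤ L := by linarith [(cast_nonneg l : (0 : ℝ) ≤ l)]
  have hL0 : 0 < L := by linarith
  set X : ℝ := ((2 : ℝ) ^ (2 * l) * L ^ θ) ^ (1 / p) with hX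
  have hX1 : 1 ≤ X := one_le_rpow hlow (by positivity)
  have hX0 : 0 < X := by linarith
  have hXl : X ≤ 2 ^ l := by
    calc X ≤ ((2 : ℝ) ^ (p * l)) ^ (1 / p) := by rw [hX]; gcongr
      _ = _ := by
        rw [← rpow_mul (by norm_num), show p * l * (1 / p) = (l : ℝ) by field_simp,
          rpow_natCast]
  have hXr : ∀ r : ℝ, X ^ r = (2 : ℝ) ^ (2 * l * r / p) * L ^ (θ * (r / p)) := fun r => by
    rw [hX, ← rpow_mul (by positivity), mul_rpow (by positivity) (by positivity),
      ← rpow_natCast, ← rpow_mul (by norm_num), ← rpow_mul hL0.le]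
    congr 2
    · push_cast; ring
    · ring
  obtain ⟨m, hm1, hm2⟩ := exists_nat_pow_near hX1 (one_lt_two (α := ℝ))
  have hml := (pow_le_pow_iff_right₀ (one_lt_two (α := ℝ))).1 (hm1.trans hXl)
  refine ⟨m, hml, ?_⟩
  set Q : ℝ := 2 ^ m with hQ
  have hQ0 : 0 < Q := by positivity
  rw [pow_succ, ← hQ] at hm2
  have hr2 : (2 : ℝ) ^ (l - m) = 2 ^ l / Q := by
    rw [hQ, pow_sub₀ _ (by norm_num) hml]; rfl
  set z : ℝ := (2 : ℝ) ^ ((l : ℝ) / p) with hz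
  have hz0 : 0 < z := by positivity
  have t2 : √Q * √L ≤ z * L ^ θ' := by
    calc √Q * √L ≤ √X * √L := by gcongr
      _ = z * L ^ θ' := by
        rw [sqrt_eq_rpow, sqrt_eq_rpow, hXr, mul_assoc, ← rpow_add hL0, hz]
        congr 2
        · ring
        · rw [← h1]; ring
  have t3 := le_mul_of_one_le_right hz0.le (one_le_rpow hL1 hθ')
  have t1 : 2 ^ l / Q * (√Q * √L * omegaRate p (2 ^ m)) ≤
      C * 2 ^ ((p - 2) / 2) * (z * L ^ θ') ^ 2 := by
    have hQX : Q ^ ((2 - p) / 2) ≤ (2 : ℝ) ^ ((p - 2) / 2) * X ^ ((2 - p) / 2) := by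
      calc Q ^ ((2 - p) / 2) ≤ (X / 2) ^ ((2 - p) / 2) :=
            rpow_le_rpow_of_nonpos (by positivity) (by linarith) (by linarith)
        _ = _ := by
          rw [div_rpow hX0.le (by norm_num), show (2 - p) / 2 = -((p - 2) / 2) by ring,
            rpow_neg (by norm_num : (0 : ℝ) ≤ 2)]
          field_simp
    calc 2 ^ l / Q * (√Q * √L * omegaRate p (2 ^ m))
        ≤ 2 ^ l / Q * (√Q * √L * (C * Q ^ ((3 - p) / 2) * L ^ τ)) := by
          gcongr; exact hω m hml
      _ = C * 2 ^ l * L ^ (1 / 2 + τ) * Q ^ ((2 - p) / 2) := by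
          rw [rpow_add hL0, ← sqrt_eq_rpow,
            show (2 - p) / 2 = (1 / 2 + (3 - p) / 2) - 1 by ring, rpow_sub hQ0,
            rpow_add hQ0, rpow_one, ← sqrt_eq_rpow]
          ring
      _ ≤ C * 2 ^ l * L ^ (1 / 2 + τ) * ((2 : ℝ) ^ ((p - 2) / 2) * X ^ ((2 - p) / 2)) := by gcongr
      _ = C * 2 ^ ((p - 2) / 2) * ((2 ^ (l : ℝ) * 2 ^ (2 * l * ((2 - p) / 2) / p))
            * (L ^ (1 / 2 + τ) * L ^ (θ * ((2 - p) / 2 / p)))) := by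
          rw [hXr, rpow_natCast]; ring
      _ = _ := by
          rw [← rpow_add (by norm_num), ← rpow_add hL0, mul_pow, ← rpow_two z,
            ← rpow_two (L ^ θ'), hz, ← rpow_mul (by norm_num), ← rpow_mul hL0.le]
          congr 3
          · field_simp; ring
          · rw [mul_comm θ', ← h2]; ring
  have hzL : 0 ≤ z * L ^ θ' := by positivity
  have t1' : √(2 ^ l / Q * (√Q * √L * omegaRate p (2 ^ m))) ≤
      √(C * 2 ^ ((p - 2) / 2)) * (z * L ^ θ') := by
    refine (sqrt_le_sqrt t1).trans (le_of_eq ?_)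
    rw [Real.sqrt_mul (by positivity), Real.sqrt_sq hzL]
  unfold levelRate
  rw [← hQ, ← hL, ← hz, hr2]
  linarith

/-- Exponent of the logarithm in the final rate. -/
def logExp (p : ℝ) : ℝ := if p = 3 then 2 / 3 else (p - 1) / (2 * p)

lemma logExp_nonneg (hp : 2 < p) : 0 ≤ logExp p := by
  unfold logExp
  split_ifs
  · norm_num
  · exact div_nonneg (by linarith) (by linarith)

lemma exists_block_lengths (hp : 2 < p) (hp3 : p ≤ 3) :
    ∃ (C : ℝ) (m : ℕ → ℕ), 0 ≤ C ∧ (∀ l, m l ≤ l) ∧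
      ∀ l, levelRate p (m l) l ≤ C * ((2 : ℝ) ^ ((l : ℝ) / p) * ((l : ℝ) + 1) ^ logExp p) := by
  have hp0 : 0 < p := by linarith
  have hl2 : ∀ l : ℕ, (l : ℝ) + 1 ≤ 2 ^ l := fun l => by
    exact_mod_cast Nat.lt_two_pow_self (n := l)
  have key : ∃ C : ℝ, ∀ l : ℕ, ∃ m ≤ l, levelRate p m l
      ≤ (√(C * 2 ^ ((p - 2) / 2)) + 2) * ((2 : ℝ) ^ ((l : ℝ) / p) * ((l : ℝ) + 1) ^ logExp p) := by
    rcases hp3.eq_or_lt with rfl | hlt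
    · refine ⟨1, fun l => exists_levelRate_le (θ := 1) (τ := 1) hp zero_le_one ?_ ?_
        (logExp_nonneg hp) l ?_ ?_ fun m hm => ?_⟩
      · norm_num [logExp]
      · norm_num [logExp]
      · rw [rpow_one]
        exact one_le_mul_of_one_le_of_one_le (one_le_pow₀ (by norm_num))
          (by linarith [(cast_nonneg l : (0 : ℝ) ≤ l)])
      · rw [rpow_one, mul_comm (3 : ℝ), rpow_mul (by norm_num), rpow_natCast]
        calc (2 : ℝ) ^ (2 * l) * ((l : ℝ) + 1) ≤ 2 ^ (2 * l) * 2 ^ l := by gcongr; exact hl2 l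
          _ = _ := by rw [← pow_add, ← rpow_natCast, ← rpow_natCast,
                        ← rpow_mul (by norm_num)]; push_cast; ring_nf
      · simp only [sub_self, zero_div, Real.rpow_zero, rpow_one, one_mul]
        refine (omegaRate_three_le m).trans ?_
        gcongr
    · have h3 : 0 < 3 - p := by linarith
      refine ⟨2 / (3 - p), fun l => exists_levelRate_le (θ := -1) (τ := 0) hp (by positivity) ?_ ?_
        (logExp_nonneg hp) l ?_ ?_ fun m hm => ?_⟩
      · rw [logExp, if_neg hlt.ne]; field_simp; ring
      · rw [logExp, if_neg hlt.ne]; field_simp; ring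
      · rw [rpow_neg_one, ← div_eq_mul_inv, le_div_iff₀ (by positivity), one_mul]
        exact (hl2 l).trans (pow_le_pow_right₀ (by norm_num) (by omega))
      · rw [rpow_neg_one]
        calc (2 : ℝ) ^ (2 * l) * ((l : ℝ) + 1)⁻¹ ≤ 2 ^ (2 * l) * 1 := by
              gcongr
              exact inv_le_one_of_one_le₀ (by linarith [(cast_nonneg l : (0 : ℝ) ≤ l)])
          _ = (2 : ℝ) ^ ((2 : ℝ) * l) := by rw [mul_one, ← rpow_natCast]; push_cast; rfl
          _ ≤ _ := rpow_le_rpow_of_exponent_le (by norm_num) (by gcongr)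
      · have := omegaRate_le (p := p) (by linarith) hlt (2 ^ m)
        push_cast at this
        simpa using this
  obtain ⟨C, hC⟩ := key
  choose m hm hr using hC
  exact ⟨_, m, by positivity, hm, hr⟩

/-- The level rates sum up geometrically. -/
lemma sum_levelRate_le (hp : 2 < p) (n : ℕ) (hn : 1 ≤ n) :
    ∑ l ∈ range (Nat.log 2 n + 1), (2 : ℝ) ^ ((l : ℝ) / p) * ((l : ℝ) + 1) ^ logExp p
      ≤ 2 ^ (1 / p) / (2 ^ (1 / p) - 1) *
        ((n : ℝ) ^ (1 / p) * (log n / log 2 + 1) ^ logExp p) := by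
  have hp0 : 0 < p := by linarith
  set q : ℝ := 2 ^ (1 / p) with hq
  have hq1 : 1 < q := Real.one_lt_rpow (by norm_num) (by positivity)
  have hql : ∀ l : ℕ, (2 : ℝ) ^ ((l : ℝ) / p) = q ^ l := fun l => by
    rw [hq, ← rpow_natCast, ← rpow_mul (by norm_num)]; congr 1; ring
  set L := Nat.log 2 n with hL
  have hpow : (2 : ℝ) ^ L ≤ n := by exact_mod_cast Nat.pow_log_le_self 2 (by omega)
  have hLlog : (L : ℝ) ≤ log n / log 2 := by
    rw [le_div_iff₀ (log_pos (by norm_num)), ← Real.log_pow]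
    exact Real.log_le_log (by positivity) hpow
  have hqL : q ^ L ≤ (n : ℝ) ^ (1 / p) := by
    rw [hq, ← rpow_natCast, ← rpow_mul (by norm_num), mul_comm, rpow_mul (by norm_num),
      rpow_natCast]
    gcongr
  calc _ ≤ ∑ l ∈ range (L + 1), q ^ l * (log n / log 2 + 1) ^ logExp p := by
        refine sum_le_sum fun l hl => ?_
        have : (l : ℝ) ≤ L := by exact_mod_cast Nat.le_of_lt_succ (mem_range.1 hl)
        rw [hql]
        have h0 := logExp_nonneg hp
        gcongr
        linarith
    _ = (q ^ (L + 1) - 1) / (q - 1) * (log n / log 2 + 1) ^ logExp p := by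
        rw [← sum_mul, geom_sum_eq hq1.ne']
    _ ≤ q * q ^ L / (q - 1) * (log n / log 2 + 1) ^ logExp p := by
        have : 0 < q - 1 := by linarith
        have h1 : 0 ≤ log n / log 2 + 1 := by
          linarith [(cast_nonneg L : (0 : ℝ) ≤ L)]
        gcongr
        rw [pow_succ']
        linarith
    _ ≤ q * (n : ℝ) ^ (1 / p) / (q - 1) * (log n / log 2 + 1) ^ logExp p := by
        have : 0 < q - 1 := by linarith
        have h1 : 0 ≤ log n / log 2 + 1 := by
          linarith [(cast_nonneg L : (0 : ℝ) ≤ L)]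
        gcongr
    _ = _ := by ring

lemma abs_sum_Ico_le_of_levels {g D : ℕ → ℝ}
    (h : ∀ l, ∀ k ≤ 2 ^ l, |(∑ j ∈ range k, g (2 ^ l + j))| ≤ D l) (L : ℕ) :
    ∀ k < 2 ^ L, |(∑ i ∈ Ico 1 (k + 1), g i)| ≤ ∑ l ∈ range L, D l := by
  induction L with
  | zero =>
    intro k hk
    obtain rfl : k = 0 := by simpa using hk
    simp
  | succ L ih =>
    intro k hk
    rw [sum_range_succ]
    have h2 := two_pow_pos L
    rcases lt_or_ge k (2 ^ L) with hlt | hge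
    · have := (abs_nonneg _).trans (h L 0 (Nat.zero_le _))
      linarith [ih k hlt]
    · rw [← Finset.sum_Ico_consecutive g (m := 1) (n := 2 ^ L) (k := k + 1) h2 (by omega),
        Finset.sum_Ico_eq_sum_range g (2 ^ L)]
      have h1 := ih (2 ^ L - 1) (by omega)
      rw [Nat.sub_add_cancel h2] at h1
      exact (abs_add_le _ _).trans (add_le_add h1 (h L _ (by rw [pow_succ] at hk; omega)))

/-- Strong approximation for normalized martingale differences. -/
theorem CoreHyp.exists_coupling (H : CoreHyp μ G e p K B a b) [IsProbabilityMeasure μ]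
    (hp : 2 < p) (hp3 : p ≤ 3) :
    ∃ N : ℕ → Ω × 𝕌 → 𝔼 ι,
      iIndepFun N (μ.prod uniformSeq) ∧
      (∀ i, MeasurePreserving (N i) (μ.prod uniformSeq) (stdG ι)) ∧
      ∃ C : ℝ, 0 ≤ C ∧ ∀ n, 1 ≤ n → ∃ M : Ω × 𝕌 → ℝ,
        Integrable M (μ.prod uniformSeq) ∧
        (∀ z, ∀ k ≤ n, ‖∑ i ∈ Icc 1 k, (e i z.1 - N i z)‖ ≤ M z) ∧
        ∫ z, M z ∂(μ.prod uniformSeq)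
          ≤ C * ((n : ℝ) ^ (1 / p) * (log n / log 2 + 1) ^ logExp p) := by
  obtain ⟨C, m, hC, hm, hr⟩ := exists_block_lengths hp hp3
  obtain ⟨N, hNi, hN, hlev⟩ := H.exists_level_coupling hp hp3 hm
  choose M hMi hM hMb using hlev
  have hc : 0 ≤ levelC ι p K B := by
    have hr1 := remC_nonneg hp H.K_nonneg H.B_nonneg
    have hr2 : 0 ≤ remC p (gaussMoment ι p) 0 := remC_nonneg hp (gaussMoment_nonneg p) le_rfl
    unfold levelC
    positivity
  have hq : (1 : ℝ) < 2 ^ (1 / p) := Real.one_lt_rpow (by norm_num) (by positivity)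
  have hq' : (0 : ℝ) < 2 ^ (1 / p) - 1 := by linarith
  refine ⟨N, hNi, hN, Fintype.card ι * (levelC ι p K B * (C * (2 ^ (1 / p) / (2 ^ (1 / p) - 1)))),
    by positivity, fun n hn => ⟨fun z => ∑ u, ∑ l ∈ range (Nat.log 2 n + 1), M l u z,
      integrable_finsetSum _ fun u _ => integrable_finsetSum _ fun l _ => hMi l u,
      fun z k hk => ?_, ?_⟩⟩
  · refine (norm_le_sum_abs _).trans (sum_le_sum fun u _ => ?_)
    have h := abs_sum_Ico_le_of_levels (g := fun i => e i z.1 u - N i z u)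
      (D := fun l => M l u z) (fun l k hk => hM l u z k hk) (Nat.log 2 n + 1) k
      (hk.trans_lt (Nat.lt_pow_succ_log_self (by norm_num) n))
    rw [Finset.Ico_add_one_right_eq_Icc] at h
    simpa [WithLp.ofLp_sum] using h
  · rw [integral_finsetSum _ fun u _ => integrable_finsetSum _ fun l _ => hMi l u]
    have hu : ∀ u, ∫ z, ∑ l ∈ range (Nat.log 2 n + 1), M l u z ∂(μ.prod uniformSeq)
        ≤ levelC ι p K B * (C * (2 ^ (1 / p) / (2 ^ (1 / p) - 1)))
          * ((n : ℝ) ^ (1 / p) * (log n / log 2 + 1) ^ logExp p) := fun u => by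
      rw [integral_finsetSum _ fun l _ => hMi l u]
      calc _ ≤ ∑ l ∈ range (Nat.log 2 n + 1),
            levelC ι p K B * (C * ((2 : ℝ) ^ ((l : ℝ) / p) * ((l : ℝ) + 1) ^ logExp p)) :=
            sum_le_sum fun l _ => (hMb l u).trans (by gcongr; exact hr l)
        _ = levelC ι p K B * (C * ∑ l ∈ range (Nat.log 2 n + 1),
            (2 : ℝ) ^ ((l : ℝ) / p) * ((l : ℝ) + 1) ^ logExp p) := by
            rw [mul_sum, mul_sum]
        _ ≤ levelC ι p K B * (C * (2 ^ (1 / p) / (2 ^ (1 / p) - 1) *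
            ((n : ℝ) ^ (1 / p) * (log n / log 2 + 1) ^ logExp p))) := by
            gcongr
            exact sum_levelRate_le hp n hn
        _ = _ := by ring
    refine (sum_le_sum fun u _ => hu u).trans (le_of_eq ?_)
    rw [sum_const, card_univ, nsmul_eq_mul]
    ring

/-- For a subadditive sequence, twice the Cesàro sum up to `n` dominates `n * f n`. -/
lemma mul_le_sum_of_subadditive {f : ℕ → ℝ≥0∞} (hf : ∀ m n, f (m + n) ≤ f m + f n) (n : ℕ) :
    n * f n ≤ 2 * ∑ k ∈ range n, f (k + 1) := by
  rcases n with _ | n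
  · simp
  have h : ∑ k ∈ range n, f (n + 1)
      ≤ ∑ k ∈ range n, (f (k + 1) + f (n - 1 - k + 1)) := by
    refine sum_le_sum fun k hk => ?_
    rw [mem_range] at hk
    refine le_trans (le_of_eq ?_) (hf _ _)
    congr 1
    omega
  rw [sum_add_distrib, sum_range_reflect (fun k => f (k + 1))] at h
  simp only [sum_const, Finset.card_range, nsmul_eq_mul] at h
  rw [sum_range_succ, Nat.cast_add, Nat.cast_one, add_mul, one_mul, mul_add, two_mul]
  gcongr
  rw [two_mul]
  exact le_self_add

lemma tsum_geometric_le_rpow (hr : 0 ≤ r) (hk : 0 < k) :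
    ∑' i : ℕ, (if k ≤ 2 ^ i then ofReal ((2 : ℝ) ^ (-(r + 1))) ^ i else 0)
      ≤ 2 * ofReal ((k : ℝ) ^ (-(r + 1))) := by
  set x := ofReal ((2 : ℝ) ^ (-(r + 1))) with hx
  have hx2 : x ≤ 2⁻¹ := by
    rw [hx, ← ofReal_ofNat, ← ENNReal.ofReal_inv_of_pos (by norm_num)]
    refine ofReal_le_ofReal ?_
    rw [← rpow_neg_one]
    exact rpow_le_rpow_of_exponent_le (by norm_num) (by linarith)
  set c := Nat.clog 2 k with hc
  have hkc : k ≤ 2 ^ c := Nat.le_pow_clog (by norm_num) k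
  have hlt : ∀ i, k ≤ 2 ^ i → c ≤ i := fun i hi => Nat.clog_le_of_le_pow hi
  have h0 : x ^ c ≤ ofReal ((k : ℝ) ^ (-(r + 1))) := by
    rw [hx, ← ENNReal.ofReal_pow (by positivity), ← rpow_natCast, ← rpow_mul (by norm_num),
      mul_comm, rpow_mul (by norm_num), rpow_natCast]
    refine ofReal_le_ofReal (rpow_le_rpow_of_nonpos (by positivity) ?_ (by linarith))
    exact_mod_cast hkc
  calc _ ≤ ∑' i : ℕ, (if c ≤ i then x ^ i else 0) := by
        refine tsum_le_tsum fun i => ?_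
        split_ifs with h1 h2
        · exact le_rfl
        · exact absurd (hlt i h1) h2
        · exact zero_le
        · exact le_rfl
    _ = ∑' i : ℕ, x ^ (c + i) := by
        rw [← summable.sum_add_tsum_nat_add' (k := c), sum_eq_zero, zero_add]
        · exact tsum_congr fun i => by rw [if_pos (Nat.le_add_left c i), add_comm]
        · exact fun i hi => if_neg (by simpa using hi)
    _ = x ^ c * (1 - x)⁻¹ := by
        simp_rw [pow_add]
        rw [ENNReal.tsum_mul_left, ENNReal.tsum_geometric]
    _ ≤ ofReal ((k : ℝ) ^ (-(r + 1))) * 2 := by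
        gcongr
        rw [← inv_inv (2 : ℝ≥0∞)]
        refine ENNReal.inv_le_inv.2 ?_
        calc (2 : ℝ≥0∞)⁻¹ = 1 - 2⁻¹ := ENNReal.one_sub_inv_two.symm
          _ ≤ 1 - x := tsub_le_tsub_left hx2 1
    _ = _ := mul_comm _ _

/-- Dyadic sums of a subadditive sequence are controlled by its full weighted sum. -/
lemma tsum_dyadic_le {f : ℕ → ℝ≥0∞} (hf : ∀ m n, f (m + n) ≤ f m + f n) (hr : 0 ≤ r) :
    ∑' i : ℕ, ofReal ((2 : ℝ) ^ (-r)) ^ i * f (2 ^ i)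
      ≤ 4 * ∑' n : ℕ, ofReal ((n + 1 : ℝ) ^ (-(r + 1))) * f (n + 1) := by
  have hx : ofReal ((2 : ℝ) ^ (-r)) = ofReal ((2 : ℝ) ^ (-(r + 1))) * 2 := by
    rw [← ofReal_ofNat, ← ofReal_mul (by positivity)]
    congr 1
    rw [show -r = -(r + 1) + 1 by ring, rpow_add (by norm_num), rpow_one]
  set x := ofReal ((2 : ℝ) ^ (-(r + 1)))
  calc _ ≤ ∑' i : ℕ, 2 * ∑' k : ℕ, (if k + 1 ≤ 2 ^ i then x ^ i else 0) * f (k + 1) := by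
        refine tsum_le_tsum fun i => ?_
        have h := mul_le_sum_of_subadditive hf (2 ^ i)
        have hs : ∑' k : ℕ, (if k + 1 ≤ 2 ^ i then x ^ i else 0) * f (k + 1)
            = x ^ i * ∑ k ∈ range (2 ^ i), f (k + 1) := by
          rw [tsum_eq_sum (s := range (2 ^ i)), mul_sum]
          · exact sum_congr rfl fun k hk => by
              rw [if_pos (Nat.succ_le_of_lt (mem_range.1 hk))]
          · intro k hk
            rw [if_neg (by simpa using hk), zero_mul]
        rw [hs, hx, mul_pow, mul_assoc, mul_left_comm (2 : ℝ≥0∞)]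
        gcongr x ^ i * ?_
        exact_mod_cast h
    _ = 2 * ∑' k : ℕ, (∑' i : ℕ, (if k + 1 ≤ 2 ^ i then x ^ i else 0)) * f (k + 1) := by
        rw [ENNReal.tsum_mul_left, ENNReal.tsum_comm]
        simp_rw [ENNReal.tsum_mul_right]
    _ ≤ 2 * ∑' k : ℕ, 2 * ofReal ((k + 1 : ℝ) ^ (-(r + 1))) * f (k + 1) := by
        gcongr with k
        exact_mod_cast tsum_geometric_le_rpow hr k.succ_pos
    _ = _ := by
        simp_rw [mul_assoc]
        rw [ENNReal.tsum_mul_left, ← mul_assoc]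
        norm_num

section envelope

lemma one_sub_stdNormalCDF (x : ℝ) : 1 - stdNormalCDF x = ((gaussianReal 0 1) (Ioi x)).toReal := by
  rw [stdNormalCDF, ← Set.compl_Iic, prob_compl_eq_one_sub measurableSet_Iic,
    ENNReal.toReal_sub_of_le prob_le_one one_ne_top, toReal_one]

lemma gaussian_tail_ge {x : ℝ} (hxy : x ≤ y) (hy : 1 ≤ y) :
    exp (-2 * y ^ 2) / 3 ≤ 1 - stdNormalCDF x := by
  rw [one_sub_stdNormalCDF, ← Measure.real]
  have hsub : Ioc y (y + 1) ⊆ Ioi x := fun z hz => hxy.trans_lt hz.1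
  refine le_trans ?_ (measureReal_mono hsub)
  rw [Measure.real, gaussianReal_apply_eq_integral 0 one_ne_zero,
    toReal_ofReal (setIntegral_nonneg measurableSet_Ioc fun z _ => gaussianPDFReal_nonneg 0 1 z)]
  have hpi : √(2 * Real.pi) ≤ 3 := by
    rw [Real.sqrt_le_left (by norm_num)]
    nlinarith [Real.pi_lt_d2]
  have hpi0 : 0 < √(2 * Real.pi) := by positivity
  calc exp (-2 * y ^ 2) / 3
      = ∫ z in Ioc y (y + 1), exp (-2 * y ^ 2) / 3 := by simp
    _ ≤ _ := by
      refine setIntegral_mono_on (integrable_const _) (integrable_gaussianPDFReal 0 1).integrableOn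
        measurableSet_Ioc fun z hz => ?_
      rw [gaussianPDFReal]
      simp only [coe_one, mul_one, sub_zero]
      rw [div_eq_inv_mul]
      gcongr
      have h1 : 0 ≤ z := by linarith [hz.1]
      have h2 : z ≤ 2 * y := by linarith [hz.2]
      nlinarith

lemma exists_stdNormalCDF_ge (hy : y < 1) : ∃ x, y ≤ stdNormalCDF x := by
  have h := tendsto_measure_Iic_atTop (gaussianReal 0 1)
  rw [measure_univ] at h
  have h' := (tendsto_toReal one_ne_top).comp h
  rw [toReal_one] at h'
  exact ((h'.eventually (lt_mem_nhds hy)).exists).imp fun x hx => hx.le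

/-- Lower bound for the Gaussian quantile function near `1`. -/
lemma sqrt_le_stdNormalCDFInv {u : ℝ} (hu0 : 0 < u) (hu1 : u < 1) :
    √(1 - log u) ≤ 4 * max 1 (stdNormalCDFInv (1 - u / 2)) := by
  set y := √(1 - log u) with hy
  have hlog := log_neg hu0 hu1
  have hy2 : y ^ 2 = 1 - log u := sq_sqrt (by linarith)
  by_contra! hlt
  have h1 : 4 < y := by linarith [le_max_left 1 (stdNormalCDFInv (1 - u / 2))]
  have h2 : stdNormalCDFInv (1 - u / 2) < y / 4 := by
    linarith [le_max_right 1 (stdNormalCDFInv (1 - u / 2))]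
  refine absurd h2 (not_lt.2 (le_csInf (exists_stdNormalCDF_ge (by linarith)) fun x hx => ?_))
  by_contra! hxy
  have h3 := gaussian_tail_ge hxy.le (by linarith)
  have hx' : 1 - u / 2 ≤ stdNormalCDF x := hx
  have h4 : u = exp (1 - y ^ 2) := by
    rw [hy2, sub_sub_cancel, exp_log hu0]
  have h5 : exp (1 - y ^ 2) * 2 ≤ exp (-2 * (y / 4) ^ 2) := by
    have : (2 : ℝ) ≤ exp 1 := by linarith [add_one_le_exp (1 : ℝ)]
    calc _ ≤ exp (1 - y ^ 2) * exp 1 := by gcongr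
      _ = exp (1 - y ^ 2 + 1) := (exp_add _ _).symm
      _ ≤ _ := exp_le_exp.2 (by nlinarith)
  linarith

variable [IsProbabilityMeasure P]

/-- A subgaussian weight restricted to a small event. -/
lemma setLIntegral_rpow_le_of_subG (hr0 : 0 ≤ r) (hr : r ≤ 1) (hY : Measurable Y)
    (hY0 : ∀ ω, 0 ≤ Y ω) (hs : SubG P Y) {A : Set Ω} (hA0 : P A ≠ 0) :
    ∫⁻ ω in A, ofReal (Y ω ^ r) ∂P
      ≤ 101 * (P A * ofReal ((1 - log (P A).toReal) ^ (r / 2))) := by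
  set α := (P A).toReal with hα
  have hα0 := toReal_pos hA0 (measure_ne_top _ _)
  have hα1 : α ≤ 1 := toReal_mono one_ne_top prob_le_one
  have hPA : P A = ofReal α := (ofReal_toReal (measure_ne_top _ _)).symm
  set L := 1 - log α with hL
  have hL1 : 1 ≤ L := by linarith [Real.log_nonpos hα0.le hα1]
  have hpt : ∀ y : ℝ, 0 ≤ y → y ^ r ≤ L ^ (r / 2) * (1 + α * exp (y ^ 2)) := fun y hy => by
    have e : y ^ r = L ^ (r / 2) * (y ^ 2 / L) ^ (r / 2) := by
      rw [← mul_rpow (by positivity) (by positivity), mul_div_cancel₀ _ (by positivity),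
        ← rpow_two, ← rpow_mul hy]
      congr 1
      ring
    rw [e]
    gcongr
    have hpos : 0 ≤ α * exp (y ^ 2) := by positivity
    rcases le_total (y ^ 2 / L) 1 with h | h
    · linarith [Real.rpow_le_one (by positivity) h (by linarith : 0 ≤ r / 2)]
    · have h1 : (y ^ 2 / L) ^ (r / 2) ≤ y ^ 2 / L := by
        simpa using rpow_le_rpow_of_exponent_le h (by linarith : r / 2 ≤ 1)
      have h2 : L ≤ y ^ 2 := by rwa [le_div_iff₀ (by positivity), one_mul] at h
      have h3 : y ^ 2 / L ≤ 1 + (y ^ 2 - L) := by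
        rw [div_le_iff₀ (by positivity)]
        nlinarith
      have h4 : 1 + (y ^ 2 - L) = y ^ 2 + log α := by rw [hL]; ring
      have h5 := add_one_le_exp (log α + y ^ 2)
      rw [exp_add, exp_log hα0] at h5
      linarith
  calc ∫⁻ ω in A, ofReal (Y ω ^ r) ∂P
      ≤ ∫⁻ ω in A, ofReal (L ^ (r / 2)) *
        (1 + ofReal α * ofReal (exp (Y ω ^ 2))) ∂P := by
        refine lintegral_mono fun ω => ?_
        rw [← ofReal_mul hα0.le, ← ofReal_one,
          ← ofReal_add zero_le_one (by positivity), ← ofReal_mul (by positivity)]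
        exact ofReal_le_ofReal (hpt _ (hY0 ω))
    _ = ofReal (L ^ (r / 2)) *
        (P A + ofReal α * ∫⁻ ω in A, ofReal (exp (Y ω ^ 2)) ∂P) := by
        rw [lintegral_const_mul _ (by fun_prop), lintegral_add_left measurable_const,
          lintegral_const_mul _ (by fun_prop)]
        simp
    _ ≤ ofReal (L ^ (r / 2)) * (P A + P A * 100) := by
        rw [← hPA]
        gcongr
        exact (setLIntegral_le_lintegral _ _).trans hs
    _ = _ := by
        rw [show (101 : ℝ≥0∞) = 1 + 100 by norm_num]
        ring

lemma le_absQuantile {X : Ω → ℝ} (hX : Measurable X) {u : ℝ} (hu : 0 < u)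
    (h : u < (P {ω | t < |X ω|}).toReal) : t ≤ absQuantile P X u := by
  refine le_csInf ?_ fun x hx => ?_
  · have hm : Measurable fun ω => |X ω| := by fun_prop
    have := Measure.isProbabilityMeasure_map (μ := P) hm.aemeasurable
    have h1 := tendsto_measure_Iic_atTop (P.map fun ω => |X ω|)
    rw [measure_univ] at h1
    have h2 := (tendsto_toReal one_ne_top).comp h1
    rw [toReal_one] at h2
    obtain ⟨x, hx⟩ := (h2.eventually (lt_mem_nhds (show 1 - u < 1 by linarith))).exists
    refine ⟨x, show _ ≤ u from ?_⟩
    have h3 : {ω | x < |X ω|} = ((fun ω => |X ω|) ⁻¹' Iic x)ᶜ := by ext; simp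
    rw [h3, prob_compl_eq_one_sub (hm measurableSet_Iic),
      ENNReal.toReal_sub_of_le prob_le_one one_ne_top, toReal_one]
    rw [comp_apply, Measure.map_apply hm measurableSet_Iic] at hx
    have hx' := hx
    linarith
  · by_contra! hlt
    refine absurd (h.trans_le (le_trans ?_ (show _ ≤ u from hx))) (lt_irrefl _)
    exact toReal_mono (measure_ne_top _ _) (measure_mono fun ω hω => hlt.trans hω)

/-- Subgaussian weights are controlled by the envelope norm. -/
theorem lintegral_rpow_mul_le_envNorm (hp : 2 < p) (hp3 : p ≤ 3) {Z : Ω → ℝ} (hY : Measurable Y)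
    (hY0 : ∀ ω, 0 ≤ Y ω) (hs : SubG P Y) (hZ : Measurable Z) :
    ∫⁻ ω, ofReal (Y ω ^ (p - 2) * |Z ω|) ∂P ≤ 404 * envNorm P p Z := by
  set r := p - 2 with hr
  set g : ℝ → ℝ≥0∞ := fun u => ofReal ((1 - log u) ^ (r / 2)) with hg
  have hgm : Measurable g := by fun_prop
  set h : ℝ → ℝ := fun t => (P {ω | t < |Z ω|}).toReal with hh
  have hanti : Antitone h := fun s t hst =>
    toReal_mono (measure_ne_top _ _) (measure_mono fun ω (hω : t < |Z ω|) => hst.trans_lt hω)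
  have hhm := hanti.measurable
  have hw : Measurable fun ω => ofReal (Y ω ^ r) := by fun_prop
  have step : ∀ t, (P.withDensity fun ω => ofReal (Y ω ^ r)) {ω | t < |Z ω|}
      ≤ 101 * ∫⁻ u in Ioo (0 : ℝ) 1, (Iio (h t)).indicator g u := fun t => by
    have hA : MeasurableSet {ω | t < |Z ω|} := measurableSet_lt measurable_const (by fun_prop)
    rw [withDensity_apply _ hA]
    by_cases hA0 : P {ω | t < |Z ω|} = 0
    · rw [Measure.restrict_eq_zero.2 hA0, lintegral_zero_measure]
      exact zero_le
    have hα0 := toReal_pos hA0 (measure_ne_top _ _)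
    have hα1 : h t ≤ 1 := toReal_mono one_ne_top prob_le_one
    refine (setLIntegral_rpow_le_of_subG (by linarith) (by linarith) hY hY0 hs hA0).trans ?_
    gcongr 101 * ?_
    calc P {ω | t < |Z ω|} * g (h t) = ∫⁻ _ in Ioo 0 (h t), g (h t) := by
          rw [setLIntegral_const, Real.volume_Ioo, sub_zero, hh,
            ofReal_toReal (measure_ne_top _ _), mul_comm]
      _ ≤ ∫⁻ u in Ioo 0 (h t), (Iio (h t)).indicator g u := by
          refine setLIntegral_mono' measurableSet_Ioo fun u hu => ?_
          rw [indicator_of_mem (Set.mem_Iio.2 hu.2)]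
          refine ofReal_le_ofReal (rpow_le_rpow ?_ ?_ (by linarith))
          · linarith [Real.log_nonpos hα0.le hα1]
          · linarith [Real.log_le_log hu.1 hu.2.le]
      _ ≤ _ := lintegral_mono_set (Set.Ioo_subset_Ioo_right hα1)
  have hQ : ∀ u ∈ Ioo (0 : ℝ) 1,
      ∫⁻ t in Ioi (0 : ℝ), (Iio (h t)).indicator g u
        ≤ 4 * ofReal ((max 1 (stdNormalCDFInv (1 - u/2))) ^ (p - 2) * absQuantile P Z u) := by
    intro u hu
    have hΦ : 1 ≤ max 1 (stdNormalCDFInv (1 - u / 2)) := le_max_left _ _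
    have hlog := log_neg hu.1 hu.2
    have hgu : g u ≤ 4 * ofReal (max 1 (stdNormalCDFInv (1 - u / 2)) ^ (p - 2)) := by
      rw [← ofReal_ofNat, ← ofReal_mul (by norm_num)]
      refine ofReal_le_ofReal ?_
      calc (1 - log u) ^ (r / 2) = (√(1 - log u)) ^ r := by
            rw [sqrt_eq_rpow, ← rpow_mul (by linarith)]
            congr 1
            ring
        _ ≤ (4 * max 1 (stdNormalCDFInv (1 - u / 2))) ^ r :=
            rpow_le_rpow (sqrt_nonneg _) (sqrt_le_stdNormalCDFInv hu.1 hu.2) (by linarith)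
        _ = 4 ^ r * max 1 (stdNormalCDFInv (1 - u / 2)) ^ r :=
            mul_rpow (by norm_num) (by linarith)
        _ ≤ _ := by
            gcongr
            simpa using rpow_le_rpow_of_exponent_le (by norm_num : (1 : ℝ) ≤ 4)
              (by linarith : r ≤ 1)
    calc ∫⁻ t in Ioi (0 : ℝ), (Iio (h t)).indicator g u
        ≤ ∫⁻ t in Ioi (0 : ℝ), (Iic (absQuantile P Z u)).indicator (fun _ => g u) t := by
          refine lintegral_mono fun t => ?_
          by_cases hut : u < h t
          · rw [indicator_of_mem (Set.mem_Iio.2 hut),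
              indicator_of_mem (Set.mem_Iic.2 (le_absQuantile hZ hu.1 hut))]
          · rw [Set.indicator_of_notMem (by simpa using hut)]
            exact zero_le
      _ = g u * ofReal (absQuantile P Z u) := by
          rw [lintegral_indicator measurableSet_Iic, setLIntegral_const,
            Measure.restrict_apply measurableSet_Iic, inter_comm, Set.Ioi_inter_Iic,
            Real.volume_Ioc, sub_zero]
      _ ≤ _ := by
          rw [ofReal_mul (by positivity), ← mul_assoc]
          gcongr
  calc ∫⁻ ω, ofReal (Y ω ^ r * |Z ω|) ∂P
      = ∫⁻ ω, ofReal |Z ω| ∂(P.withDensity fun ω => ofReal (Y ω ^ r)) := by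
        rw [lintegral_withDensity_eq_lintegral_mul _ hw (by fun_prop)]
        refine lintegral_congr fun ω => ?_
        rw [ofReal_mul (by have := hY0 ω; positivity), Pi.mul_apply]
    _ = ∫⁻ t in Ioi 0, (P.withDensity fun ω => ofReal (Y ω ^ r)) {ω | t < |Z ω|} :=
        lintegral_eq_lintegral_meas_lt _ (ae_of_all _ fun ω => abs_nonneg _) (by fun_prop)
    _ ≤ ∫⁻ t in Ioi 0, 101 * ∫⁻ u in Ioo (0 : ℝ) 1, (Iio (h t)).indicator g u :=
        lintegral_mono step
    _ = 101 * ∫⁻ u in Ioo (0 : ℝ) 1, ∫⁻ t in Ioi 0, (Iio (h t)).indicator g u := by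
        rw [lintegral_const_mul' _ _ (by norm_num)]
        congr 1
        refine lintegral_lintegral_swap (Measurable.aemeasurable ?_)
        have hset :=
          measurableSet_lt measurable_snd (hhm.comp measurable_fst)
        exact (hgm.comp measurable_snd).indicator hset
    _ ≤ 101 * ∫⁻ u in Ioo (0 : ℝ) 1, 4 * ofReal
          ((max 1 (stdNormalCDFInv (1 - u/2))) ^ (p - 2) * absQuantile P Z u) := by
        gcongr 101 * ?_
        exact setLIntegral_mono' measurableSet_Ioo hQ
    _ = _ := by
        rw [lintegral_const_mul' _ _ (by norm_num), ← mul_assoc, envNorm]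
        norm_num

end envelope

section transfer

variable {Ω₀ : Type*} {m : MeasurableSpace Ω₀} {mΩ₀ : MeasurableSpace Ω₀} {ν : Measure Ω₀}
  [IsFiniteMeasure P] [IsFiniteMeasure ν]

/-- Conditional expectations commute with measure-preserving maps. -/
lemma MeasureTheory.MeasurePreserving.condExp_comp {T : Ω → Ω₀} (hT : MeasurePreserving T P ν)
    (hm : m ≤ mΩ₀) {f : Ω₀ → ℝ} (hf : Integrable f ν) :
    (fun ω => (ν[f | m]) (T ω)) =ᵐ[P] P[fun ω => f (T ω) | m.comap T] := by
  have hle := (MeasurableSpace.comap_mono hm).trans hT.measurable.comap_le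
  have hfT := hT.integrable_comp_of_integrable hf
  have hcT : Integrable (fun ω => (ν[f | m]) (T ω)) P :=
    hT.integrable_comp_of_integrable integrable_condExp
  refine ae_eq_condExp_of_forall_setIntegral_eq hle hfT (fun s _ _ => hcT.integrableOn) ?_ ?_
  · rintro s ⟨t, ht, rfl⟩ -
    have ht' := hm t ht
    have key : ∀ g : Ω₀ → ℝ, Integrable g ν →
        ∫ ω in T ⁻¹' t, g (T ω) ∂P = ∫ η in t, g η ∂ν := fun g hg => by
      rw [← integral_indicator (hT.measurable ht'), ← integral_indicator ht', ← hT.map_eq,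
        integral_map hT.measurable.aemeasurable
          (by rw [hT.map_eq]; exact (hg.indicator ht').aestronglyMeasurable)]
      rfl
    rw [key _ integrable_condExp, key _ hf, setIntegral_condExp hm hf ht]
  · exact (stronglyMeasurable_condExp.comp_measurable (comap_measurable T)).aestronglyMeasurable

/-- Weighted contraction property of the conditional expectation. -/
lemma lintegral_mul_enorm_condExp_le {m : MeasurableSpace Ω} (hm : m ≤ mΩ) {W : Ω → ℝ≥0∞}
    (hW : Measurable[m] W) (hf : Integrable f P) :
    ∫⁻ ω, W ω * ‖(P[f | m]) ω‖ₑ ∂P ≤ ∫⁻ ω, W ω * ‖f ω‖ₑ ∂P := by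
  have hle : (P.withDensity fun ω => ‖(P[f | m]) ω‖ₑ).trim hm
      ≤ (P.withDensity fun ω => ‖f ω‖ₑ).trim hm := by
    refine Measure.le_iff.2 fun s hs => ?_
    rw [trim_measurableSet_eq hm hs, trim_measurableSet_eq hm hs, withDensity_apply _ (hm s hs),
      withDensity_apply _ (hm s hs), ← lintegral_indicator (hm s hs),
      ← lintegral_indicator (hm s hs)]
    have h := eLpNorm_condExp_le_eLpNorm (μ := P) (m := m) (s.indicator f) le_rfl
    rw [eLpNorm_congr_ae (condExp_indicator hf hs), eLpNorm_one_eq_lintegral_enorm,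
      eLpNorm_one_eq_lintegral_enorm] at h
    simpa only [enorm_indicator_eq_indicator_enorm] using h
  have key : ∀ g : Ω → ℝ, Integrable g P →
      ∫⁻ ω, W ω * ‖g ω‖ₑ ∂P = ∫⁻ ω, W ω ∂((P.withDensity fun ω => ‖g ω‖ₑ).trim hm) := fun g hg => by
    rw [lintegral_trim hm hW, lintegral_withDensity_eq_lintegral_mul₀
      hg.aestronglyMeasurable.enorm (hW.mono hm le_rfl).aemeasurable]
    exact lintegral_congr fun ω => mul_comm _ _
  rw [key _ integrable_condExp, key _ hf]
  exact lintegral_mono' hle le_rfl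

lemma lintegral_rpow_mul_abs_condExp_le {m : MeasurableSpace Ω} (hm : m ≤ mΩ) (hY : Measurable[m] Y)
    (hY0 : ∀ ω, 0 ≤ Y ω) (hf : Integrable f P) :
    ∫⁻ ω, ofReal (Y ω ^ r * |(P[f | m]) ω|) ∂P
      ≤ ∫⁻ ω, ofReal (Y ω ^ r * |f ω|) ∂P := by
  have e : ∀ g : Ω → ℝ, ∀ ω, ofReal (Y ω ^ r * |g ω|) = ofReal (Y ω ^ r) * ‖g ω‖ₑ :=
    fun g ω => by
      rw [ofReal_mul (rpow_nonneg (hY0 ω) r), ← norm_eq_abs, ofReal_norm]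
  simp_rw [e]
  exact lintegral_mul_enorm_condExp_le hm
    ((ENNReal.measurable_ofReal.comp (measurable_id.pow_const r)).comp hY) hf

end transfer

section subadditive

variable [IsFiniteMeasure μ] {X : κ → ℕ → Ω → ℝ} {N : ℕ → (Ω → ℝ) → ℝ≥0∞}

/-- Uniform size, measured by the functionals `N c`, of the conditional sums of length `n`. -/
def condSize (μ : Measure Ω) (G : ℕ → MeasurableSpace Ω) (X : κ → ℕ → Ω → ℝ)
    (N : ℕ → (Ω → ℝ) → ℝ≥0∞) (n : ℕ) : ℝ≥0∞ :=
  ⨆ (k : κ) (c : ℕ), N c (μ[fun ω => ∑ j ∈ range n, X k (c + j) ω | G c])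

lemma le_condSize (k : κ) (c n : ℕ) :
    N c (μ[fun ω => ∑ j ∈ range n, X k (c + j) ω | G c]) ≤ condSize μ G X N n :=
  le_iSup₂ (f := fun k c => N c (μ[fun ω => ∑ j ∈ range n, X k (c + j) ω | G c])) k c

lemma condSize_add (hmono : Monotone G) (hle : ∀ c, G c ≤ mΩ) (hX : ∀ k j, Integrable (X k j) μ)
    (hadd : ∀ c f g, Integrable f μ → Integrable g μ → N c (f + g) ≤ N c f + N c g)
    (hce : ∀ c c' f, c ≤ c' → Integrable f μ → N c (μ[f | G c]) ≤ N c' f)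
    (hcongr : ∀ c f g, f =ᵐ[μ] g → N c f = N c g) (m n : ℕ) :
    condSize μ G X N (m + n) ≤ condSize μ G X N m + condSize μ G X N n := by
  refine iSup₂_le fun k c => ?_
  have hI : ∀ c n, Integrable (fun ω => ∑ j ∈ range n, X k (c + j) ω) μ := fun c n =>
    integrable_finsetSum _ fun j _ => hX k _
  have e : (fun ω => ∑ j ∈ range (m + n), X k (c + j) ω)
      = (fun ω => ∑ j ∈ range m, X k (c + j) ω)
        + fun ω => ∑ j ∈ range n, X k (c + m + j) ω := by
    ext ω
    simp only [Pi.add_apply, sum_range_add, add_assoc]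
  have h : μ[fun ω => ∑ j ∈ range (m + n), X k (c + j) ω | G c]
      =ᵐ[μ] μ[fun ω => ∑ j ∈ range m, X k (c + j) ω | G c]
        + μ[μ[fun ω => ∑ j ∈ range n, X k (c + m + j) ω | G (c + m)] | G c] := by
    rw [e]
    filter_upwards [condExp_add (hI c m) (hI (c + m) n) (G c),
      condExp_condExp_of_le (f := fun ω => ∑ j ∈ range n, X k (c + m + j) ω)
        (hmono (Nat.le_add_right c m)) (hle (c + m))] with ω h1 h2
    rw [h1, Pi.add_apply, Pi.add_apply, h2]
  rw [hcongr c _ _ h]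
  refine (hadd c _ _ integrable_condExp integrable_condExp).trans
    (add_le_add (le_condSize k c m) ?_)
  exact (hce c (c + m) _ (Nat.le_add_right c m) integrable_condExp).trans (le_condSize k (c + m) n)

/-- The functional attached to nonnegative subgaussian weights. -/
def weightSize (μ : Measure Ω) (G : ℕ → MeasurableSpace Ω) (r : ℝ) (c : ℕ) (f : Ω → ℝ) : ℝ≥0∞ :=
  ⨆ (Y : Ω → ℝ) (_ : StronglyMeasurable[G c] Y) (_ : ∀ ω, 0 ≤ Y ω) (_ : SubG μ Y),
    ∫⁻ ω, ofReal (Y ω ^ r * |f ω|) ∂μ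

lemma le_weightSize {c : ℕ} (hY : StronglyMeasurable[G c] Y) (hY0 : ∀ ω, 0 ≤ Y ω) (hs : SubG μ Y)
    (f : Ω → ℝ) :
    ∫⁻ ω, ofReal (Y ω ^ r * |f ω|) ∂μ ≤ weightSize μ G r c f :=
  le_iSup_of_le Y (le_iSup_of_le hY (le_iSup_of_le hY0 (le_iSup_of_le hs le_rfl)))

lemma weightSize_le {c : ℕ} {C : ℝ≥0∞}
    (h : ∀ Y : Ω → ℝ, StronglyMeasurable[G c] Y → (∀ ω, 0 ≤ Y ω) → SubG μ Y →
      ∫⁻ ω, ofReal (Y ω ^ r * |f ω|) ∂μ ≤ C) : weightSize μ G r c f ≤ C :=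
  iSup_le fun Y => iSup_le fun hY => iSup_le fun hY0 => iSup_le fun hs => h Y hY hY0 hs

lemma condSize_weightSize_add (hmono : Monotone G) (hle : ∀ c, G c ≤ mΩ)
    (hX : ∀ k j, Integrable (X k j) μ) (m n : ℕ) :
    condSize μ G X (weightSize μ G r) (m + n)
      ≤ condSize μ G X (weightSize μ G r) m + condSize μ G X (weightSize μ G r) n := by
  refine condSize_add hmono hle hX (fun c f g hf hg => ?_) (fun c c' f hcc hf => ?_)
    (fun c f g hfg => ?_) m n
  · refine weightSize_le fun Y hY hY0 hs => ?_
    have hYm := (hY.mono (hle c)).measurable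
    refine le_trans ?_ (add_le_add (le_weightSize hY hY0 hs f) (le_weightSize hY hY0 hs g))
    rw [← lintegral_add_left' (by have := hf.aestronglyMeasurable.aemeasurable; fun_prop)]
    refine lintegral_mono fun ω => ?_
    have := rpow_nonneg (hY0 ω) r
    rw [← ofReal_add (by positivity) (by positivity), ← mul_add]
    exact ofReal_le_ofReal (mul_le_mul_of_nonneg_left (abs_add_le _ _) this)
  · exact weightSize_le fun Y hY hY0 hs =>
      (lintegral_rpow_mul_abs_condExp_le (hle c) hY.measurable hY0 hf).trans
        (le_weightSize (hY.mono (hmono hcc)) hY0 hs f)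
  · have : ∀ Y : Ω → ℝ, ∫⁻ ω, ofReal (Y ω ^ r * |f ω|) ∂μ
        = ∫⁻ ω, ofReal (Y ω ^ r * |g ω|) ∂μ := fun Y =>
      lintegral_congr_ae (by filter_upwards [hfg] with ω h; rw [h])
    simp_rw [weightSize, this]

lemma condSize_eLpNorm_add {q : ℝ≥0∞} (hq : 1 ≤ q) (hmono : Monotone G) (hle : ∀ c, G c ≤ mΩ)
    (hX : ∀ k j, Integrable (X k j) μ) (m n : ℕ) :
    condSize μ G X (fun _ f => eLpNorm f q μ) (m + n)
      ≤ condSize μ G X (fun _ f => eLpNorm f q μ) m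
        + condSize μ G X (fun _ f => eLpNorm f q μ) n :=
  condSize_add (N := fun _ f => eLpNorm f q μ) hmono hle hX
    (fun _ _ _ hf hg => eLpNorm_add_le hf.aestronglyMeasurable hg.aestronglyMeasurable hq)
    (fun _ _ f _ _ => eLpNorm_condExp_le_eLpNorm f hq) (fun _ _ _ h => eLpNorm_congr_ae h) m n

end subadditive

/-- Stationary vector-valued martingale differences with a finite moment of order `p`. -/
structure StatMDS (P : Measure Ω) (p : ℝ) (ℱ : ℤ → MeasurableSpace Ω) (d : ℤ → Ω → 𝔼 (Fin D)) :
    Prop where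
  mono : Monotone ℱ
  le : ∀ n, ℱ n ≤ mΩ
  adp : ∀ n, StronglyMeasurable[ℱ n] (d n)
  int : ∀ n, Integrable (d n) P
  mds : ∀ n : ℤ, P[d n | ℱ (n - 1)] =ᵐ[P] 0
  stat : ∀ k : ℤ, Measure.map (fun ω => fun n : ℤ => d (n + k) ω) P
    = Measure.map (fun ω => fun n : ℤ => d n ω) P
  mom : MemLp (d 0) (ofReal p) P

lemma partialSum_eq_range (n : ℕ) (ω : Ω) :
    partialSum d n ω = ∑ j ∈ range n, d (1 + j) ω := by
  induction n with
  | zero => simp [partialSum]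
  | succ n ih =>
    have e : Icc (1 : ℤ) ((n + 1 : ℕ) : ℤ) = insert (1 + (n : ℤ)) (Icc (1 : ℤ) n) := by
      ext x
      simp only [mem_Icc, Finset.mem_insert]
      omega
    rw [sum_range_succ, ← ih, partialSum, e, sum_insert (by simp), add_comm]
    rfl

/-- The time-`k` shift of the path of `d`. -/
def pathShift (d : ℤ → Ω → 𝔼 (Fin D)) (k : ℤ) (ω : Ω) :
    ℤ → 𝔼 (Fin D) := fun n => d (n + k) ω

/-- The law of the path of `d`. -/
def pathLaw (P : Measure Ω) (d : ℤ → Ω → 𝔼 (Fin D)) :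
    Measure (ℤ → 𝔼 (Fin D)) := P.map fun ω n => d n ω

/-- The σ-algebra of the path strictly before time `c`. -/
abbrev pathPast (D : ℕ) (c : ℕ) : MeasurableSpace (ℤ → 𝔼 (Fin D)) :=
  ⨆ j : {j : ℤ // j < c}, MeasurableSpace.comap (fun η => η j.1) inferInstance

lemma pathPast_mono : Monotone (pathPast D) := fun c c' h =>
  iSup_le fun j => le_iSup (fun j : {j : ℤ // j < c'} => MeasurableSpace.comap
    (fun η : ℤ → 𝔼 (Fin D) => η j.1) inferInstance) ⟨j.1, j.2.trans_le (by exact_mod_cast h)⟩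

lemma pathPast_le (c : ℕ) : pathPast D c ≤ MeasurableSpace.pi :=
  iSup_le fun j => (measurable_pi_apply j.1).comap_le

lemma measurable_pathPast {c : ℕ} {j : ℤ} (h : j < c) :
    Measurable[pathPast D c] fun η : ℤ → 𝔼 (Fin D) => η j :=
  (comap_measurable _).mono (le_iSup (fun j : {j : ℤ // j < c} => MeasurableSpace.comap
    (fun η : ℤ → 𝔼 (Fin D) => η j.1) inferInstance) ⟨j, h⟩) le_rfl

namespace StatMDS

lemma meas (H : StatMDS P p ℱ d) (n : ℤ) : Measurable (d n) := ((H.adp n).mono (H.le n)).measurable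

lemma measurePreserving_pathShift (H : StatMDS P p ℱ d) (k : ℤ) :
    MeasurePreserving (pathShift d k) P (pathLaw P d) :=
  ⟨measurable_pi_iff.2 fun n => H.meas (n + k), H.stat k⟩

lemma isProbabilityMeasure_pathLaw [IsProbabilityMeasure P] (H : StatMDS P p ℱ d) :
    IsProbabilityMeasure (pathLaw P d) :=
  Measure.isProbabilityMeasure_map (measurable_pi_iff.2 fun n => H.meas n).aemeasurable

lemma comap_pathShift_le (H : StatMDS P p ℱ d) (c : ℕ) :
    (pathPast D c).comap (pathShift d (1 - c)) ≤ ℱ 0 := by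
  rw [MeasurableSpace.comap_iSup]
  refine iSup_le fun j => ?_
  rw [MeasurableSpace.comap_comp]
  exact (H.adp (j.1 + (1 - c))).measurable.comap_le.trans (H.mono (by have := j.2; omega))

lemma memLp_path (H : StatMDS P p ℱ d) (n : ℤ) :
    MemLp (fun η : ℤ → 𝔼 (Fin D) => η n) (ofReal p) (pathLaw P d) := by
  rw [← (H.measurePreserving_pathShift (-n)).map_eq, memLp_map_measure_iff
    (measurable_pi_apply n).aestronglyMeasurable
      (H.measurePreserving_pathShift (-n)).measurable.aemeasurable]
  have e : (fun η : ℤ → 𝔼 (Fin D) => η n) ∘ pathShift d (-n) = d 0 := by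
    ext ω : 1
    simp [pathShift]
  rw [e]
  exact H.mom

lemma memLp (H : StatMDS P p ℱ d) (n : ℤ) : MemLp (d n) (ofReal p) P := by
  have h := (H.memLp_path n).comp_measurePreserving (H.measurePreserving_pathShift 0)
  have e : (fun η : ℤ → 𝔼 (Fin D) => η n) ∘ pathShift d 0 = d n := by
    ext ω : 1
    simp [pathShift]
  rwa [e] at h

lemma integrable_mul [IsFiniteMeasure P] (H : StatMDS P p ℱ d) (hp : 2 < p) (m n : ℤ)
    (a b : Fin D) : Integrable (fun ω => d m ω a * d n ω b) P := by
  have h : ∀ k c, MemLp (fun ω => d k ω c) 2 P := fun k c =>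
    ((H.memLp k).eval_piLp c).mono_exponent (by
      rw [← ofReal_ofNat]; exact ofReal_le_ofReal hp.le)
  exact (h m a).integrable_mul (h n b)

lemma condExp_coord [IsFiniteMeasure P] (H : StatMDS P p ℱ d) (n : ℤ) (a : Fin D) :
    P[fun ω => d n ω a | ℱ (n - 1)] =ᵐ[P] 0 := by
  have h := (proj a : 𝔼 (Fin D) →L[ℝ] ℝ).comp_condExp_comm
    (m := ℱ (n - 1)) (H.int n)
  filter_upwards [h, H.mds n] with ω h1 h2
  rw [show (fun ω => d n ω a) = (proj a : 𝔼 (Fin D) →L[ℝ] ℝ) ∘ d n from rfl, ← h1,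
    comp_apply, h2]
  simp

/-- Distinct times are conditionally orthogonal. -/
lemma condExp_mul_eq_zero [IsFiniteMeasure P] (H : StatMDS P p ℱ d) (hp : 2 < p) {m n : ℤ}
    (hmn : m < n) (hn : 1 ≤ n) (a b : Fin D) :
    P[fun ω => d m ω a * d n ω b | ℱ 0] =ᵐ[P] 0 := by
  have hm : StronglyMeasurable[ℱ (n - 1)] fun ω => d m ω a :=
    (((proj a : 𝔼 (Fin D) →L[ℝ] ℝ).continuous.comp_stronglyMeasurable
      (H.adp m))).mono (H.mono (by omega))
  have h1 := condExp_mul_of_stronglyMeasurable_left (μ := P) hm (H.integrable_mul hp m n a b)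
    ((H.int n).eval_piLp b)
  have h2 : P[fun ω => d m ω a * d n ω b | ℱ (n - 1)] =ᵐ[P] 0 := by
    filter_upwards [h1, H.condExp_coord n b] with ω e1 e2
    refine e1.trans ?_
    rw [Pi.mul_apply, e2]
    simp
  refine (condExp_condExp_of_le (H.mono (show 0 ≤ n - 1 by omega)) (H.le _)).symm.trans ?_
  refine (condExp_congr_ae h2).trans ?_
  rw [condExp_zero]

/-- The conditional second moments of `M_n` are those of the squared increments. -/
lemma condExp_partialSum_mul [IsFiniteMeasure P] (H : StatMDS P p ℱ d) (hp : 2 < p) (a b : Fin D)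
    (n : ℕ) :
    P[fun ω => partialSum d n ω a * partialSum d n ω b | ℱ 0]
      =ᵐ[P] P[fun ω => ∑ j ∈ range n, d (1 + j) ω a * d (1 + j) ω b | ℱ 0] := by
  have hI := H.integrable_mul hp
  induction n with
  | zero => simp [partialSum]
  | succ n ih =>
    have hS : ∀ ω (c : Fin D), partialSum d n ω c = ∑ j ∈ range n, d (1 + j) ω c :=
      fun ω c => by rw [partialSum_eq_range]; simp
    set U : Ω → ℝ := fun ω => partialSum d n ω a * partialSum d n ω b
    set V : Ω → ℝ := ∑ j ∈ range n, fun ω => d (1 + j) ω a * d (1 + n) ω b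
    set W : Ω → ℝ := ∑ j ∈ range n, fun ω => d (1 + j) ω b * d (1 + n) ω a
    set Q : Ω → ℝ := fun ω => d (1 + n) ω a * d (1 + n) ω b
    have hU : Integrable U P := by
      have : U = fun ω => ∑ i ∈ range n, ∑ j ∈ range n, d (1 + i) ω a * d (1 + j) ω b := by
        ext ω
        simp only [U, hS, sum_mul_sum]
      rw [this]
      exact integrable_finsetSum _ fun i _ => integrable_finsetSum _ fun j _ => hI _ _ _ _
    have hV : Integrable V P := integrable_finsetSum' _ fun i _ => hI _ _ _ _
    have hW : Integrable W P := integrable_finsetSum' _ fun i _ => hI _ _ _ _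
    have hz : ∀ a b : Fin D, P[∑ j ∈ range n, fun ω => d (1 + j) ω a * d (1 + n) ω b | ℱ 0]
        =ᵐ[P] 0 := fun a b => by
      have h0 : ∀ᵐ ω ∂P, ∀ j ∈ range n,
          (P[fun ω => d (1 + j) ω a * d (1 + n) ω b | ℱ 0]) ω = 0 := by
        refine (Finset.eventually_all _).2 fun j hj => H.condExp_mul_eq_zero hp ?_ ?_ a b
        · have := mem_range.1 hj
          omega
        · omega
      filter_upwards [condExp_finsetSum (s := range n)
        (fun (j : ℕ) _ => hI (1 + j) (1 + n) a b) (ℱ 0), h0] with ω h1 h2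
      rw [h1, Finset.sum_apply, sum_eq_zero h2, Pi.zero_apply]
    have e1 : (fun ω => partialSum d (n + 1) ω a * partialSum d (n + 1) ω b) =
        (U + Q) + (V + W) := by
      ext ω
      simp only [U, V, W, Q, Pi.add_apply, Finset.sum_apply, hS, ← sum_mul]
      rw [partialSum_eq_range, sum_range_succ]
      simp
      ring
    have e2 : (fun ω => ∑ j ∈ range (n + 1), d (1 + j) ω a * d (1 + j) ω b)
        = (fun ω => ∑ j ∈ range n, d (1 + j) ω a * d (1 + j) ω b) + Q := by
      ext ω
      simp [sum_range_succ, Q]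
    rw [e1, e2]
    filter_upwards [condExp_add (hU.add (hI _ _ _ _)) (hV.add hW) (ℱ 0),
      condExp_add hU (hI _ _ _ _) (ℱ 0),
      condExp_add hV hW (ℱ 0), hz a b, hz b a,
      condExp_add (integrable_finsetSum (range n) fun j _ => hI (1 + j) (1 + j) a b)
        (hI (1 + n) (1 + n) a b) (ℱ 0), ih] with ω h1 h2 h3 h4 h5 h6 h7
    rw [h1, h6]
    simp only [Pi.add_apply]
    rw [h2, h3, Pi.add_apply, Pi.add_apply, h4, h5, h7]
    simp [Q]

end StatMDS

lemma eLpNorm_sum_mul_le [Fintype κ] {q : ℝ≥0∞} (hq : 1 ≤ q) {Z : κ → Ω → ℝ}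
    (hZ : ∀ k, AEStronglyMeasurable (Z k) P) {c : κ → ℝ} (hc : ∀ k, |c k| ≤ C) :
    eLpNorm (fun ω => ∑ k, c k * Z k ω) q P ≤ ofReal C * ∑ k, eLpNorm (Z k) q P := by
  have e : (fun ω => ∑ k, c k * Z k ω) = ∑ k, c k • Z k := by
    ext ω
    simp
  rw [e, mul_sum]
  refine (eLpNorm_sum_le (fun k _ => (hZ k).const_smul _) hq).trans (sum_le_sum fun k _ => ?_)
  rw [eLpNorm_const_smul, ← ofReal_norm]
  gcongr
  exact hc k

lemma lintegral_rpow_mul_abs_sum_le [Fintype κ] (hY : Measurable Y) (hY0 : ∀ ω, 0 ≤ Y ω)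
    {Z : κ → Ω → ℝ} (hZ : ∀ k, Measurable (Z k)) {c : κ → ℝ} (hc : ∀ k, |c k| ≤ C) :
    ∫⁻ ω, ofReal (Y ω ^ r * |(∑ k, c k * Z k ω)|) ∂P
      ≤ ofReal C * ∑ k, ∫⁻ ω, ofReal (Y ω ^ r * |Z k ω|) ∂P := by
  have key : ∀ g : Ω → ℝ, Measurable g → ∫⁻ ω, ofReal (Y ω ^ r * |g ω|) ∂P
      = eLpNorm g 1 (P.withDensity fun ω => ofReal (Y ω ^ r)) := fun g hg => by
    rw [eLpNorm_one_eq_lintegral_enorm, lintegral_withDensity_eq_lintegral_mul _ (by fun_prop)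
      (by fun_prop)]
    refine lintegral_congr fun ω => ?_
    rw [ofReal_mul (rpow_nonneg (hY0 ω) r), ← norm_eq_abs, ofReal_norm]
    rfl
  rw [key _ (by fun_prop)]
  simp_rw [fun k => key _ (hZ k)]
  exact eLpNorm_sum_mul_le le_rfl (fun k => (hZ k).aestronglyMeasurable) hc

/-- The centered conditional second moment of `M_n`. -/
def condCov (P : Measure Ω) (ℱ : ℤ → MeasurableSpace Ω) (d : ℤ → Ω → 𝔼 (Fin D))
    (a b : Fin D) (n : ℕ) (ω : Ω) : ℝ :=
  (P[fun ω' => partialSum d n ω' a * partialSum d n ω' b | ℱ 0]) ω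
    - ∫ ω', partialSum d n ω' a * partialSum d n ω' b ∂P

/-- The matrix entries of a linear map between Euclidean spaces. -/
def entry (A : 𝔼 (Fin D) →L[ℝ] 𝔼 ι) (u : ι) (a : Fin D) : ℝ :=
  A (single a 1) u

lemma apply_eq_sum_entry (A : 𝔼 (Fin D) →L[ℝ] 𝔼 ι)
    (x : 𝔼 (Fin D)) (u : ι) : A x u = ∑ a, entry A u a * x a := by
  have hx : x = ∑ a, x a • single a (1 : ℝ) := by
    ext b
    simp [Finset.sum_apply, Pi.single_apply]
  conv_lhs => rw [hx, map_sum]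
  simp [entry, mul_comm]

lemma abs_entry_le (A : 𝔼 (Fin D) →L[ℝ] 𝔼 ι) (u : ι) (a : Fin D) :
    |entry A u a| ≤ ‖A‖ := by
  refine (abs_coord_le_norm _ u).trans ((A.le_opNorm _).trans ?_)
  simp

namespace StatMDS

variable [IsProbabilityMeasure P]

lemma measurable_condCov (H : StatMDS P p ℱ d) (a b : Fin D) (n : ℕ) :
    Measurable (condCov P ℱ d a b n) :=
  ((stronglyMeasurable_condExp.mono (H.le 0)).measurable).sub_const _

lemma integral_mul_eq (H : StatMDS P p ℱ d) (n : ℤ) (a b : Fin D) :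
    ∫ ω, d n ω a * d n ω b ∂P = ∫ ω, d 0 ω a * d 0 ω b ∂P := by
  have hf : AEStronglyMeasurable (fun η : ℤ → 𝔼 (Fin D) => η n a * η n b)
      (pathLaw P d) := by
    have h := measurable_pi_apply (X := fun _ : ℤ => 𝔼 (Fin D)) n
    exact Measurable.aestronglyMeasurable (by fun_prop)
  have h1 := (H.measurePreserving_pathShift 0).integral_comp_eq hf
  have h2 := (H.measurePreserving_pathShift (-n)).integral_comp_eq hf
  simpa [pathShift] using h1.trans h2.symm

lemma integral_partialSum_mul (H : StatMDS P p ℱ d) (hp : 2 < p) (a b : Fin D) (n : ℕ) :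
    ∫ ω, partialSum d n ω a * partialSum d n ω b ∂P = n * ∫ ω, d 0 ω a * d 0 ω b ∂P := by
  rw [← integral_condExp (H.le 0), integral_congr_ae (H.condExp_partialSum_mul hp a b n),
    integral_condExp (H.le 0), integral_finsetSum _ fun j _ => H.integrable_mul hp _ _ _ _]
  simp_rw [H.integral_mul_eq]
  simp

open Classical in
/-- Conditional Hermite sums of the whitened increments in terms of the conditional covariances. -/
lemma condExp_gHerm (H : StatMDS P p ℱ d) (hp : 2 < p)
    (hA : ∀ u v, ∫ ω, A (d 0 ω) u * A (d 0 ω) v ∂P = if u = v then 1 else 0) (u v : ι) (n : ℕ) :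
    P[fun ω => ∑ j ∈ range n, gHerm u v (A (d (1 + j) ω)) | ℱ 0]
      =ᵐ[P] fun ω => ∑ k : Fin D × Fin D,
        entry A u k.1 * entry A v k.2 * condCov P ℱ d k.1 k.2 n ω := by
  have hI := H.integrable_mul hp
  set S : Fin D × Fin D → Ω → ℝ := fun k ω => ∑ j ∈ range n, d (1 + j) ω k.1 * d (1 + j) ω k.2
    with hS
  have hSi : ∀ k, Integrable (S k) P := fun k => integrable_finsetSum _ fun j _ => hI _ _ _ _
  have hprod : ∀ x, A x u * A x v =
      ∑ k : Fin D × Fin D, entry A u k.1 * entry A v k.2 * (x k.1 * x k.2) :=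
    fun x => by
      rw [apply_eq_sum_entry, apply_eq_sum_entry, sum_mul_sum, Fintype.sum_prod_type]
      exact sum_congr rfl fun a _ => sum_congr rfl fun b _ => by ring
  have hcov : ∑ k : Fin D × Fin D, entry A u k.1 * entry A v k.2 * ∫ ω, d 0 ω k.1 * d 0 ω k.2 ∂P
      = if u = v then 1 else 0 := by
    rw [← hA u v]
    simp_rw [hprod]
    rw [integral_finsetSum univ fun (k : Fin D × Fin D) _ => (hI 0 0 k.1 k.2).const_mul _]
    simp_rw [integral_const_mul]
  have e : (fun ω => ∑ j ∈ range n, gHerm u v (A (d (1 + j) ω)))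
      = (∑ k, (entry A u k.1 * entry A v k.2) • S k) - fun _ =>
          (n : ℝ) * if u = v then 1 else 0 := by
    ext ω
    simp only [gHerm, hprod, sum_sub_distrib, Pi.sub_apply, Finset.sum_apply, Pi.smul_apply,
      smul_eq_mul, hS, mul_sum]
    rw [sum_comm]
    simp
  have hsm : ∀ᵐ ω ∂P, ∀ k, (P[(entry A u k.1 * entry A v k.2) • S k | ℱ 0]) ω
      = entry A u k.1 * entry A v k.2 *
        (P[fun ω => partialSum d n ω k.1 * partialSum d n ω k.2 | ℱ 0]) ω :=
    ae_all_iff.2 fun k => by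
      filter_upwards [condExp_smul (entry A u k.1 * entry A v k.2) (S k) (ℱ 0) (μ := P),
        H.condExp_partialSum_mul hp k.1 k.2 n] with ω h1 h2
      rw [h1, h2]
      rfl
  rw [e]
  filter_upwards [condExp_sub (integrable_finsetSum' univ fun k _ =>
      (hSi k).smul (entry A u k.1 * entry A v k.2))
      (integrable_const ((n : ℝ) * if u = v then 1 else 0)) (ℱ 0),
    condExp_finsetSum (s := univ)
      (fun k _ => (hSi k).smul (entry A u k.1 * entry A v k.2)) (ℱ 0), hsm] with ω h1 h2 h3
  rw [h1, Pi.sub_apply, h2, Finset.sum_apply, sum_congr rfl fun k _ => h3 k,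
    condExp_const (H.le 0), ← hcov, mul_sum, ← sum_sub_distrib]
  refine sum_congr rfl fun k _ => ?_
  rw [condCov, H.integral_partialSum_mul hp]
  ring

lemma integrable_gHerm (H : StatMDS P p ℱ d) (hp : 2 < p)
    (A : 𝔼 (Fin D) →L[ℝ] 𝔼 ι) (u v : ι) (n : ℤ) :
    Integrable (fun η : ℤ → 𝔼 (Fin D) => gHerm u v (A (η n))) (pathLaw P d) := by
  have := H.isProbabilityMeasure_pathLaw
  have h : ∀ w, MemLp (fun η : ℤ → 𝔼 (Fin D) => A (η n) w) 2 (pathLaw P d) := fun w =>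
    ((A.comp_memLp' (H.memLp_path n)).eval_piLp w).mono_exponent (by
      rw [← ofReal_ofNat]; exact ofReal_le_ofReal hp.le)
  exact ((h u).integrable_mul (h v)).sub (integrable_const _)

open Classical in
/-- Conditional Hermite sums on the path space, pulled back to the original space. -/
lemma condExp_path (H : StatMDS P p ℱ d) (hp : 2 < p)
    (hA : ∀ u v, ∫ ω, A (d 0 ω) u * A (d 0 ω) v ∂P = if u = v then 1 else 0) (u v : ι) (c n : ℕ) :
    (fun ω => ((pathLaw P d)[fun η => ∑ j ∈ range n, gHerm u v (A (η ((c + j : ℕ) : ℤ)))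
        | pathPast D c]) (pathShift d (1 - c) ω))
      =ᵐ[P] P[fun ω => ∑ k : Fin D × Fin D,
        entry A u k.1 * entry A v k.2 * condCov P ℱ d k.1 k.2 n ω
          | (pathPast D c).comap (pathShift d (1 - c))] := by
  have := H.isProbabilityMeasure_pathLaw
  refine ((H.measurePreserving_pathShift (1 - c)).condExp_comp (pathPast_le c)
    (integrable_finsetSum _ fun j _ => H.integrable_gHerm hp A u v _)).trans ?_
  have e : (fun ω => ∑ j ∈ range n, gHerm u v (A (pathShift d (1 - c) ω ((c + j : ℕ) : ℤ))))
      = fun ω => ∑ j ∈ range n, gHerm u v (A (d (1 + j) ω)) := by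
    ext ω
    refine sum_congr rfl fun j _ => ?_
    have hj : ((c + j : ℕ) : ℤ) + (1 - c) = 1 + j := by
      push_cast
      ring
    rw [pathShift, hj]
  rw [e]
  exact (condExp_condExp_of_le (H.comap_pathShift_le c) (H.le 0)).symm.trans
    (condExp_congr_ae (H.condExp_gHerm hp hA u v n))

open Classical in
lemma condSize_eLpNorm_le (H : StatMDS P p ℱ d) (hp : 2 < p)
    (hA : ∀ u v, ∫ ω, A (d 0 ω) u * A (d 0 ω) v ∂P = if u = v then 1 else 0) (n : ℕ) :
    condSize (pathLaw P d) (pathPast D) (fun (k : ι × ι) (j : ℕ) η => gHerm k.1 k.2 (A (η j)))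
      (fun _ f => eLpNorm f (ofReal (p / 2)) (pathLaw P d)) n
      ≤ ofReal (‖A‖ * ‖A‖) * ∑ k : Fin D × Fin D,
        eLpNorm (condCov P ℱ d k.1 k.2 n) (ofReal (p / 2)) P := by
  have := H.isProbabilityMeasure_pathLaw
  have hq : 1 ≤ ofReal (p / 2) := one_le_ofReal.2 (by linarith)
  refine iSup₂_le fun k c => ?_
  beta_reduce
  rw [← eLpNorm_comp_measurePreserving integrable_condExp.aestronglyMeasurable
    (H.measurePreserving_pathShift (1 - c))]
  refine (eLpNorm_congr_ae (H.condExp_path hp hA k.1 k.2 c n)).trans_le ?_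
  refine (eLpNorm_condExp_le_eLpNorm _ hq).trans ?_
  exact eLpNorm_sum_mul_le hq (fun k => (H.measurable_condCov _ _ n).aestronglyMeasurable)
    fun l => by
    rw [abs_mul]
    exact mul_le_mul (abs_entry_le _ _ _) (abs_entry_le _ _ _) (abs_nonneg _) (norm_nonneg _)

open Classical in
lemma condSize_weightSize_le (H : StatMDS P p ℱ d) (hp : 2 < p) (hp3 : p ≤ 3)
    (hA : ∀ u v, ∫ ω, A (d 0 ω) u * A (d 0 ω) v ∂P = if u = v then 1 else 0) (n : ℕ) :
    condSize (pathLaw P d) (pathPast D) (fun (k : ι × ι) (j : ℕ) η => gHerm k.1 k.2 (A (η j)))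
      (weightSize (pathLaw P d) (pathPast D) (p - 2)) n
      ≤ ofReal (‖A‖ * ‖A‖) * ∑ k : Fin D × Fin D,
        404 * envNorm P p (condCov P ℱ d k.1 k.2 n) := by
  have := H.isProbabilityMeasure_pathLaw
  refine iSup₂_le fun k c => weightSize_le fun Y hY hY0 hs => ?_
  have hT := H.measurePreserving_pathShift (1 - c)
  have hYm := (hY.mono (pathPast_le c)).measurable
  set T := pathShift d (1 - c)
  have hle := (H.comap_pathShift_le c).trans (H.le 0)
  rw [← hT.lintegral_comp (by
    have := (stronglyMeasurable_condExp.mono (pathPast_le c) :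
      StronglyMeasurable ((pathLaw P d)[fun η => ∑ j ∈ range n,
        gHerm k.1 k.2 (A (η ((c + j : ℕ) : ℤ))) | pathPast D c])).measurable
    fun_prop)]
  have h1 : ∀ᵐ ω ∂P, ofReal (Y (T ω) ^ (p - 2) *
      |((pathLaw P d)[fun η => ∑ j ∈ range n, gHerm k.1 k.2 (A (η ((c + j : ℕ) : ℤ)))
        | pathPast D c]) (T ω)|) = ofReal (Y (T ω) ^ (p - 2) *
      |(P[fun ω => ∑ l : Fin D × Fin D, entry A k.1 l.1 * entry A k.2 l.2 *
        condCov P ℱ d l.1 l.2 n ω | (pathPast D c).comap T]) ω|) := by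
    filter_upwards [H.condExp_path hp hA k.1 k.2 c n] with ω h
    rw [h]
  rw [lintegral_congr_ae h1]
  have hYT :=
    hY.measurable.comp (comap_measurable T)
  have hYT' := hYm.comp hT.measurable
  have hZ : ∀ l : Fin D × Fin D, Measurable (condCov P ℱ d l.1 l.2 n) := fun l =>
    H.measurable_condCov l.1 l.2 n
  have hZi : Integrable (fun ω => ∑ l : Fin D × Fin D, entry A k.1 l.1 * entry A k.2 l.2 *
      condCov P ℱ d l.1 l.2 n ω) P := integrable_finsetSum _ fun l _ =>
    (integrable_condExp.sub (integrable_const _) :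
      Integrable (condCov P ℱ d l.1 l.2 n) P).const_mul _
  have hc : ∀ l : Fin D × Fin D, |entry A k.1 l.1 * entry A k.2 l.2| ≤ ‖A‖ * ‖A‖ := fun l => by
    rw [abs_mul]
    exact mul_le_mul (abs_entry_le _ _ _) (abs_entry_le _ _ _) (abs_nonneg _) (norm_nonneg _)
  have h2 := lintegral_rpow_mul_abs_condExp_le (r := p - 2) hle hYT (fun ω => hY0 _) hZi
  have h3 := lintegral_rpow_mul_abs_sum_le (P := P) (r := p - 2) hYT' (fun ω => hY0 _) hZ hc
  refine h2.trans (h3.trans ?_)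
  gcongr with l
  exact lintegral_rpow_mul_le_envNorm hp hp3 hYT' (fun ω => hY0 _) (hs.comp hT hYm) (hZ l)

end StatMDS

section

variable {f : ℕ → ℝ≥0∞}

lemma sum_dyadic_toReal_le (hf : ∀ m n, f (m + n) ≤ f m + f n) (hr : 0 ≤ r)
    (h : ∑' n : ℕ, ofReal ((n + 1 : ℝ) ^ (-(r + 1))) * f (n + 1) < ⊤) :
    (∀ i, f (2 ^ i) ≠ ⊤) ∧ ∃ B : ℝ, ∀ n,
      ∑ i ∈ range n, (f (2 ^ i)).toReal / ((2 : ℝ) ^ r) ^ i ≤ B := by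
  have hT :=
    ((tsum_dyadic_le hf hr).trans_lt (mul_lt_top (by finiteness) h)).ne
  have hi := ENNReal.ne_top_of_tsum_ne_top hT
  refine ⟨fun i hi' => hi i ?_, _, fun n =>
    le_trans (le_of_eq ?_) (toReal_mono hT (ENNReal.sum_le_tsum (range n)))⟩
  · rw [hi', ENNReal.mul_top]
    exact pow_ne_zero _ (by simpa using Real.rpow_pos_of_pos two_pos (-r))
  · rw [ENNReal.toReal_sum fun i _ => hi i]
    refine sum_congr rfl fun i _ => ?_
    rw [ENNReal.toReal_mul, ENNReal.toReal_pow, toReal_ofReal (by positivity),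
      rpow_neg zero_le_two, inv_pow, div_eq_inv_mul]

lemma tsum_mul_lt_top [Fintype κ] {w : ℕ → ℝ≥0∞} {ψ : κ → ℕ → ℝ≥0∞} {C : ℝ≥0∞} (hC : C ≠ ⊤)
    (h : ∀ n, f n ≤ C * ∑ k, ψ k n) (hψ : ∀ k, ∑' n, w n * ψ k (n + 1) < ⊤) :
    ∑' n, w n * f (n + 1) < ⊤ := by
  refine (tsum_le_tsum fun n => mul_le_mul_right (h (n + 1)) (w n)).trans_lt ?_
  simp_rw [mul_left_comm _ C]
  rw [ENNReal.tsum_mul_left]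
  simp_rw [mul_sum]
  rw [Summable.tsum_finsetSum fun _ _ => summable]
  exact mul_lt_top hC.lt_top (ENNReal.sum_lt_top.2 fun k _ => hψ k)

end

namespace StatMDS

variable [IsProbabilityMeasure P]

lemma isMDS_path (H : StatMDS P p ℱ d) (A : 𝔼 (Fin D) →L[ℝ] 𝔼 ι)
    (hp : 1 ≤ p) (u : ι) :
    IsMDS (pathLaw P d) (pathPast D) fun (k : ℕ) (η : ℤ → 𝔼 (Fin D)) => A (η k) u where
  mono := pathPast_mono
  le := pathPast_le
  meas n := by
    have h : Measurable[pathPast D (n + 1)] fun η : ℤ → 𝔼 (Fin D) => η (n : ℤ) :=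
      measurable_pathPast (by push_cast; omega)
    have hc : Continuous fun x => A x u := by fun_prop
    exact (hc.measurable.comp h).stronglyMeasurable
  int n := by
    have := H.isProbabilityMeasure_pathLaw
    exact ((A.comp_memLp' (H.memLp_path n)).eval_piLp u).integrable (one_le_ofReal.2 hp)
  zero n := by
    have := H.isProbabilityMeasure_pathLaw
    have hT := H.measurePreserving_pathShift (1 - n)
    have hint : Integrable (fun η : ℤ → 𝔼 (Fin D) => A (η n) u) (pathLaw P d) :=
      ((A.comp_memLp' (H.memLp_path n)).eval_piLp u).integrable (one_le_ofReal.2 hp)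
    have h0 : P[fun ω => A (d 1 ω) u | ℱ 0] =ᵐ[P] 0 := by
      have h := ((proj u : 𝔼 ι →L[ℝ] ℝ).comp A).comp_condExp_comm
        (m := ℱ 0) (H.int 1)
      filter_upwards [h, H.mds 1] with ω h1 h2
      refine h1.symm.trans ?_
      have h3 : (P[d 1 | ℱ 0]) ω = 0 := h2
      simp [h3]
    have h1 := hT.condExp_comp (pathPast_le n) hint
    have e : (fun ω => A (pathShift d (1 - n) ω n) u) = fun ω => A (d 1 ω) u := by
      ext ω
      rw [pathShift, add_sub_cancel]
    rw [e] at h1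
    have h2 := (condExp_condExp_of_le (H.comap_pathShift_le n) (H.le 0)
      (f := fun ω => A (d 1 ω) u) (μ := P)).symm.trans (condExp_congr_ae h0)
    rw [condExp_zero] at h2
    have h3 := h1.trans h2
    refine (hT.map_eq ▸ ae_map_iff hT.measurable.aemeasurable ?_ :
      (∀ᵐ η ∂(pathLaw P d), _) ↔ _).2 h3
    exact measurableSet_eq_fun (stronglyMeasurable_condExp.mono (pathPast_le n)).measurable
      measurable_const

open Classical in
/-- The whitened path of a stationary martingale difference sequence satisfies the hypotheses of the
coupling theorem. -/
theorem coreHyp (H : StatMDS P p ℱ d) (hp : 2 < p) (hp3 : p ≤ 3)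
    (hA : ∀ u v, ∫ ω, A (d 0 ω) u * A (d 0 ω) v ∂P = if u = v then 1 else 0)
    (hC1 : ∀ i j : Fin D, ∑' n : ℕ, ofReal ((n + 1 : ℝ) ^ (-(3 - p / 2))) *
      envNorm P p (condCov P ℱ d i j (n + 1)) < ⊤)
    (hC2 : ∀ i j : Fin D, ∑' n : ℕ, ofReal ((n + 1 : ℝ) ^ (-(1 + 2 / p))) *
      eLpNorm (condCov P ℱ d i j (n + 1)) (ofReal (p / 2)) P < ⊤) :
    ∃ K B a b, CoreHyp (pathLaw P d) (pathPast D)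
      (fun (k : ℕ) (η : ℤ → 𝔼 (Fin D)) => A (η k)) p K B a b := by
  have := H.isProbabilityMeasure_pathLaw
  set X : ι × ι → ℕ → (ℤ → 𝔼 (Fin D)) → ℝ := fun k j η => gHerm k.1 k.2 (A (η j)) with hX
  have hXi : ∀ k j, Integrable (X k j) (pathLaw P d) := fun k j => H.integrable_gHerm hp A k.1 k.2 j
  have hq : 1 ≤ ofReal (p / 2) := one_le_ofReal.2 (by linarith)
  set α := condSize (pathLaw P d) (pathPast D) X (weightSize (pathLaw P d) (pathPast D) (p - 2))
  set β := condSize (pathLaw P d) (pathPast D) X fun _ f => eLpNorm f (ofReal (p / 2)) (pathLaw P d)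
  have hα : ∑' n : ℕ, ofReal ((n + 1 : ℝ) ^ (-(2 - p / 2 + 1))) * α (n + 1) < ⊤ := by
    refine tsum_mul_lt_top (κ := Fin D × Fin D) (C := ofReal (‖A‖ * ‖A‖) * 404)
      (ψ := fun k n => envNorm P p (condCov P ℱ d k.1 k.2 n)) (by finiteness) (fun n => ?_)
      fun k => ?_
    · rw [mul_assoc, mul_sum]
      exact H.condSize_weightSize_le hp hp3 hA n
    · rw [show -(2 - p / 2 + 1) = -(3 - p / 2) by ring]
      exact hC1 k.1 k.2
  have hβ : ∑' n : ℕ, ofReal ((n + 1 : ℝ) ^ (-(1 / (p / 2) + 1))) * β (n + 1) < ⊤ := by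
    refine tsum_mul_lt_top (κ := Fin D × Fin D) (C := ofReal (‖A‖ * ‖A‖))
      (ψ := fun k n => eLpNorm (condCov P ℱ d k.1 k.2 n) (ofReal (p / 2)) P) (by finiteness)
      (H.condSize_eLpNorm_le hp hA) fun k => ?_
    rw [show -(1 / (p / 2) + 1) = -(1 + 2 / p) by rw [one_div_div]; ring]
    exact hC2 k.1 k.2
  obtain ⟨hα', Ba, hBa⟩ := sum_dyadic_toReal_le
    (condSize_weightSize_add pathPast_mono pathPast_le hXi) (by linarith) hα
  obtain ⟨hβ', Bb, hBb⟩ := sum_dyadic_toReal_le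
    (condSize_eLpNorm_add hq pathPast_mono pathPast_le hXi) (by positivity) hβ
  refine ⟨∫ ω, ‖A (d 0 ω)‖ ^ p ∂P, max Ba Bb, fun i => (α (2 ^ i)).toReal,
    fun i => (β (2 ^ i)).toReal, ?_⟩
  exact
  { mono := pathPast_mono
    le := pathPast_le
    mds := H.isMDS_path A (by linarith)
    mom := fun k => by
      have h := (A.comp_memLp' (H.memLp_path k)).integrable_norm_rpow
        (by simp; linarith) ofReal_ne_top
      rwa [toReal_ofReal (by linarith)] at h
    mom_le := fun k => by
      have hm := measurable_pi_apply (X := fun _ : ℤ => 𝔼 (Fin D)) (k : ℤ)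
      have h := (H.measurePreserving_pathShift (-(k : ℤ))).integral_comp_eq
        (f := fun η => ‖A (η k)‖ ^ p) (by
          have : Measurable fun η : ℤ → 𝔼 (Fin D) => A (η k) := by fun_prop
          exact Measurable.aestronglyMeasurable (by fun_prop))
      rw [← h]
      simp [pathShift]
    a_nonneg := fun i => toReal_nonneg
    b_nonneg := fun i => toReal_nonneg
    a_le := fun c i u v Y hY hY0 hs => by
      rw [ofReal_toReal (hα' i)]
      exact (le_weightSize hY hY0 hs _).trans
        (le_condSize (N := weightSize (pathLaw P d) (pathPast D) (p - 2)) (X := X) (u, v) c (2 ^ i))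
    b_le := fun c i u v => by
      rw [ofReal_toReal (hβ' i)]
      exact le_condSize (N := fun _ f => eLpNorm f (ofReal (p / 2)) (pathLaw P d)) (X := X)
        (u, v) c (2 ^ i)
    a_sum := fun n => (hBa n).trans (le_max_left _ _)
    b_sum := fun n => (hBb n).trans (le_max_right _ _) }

end StatMDS

section

variable [Fintype κ] {Y : Ω → 𝔼 κ} {X : Ω → 𝔼 (Fin D)}

/-- The matrix of second moments of `Y`. -/
def momMatrix (P : Measure Ω) (Y : Ω → 𝔼 κ) : Matrix κ κ ℝ :=
  fun a b => ∫ ω, Y ω a * Y ω b ∂P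

lemma isHermitian_momMatrix : (momMatrix P Y).IsHermitian := by
  ext a b
  simp [momMatrix, mul_comm]

lemma integral_inner_mul_inner (hY : ∀ a b, Integrable (fun ω => Y ω a * Y ω b) P)
    (v w : 𝔼 κ) :
    Integrable (fun ω => inner ℝ v (Y ω) * inner ℝ w (Y ω)) P ∧
      ∫ ω, inner ℝ v (Y ω) * inner ℝ w (Y ω) ∂P = ∑ a, ∑ b, v a * momMatrix P Y a b * w b := by
  have e : (fun ω => inner ℝ v (Y ω) * inner ℝ w (Y ω))
      = fun ω => ∑ a, ∑ b, v a * w b * (Y ω a * Y ω b) := by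
    ext ω
    simp only [PiLp.inner_apply, sum_mul_sum, RCLike.inner_apply, conj_trivial]
    exact sum_congr rfl fun a _ => sum_congr rfl fun b _ => by ring
  have hI : ∀ a b, Integrable (fun ω => v a * w b * (Y ω a * Y ω b)) P := fun a b =>
    (hY a b).const_mul _
  have hI' : ∀ a, Integrable (fun ω => ∑ b, v a * w b * (Y ω a * Y ω b)) P := fun a =>
    integrable_finsetSum _ fun b _ => hI a b
  rw [e]
  refine ⟨integrable_finsetSum _ fun a _ => hI' a, ?_⟩
  rw [integral_finsetSum univ fun a _ => hI' a]
  refine sum_congr rfl fun a _ => ?_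
  rw [integral_finsetSum univ fun b _ => hI a b]
  refine sum_congr rfl fun b _ => ?_
  rw [integral_const_mul, momMatrix]
  ring

lemma exists_orthonormalBasis_integral_inner (hX : ∀ a b, Integrable (fun ω => X ω a * X ω b) P) :
    ∃ (v : OrthonormalBasis (Fin D) ℝ (𝔼 (Fin D))) (l : Fin D → ℝ), ∀ i j,
      ∫ ω, inner ℝ (v i) (X ω) * inner ℝ (v j) (X ω) ∂P = if i = j then l j else 0 := by
  have hS := isHermitian_momMatrix (P := P) (Y := X)
  refine ⟨hS.eigenvectorBasis, hS.eigenvalues, fun i j => ?_⟩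
  rw [(integral_inner_mul_inner hX _ _).2]
  have h : ∀ a, ∑ b, momMatrix P X a b * hS.eigenvectorBasis j b
      = hS.eigenvalues j * hS.eigenvectorBasis j a := fun a =>
    congrFun (hS.mulVec_eigenvectorBasis j) a
  simp_rw [mul_assoc, ← mul_sum, h]
  have ho := orthonormal_iff_ite.1 hS.eigenvectorBasis.orthonormal i j
  rw [PiLp.inner_apply] at ho
  simp only [RCLike.inner_apply, conj_trivial] at ho
  rw [← mul_one (hS.eigenvalues j), ← mul_zero (hS.eigenvalues j), ← mul_ite, ← ho, mul_sum]
  exact sum_congr rfl fun a _ => by ring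

open Classical in
/-- A square-integrable vector is almost surely a linear image of a vector with identity covariance
depending linearly on it. -/
theorem exists_whitening (hX : ∀ a b, Integrable (fun ω => X ω a * X ω b) P) :
    ∃ (ι : Type) (_ : Fintype ι) (A : 𝔼 (Fin D) →L[ℝ] 𝔼 ι)
      (B : 𝔼 ι →L[ℝ] 𝔼 (Fin D)),
      (∀ u v, ∫ ω, A (X ω) u * A (X ω) v ∂P = if u = v then 1 else 0) ∧
        ∀ᵐ ω ∂P, B (A (X ω)) = X ω := by
  obtain ⟨v, l, hv⟩ := exists_orthonormalBasis_integral_inner hX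
  have hl : ∀ i, 0 ≤ l i := fun i => by
    have h := hv i i
    rw [if_pos rfl] at h
    rw [← h]
    exact integral_nonneg fun ω => mul_self_nonneg _
  let A : 𝔼 (Fin D) →L[ℝ] 𝔼 {i // l i ≠ 0} :=
    ∑ u : {i // l i ≠ 0}, (innerSL ℝ (v u)).smulRight (single u (√(l u))⁻¹)
  let B : 𝔼 {i // l i ≠ 0} →L[ℝ] 𝔼 (Fin D) :=
    ∑ u : {i // l i ≠ 0}, (proj u : 𝔼 {i // l i ≠ 0} →L[ℝ] ℝ).smulRight
      (√(l u) • v u)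
  have hA : ∀ x u, A x u = inner ℝ (v u) x * (√(l u))⁻¹ := fun x u => by
    simp [A, sum_apply, Pi.single_apply]
  have hs : ∀ u : {i // l i ≠ 0}, √(l u) ≠ 0 := fun u =>
    (sqrt_pos.2 (lt_of_le_of_ne (hl u) (Ne.symm u.2))).ne'
  refine ⟨{i // l i ≠ 0}, inferInstance, A, B, fun u w => ?_, ?_⟩
  · have e : (fun ω => A (X ω) u * A (X ω) w) = fun ω =>
        inner ℝ (v u) (X ω) * inner ℝ (v w) (X ω) * ((√(l u))⁻¹ * (√(l w))⁻¹) := by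
      ext ω
      rw [hA, hA]
      ring
    rw [e, integral_mul_const, hv]
    simp only [Subtype.ext_iff]
    split_ifs with h
    · rw [h, ← mul_inv, mul_self_sqrt (hl _)]
      exact mul_inv_cancel₀ w.2
    · simp
  · have h0 : ∀ᵐ ω ∂P, ∀ i, l i = 0 → inner ℝ (v i) (X ω) = 0 := ae_all_iff.2 fun i => by
      by_cases hi : l i = 0
      · have h := hv i i
        rw [if_pos rfl, hi, integral_eq_zero_iff_of_nonneg
          (fun ω => mul_self_nonneg _) (integral_inner_mul_inner hX _ _).1] at h
        filter_upwards [h] with ω hω _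
        exact mul_self_eq_zero.1 hω
      · exact ae_of_all _ fun ω h => absurd h hi
    filter_upwards [h0] with ω hω
    have hB : B (A (X ω)) = ∑ u : {i // l i ≠ 0}, inner ℝ (v u) (X ω) • v u := by
      simp only [B, sum_apply, ContinuousLinearMap.smulRight_apply, smul_smul]
      refine sum_congr rfl fun u _ => ?_
      congr 1
      change A (X ω) u * _ = _
      rw [hA, inv_mul_cancel_right₀ (hs u)]
    refine hB.trans (Eq.trans ?_ (v.sum_repr' (X ω)))
    rw [← Finset.sum_subtype (p := fun i => l i ≠ 0) (univ.filter fun i => l i ≠ 0) (by simp)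
      fun i => inner ℝ (v i) (X ω) • v i]
    refine Finset.sum_filter_of_ne fun i _ hi hl0 => hi ?_
    rw [hω i hl0, zero_smul]

end

lemma partialSum_eq_Icc (d : ℤ → Ω → 𝔼 (Fin D)) (n : ℕ) (ω : Ω) :
    partialSum d n ω = ∑ i ∈ Icc 1 n, d i ω := by
  rw [partialSum_eq_range]
  induction n with
  | zero => simp
  | succ n ih =>
    rw [sum_range_succ, ih, Finset.sum_Icc_succ_top (by omega)]
    push_cast
    rw [add_comm (n : ℤ)]

open Classical in
/-- The law of a linear image of a standard Gaussian vector, in terms of the vector it whitens. -/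
lemma isCenteredGaussianCov_map {X : Ω → 𝔼 (Fin D)} (hX : MemLp X 2 P) {B : 𝔼 ι →L[ℝ] 𝔼 (Fin D)}
    (hA : ∀ u v, ∫ ω, A (X ω) u * A (X ω) v ∂P = if u = v then 1 else 0)
    (hBA : ∀ᵐ ω ∂P, B (A (X ω)) = X ω) :
    IsCenteredGaussianCov D (fun a b => ∫ ω, X ω a * X ω b ∂P) ((stdG ι).map B) := by
  refine ⟨Measure.isProbabilityMeasure_map B.continuous.measurable.aemeasurable, fun t => ?_⟩
  set L : 𝔼 (Fin D) →L[ℝ] ℝ := innerSL ℝ (WithLp.toLp 2 t)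
  have hL : (fun x : 𝔼 (Fin D) => ∑ i, t i * x i) = L := by
    ext x
    simp [L, PiLp.inner_apply, mul_comm]
  rw [hL, Measure.map_map L.continuous.measurable B.continuous.measurable,
    ← ContinuousLinearMap.coe_comp, IsGaussian.map_eq_gaussianReal, integral_strongDual_stdGaussian,
    variance_dual_stdGaussian]
  congr 2
  set w := (InnerProductSpace.toDual ℝ (𝔼 ι)).symm (L.comp B)
  have hw : ∀ z, inner ℝ w z = L (B z) := fun z => InnerProductSpace.toDual_symm_apply
  have h1 := (integral_inner_mul_inner (fun a b => (hX.eval_piLp a).integrable_mul (hX.eval_piLp b))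
    (WithLp.toLp 2 t) (WithLp.toLp 2 t)).2
  have hAX := A.comp_memLp' hX
  have h2 := (integral_inner_mul_inner
    (fun a b => (hAX.eval_piLp a).integrable_mul (hAX.eval_piLp b)) w w).2
  have h3 : ∫ ω, inner ℝ (WithLp.toLp 2 t) (X ω) * inner ℝ (WithLp.toLp 2 t) (X ω) ∂P
      = ∫ ω, inner ℝ w (A (X ω)) * inner ℝ w (A (X ω)) ∂P := by
    refine integral_congr_ae ?_
    filter_upwards [hBA] with ω hω
    rw [hw, hω]
    rfl
  have h4 : ‖L.comp B‖ = ‖w‖ := ((InnerProductSpace.toDual ℝ _).symm.norm_map (L.comp B)).symm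
  refine Eq.trans ?_ (h2.symm.trans (h3.symm.trans h1))
  rw [h4, real_norm_sq_eq]
  refine sum_congr rfl fun u _ => ?_
  simp [momMatrix, hA, sq]

/-- The logarithmic factors of the coupling bound, up to constants. -/
lemma log_factor_le {θ : ℝ} (hθ : 0 ≤ θ) (hn : 3 ≤ n) :
    (log n / log 2 + 1) ^ θ ≤ (1 / log 2 + 1) ^ θ * log n ^ θ := by
  have h1 : 1 ≤ log n := by
    rw [Real.le_log_iff_exp_le (by positivity)]
    have : (3 : ℝ) ≤ n := by exact_mod_cast hn
    linarith [Real.exp_one_lt_d9]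
  have h2 := log_pos one_lt_two
  rw [← mul_rpow (by positivity) (by linarith)]
  refine rpow_le_rpow (by positivity) ?_ hθ
  rw [add_mul, one_mul, one_div_mul_eq_div]
  linarith

end helpers

/-- **Theorem 2.3 (ASIP, item 2).** -/
theorem asip_martingale_differences
    {Ω : Type*} [MeasurableSpace Ω] (P : Measure Ω) [IsProbabilityMeasure P]
    (D : ℕ) (p : ℝ) (hp : 2 < p) (hp3 : p ≤ 3)
    (ℱ : ℤ → MeasurableSpace Ω) (hmono : Monotone ℱ)
    (hle : ∀ n, ℱ n ≤ ‹MeasurableSpace Ω›)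
    (d : ℤ → Ω → EuclideanSpace ℝ (Fin D))
    (hadp : ∀ n, StronglyMeasurable[ℱ n] (d n))
    (hint : ∀ n, Integrable (d n) P)
    (hmds : ∀ n : ℤ, P[d n | ℱ (n - 1)] =ᵐ[P] 0)
    -- stationarity of the sequence
    (hstat : ∀ k : ℤ,
      Measure.map (fun ω => fun n : ℤ => d (n + k) ω) P
        = Measure.map (fun ω => fun n : ℤ => d n ω) P)
    -- moment of order `p`
    (hmom : MemLp (d 0) (ENNReal.ofReal p) P)
    -- condition (C1)
    (hC1 : ∀ i j : Fin D,
      ∑' n : ℕ, ENNReal.ofReal ((n + 1 : ℝ) ^ (-(3 - p / 2))) *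
        envNorm P p (fun ω =>
          (P[fun ω' => partialSum d (n + 1) ω' i * partialSum d (n + 1) ω' j | ℱ 0]) ω
            - ∫ ω', partialSum d (n + 1) ω' i * partialSum d (n + 1) ω' j ∂P) < ⊤)
    -- condition (C2)
    (hC2 : ∀ i j : Fin D,
      ∑' n : ℕ, ENNReal.ofReal ((n + 1 : ℝ) ^ (-(1 + 2 / p))) *
        eLpNorm (fun ω =>
          (P[fun ω' => partialSum d (n + 1) ω' i * partialSum d (n + 1) ω' j | ℱ 0]) ω
            - ∫ ω', partialSum d (n + 1) ω' i * partialSum d (n + 1) ω' j ∂P)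
          (ENNReal.ofReal (p / 2)) P < ⊤) :
    ∃ (Ω' : Type) (_ : MeasurableSpace Ω') (P' : Measure Ω'),
      IsProbabilityMeasure P' ∧
      ∃ (S : Ω' → ℕ → EuclideanSpace ℝ (Fin D)) (N : ℕ → Ω' → EuclideanSpace ℝ (Fin D)),
        -- `S` is a copy of the sequence of partial sums `(M_n)`
        Measure.map S P' = Measure.map (fun ω => fun n : ℕ => partialSum d n ω) P ∧
        -- `(N_i)` are iid centered Gaussian with covariance `E(d₀ d₀ᵗ)`
        iIndepFun N P' ∧
        (∀ i : ℕ, IsCenteredGaussianCov D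
          (fun a b => ∫ ω, d 0 ω a * d 0 ω b ∂P) (Measure.map (N i) P')) ∧
        (fun n : ℕ => ∫ ω', (⨆ k ∈ Finset.Icc 1 n,
              ‖S ω' k - ∑ i ∈ Finset.Icc 1 k, N i ω'‖) ∂P')
          =O[atTop]
        (fun n : ℕ => (n : ℝ) ^ (1 / p) *
          Real.log n ^ (if p = 3 then (2 : ℝ) / 3 else (p - 1) / (2 * p))) := by
  have H : StatMDS P p ℱ d := ⟨hmono, hle, hadp, hint, hmds, hstat, hmom⟩
  have hprob := H.isProbabilityMeasure_pathLaw
  obtain ⟨ι, _, A, B, hA, hBA⟩ := exists_whitening (X := d 0) (H.integrable_mul hp 0 0)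
  obtain ⟨K, C', a, b, hcore⟩ := H.coreHyp hp hp3 hA hC1 hC2
  obtain ⟨N, hind, hN, C, hC0, hC⟩ := hcore.exists_coupling hp hp3
  have hX2 : MemLp (d 0) 2 P := hmom.mono_exponent (by
    rw [← ENNReal.ofReal_ofNat]; exact ENNReal.ofReal_le_ofReal hp.le)
  set Q := (pathLaw P d).prod uniformSeq
  have hfst : MeasurePreserving Prod.fst Q (pathLaw P d) := measurePreserving_fst
  have hBm : Measurable B := B.continuous.measurable
  have hBAc : MeasurableSet {x | B (A x) = x} := measurableSet_eq_fun (by fun_prop) measurable_id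
  have hpath : ∀ᵐ z ∂Q, ∀ n : ℤ, B (A (z.1 n)) = z.1 n := ae_all_iff.2 fun n => by
    have hT := H.measurePreserving_pathShift (-n)
    have hms : MeasurableSet {η : ℤ → EuclideanSpace ℝ (Fin D) | B (A (η n)) = η n} :=
      hBAc.preimage (measurable_pi_apply n)
    have h : ∀ᵐ η ∂(pathLaw P d), B (A (η n)) = η n := by
      refine (hT.map_eq ▸ ae_map_iff hT.measurable.aemeasurable hms :
        (∀ᵐ η ∂(pathLaw P d), _) ↔ _).2 ?_
      filter_upwards [hBA] with ω hω
      simpa [pathShift] using hω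
    exact hfst.quasiMeasurePreserving.ae h
  have hpart : Measurable fun (η : ℤ → EuclideanSpace ℝ (Fin D)) (n : ℕ) =>
      partialSum (fun k η => η k) n η :=
    measurable_pi_iff.2 fun n => Finset.measurable_sum _ fun k _ => measurable_pi_apply k
  refine ⟨_, _, Q, inferInstance, fun z n => partialSum (fun k η => η k) n z.1,
    fun i z => B (N i z), ?_, hind.comp (fun _ => B) fun _ => hBm, fun i => ?_, ?_⟩
  · rw [show (fun z : (ℤ → EuclideanSpace ℝ (Fin D)) × (ℕ → unitInterval) => fun n : ℕ =>
        partialSum (fun k (η : ℤ → EuclideanSpace ℝ (Fin D)) => η k) n z.1)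
      = (fun η n => partialSum (fun k η => η k) n η) ∘ Prod.fst from rfl,
      ← Measure.map_map hpart measurable_fst, hfst.map_eq, pathLaw,
      Measure.map_map hpart (measurable_pi_iff.2 H.meas)]
    rfl
  · change IsCenteredGaussianCov D _ (Q.map (B ∘ N i))
    rw [← Measure.map_map hBm (hN i).measurable,
      (hN i).map_eq]
    exact isCenteredGaussianCov_map hX2 hA hBA
  · refine IsBigO.of_bound (‖B‖ * C * (1 / Real.log 2 + 1) ^ logExp p) ?_
    filter_upwards [eventually_ge_atTop 3] with n hn
    obtain ⟨M, hMi, hM, hMC⟩ := hC n (by omega)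
    have hM0 : ∀ z, 0 ≤ ‖B‖ * M z := fun z =>
      mul_nonneg (norm_nonneg _) ((norm_nonneg _).trans (hM z 0 (Nat.zero_le _)))
    have hnn : ∀ z, 0 ≤ ⨆ k ∈ Finset.Icc 1 n, ‖partialSum (fun k η => η k) k z.1
        - ∑ i ∈ Finset.Icc 1 k, B (N i z)‖ := fun z =>
      Real.iSup_nonneg fun k => Real.iSup_nonneg fun _ => norm_nonneg _
    have hle' : ∀ᵐ z ∂Q, ⨆ k ∈ Finset.Icc 1 n, ‖partialSum (fun k η => η k) k z.1
        - ∑ i ∈ Finset.Icc 1 k, B (N i z)‖ ≤ ‖B‖ * M z := by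
      filter_upwards [hpath] with z hz
      refine Real.iSup_le (fun k => Real.iSup_le (fun hk => ?_) (hM0 z)) (hM0 z)
      have e : partialSum (fun k η => η k) k z.1 - ∑ i ∈ Finset.Icc 1 k, B (N i z)
          = B (∑ i ∈ Finset.Icc 1 k, (A (z.1 i) - N i z)) := by
        rw [partialSum_eq_Icc, ← Finset.sum_sub_distrib, map_sum]
        simp_rw [map_sub, hz]
      rw [e]
      exact (B.le_opNorm _).trans
        (mul_le_mul_of_nonneg_left (hM z k (Finset.mem_Icc.1 hk).2) (norm_nonneg _))
    rw [Real.norm_of_nonneg (integral_nonneg hnn), Real.norm_of_nonneg (by positivity)]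
    calc _ ≤ ∫ z, ‖B‖ * M z ∂Q :=
          integral_mono_of_nonneg (ae_of_all _ hnn) (hMi.const_mul _) hle'
      _ ≤ ‖B‖ * (C * ((n : ℝ) ^ (1 / p) *
          ((1 / Real.log 2 + 1) ^ logExp p * Real.log n ^ logExp p))) := by
        rw [integral_const_mul]
        gcongr
        refine hMC.trans ?_
        gcongr
        exact log_factor_le (logExp_nonneg (by linarith)) hn
      _ = _ := by
        rw [logExp]
        ring

end
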